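/- Let -2 ≤ a < b ≤ 2 be real numbers. For a prime p ≡ 1 (mod 3) let a_p(λ) := -∑_{x∈F_p} φ(x(x-1)(x-λ)). Then, as p tends to infinity through primes p ≡ 1 (mod 3), (1/p) · #{λ ∈ F_p, λ ≠ 0,1 : a ≤ φ(-2)·a_p(λ)/√p ≤ b} converges to (1/(2π)) ∫_a^b √(4-t²) dt. (For λ ≠ 0,±1 the quantity φ(-2)·a_p(λ) equals the value of the p-adic hypergeometric function ₂G₂(λ)_p considered in the paper, so this is the semicircular limiting distribution of p^{-1/2}·₂G₂(λ)_p.) -/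

import Mathlib

namespace LegendreSatoTate

open Complex Filter Topology

section Theta

/-- The general term of the series defining `jacobiTheta`. -/
noncomputable def thetaTerm (τ : ℂ) (n : ℤ) : ℂ := cexp (Real.pi * I * (n : ℂ) ^ 2 * τ)

lemma summable_norm_thetaTerm {τ : ℂ} (hτ : 0 < τ.im) : Summable fun n => ‖thetaTerm τ n‖ := by
  have := (hasSum_jacobiTheta₂_term 0 hτ).summable.norm
  simpa [jacobiTheta₂_term, thetaTerm] using this

lemma thetaTerm_add_one (τ : ℂ) (n : ℤ) :
    thetaTerm (τ + 1) n = if Even n then thetaTerm τ n else -thetaTerm τ n := by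
  unfold thetaTerm
  rw [mul_add, Complex.exp_add, mul_one]
  split_ifs with h
  · obtain ⟨k, rfl⟩ := h
    have : (Real.pi * I * ((k + k : ℤ) : ℂ) ^ 2) = ((2 * k ^ 2 : ℤ) : ℂ) * (2 * Real.pi * I) := by
      push_cast; ring
    rw [this, Complex.exp_int_mul_two_pi_mul_I, mul_one]
  · obtain ⟨k, rfl⟩ := Int.not_even_iff_odd.mp h
    have : (Real.pi * I * ((2 * k + 1 : ℤ) : ℂ) ^ 2)
        = ((2 * k ^ 2 + 2 * k : ℤ) : ℂ) * (2 * Real.pi * I) + Real.pi * I := by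
      push_cast; ring
    rw [this, Complex.exp_add, Complex.exp_int_mul_two_pi_mul_I, Complex.exp_pi_mul_I]
    ring

lemma thetaTerm_mul_rotate (τ : ℂ) (u v : ℤ) :
    thetaTerm τ (u + v) * thetaTerm τ (u - v) = thetaTerm (2 * τ) u * thetaTerm (2 * τ) v := by
  simp only [thetaTerm, ← Complex.exp_add]
  congr 1
  push_cast
  ring

lemma tsum_rotate {F : ℤ × ℤ → ℂ} (hF : ∀ m n, ¬ Even (m + n) → F (m, n) = 0) :
    ∑' x, F x = ∑' x : ℤ × ℤ, F (x.1 + x.2, x.1 - x.2) := by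
  symm
  refine Function.Injective.tsum_eq (g := fun x : ℤ × ℤ => (x.1 + x.2, x.1 - x.2)) (f := F) ?_ ?_
  · rintro ⟨a, b⟩ ⟨c, d⟩ h
    simp only [Prod.mk.injEq] at h ⊢
    omega
  · rintro ⟨m, n⟩ h
    have : Even (m + n) := by
      by_contra hc
      exact h (hF m n hc)
    obtain ⟨k, hk⟩ := this
    exact ⟨(k, k - n), by ext <;> simp; omega⟩

lemma jacobiTheta_mul {τ τ' : ℂ} (hτ : 0 < τ.im) (hτ' : 0 < τ'.im) :
    jacobiTheta τ * jacobiTheta τ' = ∑' x : ℤ × ℤ, thetaTerm τ x.1 * thetaTerm τ' x.2 :=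
  tsum_mul_tsum_of_summable_norm (summable_norm_thetaTerm hτ) (summable_norm_thetaTerm hτ')

lemma summable_thetaTerm_mul {τ τ' : ℂ} (hτ : 0 < τ.im) (hτ' : 0 < τ'.im) :
    Summable fun x : ℤ × ℤ => thetaTerm τ x.1 * thetaTerm τ' x.2 :=
  summable_mul_of_summable_norm (summable_norm_thetaTerm hτ) (summable_norm_thetaTerm hτ')

/-- The square of the theta constant `θ₃`. -/
noncomputable def thA (τ : ℂ) : ℂ := jacobiTheta τ ^ 2

/-- The square of the theta constant `θ₄`. -/
noncomputable def thB (τ : ℂ) : ℂ := thA (τ + 1)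

/-- The square of the theta constant `θ₂`. -/
noncomputable def thC (τ : ℂ) : ℂ := I / τ * thB (-1 / τ)

lemma im_add_one_pos {τ : ℂ} (hτ : 0 < τ.im) : 0 < (τ + 1).im := by simpa using hτ

lemma im_two_mul_pos {τ : ℂ} (hτ : 0 < τ.im) : 0 < (2 * τ).im := by simpa using hτ

lemma im_neg_one_div_pos {τ : ℂ} (hτ : 0 < τ.im) : 0 < (-1 / τ).im := by
  have h0 : τ ≠ 0 := by rintro rfl; simp at hτ
  rw [neg_div, one_div, neg_im, inv_im, neg_div, neg_neg]
  exact div_pos hτ (normSq_pos.mpr h0)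

lemma ne_zero_of_im_pos {τ : ℂ} (hτ : 0 < τ.im) : τ ≠ 0 := by rintro rfl; simp at hτ

lemma thA_add_thB {τ : ℂ} (hτ : 0 < τ.im) : thA τ + thB τ = 2 * thA (2 * τ) := by
  have h1 := im_add_one_pos hτ
  have h2 := im_two_mul_pos hτ
  unfold thB thA
  rw [sq, sq, sq, jacobiTheta_mul hτ hτ, jacobiTheta_mul h1 h1, jacobiTheta_mul h2 h2,
    ← (summable_thetaTerm_mul hτ hτ).tsum_add (summable_thetaTerm_mul h1 h1), tsum_rotate,
    ← tsum_mul_left]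
  · refine tsum_congr fun x => ?_
    simp only [thetaTerm_add_one]
    have key := thetaTerm_mul_rotate τ x.1 x.2
    by_cases h : Even (x.1 + x.2)
    · have h' : Even (x.1 - x.2) := by grind
      simp only [h, h', if_true]; linear_combination 2 * key
    · have h' : ¬ Even (x.1 - x.2) := by grind
      simp only [h, h', if_false]; linear_combination 2 * key
  · intro m n h
    simp only [thetaTerm_add_one]
    by_cases hm : Even m
    · have hn : ¬ Even n := by grind
      simp [hm, hn]
    · have hn : Even n := by grind
      simp [hm, hn]

lemma jacobiTheta_mul_shift {τ : ℂ} (hτ : 0 < τ.im) :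
    jacobiTheta τ * jacobiTheta (τ + 1) = jacobiTheta (2 * τ + 1) ^ 2 := by
  have h1 := im_add_one_pos hτ
  have h2 := im_add_one_pos (im_two_mul_pos hτ)
  have e1 := jacobiTheta_mul hτ h1
  have e2 := jacobiTheta_mul h1 hτ
  have : 2 * (jacobiTheta τ * jacobiTheta (τ + 1)) = 2 * jacobiTheta (2 * τ + 1) ^ 2 := by
    rw [two_mul]
    nth_rewrite 2 [mul_comm]
    rw [e1, e2, sq, jacobiTheta_mul h2 h2,
      ← (summable_thetaTerm_mul hτ h1).tsum_add (summable_thetaTerm_mul h1 hτ), tsum_rotate,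
      ← tsum_mul_left]
    · refine tsum_congr fun x => ?_
      simp only [thetaTerm_add_one]
      have key := thetaTerm_mul_rotate τ x.1 x.2
      by_cases hu : Even x.1 <;> by_cases hv : Even x.2
      · have h : Even (x.1 + x.2) := by grind
        have h' : Even (x.1 - x.2) := by grind
        simp only [h, h', hu, hv, if_true]; linear_combination 2 * key
      · have h : ¬ Even (x.1 + x.2) := by grind
        have h' : ¬ Even (x.1 - x.2) := by grind
        simp only [h, h', hu, hv, if_true, if_false]; linear_combination -2 * key
      · have h : ¬ Even (x.1 + x.2) := by grind
        have h' : ¬ Even (x.1 - x.2) := by grind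
        simp only [h, h', hu, hv, if_true, if_false]; linear_combination -2 * key
      · have h : Even (x.1 + x.2) := by grind
        have h' : Even (x.1 - x.2) := by grind
        simp only [h, h', hu, hv, if_true, if_false]; linear_combination 2 * key
    · intro m n h
      simp only [thetaTerm_add_one]
      by_cases hm : Even m
      · have hn : ¬ Even n := by grind
        simp [hm, hn]
      · have hn : Even n := by grind
        simp [hm, hn]
  exact mul_left_cancel₀ two_ne_zero this

lemma thA_mul_thB {τ : ℂ} (hτ : 0 < τ.im) : thA τ * thB τ = thB (2 * τ) ^ 2 := by
  unfold thB thA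
  rw [← mul_pow, jacobiTheta_mul_shift hτ]

lemma thA_S {τ : ℂ} (hτ : 0 < τ.im) : thA (-1 / τ) = -I * τ * thA τ := by
  have := jacobiTheta_S_smul ⟨τ, hτ⟩
  rw [UpperHalfPlane.modular_S_smul] at this
  have e : ((UpperHalfPlane.mk (-(UpperHalfPlane.mk τ hτ : ℂ))⁻¹
    (UpperHalfPlane.mk τ hτ).im_inv_neg_coe_pos : UpperHalfPlane) : ℂ) = -1 / τ := by
    simp [neg_div, inv_neg]
  rw [e] at this
  unfold thA
  rw [this, mul_pow, ← Complex.cpow_nat_mul]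
  norm_num

lemma thA_add_two (τ : ℂ) : thA (τ + 2) = thA τ := by
  unfold thA; rw [add_comm, jacobiTheta_two_add]

lemma thB_add_one (τ : ℂ) : thB (τ + 1) = thA τ := by
  unfold thB; rw [add_assoc, one_add_one_eq_two, thA_add_two]

lemma thB_add_two (τ : ℂ) : thB (τ + 2) = thB τ := by
  unfold thB; rw [add_right_comm, thA_add_two]

lemma thB_S {τ : ℂ} (hτ : 0 < τ.im) : thB (-1 / τ) = -I * τ * thC τ := by
  have := ne_zero_of_im_pos hτ
  unfold thC
  field_simp
  linear_combination (thB (-(1 / τ)) * I_sq)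

lemma thA_two_mul_add_thC {τ : ℂ} (hτ : 0 < τ.im) : thA (2 * τ) + thC (2 * τ) = thA τ := by
  have h2 := im_two_mul_pos hτ
  have h0 := ne_zero_of_im_pos hτ
  have key := thA_add_thB (im_neg_one_div_pos h2)
  have e : 2 * (-1 / (2 * τ)) = -1 / τ := by field_simp
  rw [e, thA_S h2, thB_S h2, thA_S hτ] at key
  have : (-I * (2 * τ)) * (thA (2 * τ) + thC (2 * τ)) = (-I * (2 * τ)) * thA τ := by
    linear_combination key
  exact mul_left_cancel₀ (by simp [h0]) this

lemma thA_sub_thB {τ : ℂ} (hτ : 0 < τ.im) : thA τ - thB τ = 2 * thC (2 * τ) := by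
  linear_combination -2 * thA_two_mul_add_thC hτ - thA_add_thB hτ

lemma thC_sq {τ : ℂ} (hτ : 0 < τ.im) : thC τ ^ 2 = thA τ ^ 2 - thB τ ^ 2 := by
  have h2 := im_two_mul_pos hτ
  have h0 := ne_zero_of_im_pos hτ
  have key := thA_mul_thB (im_neg_one_div_pos h2)
  have e : 2 * (-1 / (2 * τ)) = -1 / τ := by field_simp
  rw [e, thA_S h2, thB_S h2, thB_S hτ] at key
  have e2 : 4 * thA (2 * τ) * thC (2 * τ) = thC τ ^ 2 := by
    have : (-I * τ) ^ 2 * (4 * thA (2 * τ) * thC (2 * τ)) = (-I * τ) ^ 2 * thC τ ^ 2 := by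
      linear_combination key
    exact mul_left_cancel₀ (by simp [h0]) this
  rw [← e2]
  have a1 := thA_add_thB hτ
  have a2 := thA_sub_thB hτ
  linear_combination -(thA τ - thB τ) * a1 - 2 * thA (2 * τ) * a2

/-! ### Non-vanishing -/

lemma tendsto_jacobiTheta_im : Tendsto jacobiTheta (comap im atTop) (𝓝 1) := by
  have h := isBigO_at_im_infty_jacobiTheta_sub_one
  have h2 : Tendsto (fun τ : ℂ => Real.exp (-Real.pi * τ.im)) (comap im atTop) (𝓝 0) := by
    refine Real.tendsto_exp_atBot.comp ?_
    exact (tendsto_const_mul_atBot_of_neg (by simp [Real.pi_pos])).mpr tendsto_comap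
  have := (h.trans_tendsto h2).add_const 1
  simpa using this

lemma jacobiTheta_shift_two_pow {τ : ℂ} (hτ : 0 < τ.im) (h : jacobiTheta (τ + 1) = 0) (n : ℕ) :
    jacobiTheta (2 ^ n * τ + 1) = 0 := by
  induction n with
  | zero => simpa using h
  | succ k ih =>
    have hk : 0 < (2 ^ k * τ).im := by
      have : (2 ^ k * τ).im = 2 ^ k * τ.im := by
        have : ((2 : ℂ) ^ k) = ((2 ^ k : ℝ) : ℂ) := by push_cast; rfl
        rw [this, im_ofReal_mul]
      rw [this]; positivity
    have := jacobiTheta_mul_shift hk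
    rw [ih, mul_zero] at this
    rw [pow_succ', mul_assoc]
    exact pow_eq_zero_iff (two_ne_zero) |>.mp this.symm

lemma jacobiTheta_shift_ne_zero {τ : ℂ} (hτ : 0 < τ.im) : jacobiTheta (τ + 1) ≠ 0 := by
  intro h
  have h1 : Tendsto (fun n : ℕ => (2 : ℂ) ^ n * τ + 1) atTop (comap im atTop) := by
    rw [tendsto_comap_iff]
    have : (im ∘ fun n : ℕ => (2 : ℂ) ^ n * τ + 1) = fun n => (2 : ℝ) ^ n * τ.im := by
      ext n
      have : ((2 : ℂ) ^ n) = ((2 ^ n : ℝ) : ℂ) := by push_cast; rfl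
      simp only [Function.comp, this, add_im, im_ofReal_mul, one_im, add_zero]
    rw [this]
    exact (tendsto_pow_atTop_atTop_of_one_lt one_lt_two).atTop_mul_const hτ
  have h2 := tendsto_jacobiTheta_im.comp h1
  have h3 : (jacobiTheta ∘ fun n : ℕ => (2 : ℂ) ^ n * τ + 1) = fun _ => 0 := by
    ext n; exact jacobiTheta_shift_two_pow hτ h n
  rw [h3] at h2
  exact zero_ne_one (tendsto_nhds_unique tendsto_const_nhds h2)

lemma thB_ne_zero {τ : ℂ} (hτ : 0 < τ.im) : thB τ ≠ 0 :=
  pow_ne_zero 2 (jacobiTheta_shift_ne_zero hτ)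

lemma thA_ne_zero {τ : ℂ} (hτ : 0 < τ.im) : thA τ ≠ 0 := by
  rw [← thB_add_one]; exact thB_ne_zero (im_add_one_pos hτ)

lemma thC_ne_zero {τ : ℂ} (hτ : 0 < τ.im) : thC τ ≠ 0 := by
  unfold thC
  exact mul_ne_zero (div_ne_zero I_ne_zero (ne_zero_of_im_pos hτ))
    (thB_ne_zero (im_neg_one_div_pos hτ))

/-! ### The modular lambda function -/

/-- The modular function `λ = 1 - θ₄⁴ / θ₃⁴`. -/
noncomputable def lam (τ : ℂ) : ℂ := 1 - thB τ ^ 2 / thA τ ^ 2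

lemma lam_eq {τ : ℂ} (hτ : 0 < τ.im) : lam τ = thC τ ^ 2 / thA τ ^ 2 := by
  have := thA_ne_zero hτ
  rw [thC_sq hτ, lam]; field_simp

lemma lam_ne_zero {τ : ℂ} (hτ : 0 < τ.im) : lam τ ≠ 0 := by
  rw [lam_eq hτ]
  exact div_ne_zero (pow_ne_zero 2 (thC_ne_zero hτ)) (pow_ne_zero 2 (thA_ne_zero hτ))

lemma lam_ne_one {τ : ℂ} (hτ : 0 < τ.im) : lam τ ≠ 1 := by
  intro h
  have : thB τ ^ 2 / thA τ ^ 2 = 0 := by unfold lam at h; linear_combination -h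
  exact div_ne_zero (pow_ne_zero 2 (thB_ne_zero hτ)) (pow_ne_zero 2 (thA_ne_zero hτ)) this

lemma lam_add_one {τ : ℂ} (hτ : 0 < τ.im) : lam (τ + 1) = lam τ / (lam τ - 1) := by
  have h1 := thA_ne_zero hτ
  have h2 := thB_ne_zero hτ
  unfold lam
  rw [thB_add_one]
  change 1 - thA τ ^ 2 / thB τ ^ 2 = _
  have : (1 - thB τ ^ 2 / thA τ ^ 2 - 1) ≠ 0 := by
    rw [sub_sub_cancel_left]
    exact neg_ne_zero.mpr (div_ne_zero (pow_ne_zero 2 h2) (pow_ne_zero 2 h1))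
  rw [eq_div_iff this]
  field_simp
  ring

lemma lam_add_two (τ : ℂ) : lam (τ + 2) = lam τ := by
  unfold lam; rw [thB_add_two, thA_add_two]

lemma lam_S {τ : ℂ} (hτ : 0 < τ.im) : lam (-1 / τ) = 1 - lam τ := by
  have h1 := thA_ne_zero hτ
  have h0 := ne_zero_of_im_pos hτ
  rw [lam_eq hτ, lam, thB_S hτ, thA_S hτ]
  field_simp

lemma lam_one_sub_inv {τ : ℂ} (hτ : 0 < τ.im) : lam (1 - 1 / τ) = 1 - 1 / lam τ := by
  have h1 := lam_ne_zero hτ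
  have e : 1 - 1 / τ = -1 / τ + 1 := by ring
  rw [e, lam_add_one (im_neg_one_div_pos hτ), lam_S hτ]
  have h2 : 1 - lam τ - 1 ≠ 0 := by simpa using h1
  rw [div_eq_iff h2]
  field_simp
  ring

lemma thA_one_sub_inv {τ : ℂ} (hτ : 0 < τ.im) : thA (1 - 1 / τ) = -I * τ * thC τ := by
  have e : 1 - 1 / τ = -1 / τ + 1 := by ring
  rw [e, ← thB_S hτ]; rfl

lemma differentiableAt_thA {τ : ℂ} (hτ : 0 < τ.im) : DifferentiableAt ℂ thA τ :=
  (differentiableAt_jacobiTheta hτ).pow 2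

lemma differentiableAt_thB {τ : ℂ} (hτ : 0 < τ.im) : DifferentiableAt ℂ thB τ := by
  exact DifferentiableAt.comp (f := fun z : ℂ => z + 1) τ
    (differentiableAt_thA (im_add_one_pos hτ)) (by fun_prop)

lemma differentiableAt_lam {τ : ℂ} (hτ : 0 < τ.im) : DifferentiableAt ℂ lam τ := by
  unfold lam
  exact (differentiableAt_const _).sub (((differentiableAt_thB hτ).pow 2).div
    ((differentiableAt_thA hτ).pow 2) (pow_ne_zero 2 (thA_ne_zero hτ)))

lemma tendsto_thA_im : Tendsto thA (comap im atTop) (𝓝 1) := by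
  simpa using! tendsto_jacobiTheta_im.pow 2

lemma tendsto_thB_im : Tendsto thB (comap im atTop) (𝓝 1) := by
  refine tendsto_thA_im.comp ?_
  rw [tendsto_comap_iff]
  have : (im ∘ fun τ : ℂ => τ + 1) = im := by ext; simp
  rw [this]; exact tendsto_comap

lemma tendsto_lam_im : Tendsto lam (comap im atTop) (𝓝 0) := by
  have := (tendsto_const_nhds (x := (1 : ℂ))).sub
    ((tendsto_thB_im.pow 2).div (tendsto_thA_im.pow 2) (by simp))
  simpa using! this

end Theta

end LegendreSatoTate


namespace LegendreSatoTate

open Complex Filter Topology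

section Moebius

/-- The Möbius action of an integer matrix. -/
noncomputable def mob (M : Matrix (Fin 2) (Fin 2) ℤ) (τ : ℂ) : ℂ :=
  (M 0 0 * τ + M 0 1) / (M 1 0 * τ + M 1 1)

/-- The denominator of the Möbius action. -/
noncomputable def den (M : Matrix (Fin 2) (Fin 2) ℤ) (τ : ℂ) : ℂ := M 1 0 * τ + M 1 1

lemma den_ne_zero {M : Matrix (Fin 2) (Fin 2) ℤ} (hM : M.det ≠ 0) {τ : ℂ} (hτ : 0 < τ.im) :
    den M τ ≠ 0 := by
  intro h
  have him := congrArg im h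
  have hre := congrArg re h
  simp [den] at him hre
  rcases him with h1 | h1
  · simp only [h1, Int.cast_zero, zero_mul, zero_add] at hre
    apply hM
    rw [Matrix.det_fin_two, h1]
    have : M 1 1 = 0 := by exact_mod_cast hre
    rw [this]; ring
  · exact hτ.ne' h1

lemma im_mob (M : Matrix (Fin 2) (Fin 2) ℤ) (τ : ℂ) :
    (mob M τ).im = M.det * τ.im / normSq (den M τ) := by
  rw [mob, div_im, Matrix.det_fin_two]
  change _ / normSq (den M τ) - _ / normSq (den M τ) = _
  rw [← sub_div]
  congr 1
  simp
  ring

lemma im_mob_pos {M : Matrix (Fin 2) (Fin 2) ℤ} (hM : 0 < M.det) {τ : ℂ} (hτ : 0 < τ.im) :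
    0 < (mob M τ).im := by
  rw [im_mob]
  exact div_pos (mul_pos (by exact_mod_cast hM) hτ) (normSq_pos.mpr (den_ne_zero hM.ne' hτ))

lemma den_mul (M N : Matrix (Fin 2) (Fin 2) ℤ) {τ : ℂ} (hN : den N τ ≠ 0) :
    den (M * N) τ = den M (mob N τ) * den N τ := by
  have h : (N 1 0 * τ + N 1 1 : ℂ) ≠ 0 := hN
  simp only [den, mob, Matrix.mul_apply, Fin.sum_univ_two]
  push_cast
  field_simp
  ring

lemma mob_mul (M N : Matrix (Fin 2) (Fin 2) ℤ) {τ : ℂ} (hN : den N τ ≠ 0) :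
    mob (M * N) τ = mob M (mob N τ) := by
  have h : (N 1 0 * τ + N 1 1 : ℂ) ≠ 0 := hN
  have e : (M 1 0 * mob N τ + M 1 1 : ℂ) = den M (mob N τ) := rfl
  have e2 := den_mul M N hN
  have e3 : mob M (mob N τ) = ((M 0 0 * mob N τ + M 0 1) * den N τ) /
      (den M (mob N τ) * den N τ) := by
    rw [mul_div_mul_right _ _ hN]; rfl
  rw [e3, ← e2]
  change _ / den (M * N) τ = _
  congr 1
  simp only [den, mob, Matrix.mul_apply, Fin.sum_univ_two]
  push_cast
  field_simp
  ring

lemma mob_neg (M : Matrix (Fin 2) (Fin 2) ℤ) (τ : ℂ) : mob (-M) τ = mob M τ := by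
  simp only [mob, Matrix.neg_apply, Int.cast_neg]
  rw [← neg_div_neg_eq]
  congr 1 <;> ring

lemma den_neg (M : Matrix (Fin 2) (Fin 2) ℤ) (τ : ℂ) : den (-M) τ = -den M τ := by
  simp only [den, Matrix.neg_apply, Int.cast_neg]
  ring

/-- Integer matrices of determinant `n` congruent to the identity modulo `2`. -/
def X2 (n : ℤ) : Set (Matrix (Fin 2) (Fin 2) ℤ) :=
  {M | M.det = n ∧ Odd (M 0 0) ∧ Even (M 0 1) ∧ Even (M 1 0) ∧ Odd (M 1 1)}

lemma X2_mul {m n : ℤ} {M N : Matrix (Fin 2) (Fin 2) ℤ} (hM : M ∈ X2 m) (hN : N ∈ X2 n) :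
    M * N ∈ X2 (m * n) := by
  obtain ⟨h1, h2, h3, h4, h5⟩ := hM
  obtain ⟨k1, k2, k3, k4, k5⟩ := hN
  refine ⟨by rw [Matrix.det_mul, h1, k1], ?_⟩
  simp only [Matrix.mul_apply, Fin.sum_univ_two]
  exact ⟨(h2.mul k2).add_even (h3.mul_right _), (k3.mul_left _).add (h3.mul_right _),
    (h4.mul_right _).add (k4.mul_left _), (h4.mul_right _).add_odd (h5.mul k5)⟩

lemma X2_neg {n : ℤ} {M : Matrix (Fin 2) (Fin 2) ℤ} (hM : M ∈ X2 n) : -M ∈ X2 n := by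
  obtain ⟨h1, h2, h3, h4, h5⟩ := hM
  refine ⟨?_, by simpa using h2, by simpa using h3, by simpa using h4, by simpa using h5⟩
  rw [← h1, Matrix.det_fin_two, Matrix.det_fin_two]; simp

lemma X2_adjugate {n : ℤ} {M : Matrix (Fin 2) (Fin 2) ℤ} (hM : M ∈ X2 n) :
    M.adjugate ∈ X2 n := by
  obtain ⟨h1, h2, h3, h4, h5⟩ := hM
  rw [Matrix.adjugate_fin_two]
  refine ⟨?_, by simpa using h5, by simpa using h3, by simpa using h4, by simpa using h2⟩
  rw [← h1, Matrix.det_fin_two, Matrix.det_fin_two]; simp; ring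

lemma X2_upper (k : ℤ) : !![1, 2 * k; 0, 1] ∈ X2 1 := by
  refine ⟨by simp [Matrix.det_fin_two], by simp, by simp, by simp, by simp⟩

lemma X2_lower (k : ℤ) : !![1, 0; 2 * k, 1] ∈ X2 1 := by
  refine ⟨by simp [Matrix.det_fin_two], by simp, by simp, by simp, by simp⟩

/-- For `y ≠ 0` any integer can be translated by multiples of `2 * y` into `[-|y|, |y|]`. -/
lemma exists_abs_add_two_mul_le (x y : ℤ) (hy : y ≠ 0) : ∃ k : ℤ, |x + 2 * k * y| ≤ |y| := by
  refine ⟨-((x + |y|) / (2 * |y|)) * y.sign, ?_⟩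
  have e : x + 2 * (-((x + |y|) / (2 * |y|)) * y.sign) * y
      = (x + |y|) % (2 * |y|) - |y| := by
    rw [Int.emod_def]
    have : y.sign * y = |y| := Int.sign_mul_self_eq_abs y
    linear_combination (-2 * ((x + |y|) / (2 * |y|))) * this
  have hp : 0 < |y| := abs_pos.mpr hy
  have h1 := Int.emod_nonneg (x + |y|) (by positivity : 2 * |y| ≠ 0)
  have h2 := Int.emod_lt_of_pos (x + |y|) (by positivity : 0 < 2 * |y|)
  rw [e, abs_le]
  constructor <;> linarith

/-- `Γ(2)` is generated by the upper and lower unipotents and `-1`. -/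
theorem gamma2_induction {P : Matrix (Fin 2) (Fin 2) ℤ → Prop} (h1 : P 1)
    (hneg : ∀ M ∈ X2 1, P M → P (-M))
    (hT : ∀ M ∈ X2 1, ∀ k : ℤ, P M → P (!![1, 2 * k; 0, 1] * M))
    (hV : ∀ M ∈ X2 1, ∀ k : ℤ, P M → P (!![1, 0; 2 * k, 1] * M))
    {M : Matrix (Fin 2) (Fin 2) ℤ} (hM : M ∈ X2 1) : P M := by
  have hone : (1 : Matrix (Fin 2) (Fin 2) ℤ) ∈ X2 1 := by
    refine ⟨by simp, by simp, by simp, by simp, by simp⟩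
  induction hn : (M 1 0).natAbs using Nat.strong_induction_on generalizing M with
  | _ n ih =>
    by_cases hc : M 1 0 = 0
    · obtain ⟨hd, ho, he, -, -⟩ := hM
      rw [Matrix.det_fin_two, hc, mul_zero, sub_zero] at hd
      obtain ⟨k, hk⟩ := he
      rcases Int.mul_eq_one_iff_eq_one_or_neg_one.mp hd with ⟨ha, hd⟩ | ⟨ha, hd⟩
      · have : M = !![1, 2 * k; 0, 1] * 1 := by
          ext i j; fin_cases i <;> fin_cases j <;> simp [ha, hd, hc, hk]; ring
        rw [this]; exact hT 1 hone k h1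
      · have : M = !![1, 2 * (-k); 0, 1] * (-1) := by
          ext i j; fin_cases i <;> fin_cases j <;> simp [ha, hd, hc, hk]; ring
        rw [this]; exact hT _ (X2_neg hone) _ (hneg 1 hone h1)
    · obtain ⟨k, hk⟩ := exists_abs_add_two_mul_le (M 0 0) (M 1 0) hc
      set N := !![1, 2 * k; 0, 1] * M with hN
      have hNX : N ∈ X2 1 := by have := X2_mul (X2_upper k) hM; rwa [one_mul] at this
      have hN10 : N 1 0 = M 1 0 := by
        rw [hN, Matrix.mul_apply, Fin.sum_univ_two]; simp
      have hN00 : N 0 0 = M 0 0 + 2 * k * M 1 0 := by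
        rw [hN, Matrix.mul_apply, Fin.sum_univ_two]; simp
      have hlt : |N 0 0| < |M 1 0| := by
        rw [hN00]
        refine lt_of_le_of_ne hk fun he => ?_
        have o1 : Odd |N 0 0| := odd_abs.mpr hNX.2.1
        have o2 : Even |M 1 0| := even_abs.mpr hM.2.2.2.1
        rw [hN00, he] at o1
        exact Int.not_even_iff_odd.mpr o1 o2
      have hne : N 0 0 ≠ 0 := by
        intro h0; have := hNX.2.1; rw [h0] at this; simp at this
      obtain ⟨l, hl⟩ := exists_abs_add_two_mul_le (N 1 0) (N 0 0) hne
      set N' := !![1, 0; 2 * l, 1] * N with hN'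
      have hNX' : N' ∈ X2 1 := by have := X2_mul (X2_lower l) hNX; rwa [one_mul] at this
      have hN10' : N' 1 0 = N 1 0 + 2 * l * N 0 0 := by
        rw [hN', Matrix.mul_apply, Fin.sum_univ_two]; simp; ring
      have hP' : P N' := by
        refine ih _ ?_ hNX' rfl
        rw [← hn]
        have : |N' 1 0| < |M 1 0| := by rw [hN10']; exact lt_of_le_of_lt hl hlt
        rw [Int.abs_eq_natAbs, Int.abs_eq_natAbs] at this
        exact_mod_cast this
      have hPN : P N := by
        have : N = !![1, 0; 2 * (-l), 1] * N' := by
          rw [hN', ← Matrix.mul_assoc]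
          have : !![1, 0; 2 * (-l), 1] * !![1, 0; 2 * l, 1] = (1 : Matrix (Fin 2) (Fin 2) ℤ) := by
            ext i j; fin_cases i <;> fin_cases j <;> simp
          rw [this, one_mul]
        rw [this]; exact hV _ hNX' _ hP'
      have : M = !![1, 2 * (-k); 0, 1] * N := by
        rw [hN, ← Matrix.mul_assoc]
        have : !![1, 2 * (-k); 0, 1] * !![1, 2 * k; 0, 1] = (1 : Matrix (Fin 2) (Fin 2) ℤ) := by
          ext i j; fin_cases i <;> fin_cases j <;> simp
        rw [this, one_mul]
      rw [this]; exact hT _ hNX _ hPN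

/-- The character `χ₄` of the upper left entry. -/
def chi (M : Matrix (Fin 2) (Fin 2) ℤ) : ℤ := ZMod.χ₄ (M 0 0 : ZMod 4)

lemma chi_mul {m n : ℤ} {M N : Matrix (Fin 2) (Fin 2) ℤ} (hM : M ∈ X2 m) (hN : N ∈ X2 n) :
    chi (M * N) = chi M * chi N := by
  unfold chi
  rw [← map_mul]
  congr 1
  obtain ⟨k, hk⟩ := hM.2.2.1
  obtain ⟨l, hl⟩ := hN.2.2.2.1
  simp only [Matrix.mul_apply, Fin.sum_univ_two, hk, hl]
  push_cast
  have : (4 : ZMod 4) = 0 := rfl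
  linear_combination (k * l : ZMod 4) * this

lemma chi_neg (M : Matrix (Fin 2) (Fin 2) ℤ) : chi (-M) = -chi M := by
  unfold chi
  rw [Matrix.neg_apply, Int.cast_neg, ← neg_one_mul, map_mul]
  have : ZMod.χ₄ (-1 : ZMod 4) = -1 := by decide
  rw [this]; ring

lemma chi_sq {n : ℤ} {M : Matrix (Fin 2) (Fin 2) ℤ} (hM : M ∈ X2 n) : chi M ^ 2 = 1 := by
  have h := hM.2.1
  unfold chi
  have : ∀ x : ZMod 4, x = 1 ∨ x = 3 → ZMod.χ₄ x ^ 2 = 1 := by decide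
  apply this
  obtain ⟨k, hk⟩ := h
  rw [hk]
  rcases Int.even_or_odd' k with ⟨l, rfl | rfl⟩
  · left
    have : (4 : ZMod 4) = 0 := rfl
    push_cast; linear_combination (l : ZMod 4) * this
  · right
    have : (4 : ZMod 4) = 0 := rfl
    push_cast; linear_combination (l : ZMod 4) * this

lemma periodic_int_of_two {F : ℂ → ℂ} (h : ∀ τ, F (τ + 2) = F τ) (k : ℤ) (τ : ℂ) :
    F (τ + 2 * k) = F τ := by
  have hp : Function.Periodic F 2 := h
  have := hp.int_mul k τ
  rw [mul_comm]; exact this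

lemma mob_upper (k : ℤ) (τ : ℂ) : mob !![1, 2 * k; 0, 1] τ = τ + 2 * k := by
  simp [mob]

lemma den_upper (k : ℤ) (τ : ℂ) : den !![1, 2 * k; 0, 1] τ = 1 := by
  simp [den]

lemma neg_one_div_mob_lower (k : ℤ) {τ : ℂ} (hτ : 0 < τ.im) :
    -1 / mob !![1, 0; 2 * k, 1] τ = -1 / τ + 2 * (-k : ℤ) := by
  have h0 := ne_zero_of_im_pos hτ
  simp [mob]
  field_simp
  ring

lemma lam_lower (k : ℤ) {τ : ℂ} (hτ : 0 < τ.im) : lam (mob !![1, 0; 2 * k, 1] τ) = lam τ := by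
  have hp : 0 < (mob !![1, 0; 2 * k, 1] τ).im := im_mob_pos (by simp [Matrix.det_fin_two]) hτ
  have h1 := lam_S hp
  rw [neg_one_div_mob_lower k hτ, periodic_int_of_two lam_add_two, lam_S hτ] at h1
  linear_combination h1

lemma thA_lower (k : ℤ) {τ : ℂ} (hτ : 0 < τ.im) :
    thA (mob !![1, 0; 2 * k, 1] τ) = den !![1, 0; 2 * k, 1] τ * thA τ := by
  have hp : 0 < (mob !![1, 0; 2 * k, 1] τ).im := im_mob_pos (by simp [Matrix.det_fin_two]) hτ
  have h1 := thA_S hp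
  rw [neg_one_div_mob_lower k hτ, periodic_int_of_two thA_add_two, thA_S hτ] at h1
  have hd : den !![1, 0; 2 * k, 1] τ ≠ 0 := den_ne_zero (by simp [Matrix.det_fin_two]) hτ
  have e : mob !![1, 0; 2 * k, 1] τ * den !![1, 0; 2 * k, 1] τ = τ := by
    have : mob !![1, 0; 2 * k, 1] τ = τ / den !![1, 0; 2 * k, 1] τ := by
      simp [mob, den]
    rw [this, div_mul_cancel₀ _ hd]
  have h0 := ne_zero_of_im_pos hp
  have : (-I * mob !![1, 0; 2 * k, 1] τ) * thA (mob !![1, 0; 2 * k, 1] τ)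
    = (-I * mob !![1, 0; 2 * k, 1] τ) * (den !![1, 0; 2 * k, 1] τ * thA τ) := by
    linear_combination -h1 + I * thA τ * e
  exact mul_left_cancel₀ (by simp [h0]) this

lemma lam_gamma2 {M : Matrix (Fin 2) (Fin 2) ℤ} (hM : M ∈ X2 1) {τ : ℂ} (hτ : 0 < τ.im) :
    lam (mob M τ) = lam τ := by
  revert τ
  refine gamma2_induction (P := fun M => ∀ {τ : ℂ}, 0 < τ.im → lam (mob M τ) = lam τ)
    ?_ ?_ ?_ ?_ hM
  · intro τ hτ; simp [mob]
  · intro M hM h τ hτ; rw [mob_neg, h hτ]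
  · intro M hM k h τ hτ
    rw [mob_mul _ _ (den_ne_zero (by rw [hM.1]; simp) hτ), mob_upper,
      periodic_int_of_two lam_add_two, h hτ]
  · intro M hM k h τ hτ
    rw [mob_mul _ _ (den_ne_zero (by rw [hM.1]; simp) hτ),
      lam_lower k (im_mob_pos (by rw [hM.1]; simp) hτ), h hτ]

lemma thA_gamma2 {M : Matrix (Fin 2) (Fin 2) ℤ} (hM : M ∈ X2 1) {τ : ℂ} (hτ : 0 < τ.im) :
    thA (mob M τ) = chi M * den M τ * thA τ := by
  revert τ
  refine gamma2_induction (P := fun M => ∀ {τ : ℂ}, 0 < τ.im →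
    thA (mob M τ) = chi M * den M τ * thA τ) ?_ ?_ ?_ ?_ hM
  · intro τ hτ; simp [mob, den, chi]
  · intro M hM h τ hτ; rw [mob_neg, h hτ, chi_neg, den_neg]; push_cast; ring
  · intro M hM k h τ hτ
    have hd := den_ne_zero (by rw [hM.1]; simp : M.det ≠ 0) hτ
    rw [mob_mul _ _ hd, mob_upper, periodic_int_of_two thA_add_two, h hτ, chi_mul (X2_upper k) hM,
      den_mul _ _ hd, den_upper]
    simp [chi]
  · intro M hM k h τ hτ
    have hd := den_ne_zero (by rw [hM.1]; simp : M.det ≠ 0) hτ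
    rw [mob_mul _ _ hd, thA_lower k (im_mob_pos (by rw [hM.1]; simp) hτ), h hτ,
      chi_mul (X2_lower k) hM, den_mul _ _ hd]
    simp [chi]; ring

end Moebius

end LegendreSatoTate

namespace LegendreSatoTate

open Complex Filter Topology

section QSeries

open PowerSeries

/-- The nome `e ^ (π i τ)`. -/
noncomputable def nome (τ : ℂ) : ℂ := cexp (Real.pi * I * τ)

lemma nome_ne_zero (τ : ℂ) : nome τ ≠ 0 := exp_ne_zero _

lemma nome_eq_qParam (τ : ℂ) : nome τ = Function.Periodic.qParam 2 τ := by
  rw [nome, Function.Periodic.qParam]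
  congr 1
  push_cast
  field_simp

lemma norm_nome (τ : ℂ) : ‖nome τ‖ = Real.exp (-Real.pi * τ.im) := by
  rw [nome, norm_exp]
  simp

lemma norm_nome_lt_one {τ : ℂ} (hτ : 0 < τ.im) : ‖nome τ‖ < 1 := by
  rw [norm_nome, Real.exp_lt_one_iff]
  nlinarith [Real.pi_pos]

lemma nome_add (τ w : ℂ) : nome (τ + w) = nome τ * nome w := by
  rw [nome, mul_add, exp_add]; rfl

lemma nome_nat_mul (k : ℕ) (τ : ℂ) : nome (k * τ) = nome τ ^ k := by
  rw [nome, nome, ← exp_nat_mul]; congr 1; ring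

lemma nome_two : nome 2 = 1 := by
  rw [nome, ← exp_two_pi_mul_I]; congr 1; ring

lemma nome_one : nome 1 = -1 := by
  rw [nome, mul_one, exp_pi_mul_I]

lemma tendsto_nome : Tendsto nome (comap im atTop) (𝓝[≠] 0) := by
  have := Function.Periodic.qParam_tendsto (h := 2) two_pos
  rwa [show Function.Periodic.qParam 2 = nome from (funext nome_eq_qParam).symm] at this

lemma map_nome : map nome (comap im atTop) = 𝓝[≠] 0 := by
  refine le_antisymm tendsto_nome ?_
  have h := Function.Periodic.invQParam_tendsto (h := 2) two_pos
  have h2 := map_mono (m := nome) h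
  rw [map_map] at h2
  refine le_trans (le_of_eq ?_) h2
  conv_lhs => rw [← map_id (f := 𝓝[≠] (0 : ℂ))]
  refine Filter.map_congr ?_
  filter_upwards [self_mem_nhdsWithin] with s hs
  simp only [id, Function.comp]
  rw [nome_eq_qParam, Function.Periodic.qParam_right_inv two_ne_zero hs]

instance neBot_comap_im : (comap im atTop).NeBot := by
  have : (map nome (comap im atTop)).NeBot := by rw [map_nome]; infer_instance
  exact this.of_map

/-- `QExp u g` says that near `i∞` the function `g` is the sum of the power series `u` in the
nome. -/
def QExp (u : ℂ⟦X⟧) (g : ℂ → ℂ) : Prop :=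
  ∀ᶠ τ in comap im atTop, HasSum (fun n => coeff n u * nome τ ^ n) (g τ)

lemma QExp.congr {u : ℂ⟦X⟧} {g h : ℂ → ℂ} (hu : QExp u g) (hgh : ∀ᶠ τ in comap im atTop, g τ = h τ) :
    QExp u h := by
  filter_upwards [hu, hgh] with τ h1 h2
  rwa [h2] at h1

lemma QExp.add {u v : ℂ⟦X⟧} {g h : ℂ → ℂ} (hu : QExp u g) (hv : QExp v h) :
    QExp (u + v) (fun τ => g τ + h τ) := by
  filter_upwards [hu, hv] with τ h1 h2
  convert! h1.add h2 using 2 with n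
  simp [add_mul]

lemma QExp.C (c : ℂ) : QExp (C c) (fun _ => c) := by
  refine Eventually.of_forall fun τ => ?_
  convert! hasSum_single (f := fun n => coeff n (PowerSeries.C c) * nome τ ^ n) 0 ?_ using 1
  · simp
  · intro n hn
    simp [coeff_C, hn]

lemma QExp.mul {u v : ℂ⟦X⟧} {g h : ℂ → ℂ} (hu : QExp u g) (hv : QExp v h) :
    QExp (u * v) (fun τ => g τ * h τ) := by
  filter_upwards [hu, hv] with τ h1 h2
  have s1 := h1.summable.norm
  have s2 := h2.summable.norm
  have hs := summable_norm_sum_mul_antidiagonal_of_summable_norm s1 s2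
  have ht := tsum_mul_tsum_eq_tsum_sum_antidiagonal_of_summable_norm s1 s2
  rw [h1.tsum_eq, h2.tsum_eq] at ht
  have := hs.of_norm.hasSum
  rw [← ht] at this
  convert! this using 2 with n
  rw [coeff_mul, Finset.sum_mul]
  refine Finset.sum_congr rfl fun x hx => ?_
  rw [← Finset.HasAntidiagonal.mem_antidiagonal.mp hx]
  ring

lemma QExp.neg {u : ℂ⟦X⟧} {g : ℂ → ℂ} (hu : QExp u g) : QExp (-u) (fun τ => -g τ) := by
  filter_upwards [hu] with τ h1
  convert! h1.neg using 2 with n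
  simp

lemma QExp.sub {u v : ℂ⟦X⟧} {g h : ℂ → ℂ} (hu : QExp u g) (hv : QExp v h) :
    QExp (u - v) (fun τ => g τ - h τ) := by
  simpa only [sub_eq_add_neg] using! hu.add hv.neg

lemma QExp.pow {u : ℂ⟦X⟧} {g : ℂ → ℂ} (hu : QExp u g) (n : ℕ) :
    QExp (u ^ n) (fun τ => g τ ^ n) := by
  induction n with
  | zero => simpa using! QExp.C 1
  | succ n ih => simpa only [pow_succ] using! ih.mul hu

lemma QExp.prod {ι : Type*} (s : Finset ι) {u : ι → ℂ⟦X⟧} {g : ι → ℂ → ℂ}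
    (h : ∀ i ∈ s, QExp (u i) (g i)) : QExp (∏ i ∈ s, u i) (fun τ => ∏ i ∈ s, g i τ) := by
  classical
  induction s using Finset.induction_on with
  | empty => simpa using! QExp.C 1
  | insert i s hi ih =>
    simp only [Finset.prod_insert hi]
    exact (h i (by simp)).mul (ih fun j hj => h j (by simp [hj]))

lemma QExp.sum {ι : Type*} (s : Finset ι) {u : ι → ℂ⟦X⟧} {g : ι → ℂ → ℂ}
    (h : ∀ i ∈ s, QExp (u i) (g i)) : QExp (∑ i ∈ s, u i) (fun τ => ∑ i ∈ s, g i τ) := by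
  classical
  induction s using Finset.induction_on with
  | empty => simpa using! QExp.C 0
  | insert i s hi ih =>
    simp only [Finset.sum_insert hi]
    exact (h i (by simp)).add (ih fun j hj => h j (by simp [hj]))

lemma QExp.aeval {u : ℂ⟦X⟧} {g : ℂ → ℂ} (hu : QExp u g) (P : Polynomial ℂ) :
    QExp (Polynomial.aeval u P) (fun τ => P.eval (g τ)) := by
  simp only [Polynomial.aeval_eq_sum_range, Polynomial.eval_eq_sum_range]
  refine QExp.sum _ fun i _ => ?_
  have := (QExp.C (P.coeff i)).mul (hu.pow i)
  rwa [← smul_eq_C_mul] at this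

lemma tendsto_add_const_im (c : ℂ) :
    Tendsto (fun τ : ℂ => τ + c) (comap im atTop) (comap im atTop) := by
  rw [tendsto_comap_iff]
  exact tendsto_atTop_add_const_right _ c.im tendsto_comap

lemma tendsto_nat_mul_im {k : ℕ} (hk : k ≠ 0) :
    Tendsto (fun τ : ℂ => (k : ℂ) * τ) (comap im atTop) (comap im atTop) := by
  rw [tendsto_comap_iff]
  have : (im ∘ fun τ : ℂ => (k : ℂ) * τ) = fun τ : ℂ => (k : ℝ) * τ.im := by
    ext τ; simp
  rw [this]
  exact tendsto_comap.const_mul_atTop (by positivity)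

lemma QExp.shift {u : ℂ⟦X⟧} {g : ℂ → ℂ} (hu : QExp u g) (c : ℂ) :
    QExp (rescale (nome c) u) (fun τ => g (τ + c)) := by
  filter_upwards [(tendsto_add_const_im c).eventually hu] with τ h
  convert! h using 2 with n
  rw [coeff_rescale, nome_add]; ring

lemma QExp.dilate {u : ℂ⟦X⟧} {g : ℂ → ℂ} (hu : QExp u g) {k : ℕ} (hk : k ≠ 0) :
    QExp (expand k hk u) (fun τ => g (k * τ)) := by
  filter_upwards [(tendsto_nat_mul_im hk).eventually hu] with τ h
  have hinj : Function.Injective (fun n : ℕ => k * n) := fun a b hab =>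
    Nat.eq_of_mul_eq_mul_left (Nat.pos_of_ne_zero hk) hab
  rw [← hinj.hasSum_iff]
  · convert! h using 2 with n
    simp only [Function.comp]
    rw [coeff_expand_mul, nome_nat_mul, pow_mul]
  · intro x hx
    rw [coeff_expand_of_not_dvd, zero_mul]
    rintro ⟨y, rfl⟩
    exact hx ⟨y, rfl⟩

/-- A power series converging near `i∞` comes from a germ of analytic function at `0`. -/
lemma QExp.exists_analytic {u : ℂ⟦X⟧} {g : ℂ → ℂ} (hu : QExp u g) :
    ∃ S : ℂ → ℂ, HasFPowerSeriesAt S (FormalMultilinearSeries.ofScalars ℂ (fun n => coeff n u)) 0 ∧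
      ∀ᶠ τ in comap im atTop, g τ = S (nome τ) := by
  obtain ⟨τ, hτ⟩ := hu.exists
  set p := FormalMultilinearSeries.ofScalars ℂ (fun n => coeff n u) with hp
  have hr : (‖nome τ‖₊ : ENNReal) ≤ p.radius := by
    refine p.le_radius_of_tendsto (l := 0) ?_
    have := hτ.summable.norm.tendsto_atTop_zero
    refine squeeze_zero (fun n => by positivity) (fun n => ?_) this
    rw [norm_mul, norm_pow]
    gcongr
    · exact le_of_eq (by rw [hp, FormalMultilinearSeries.ofScalars_norm])
    · rfl
  have hr0 : 0 < p.radius := lt_of_lt_of_le (by simpa using nome_ne_zero τ) hr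
  have hS := p.hasFPowerSeriesOnBall hr0
  refine ⟨p.sum, hS.hasFPowerSeriesAt, ?_⟩
  filter_upwards [hu, (tendsto_nome.mono_right nhdsWithin_le_nhds).eventually
    hS.hasFPowerSeriesAt.eventually_hasSum] with τ h1 h2
  refine h1.unique ?_
  rw [zero_add] at h2
  convert! h2 using 2 with n
  simp [hp, FormalMultilinearSeries.ofScalars, mul_comm]

lemma qExp_of_analytic {S : ℂ → ℂ} {p : FormalMultilinearSeries ℂ ℂ ℂ} (h : HasFPowerSeriesAt S p 0) :
    QExp (PowerSeries.mk p.coeff) (fun τ => S (nome τ)) := by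
  filter_upwards [(tendsto_nome.mono_right nhdsWithin_le_nhds).eventually h.eventually_hasSum]
    with τ h2
  rw [zero_add] at h2
  convert! h2 using 2 with n
  simp [mul_comm]

lemma QExp.eq_zero {u : ℂ⟦X⟧} (hu : QExp u (fun _ => 0)) : u = 0 := by
  obtain ⟨S, hS, hg⟩ := hu.exists_analytic
  have h0 : ∀ᶠ s in 𝓝[≠] (0 : ℂ), S s = 0 := by
    rw [← map_nome]
    rw [eventually_map]
    filter_upwards [hg] with τ h using h.symm
  have h1 := hS.analyticAt.frequently_zero_iff_eventually_zero.mp h0.frequently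
  have h2 := hS.eq_zero_of_eventually h1
  ext n
  have h3 := congrArg (fun p : FormalMultilinearSeries ℂ ℂ ℂ => p n fun _ => 1) h2
  simpa [FormalMultilinearSeries.ofScalars] using h3

lemma QExp.unique {u v : ℂ⟦X⟧} {g : ℂ → ℂ} (hu : QExp u g) (hv : QExp v g) : u = v := by
  have := hu.sub hv
  simp only [sub_self] at this
  exact sub_eq_zero.mp this.eq_zero

lemma QExp.tendsto {u : ℂ⟦X⟧} {g : ℂ → ℂ} (hu : QExp u g) :
    Tendsto g (comap im atTop) (𝓝 (constantCoeff u)) := by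
  obtain ⟨S, hS, hg⟩ := hu.exists_analytic
  have h0 : S 0 = constantCoeff u := by
    have := hS.coeff_zero (fun _ => 0)
    rw [← this]; simp
  rw [← h0]
  have := hS.continuousAt.tendsto.comp (tendsto_nome.mono_right nhdsWithin_le_nhds)
  refine this.congr' ?_
  filter_upwards [hg] with τ h using h.symm

lemma QExp.inv {u v : ℂ⟦X⟧} {g : ℂ → ℂ} (hu : QExp u g) (huv : u * v = 1) :
    QExp v (fun τ => (g τ)⁻¹) := by
  obtain ⟨S, hS, hg⟩ := hu.exists_analytic
  have h0 : S 0 = constantCoeff u := by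
    have := hS.coeff_zero (fun _ => 0)
    rw [← this]; simp
  have hc : constantCoeff u ≠ 0 := by
    intro h
    have := congrArg constantCoeff huv
    simp [h] at this
  have hne : S 0 ≠ 0 := by rwa [h0]
  obtain ⟨p, hp⟩ := hS.analyticAt.inv hne
  have hw : QExp (PowerSeries.mk p.coeff) (fun τ => (g τ)⁻¹) := by
    refine (qExp_of_analytic hp).congr ?_
    filter_upwards [hg] with τ h
    rw [h]; rfl
  have h1 : QExp (u * PowerSeries.mk p.coeff) (fun _ => 1) := by
    refine (hu.mul hw).congr ?_
    have : ∀ᶠ τ in comap im atTop, g τ ≠ 0 :=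
      hu.tendsto.eventually_ne hc
    filter_upwards [this] with τ h
    exact mul_inv_cancel₀ h
  have h2 := h1.unique (by simpa using! QExp.C 1)
  have : PowerSeries.mk p.coeff = v := by
    calc _ = (v * u) * PowerSeries.mk p.coeff := by rw [mul_comm v u, huv, one_mul]
      _ = v := by rw [mul_assoc, h2, mul_one]
  rwa [← this]

/-- The theta series `∑ q ^ (n ^ 2)` over all integers `n`. -/
noncomputable def thetaSer : ℤ⟦X⟧ :=
  PowerSeries.mk fun n => if n = 0 then 1 else if IsSquare n then 2 else 0

lemma hasSum_thetaSer {τ : ℂ} (hτ : 0 < τ.im) :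
    HasSum (fun n => ((coeff n thetaSer : ℤ) : ℂ) * nome τ ^ n) (jacobiTheta τ) := by
  have h := (hasSum_nat_jacobiTheta hτ).mul_left 2
  have hinj : Function.Injective (fun n : ℕ => (n + 1) ^ 2) := fun a b hab => by
    have := Nat.pow_left_injective (n := 2) (by norm_num) hab
    simpa using this
  have h2 : HasSum (fun n : ℕ => if n = 0 then 0 else ((coeff n thetaSer : ℤ) : ℂ) * nome τ ^ n)
      (2 * ((jacobiTheta τ - 1) / 2)) := by
    rw [← hinj.hasSum_iff]
    · convert! h using 2 with n
      have : IsSquare ((n + 1) ^ 2) := ⟨n + 1, by ring⟩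
      have h0 : (n + 1) ^ 2 ≠ 0 := by positivity
      simp only [Function.comp, thetaSer, coeff_mk, if_neg h0, if_pos this]
      rw [nome, ← exp_nat_mul]
      push_cast
      congr 2; ring
    · intro x hx
      by_cases hx0 : x = 0
      · simp [hx0]
      · have : ¬ IsSquare x := by
          rintro ⟨r, rfl⟩
          refine hx ⟨r - 1, ?_⟩
          have : r ≠ 0 := by rintro rfl; simp at hx0
          simp only
          rw [Nat.sub_add_cancel (by omega)]; ring
        simp [hx0, thetaSer, this]
  have h3 := h2.add (hasSum_ite_eq (0 : ℕ) (1 : ℂ))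
  convert! h3 using 1
  · ext n
    by_cases hn : n = 0
    · simp [hn, thetaSer]
    · simp [hn]
  · ring

/-- The `q`-expansion of `thA`. -/
noncomputable def psiSer : ℤ⟦X⟧ := thetaSer ^ 2

/-- The inverse of the `q`-expansion of `thA`. -/
noncomputable def psiInv : ℤ⟦X⟧ := invOfUnit psiSer 1

/-- The `q`-expansion of `lam`. -/
noncomputable def lamSer : ℤ⟦X⟧ := 1 - (rescale (-1) psiSer * psiInv) ^ 2

lemma constantCoeff_psiSer : constantCoeff psiSer = 1 := by
  rw [psiSer, map_pow, ← coeff_zero_eq_constantCoeff_apply]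
  simp [thetaSer, -coeff_zero_eq_constantCoeff]

lemma psiSer_mul_psiInv : psiSer * psiInv = 1 :=
  mul_invOfUnit _ _ (by simp [constantCoeff_psiSer])

/-- Complexification of an integral power series. -/
noncomputable abbrev toC : ℤ⟦X⟧ →+* ℂ⟦X⟧ := PowerSeries.map (Int.castRingHom ℂ)

lemma eventually_im_pos : ∀ᶠ τ : ℂ in comap im atTop, 0 < τ.im :=
  tendsto_comap.eventually (eventually_gt_atTop 0)

lemma qExp_thA : QExp (toC psiSer) thA := by
  have : QExp (toC thetaSer) jacobiTheta := by
    filter_upwards [eventually_im_pos] with τ hτ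
    simpa using! hasSum_thetaSer hτ
  simpa [psiSer] using! this.pow 2

lemma rescale_toC_neg_one (u : ℤ⟦X⟧) : rescale (-1 : ℂ) (toC u) = toC (rescale (-1) u) := by
  ext n; simp [coeff_rescale]

lemma qExp_thB : QExp (toC (rescale (-1) psiSer)) thB := by
  have := qExp_thA.shift 1
  rw [nome_one, rescale_toC_neg_one] at this
  exact this

lemma qExp_thA_inv : QExp (toC psiInv) (fun τ => (thA τ)⁻¹) := by
  refine qExp_thA.inv ?_
  rw [← map_mul, psiSer_mul_psiInv, map_one]

lemma qExp_lam : QExp (toC lamSer) lam := by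
  have := (QExp.C 1).sub ((qExp_thB.mul qExp_thA_inv).pow 2)
  have h2 := this.congr (h := lam) (Eventually.of_forall fun τ => by
    rw [lam]; simp only [div_eq_mul_inv]; ring)
  convert! h2 using 1
  simp [lamSer]

lemma coeff_zero_lamSer : coeff 0 lamSer = 0 := by
  have h := congrArg constantCoeff psiSer_mul_psiInv
  rw [map_mul, constantCoeff_psiSer, map_one, one_mul] at h
  have h2 : constantCoeff (rescale (-1 : ℤ) psiSer) = 1 := by
    rw [← coeff_zero_eq_constantCoeff_apply, coeff_rescale]
    simp [constantCoeff_psiSer]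
  rw [coeff_zero_eq_constantCoeff_apply]
  simp [lamSer, h, h2]

lemma coeff_one_psiSer : coeff 1 psiSer = 4 := by
  rw [psiSer, sq, coeff_mul]
  have : Finset.HasAntidiagonal.antidiagonal (1 : ℕ) = {(0, 1), (1, 0)} := by decide
  rw [this]
  simp [thetaSer]

lemma coeff_one_lamSer : coeff 1 lamSer = 16 := by
  have hc := constantCoeff_psiSer
  have h := congrArg constantCoeff psiSer_mul_psiInv
  rw [map_mul, hc, map_one, one_mul] at h
  have h1 := congrArg (coeff 1) psiSer_mul_psiInv
  have hanti : Finset.HasAntidiagonal.antidiagonal (1 : ℕ) = {(0, 1), (1, 0)} := by decide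
  rw [coeff_mul, hanti] at h1
  simp [hc, h, coeff_one_psiSer, coeff_one] at h1
  rw [lamSer, map_sub, sq, coeff_mul, hanti]
  simp [coeff_mul, hanti, hc, h, coeff_one_psiSer, coeff_one, coeff_rescale]
  omega

lemma tendsto_lam_div_nome : Tendsto (fun τ => lam τ / nome τ) (comap im atTop) (𝓝 16) := by
  have h : ∃ w : ℤ⟦X⟧, lamSer = PowerSeries.X * w :=
    X_dvd_iff.mpr (by rw [← coeff_zero_eq_constantCoeff_apply, coeff_zero_lamSer])
  obtain ⟨w, hw⟩ := h
  have hw0 : constantCoeff w = 16 := by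
    have := coeff_one_lamSer
    rw [hw, show 1 = 0 + 1 from rfl, coeff_succ_X_mul] at this
    simpa using this
  have : QExp (toC w) (fun τ => lam τ / nome τ) := by
    filter_upwards [qExp_lam] with τ h
    have h2 := h.mul_right (nome τ)⁻¹
    rw [hw] at h2
    rw [← hasSum_nat_add_iff' 1] at h2
    convert! h2 using 1
    · ext n
      have e : coeff (n + 1) (toC (PowerSeries.X * w)) = coeff n (toC w) := by
        rw [PowerSeries.coeff_map, coeff_succ_X_mul, PowerSeries.coeff_map]
      have := nome_ne_zero τ
      rw [e, pow_succ, mul_assoc, mul_assoc, mul_inv_cancel₀ this, mul_one]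
    · rw [Finset.sum_range_one, PowerSeries.coeff_map, coeff_zero_X_mul]
      simp [div_eq_mul_inv]
  have h3 := this.tendsto
  have h4 : constantCoeff (toC w) = 16 := by
    rw [← coeff_zero_eq_constantCoeff_apply, PowerSeries.coeff_map, coeff_zero_eq_constantCoeff_apply, hw0]
    simp
  rwa [h4] at h3

end QSeries

end LegendreSatoTate

namespace LegendreSatoTate

open Complex Filter Topology Asymptotics

section PolyLemma

open UpperHalfPlane ModularForm Matrix.SpecialLinearGroup
open scoped MatrixGroups

/-- A function on the upper half-plane invariant under the principal congruence subgroup of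
level two. -/
structure Gamma2Invariant (G : ℂ → ℂ) : Prop where
  differentiableAt : ∀ τ : ℂ, 0 < τ.im → DifferentiableAt ℂ G τ
  invariant : ∀ M ∈ X2 1, ∀ τ : ℂ, 0 < τ.im → G (mob M τ) = G τ

lemma im_one_sub_inv_pos {τ : ℂ} (hτ : 0 < τ.im) : 0 < (1 - 1 / τ).im := by
  have := im_neg_one_div_pos hτ
  have e : 1 - 1 / τ = -1 / τ + 1 := by ring
  rw [e]; simpa using this

lemma coe_SL_smul (γ : SL(2, ℤ)) (z : ℍ) :
    ((γ • z : ℍ) : ℂ) = mob (γ : Matrix (Fin 2) (Fin 2) ℤ) z := by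
  rw [UpperHalfPlane.coe_specialLinearGroup_apply]
  simp [mob]

/-- Every matrix in `SL(2, ℤ)` decomposes along the three cusps of the principal congruence
subgroup of level two. -/
lemma SL2Z_decomp (γ : SL(2, ℤ)) : ∃ g ∈ X2 1, ∃ j : ℤ, (j = 0 ∨ j = 1) ∧
    ((γ : Matrix (Fin 2) (Fin 2) ℤ) = g * !![1, j; 0, 1] ∨
    (γ : Matrix (Fin 2) (Fin 2) ℤ) = g * (!![0, -1; 1, 0] * !![1, j; 0, 1]) ∨
    (γ : Matrix (Fin 2) (Fin 2) ℤ) = g * (!![1, -1; 1, 0] * !![1, j; 0, 1])) := by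
  have hdet : (γ : Matrix (Fin 2) (Fin 2) ℤ).det = 1 := γ.2
  obtain ⟨a, ha⟩ : ∃ a, a = γ 0 0 := ⟨_, rfl⟩
  obtain ⟨b, hb⟩ : ∃ a, a = γ 0 1 := ⟨_, rfl⟩
  obtain ⟨c, hc⟩ : ∃ a, a = γ 1 0 := ⟨_, rfl⟩
  obtain ⟨d, hd⟩ : ∃ a, a = γ 1 1 := ⟨_, rfl⟩
  have hγ : (γ : Matrix (Fin 2) (Fin 2) ℤ) = !![a, b; c, d] := by
    rw [ha, hb, hc, hd]; exact Matrix.eta_fin_two _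
  rw [hγ] at hdet ⊢
  rw [Matrix.det_fin_two_of] at hdet
  have hodd : Odd (a * d - b * c) := by rw [hdet]; exact odd_one
  have key : ∀ x y : ℤ, Odd x → ∃ j : ℤ, (j = 0 ∨ j = 1) ∧ Even (y - j * x) := by
    intro x y hx
    rcases Int.even_or_odd y with hy | hy
    · exact ⟨0, by simp, by simpa using hy⟩
    · exact ⟨1, by simp, by simpa using hy.sub_odd hx⟩
  have mk : ∀ x y z w : ℤ, x * w - y * z = 1 → Odd x → Even y → Even z → Odd w →
      !![x, y; z, w] ∈ X2 1 := by
    intro x y z w h1 h2 h3 h4 h5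
    exact ⟨by rw [Matrix.det_fin_two_of]; exact h1, h2, h3, h4, h5⟩
  rcases Int.even_or_odd a with hae | hao
  · have hco : Odd c := by
      by_contra hc; rw [Int.not_odd_iff_even] at hc
      exact (Int.not_odd_iff_even.mpr ((hae.mul_right d).sub (hc.mul_left b))) hodd
    obtain ⟨j, hj01, hj⟩ := key c d hco
    refine ⟨!![-(b - j * a), a; -(d - j * c), c], mk _ _ _ _ ?_ ?_ hae hj.neg hco, j, hj01, Or.inr (Or.inl ?_)⟩
    · linarith
    · have : Odd b := by
        by_contra hb; rw [Int.not_odd_iff_even] at hb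
        exact (Int.not_odd_iff_even.mpr ((hae.mul_right d).sub (hb.mul_right c))) hodd
      exact (this.sub_even (hae.mul_left j)).neg
    · ext i k; fin_cases i <;> fin_cases k <;> simp [Matrix.mul_apply, Fin.sum_univ_two] <;> ring
  · rcases Int.even_or_odd c with hce | hco
    · obtain ⟨j, hj01, hj⟩ := key a b hao
      have : Odd d := by
        by_contra hd; rw [Int.not_odd_iff_even] at hd
        exact (Int.not_odd_iff_even.mpr ((hd.mul_left a).sub (hce.mul_left b))) hodd
      refine ⟨!![a, b - j * a; c, d - j * c], mk _ _ _ _ (by linarith) hao hj hce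
        (this.sub_even (hce.mul_left j)), j, hj01, Or.inl ?_⟩
      ext i k; fin_cases i <;> fin_cases k <;> simp [Matrix.mul_apply, Fin.sum_univ_two] <;> ring
    · obtain ⟨j, hj01, hj⟩ := key c d hco
      have : Odd (b - j * a) := by
        by_contra hb; rw [Int.not_odd_iff_even] at hb
        have h2 : Even (a * (d - j * c) - (b - j * a) * c) := (hj.mul_left a).sub (hb.mul_right c)
        have h3 : a * (d - j * c) - (b - j * a) * c = a * d - b * c := by ring
        rw [h3] at h2
        exact (Int.not_odd_iff_even.mpr h2) hodd
      refine ⟨!![-(b - j * a), a + (b - j * a); -(d - j * c), c + (d - j * c)],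
        mk _ _ _ _ (by linarith) this.neg (hao.add_odd this) hj.neg (hco.add_even hj), j, hj01,
        Or.inr (Or.inr ?_)⟩
      ext i k; fin_cases i <;> fin_cases k <;> simp [Matrix.mul_apply, Fin.sum_univ_two] <;> ring

lemma Gamma2Invariant.slash {G : ℂ → ℂ} (hG : Gamma2Invariant G) (γ : SL(2, ℤ)) :
    ∃ j : ℤ, (∀ z : ℍ, G (γ • z : ℍ) = G (z + j)) ∨ (∀ z : ℍ, G (γ • z : ℍ) = G (-1 / (z + j))) ∨
      (∀ z : ℍ, G (γ • z : ℍ) = G (1 - 1 / (z + j))) := by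
  obtain ⟨g, hg, j, -, h⟩ := SL2Z_decomp γ
  have hT : ∀ z : ℂ, mob !![1, j; 0, 1] z = z + j := fun z => by simp [mob]
  have hTd : ∀ z : ℂ, den !![1, j; 0, 1] z ≠ 0 := fun z => by simp [den]
  have hz : ∀ z : ℍ, 0 < ((z : ℂ) + j).im := fun z => by simpa using z.2
  refine ⟨j, ?_⟩
  rcases h with h | h | h
  · refine Or.inl fun z => ?_
    rw [coe_SL_smul, h, mob_mul _ _ (hTd z), hT, hG.invariant g hg _ (hz z)]
  · refine Or.inr (Or.inl fun z => ?_)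
    have h0 := ne_zero_of_im_pos (hz z)
    have hd : den (!![0, -1; 1, 0] * !![1, j; 0, 1]) z ≠ 0 := by
      rw [den_mul _ _ (hTd z), hT]
      simpa [den] using h0
    rw [coe_SL_smul, h, mob_mul _ _ hd, mob_mul _ _ (hTd z), hT]
    have e : mob !![0, -1; 1, 0] ((z : ℂ) + j) = -1 / (z + j) := by simp [mob]
    rw [e, hG.invariant g hg _ (im_neg_one_div_pos (hz z))]
  · refine Or.inr (Or.inr fun z => ?_)
    have h0 := ne_zero_of_im_pos (hz z)
    have hd : den (!![1, -1; 1, 0] * !![1, j; 0, 1]) z ≠ 0 := by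
      rw [den_mul _ _ (hTd z), hT]
      simpa [den] using h0
    rw [coe_SL_smul, h, mob_mul _ _ hd, mob_mul _ _ (hTd z), hT]
    have e : mob !![1, -1; 1, 0] ((z : ℂ) + j) = 1 - 1 / (z + j) := by
      simp [mob]; field_simp; ring
    rw [e, hG.invariant g hg _ (im_one_sub_inv_pos (hz z))]

lemma Gamma2Invariant.const {G : ℂ → ℂ} (hG : Gamma2Invariant G)
    (h1 : G =O[comap Complex.im atTop] (1 : ℂ → ℝ))
    (h2 : (fun τ => G (-1 / τ)) =O[comap Complex.im atTop] (1 : ℂ → ℝ))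
    (h3 : (fun τ => G (1 - 1 / τ)) =O[comap Complex.im atTop] (1 : ℂ → ℝ)) :
    ∃ c, ∀ τ : ℂ, 0 < τ.im → G τ = c := by
  let F : ModularForm ((CongruenceSubgroup.Gamma 2).map (mapGL ℝ)) 0 :=
    { toFun := fun z => G z
      slash_action_eq' := by
        rintro _ ⟨A, hA, rfl⟩
        have hA' := CongruenceSubgroup.Gamma_mem.mp hA
        funext z
        change ((fun z : ℍ => G z) ∣[(0 : ℤ)] A) z = G z
        rw [ModularForm.SL_slash_apply]
        simp only [neg_zero, zpow_zero, mul_one]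
        rw [coe_SL_smul]
        refine hG.invariant _ ⟨A.2, ?_, ?_, ?_, ?_⟩ _ z.2
        · exact ZMod.intCast_eq_one_iff_odd.mp hA'.1
        · exact ZMod.intCast_eq_zero_iff_even.mp hA'.2.1
        · exact ZMod.intCast_eq_zero_iff_even.mp hA'.2.2.1
        · exact ZMod.intCast_eq_one_iff_odd.mp hA'.2.2.2
      holo' := by
        rw [UpperHalfPlane.mdifferentiable_iff]
        refine .congr (f := G) (fun z hz ↦ (hG.differentiableAt z hz).differentiableWithinAt)
          fun z hz ↦ ?_
        simp [ofComplex_apply_of_im_pos hz]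
      bdd_at_cusps' := by
        intro c hc
        rw [Subgroup.IsArithmetic.isCusp_iff_isCusp_SL2Z] at hc
        rw [OnePoint.isBoundedAt_iff_forall_SL2Z hc]
        intro γ _
        have e : ((fun z : ℍ => G z) ∣[(0 : ℤ)] γ) = fun z => G (γ • z : ℍ) := by
          funext z
          rw [ModularForm.SL_slash_apply]
          simp
        change BoundedAtFilter atImInfty ((fun z : ℍ => G z) ∣[(0 : ℤ)] γ)
        rw [e]
        obtain ⟨j, h⟩ := hG.slash γ
        have ht : Tendsto (fun z : ℍ => (z : ℂ) + j) atImInfty (comap Complex.im atTop) :=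
          (tendsto_add_const_im (j : ℂ)).comp tendsto_coe_atImInfty
        rcases h with h | h | h
        · simp only [h]; exact h1.comp_tendsto ht
        · simp only [h]; exact h2.comp_tendsto ht
        · simp only [h]; exact h3.comp_tendsto ht }
  obtain ⟨c, hc⟩ := ModularForm.eq_const_of_weight_zero F
  refine ⟨c, fun τ hτ => ?_⟩
  exact congrFun hc ⟨τ, hτ⟩

lemma Gamma2Invariant.periodic_one_sub_inv {G : ℂ → ℂ} (hG : Gamma2Invariant G) {τ : ℂ}
    (hτ : 0 < τ.im) : G (1 - 1 / (τ + 2)) = G (1 - 1 / τ) := by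
  have h0 := ne_zero_of_im_pos hτ
  have h2 : τ + 2 ≠ 0 := ne_zero_of_im_pos (τ := τ + 2) (by simpa using hτ)
  have hM : !![-1, 2; -2, 3] ∈ X2 1 := by
    refine ⟨by simp [Matrix.det_fin_two], by simp, by simp, by simp, ?_⟩
    exact ⟨1, by norm_num⟩
  rw [← hG.invariant _ hM _ (im_one_sub_inv_pos hτ)]
  congr 1
  have e : mob !![-1, 2; -2, 3] (1 - 1 / τ) = (-(1 - 1 / τ) + 2) / (-2 * (1 - 1 / τ) + 3) := by
    simp [mob]
  have e2 : -2 * (1 - 1 / τ) + 3 = (τ + 2) / τ := by field_simp; ring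
  rw [e, e2]
  field_simp
  ring

lemma isBigO_nome_lam : nome =O[comap Complex.im atTop] lam := by
  have h := tendsto_lam_div_nome
  have hne : ∀ᶠ τ in comap Complex.im atTop, lam τ ≠ 0 := by
    filter_upwards [eventually_im_pos] with τ hτ using lam_ne_zero hτ
  have h2 := h.inv₀ (by norm_num)
  have h3 := h2.isBigO_one ℂ
  refine (h3.mul (isBigO_refl lam _)).congr' ?_ ?_
  · filter_upwards [hne] with τ hτ
    field_simp
  · exact Eventually.of_forall fun τ => by simp

theorem Gamma2Invariant.exists_polynomial (N : ℕ) : ∀ {G : ℂ → ℂ}, Gamma2Invariant G →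
    G =O[comap Complex.im atTop] (1 : ℂ → ℝ) →
    (fun τ => G (-1 / τ)) =O[comap Complex.im atTop] (1 : ℂ → ℝ) →
    (fun τ => lam τ ^ N * G (1 - 1 / τ)) =O[comap Complex.im atTop] (1 : ℂ → ℝ) →
    ∃ P : Polynomial ℂ, P.natDegree ≤ N ∧ ∀ τ : ℂ, 0 < τ.im → G τ = P.eval (lam τ) := by
  induction N with
  | zero =>
    intro G hG h1 h2 h3
    obtain ⟨c, hc⟩ := hG.const h1 h2 (by simpa using h3)
    exact ⟨Polynomial.C c, by simp, by simpa using hc⟩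
  | succ N ih =>
    intro G hG h1 h2 h3
    let K : ℂ → ℂ := fun τ => if 0 < τ.im then lam τ ^ (N + 1) * G (1 - 1 / τ) else 0
    have hK : ∀ {τ : ℂ}, 0 < τ.im → K τ = lam τ ^ (N + 1) * G (1 - 1 / τ) := fun h => if_pos h
    have hKe : K =ᶠ[comap Complex.im atTop] fun τ => lam τ ^ (N + 1) * G (1 - 1 / τ) := by
      filter_upwards [eventually_im_pos] with τ hτ using hK hτ
    have hper : Function.Periodic K (2 : ℝ) := by
      intro τ
      have hi : (τ + (2 : ℝ)).im = τ.im := by simp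
      simp only [K, hi]
      split_ifs with hτ
      · push_cast
        rw [lam_add_two, hG.periodic_one_sub_inv hτ]
      · rfl
    have hdiff : ∀ᶠ τ in comap Complex.im atTop, DifferentiableAt ℂ K τ := by
      filter_upwards [eventually_im_pos] with τ hτ
      have hev : K =ᶠ[𝓝 τ] fun τ => lam τ ^ (N + 1) * G (1 - 1 / τ) := by
        have : {τ : ℂ | 0 < τ.im} ∈ 𝓝 τ :=
          (isOpen_lt continuous_const Complex.continuous_im).mem_nhds hτ
        filter_upwards [this] with w hw using hK hw
      rw [hev.differentiableAt_iff]
      have hG' := hG.differentiableAt _ (im_one_sub_inv_pos hτ)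
      refine ((differentiableAt_lam hτ).pow _).mul ?_
      exact DifferentiableAt.comp (g := G) τ hG' (by
        have := ne_zero_of_im_pos hτ
        fun_prop (disch := assumption))
    have hbd : BoundedAtFilter (comap Complex.im atTop) K := h3.congr' hKe.symm (by rfl)
    have hlim := Function.Periodic.tendsto_at_I_inf two_pos hper hdiff hbd
    set ℓ := Function.Periodic.cuspFunction 2 K 0 with hℓ
    let G' : ℂ → ℂ := fun τ => G τ - (-1) ^ (N + 1) * ℓ * lam τ ^ (N + 1)
    have hG' : Gamma2Invariant G' := by
      refine ⟨fun τ hτ => ?_, fun M hM τ hτ => ?_⟩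
      · exact (hG.differentiableAt τ hτ).sub (((differentiableAt_lam hτ).pow _).const_mul _)
      · simp only [G']
        rw [hG.invariant M hM τ hτ, lam_gamma2 hM hτ]
    have hdec := Function.Periodic.exp_decay_sub_of_bounded_at_inf two_pos hper hdiff hbd
    have hdec2 : (fun τ => K τ - ℓ) =O[comap Complex.im atTop] lam := by
      refine IsBigO.trans (IsBigO.trans hdec ?_) isBigO_nome_lam
      refine IsBigO.of_bound 1 (Eventually.of_forall fun τ => ?_)
      rw [norm_nome, Real.norm_of_nonneg (Real.exp_pos _).le, one_mul]
      refine le_of_eq ?_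
      congr 1; ring
    have hlamO : (fun τ => (lam τ - 1) ^ (N + 1) - (-1) ^ (N + 1)) =O[comap Complex.im atTop] lam := by
      have e : ∀ τ, (lam τ - 1) ^ (N + 1) - (-1) ^ (N + 1) =
          lam τ * ∑ i ∈ Finset.range (N + 1), (lam τ - 1) ^ i * (-1) ^ (N + 1 - 1 - i) := by
        intro τ
        rw [mul_comm, ← geom_sum₂_mul]
        have := (Commute.all (lam τ - 1) (-1)).geom_sum₂_mul (N + 1)
        rw [geom_sum₂_mul]
        rw [← this]; ring
      simp only [e]
      have hb : (fun τ => ∑ i ∈ Finset.range (N + 1), (lam τ - 1) ^ i * (-1 : ℂ) ^ (N + 1 - 1 - i))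
          =O[comap Complex.im atTop] (1 : ℂ → ℂ) := by
        have : Tendsto (fun τ => ∑ i ∈ Finset.range (N + 1),
          (lam τ - 1) ^ i * (-1 : ℂ) ^ (N + 1 - 1 - i)) (comap Complex.im atTop)
            (𝓝 (∑ i ∈ Finset.range (N + 1), (0 - 1) ^ i * (-1 : ℂ) ^ (N + 1 - 1 - i))) := by
          refine tendsto_finsetSum _ fun i _ => ?_
          exact ((tendsto_lam_im.sub_const 1).pow i).mul_const _
        exact this.isBigO_one ℂ
      simpa using! (isBigO_refl lam _).mul hb
    have hb1 : G' =O[comap Complex.im atTop] (1 : ℂ → ℝ) :=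
      h1.sub (((tendsto_lam_im.pow (N + 1)).const_mul _).isBigO_one ℝ)
    have hb2 : (fun τ => G' (-1 / τ)) =O[comap Complex.im atTop] (1 : ℂ → ℝ) := by
      refine h2.sub ?_
      have : Tendsto (fun τ => (-1) ^ (N + 1) * ℓ * lam (-1 / τ) ^ (N + 1)) (comap Complex.im atTop)
          (𝓝 ((-1) ^ (N + 1) * ℓ * (1 - 0) ^ (N + 1))) := by
        refine (((tendsto_lam_im.const_sub 1).pow (N + 1)).const_mul _).congr' ?_
        filter_upwards [eventually_im_pos] with τ hτ
        rw [lam_S hτ]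
      exact this.isBigO_one ℝ
    have hb3 : (fun τ => lam τ ^ N * G' (1 - 1 / τ)) =O[comap Complex.im atTop] (1 : ℂ → ℝ) := by
      have hm := hdec2.sub (hlamO.const_mul_left ((-1) ^ (N + 1) * ℓ))
      have hinv : (fun τ => (lam τ)⁻¹) =O[comap Complex.im atTop] fun τ => (lam τ)⁻¹ := isBigO_refl _ _
      have h4 := hinv.mul hm
      refine (h4.trans (g := fun τ => (lam τ)⁻¹ * lam τ) (isBigO_of_le _ fun τ => le_rfl)).congr' ?_ ?_ |>.trans (isBigO_const_one ℝ (1 : ℂ) _)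
      · filter_upwards [eventually_im_pos] with τ hτ
        have hl := lam_ne_zero hτ
        simp only [G']
        rw [hK hτ, lam_one_sub_inv hτ]
        have e : (1 - 1 / lam τ) ^ (N + 1) = (lam τ - 1) ^ (N + 1) / lam τ ^ (N + 1) := by
          rw [← div_pow]; congr 1; field_simp
        have e1 : ((-1 : ℂ)) ^ (N + 1) * (-1) ^ (N + 1) = 1 := by
          rw [← mul_pow]; simp
        rw [e, pow_succ (lam τ) N]
        field_simp
        linear_combination ℓ * e1
      · filter_upwards [eventually_im_pos] with τ hτ
        exact inv_mul_cancel₀ (lam_ne_zero hτ)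
    obtain ⟨P, hPd, hP⟩ := ih hG' hb1 hb2 hb3
    refine ⟨P + Polynomial.C ((-1) ^ (N + 1) * ℓ) * Polynomial.X ^ (N + 1), ?_, fun τ hτ => ?_⟩
    · refine (Polynomial.natDegree_add_le _ _).trans (max_le (by omega) ?_)
      exact Polynomial.natDegree_C_mul_X_pow_le _ _
    · have := hP τ hτ
      simp only [G'] at this
      simp [← this]

end PolyLemma

end LegendreSatoTate

namespace LegendreSatoTate

open Complex Filter Topology Asymptotics

section LambdaDerivative

lemma isOpen_im_pos : IsOpen {τ : ℂ | 0 < τ.im} := isOpen_lt continuous_const continuous_im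

lemma hasDerivAt_mob (M : Matrix (Fin 2) (Fin 2) ℤ) {τ : ℂ} (h : den M τ ≠ 0) :
    HasDerivAt (mob M) (M.det / den M τ ^ 2) τ := by
  have h1 : HasDerivAt (fun τ : ℂ => (M 0 0 * τ + M 0 1 : ℂ)) (M 0 0) τ := by
    simpa using ((hasDerivAt_id τ).const_mul (M 0 0 : ℂ)).add_const (M 0 1 : ℂ)
  have h2 : HasDerivAt (fun τ : ℂ => (M 1 0 * τ + M 1 1 : ℂ)) (M 1 0) τ := by
    simpa using ((hasDerivAt_id τ).const_mul (M 1 0 : ℂ)).add_const (M 1 1 : ℂ)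
  refine (h1.div h2 h).congr_deriv ?_
  rw [den, Matrix.det_fin_two]
  push_cast
  congr 1
  ring

lemma deriv_lam_gamma2 {M : Matrix (Fin 2) (Fin 2) ℤ} (hM : M ∈ X2 1) {τ : ℂ} (hτ : 0 < τ.im) :
    deriv lam (mob M τ) = den M τ ^ 2 * deriv lam τ := by
  have hd := den_ne_zero (M := M) (by rw [hM.1]; norm_num) hτ
  have him : 0 < (mob M τ).im := im_mob_pos (by rw [hM.1]; norm_num) hτ
  have h1 := (differentiableAt_lam him).hasDerivAt.comp τ (hasDerivAt_mob M hd)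
  have h2 : (lam ∘ mob M) =ᶠ[𝓝 τ] lam := by
    filter_upwards [isOpen_im_pos.mem_nhds hτ] with w hw using lam_gamma2 hM hw
  have h3 := (h1.congr_of_eventuallyEq h2.symm).deriv
  rw [h3, hM.1]
  push_cast
  field_simp

lemma deriv_lam_S {τ : ℂ} (hτ : 0 < τ.im) :
    deriv lam (-1 / τ) = - τ ^ 2 * deriv lam τ := by
  have h0 := ne_zero_of_im_pos hτ
  have hi : HasDerivAt (fun τ : ℂ => -1 / τ) (1 / τ ^ 2) τ := by
    have := ((hasDerivAt_const τ (-1 : ℂ)).div (hasDerivAt_id τ) h0)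
    simpa using! this
  have h1 := (differentiableAt_lam (im_neg_one_div_pos hτ)).hasDerivAt.comp τ hi
  have h2 : (lam ∘ fun τ : ℂ => -1 / τ) =ᶠ[𝓝 τ] fun τ => 1 - lam τ := by
    filter_upwards [isOpen_im_pos.mem_nhds hτ] with w hw using lam_S hw
  have h3 := (h1.congr_of_eventuallyEq h2.symm).deriv
  have h4 := ((differentiableAt_lam hτ).hasDerivAt.const_sub 1).deriv
  rw [h4] at h3
  have h5 := congrArg (· * τ ^ 2) h3
  simp only [mul_assoc, one_div, inv_mul_cancel₀ (pow_ne_zero 2 h0), mul_one] at h5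
  rw [← h5]; ring

lemma deriv_lam_one_sub_inv {τ : ℂ} (hτ : 0 < τ.im) :
    deriv lam (1 - 1 / τ) = τ ^ 2 * deriv lam τ / lam τ ^ 2 := by
  have h0 := ne_zero_of_im_pos hτ
  have hl := lam_ne_zero hτ
  have hi : HasDerivAt (fun τ : ℂ => 1 - 1 / τ) (1 / τ ^ 2) τ := by
    have := ((hasDerivAt_const τ (1 : ℂ)).div (hasDerivAt_id τ) h0).const_sub 1
    simpa [neg_div] using! this
  have h1 := (differentiableAt_lam (im_one_sub_inv_pos hτ)).hasDerivAt.comp τ hi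
  have h2 : (lam ∘ fun τ : ℂ => 1 - 1 / τ) =ᶠ[𝓝 τ] fun τ => 1 - 1 / lam τ := by
    filter_upwards [isOpen_im_pos.mem_nhds hτ] with w hw using lam_one_sub_inv hw
  have h3 := (h1.congr_of_eventuallyEq h2.symm).deriv
  have h5 := (((hasDerivAt_const τ (1 : ℂ)).div (differentiableAt_lam hτ).hasDerivAt hl).const_sub
    1).deriv
  have h6 : deriv (fun τ => 1 - 1 / lam τ) τ = _ := h5
  rw [h6] at h3
  have h7 := congrArg (· * τ ^ 2) h3
  simp only [mul_assoc, one_div, inv_mul_cancel₀ (pow_ne_zero 2 h0), mul_one] at h7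
  rw [one_div, ← h7]; ring

lemma thA_sq_gamma2 {M : Matrix (Fin 2) (Fin 2) ℤ} (hM : M ∈ X2 1) {τ : ℂ} (hτ : 0 < τ.im) :
    thA (mob M τ) ^ 2 = den M τ ^ 2 * thA τ ^ 2 := by
  rw [thA_gamma2 hM hτ]
  have h : (chi M : ℂ) ^ 2 = 1 := by exact_mod_cast chi_sq hM
  rw [mul_pow, mul_pow, h, one_mul]

/-- The germ at the cusp `i∞` of the modular lambda function. -/
lemma exists_lam_germ : ∃ S : ℂ → ℂ, AnalyticAt ℂ S 0 ∧ S 0 = 0 ∧ deriv S 0 = 16 ∧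
    ∀ᶠ τ in comap im atTop, lam τ = S (nome τ) := by
  obtain ⟨S, hS, hg⟩ := qExp_lam.exists_analytic
  have h0 : S 0 = 0 := by
    have := hS.coeff_zero (fun _ => 0)
    rw [← this]
    have := coeff_zero_lamSer
    simp only [PowerSeries.coeff_zero_eq_constantCoeff] at this
    simp [this]
  refine ⟨S, hS.analyticAt, h0, ?_, hg⟩
  have h1 := hS.analyticAt.differentiableAt.hasDerivAt
  have h2 := h1.tendsto_slope
  have h3 : Tendsto (fun τ => slope S 0 (nome τ)) (comap im atTop) (𝓝 (deriv S 0)) :=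
    h2.comp tendsto_nome
  refine tendsto_nhds_unique h3 (tendsto_lam_div_nome.congr' ?_)
  filter_upwards [hg] with τ h
  rw [slope_def_field, h, h0]; simp

lemma hasDerivAt_nome (τ : ℂ) : HasDerivAt nome (Real.pi * I * nome τ) τ := by
  have := ((hasDerivAt_id τ).const_mul (Real.pi * I : ℂ)).cexp
  refine this.congr_deriv ?_
  simp only [id, nome]; ring

lemma eventually_comap_im_nhds {p : ℂ → Prop} (h : ∀ᶠ τ in comap im atTop, p τ) :
    ∀ᶠ τ in comap im atTop, ∀ᶠ w in 𝓝 τ, p w := by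
  rw [eventually_comap] at h
  obtain ⟨R, hR⟩ := eventually_atTop.mp h
  filter_upwards [tendsto_comap.eventually (eventually_gt_atTop R)] with τ hτ
  have : IsOpen {w : ℂ | R < w.im} := isOpen_lt continuous_const continuous_im
  filter_upwards [this.mem_nhds hτ] with w hw
  exact hR _ (le_of_lt hw) w rfl

lemma tendsto_deriv_lam_div_lam :
    Tendsto (fun τ => deriv lam τ / lam τ) (comap im atTop) (𝓝 (Real.pi * I)) := by
  obtain ⟨S, hS, h0, h1, hg⟩ := exists_lam_germ
  have hd : ∀ᶠ τ in comap im atTop, deriv lam τ = Real.pi * I * nome τ * deriv S (nome τ) := by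
    have hSd : ∀ᶠ τ in comap im atTop, DifferentiableAt ℂ S (nome τ) :=
      (tendsto_nome.mono_right nhdsWithin_le_nhds).eventually
        (hS.eventually_analyticAt.mono fun _ h => h.differentiableAt)
    filter_upwards [eventually_comap_im_nhds hg, hSd] with τ h h2
    have h3 := h2.hasDerivAt.comp τ (hasDerivAt_nome τ)
    have h4 : lam =ᶠ[𝓝 τ] (S ∘ nome) := h
    rw [h4.deriv_eq, h3.deriv]; ring
  have hc : Tendsto (fun τ => deriv S (nome τ)) (comap im atTop) (𝓝 16) := by
    rw [← h1]
    exact hS.deriv.continuousAt.tendsto.comp (tendsto_nome.mono_right nhdsWithin_le_nhds)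
  have := (hc.div tendsto_lam_div_nome (by norm_num)).const_mul (Real.pi * I : ℂ)
  rw [div_self (by norm_num), mul_one] at this
  refine this.congr' ?_
  filter_upwards [hd] with τ h
  have := nome_ne_zero τ
  rw [h]
  simp only [Pi.div_apply]
  field_simp

theorem deriv_lam {τ : ℂ} (hτ : 0 < τ.im) :
    deriv lam τ = Real.pi * I * (lam τ * (1 - lam τ) * thA τ ^ 2) := by
  let G : ℂ → ℂ := fun τ => deriv lam τ / (lam τ * (1 - lam τ) * thA τ ^ 2)
  have hne : ∀ {τ : ℂ}, 0 < τ.im → lam τ * (1 - lam τ) * thA τ ^ 2 ≠ 0 := fun h =>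
    mul_ne_zero (mul_ne_zero (lam_ne_zero h) (sub_ne_zero.mpr (lam_ne_one h).symm))
      (pow_ne_zero 2 (thA_ne_zero h))
  have hG : Gamma2Invariant G := by
    refine ⟨fun τ hτ => ?_, fun M hM τ hτ => ?_⟩
    · have hl := differentiableAt_lam hτ
      refine DifferentiableAt.div ?_ ?_ (hne hτ)
      · have : AnalyticAt ℂ lam τ := by
          refine DifferentiableOn.analyticAt (s := {τ : ℂ | 0 < τ.im}) (fun w hw =>
            (differentiableAt_lam hw).differentiableWithinAt) (isOpen_im_pos.mem_nhds hτ)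
        exact this.deriv.differentiableAt
      · exact (hl.mul (hl.const_sub 1)).mul ((differentiableAt_thA hτ).pow 2)
    · have hd := den_ne_zero (M := M) (by rw [hM.1]; norm_num) hτ
      simp only [G]
      rw [deriv_lam_gamma2 hM hτ, lam_gamma2 hM hτ, thA_sq_gamma2 hM hτ]
      have := hne hτ
      field_simp
  have hS : ∀ {τ : ℂ}, 0 < τ.im → G (-1 / τ) = G τ := by
    intro τ hτ
    have h0 := ne_zero_of_im_pos hτ
    have := hne hτ
    simp only [G]
    rw [deriv_lam_S hτ, lam_S hτ, thA_S hτ]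
    have e : (1 - lam τ) * (1 - (1 - lam τ)) * (-I * τ * thA τ) ^ 2
      = -τ ^ 2 * (lam τ * (1 - lam τ) * thA τ ^ 2) := by
      linear_combination ((1 - lam τ) * lam τ * τ ^ 2 * thA τ ^ 2) * I_sq
    rw [e, mul_div_mul_left _ _ (by simpa using h0)]
  have hU : ∀ {τ : ℂ}, 0 < τ.im → G (1 - 1 / τ) = G τ := by
    intro τ hτ
    have h0 := ne_zero_of_im_pos hτ
    have hl := lam_ne_zero hτ
    have hA := thA_ne_zero hτ
    have hC : thC τ ^ 2 = lam τ * thA τ ^ 2 := by rw [lam_eq hτ]; field_simp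
    have h1 : (1 - lam τ) ≠ 0 := sub_ne_zero.mpr (lam_ne_one hτ).symm
    simp only [G]
    rw [deriv_lam_one_sub_inv hτ, lam_one_sub_inv hτ, thA_one_sub_inv hτ]
    have e : (1 - 1 / lam τ) * (1 - (1 - 1 / lam τ)) * (-I * τ * thC τ) ^ 2
      = τ ^ 2 / lam τ ^ 2 * (lam τ * (1 - lam τ) * thA τ ^ 2) := by
      rw [mul_pow _ (thC τ), hC, mul_pow, neg_sq, I_sq]
      field_simp
      ring
    have h2 : τ ^ 2 / lam τ ^ 2 ≠ 0 := div_ne_zero (pow_ne_zero 2 h0) (pow_ne_zero 2 hl)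
    rw [e, mul_div_right_comm, mul_div_mul_left _ _ h2]
  have hlim : Tendsto G (comap im atTop) (𝓝 (Real.pi * I)) := by
    have := tendsto_deriv_lam_div_lam.div
      ((tendsto_lam_im.const_sub 1).mul (tendsto_thA_im.pow 2)) (by simp)
    simp only [sub_zero, one_pow, mul_one, div_one] at this
    refine this.congr fun τ => ?_
    simp only [G, Pi.div_apply]
    rw [div_div, mul_assoc]
  have hb := hlim.isBigO_one ℝ
  obtain ⟨c, hc⟩ := hG.const hb
    (hb.congr' (by filter_upwards [eventually_im_pos] with τ h using (hS h).symm) (by rfl))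
    (hb.congr' (by filter_upwards [eventually_im_pos] with τ h using (hU h).symm) (by rfl))
  have hcc : c = Real.pi * I := by
    refine tendsto_nhds_unique (tendsto_const_nhds.congr' ?_) hlim
    filter_upwards [eventually_im_pos] with τ h using (hc τ h).symm
  have := hc τ hτ
  simp only [G] at this
  rw [hcc, div_eq_iff (hne hτ)] at this
  exact this

lemma deriv_lam_ne_zero {τ : ℂ} (hτ : 0 < τ.im) : deriv lam τ ≠ 0 := by
  rw [deriv_lam hτ]
  have := lam_ne_zero hτ
  have h1 : (1 - lam τ) ≠ 0 := sub_ne_zero.mpr (lam_ne_one hτ).symm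
  have hA := thA_ne_zero hτ
  have := Real.pi_ne_zero
  simp_all

end LambdaDerivative

end LegendreSatoTate

namespace LegendreSatoTate

open Complex Filter Topology Asymptotics

section LambdaInjective

/-- Equivalence under the principal congruence subgroup of level two. -/
def Equiv2 (τ w : ℂ) : Prop := ∃ M ∈ X2 1, mob M τ = w

lemma mob_one (τ : ℂ) : mob 1 τ = τ := by simp [mob]

lemma Equiv2.trans {x y z : ℂ} (hx : 0 < x.im) (h1 : Equiv2 x y) (h2 : Equiv2 y z) : Equiv2 x z := by
  obtain ⟨M, hM, rfl⟩ := h1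
  obtain ⟨N, hN, rfl⟩ := h2
  refine ⟨N * M, by simpa using X2_mul hN hM, ?_⟩
  exact mob_mul _ _ (den_ne_zero (by rw [hM.1]; norm_num) hx)

lemma mob_adjugate_mob {n : ℤ} (hn : n ≠ 0) {M : Matrix (Fin 2) (Fin 2) ℤ} (hM : M.det = n) {τ : ℂ}
    (hτ : 0 < τ.im) : mob M.adjugate (mob M τ) = τ := by
  have hd := den_ne_zero (M := M) (by rwa [hM]) hτ
  rw [← mob_mul _ _ hd, Matrix.adjugate_mul, hM]
  have : (n : ℂ) ≠ 0 := by exact_mod_cast hn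
  simp [mob]
  field_simp

lemma Equiv2.symm {x y : ℂ} (hx : 0 < x.im) (h : Equiv2 x y) : Equiv2 y x := by
  obtain ⟨M, hM, rfl⟩ := h
  exact ⟨M.adjugate, X2_adjugate hM, mob_adjugate_mob one_ne_zero hM.1 hx⟩

lemma Equiv2.lam_eq {x y : ℂ} (hx : 0 < x.im) (h : Equiv2 x y) : lam y = lam x := by
  obtain ⟨M, hM, rfl⟩ := h
  exact lam_gamma2 hM hx

/-- Proper discontinuity. -/
lemma finite_gamma2 (R δ : ℝ) (hδ : 0 < δ) :
    {M ∈ X2 1 | ∃ x : ℂ, ‖x‖ ≤ R ∧ δ ≤ x.im ∧ ‖mob M x‖ ≤ R ∧ δ ≤ (mob M x).im}.Finite := by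
  have key : ∀ a b : ℤ, ∀ x : ℂ, ∀ C : ℝ, ‖x‖ ≤ R → δ ≤ x.im → ‖a * x + b‖ ≤ C →
      |a| ≤ ⌈C / δ⌉ ∧ |b| ≤ ⌈C + C / δ * R⌉ := by
    intro a b x C hx hxi h
    have h1 : |(a : ℝ)| * δ ≤ C := by
      have h2 := (abs_im_le_norm (a * x + b : ℂ)).trans h
      have e : (a * x + b : ℂ).im = a * x.im := by simp
      rw [e, abs_mul, abs_of_pos (hδ.trans_le hxi)] at h2
      exact (mul_le_mul_of_nonneg_left hxi (abs_nonneg _)).trans h2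
    have h2 : |(a : ℝ)| ≤ C / δ := by rwa [le_div_iff₀ hδ]
    have h3 : |(b : ℝ)| ≤ C + C / δ * R := by
      have : (b : ℂ) = (a * x + b) - a * x := by ring
      have h4 : ‖(b : ℂ)‖ ≤ C + C / δ * R := by
        rw [this]
        refine (norm_sub_le _ _).trans (add_le_add h ?_)
        rw [norm_mul]
        refine mul_le_mul ?_ hx (norm_nonneg _) ((abs_nonneg _).trans h2)
        simpa using h2
      simpa using h4
    constructor
    · have : ((|a| : ℤ) : ℝ) ≤ (⌈C / δ⌉ : ℤ) := by push_cast; exact h2.trans (Int.le_ceil _)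
      exact_mod_cast this
    · have : ((|b| : ℤ) : ℝ) ≤ (⌈C + C / δ * R⌉ : ℤ) := by push_cast; exact h3.trans (Int.le_ceil _)
      exact_mod_cast this
  set C1 := Real.sqrt (R / δ) with hC1
  set B : ℤ := |⌈C1 / δ⌉| + |⌈C1 + C1 / δ * R⌉| + |⌈R * C1 / δ⌉| + |⌈R * C1 + R * C1 / δ * R⌉| with hB
  have hfin : {M : Matrix (Fin 2) (Fin 2) ℤ | ∀ i j, M i j ∈ Set.Icc (-B) B}.Finite := by
    have : (Set.univ.pi fun _ : Fin 2 => Set.univ.pi fun _ : Fin 2 => Set.Icc (-B) B).Finite :=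
      Set.Finite.pi fun _ => Set.Finite.pi fun _ => Set.finite_Icc _ _
    refine this.subset ?_
    intro M hM i _ j _
    exact hM i j
  refine hfin.subset ?_
  rintro M ⟨hM, x, hx, hxi, hm, hmi⟩
  have hx0 : 0 < x.im := hδ.trans_le hxi
  have hd0 := den_ne_zero (M := M) (by rw [hM.1]; norm_num) hx0
  have hden : ‖den M x‖ ≤ C1 := by
    rw [im_mob, hM.1] at hmi
    have hns : 0 < normSq (den M x) := normSq_pos.mpr hd0
    rw [le_div_iff₀ hns] at hmi
    push_cast at hmi
    rw [hC1]
    apply Real.le_sqrt_of_sq_le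
    rw [← normSq_eq_norm_sq, le_div_iff₀ hδ]
    have := (le_abs_self x.im).trans ((abs_im_le_norm x).trans hx)
    linarith
  have hnum : ‖(M 0 0 * x + M 0 1 : ℂ)‖ ≤ R * C1 := by
    have e : (M 0 0 * x + M 0 1 : ℂ) = mob M x * den M x := by
      rw [mob]; exact (div_mul_cancel₀ _ hd0).symm
    rw [e, norm_mul]
    exact mul_le_mul hm hden (norm_nonneg _) ((norm_nonneg _).trans hm)
  have k1 := key _ _ x _ hx hxi hden
  have k2 := key _ _ x _ hx hxi hnum
  have a1 := le_abs_self ⌈C1 / δ⌉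
  have a2 := le_abs_self ⌈C1 + C1 / δ * R⌉
  have a3 := le_abs_self ⌈R * C1 / δ⌉
  have a4 := le_abs_self ⌈R * C1 + R * C1 / δ * R⌉
  have b1 := abs_nonneg ⌈C1 / δ⌉
  have b2 := abs_nonneg ⌈C1 + C1 / δ * R⌉
  have b3 := abs_nonneg ⌈R * C1 / δ⌉
  have b4 := abs_nonneg ⌈R * C1 + R * C1 / δ * R⌉
  intro i j
  fin_cases i <;> fin_cases j <;> simp only [Fin.zero_eta, Fin.mk_one, Fin.isValue, Set.mem_Icc] <;>
    rw [← abs_le] <;> simp only [hB] <;> linarith [k1.1, k1.2, k2.1, k2.2]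

lemma exists_reduced {τ : ℂ} (hτ : 0 < τ.im) : ∃ z : ℂ, |z.re| ≤ 2 ∧ 1 / 2 ≤ z.im ∧
    (Equiv2 z τ ∨ Equiv2 (-1 / z) τ ∨ Equiv2 (1 - 1 / z) τ) := by
  obtain ⟨g, hg⟩ := ModularGroup.exists_smul_mem_fd ⟨τ, hτ⟩
  obtain ⟨w, hw⟩ : ∃ w : UpperHalfPlane, w = g • (⟨τ, hτ⟩ : UpperHalfPlane) := ⟨_, rfl⟩
  rw [← hw] at hg
  have him := ModularGroup.three_le_four_mul_im_sq_of_mem_fd hg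
  have hre := hg.2
  have hτw : τ = mob (g⁻¹ : Matrix.SpecialLinearGroup (Fin 2) ℤ) w := by
    rw [← coe_SL_smul, hw, inv_smul_smul]
  obtain ⟨M, hM, j, hj, h⟩ := SL2Z_decomp g⁻¹
  have hT : mob !![1, j; 0, 1] w = w + j := by simp [mob]
  have hTd : den !![1, j; 0, 1] w ≠ 0 := by simp [den]
  have hz : 0 < ((w : ℂ) + j).im := by simpa using w.2
  have h0 := ne_zero_of_im_pos hz
  refine ⟨w + j, ?_, ?_, ?_⟩
  · have := abs_le.mp hre
    rw [abs_le]
    rcases hj with rfl | rfl <;> simp <;> constructor <;> linarith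
  · have hp : 0 < w.im := w.2
    have : 1 / 2 ≤ w.im := by nlinarith
    simpa using this
  · rcases h with h | h | h
    · left
      refine ⟨M, hM, ?_⟩
      rw [hτw, h, mob_mul _ _ hTd, hT]
    · right; left
      have hd : den (!![0, -1; 1, 0] * !![1, j; 0, 1]) w ≠ 0 := by
        rw [den_mul _ _ hTd, hT]; simpa [den] using h0
      refine ⟨M, hM, ?_⟩
      rw [hτw, h, mob_mul _ _ hd, mob_mul _ _ hTd, hT]
      simp [mob]
    · right; right
      have hd : den (!![1, -1; 1, 0] * !![1, j; 0, 1]) w ≠ 0 := by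
        rw [den_mul _ _ hTd, hT]; simpa [den] using h0
      refine ⟨M, hM, ?_⟩
      rw [hτw, h, mob_mul _ _ hd, mob_mul _ _ hTd, hT]
      congr 1
      simp [mob]; field_simp; ring

/-- The box of reduced points of bounded height. -/
def redBox (R : ℝ) : Set ℂ := {z | |z.re| ≤ 2 ∧ 1 / 2 ≤ z.im ∧ z.im ≤ R}

lemma isCompact_redBox (R : ℝ) : IsCompact (redBox R) := by
  have : redBox R = Set.Icc (-2) 2 ×ℂ Set.Icc (1 / 2) R := by
    ext z; simp [redBox, mem_reProdIm, abs_le]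
  rw [this]
  exact isCompact_Icc.reProdIm isCompact_Icc

lemma redBox_im_pos {R : ℝ} {z : ℂ} (h : z ∈ redBox R) : 0 < z.im := by
  have := h.2.1; linarith

/-- The union of the translates of `redBox` to the three cusps. -/
def cuspBox (R : ℝ) : Set ℂ :=
  redBox R ∪ ((fun z => -1 / z) '' redBox R ∪ (fun z => 1 - 1 / z) '' redBox R)

lemma isCompact_cuspBox (R : ℝ) : IsCompact (cuspBox R) := by
  have hc : ContinuousOn (fun z : ℂ => -1 / z) (redBox R) :=
    continuousOn_const.div continuousOn_id fun z hz => ne_zero_of_im_pos (redBox_im_pos hz)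
  have hc2 : ContinuousOn (fun z : ℂ => 1 - 1 / z) (redBox R) :=
    continuousOn_const.sub
      (continuousOn_const.div continuousOn_id fun z hz => ne_zero_of_im_pos (redBox_im_pos hz))
  exact (isCompact_redBox R).union
    (((isCompact_redBox R).image_of_continuousOn hc).union
      ((isCompact_redBox R).image_of_continuousOn hc2))

lemma cuspBox_im_pos {R : ℝ} {z : ℂ} (h : z ∈ cuspBox R) : 0 < z.im := by
  rcases h with h | ⟨w, hw, rfl⟩ | ⟨w, hw, rfl⟩
  · exact redBox_im_pos h
  · exact im_neg_one_div_pos (redBox_im_pos hw)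
  · exact im_one_sub_inv_pos (redBox_im_pos hw)

lemma exists_height {η : ℝ} (hη : 0 < η) : ∃ R : ℝ, 0 < R ∧ ∀ z : ℂ, R < z.im → ‖lam z‖ < η := by
  have h := tendsto_lam_im.eventually (Metric.ball_mem_nhds 0 hη)
  rw [eventually_comap] at h
  obtain ⟨R, hR⟩ := eventually_atTop.mp h
  refine ⟨max R 1, by positivity, fun z hz => ?_⟩
  have := hR z.im ((le_max_left _ _).trans hz.le) z rfl
  simpa using this

/-- Properness of the modular lambda function. -/
lemma exists_cuspBox {v : ℂ} (h0 : v ≠ 0) (h1 : v ≠ 1) : ∃ R : ℝ, ∀ᶠ u in 𝓝 v,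
    ∀ τ : ℂ, 0 < τ.im → lam τ = u → ∃ z ∈ cuspBox R, Equiv2 z τ := by
  have hn0 : 0 < ‖v‖ := norm_pos_iff.mpr h0
  have hn1 : 0 < ‖1 - v‖ := norm_pos_iff.mpr (sub_ne_zero.mpr h1.symm)
  obtain ⟨η, hη, hη0, hη1, hη2⟩ : ∃ η : ℝ, 0 < η ∧ η < ‖v‖ ∧ η < ‖1 - v‖ ∧ η * (‖1 - v‖ + 1) < 1 := by
    have hlim : Tendsto (fun η : ℝ => η * (‖1 - v‖ + 1)) (𝓝[>] 0) (𝓝 0) := by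
      have : Tendsto (fun η : ℝ => η * (‖1 - v‖ + 1)) (𝓝 0) (𝓝 (0 * (‖1 - v‖ + 1))) :=
        tendsto_id.mul_const _
      rw [zero_mul] at this
      exact this.mono_left nhdsWithin_le_nhds
    have e1 : ∀ᶠ η : ℝ in 𝓝[>] 0, η < ‖v‖ := nhdsWithin_le_nhds (eventually_lt_nhds hn0)
    have e2 : ∀ᶠ η : ℝ in 𝓝[>] 0, η < ‖1 - v‖ := nhdsWithin_le_nhds (eventually_lt_nhds hn1)
    obtain ⟨η, hη⟩ := ((eventually_mem_nhdsWithin (a := (0 : ℝ)) (s := Set.Ioi 0)).and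
      (e1.and (e2.and (hlim.eventually_lt_const one_pos)))).exists
    exact ⟨η, hη.1, hη.2.1, hη.2.2.1, hη.2.2.2⟩
  obtain ⟨R, hR0, hR⟩ := exists_height hη
  refine ⟨R, ?_⟩
  have c0 : Tendsto (fun u : ℂ => ‖u‖) (𝓝 v) (𝓝 ‖v‖) := tendsto_id.norm
  have c1 : Tendsto (fun u : ℂ => ‖1 - u‖) (𝓝 v) (𝓝 ‖1 - v‖) := (tendsto_id.const_sub 1).norm
  have c2 : Tendsto (fun u : ℂ => η * (‖1 - u‖ + 1)) (𝓝 v) (𝓝 (η * (‖1 - v‖ + 1))) :=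
    (c1.add_const 1).const_mul η
  filter_upwards [c0.eventually_const_lt hη0, c1.eventually_const_lt hη1,
    c2.eventually_lt_const hη2] with u u0 u1 u2 τ hτ hu
  obtain ⟨z, hz1, hz2, hz⟩ := exists_reduced hτ
  have hzp : 0 < z.im := by linarith
  by_cases hzR : z.im ≤ R
  · have hmem : z ∈ redBox R := ⟨hz1, hz2, hzR⟩
    rcases hz with h | h | h
    · exact ⟨z, Or.inl hmem, h⟩
    · exact ⟨_, Or.inr (Or.inl ⟨z, hmem, rfl⟩), h⟩
    · exact ⟨_, Or.inr (Or.inr ⟨z, hmem, rfl⟩), h⟩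
  · exfalso
    have hl := hR z (not_le.mp hzR)
    have hl0 := lam_ne_zero hzp
    rcases hz with h | h | h
    · rw [← hu, h.lam_eq hzp] at u0
      linarith
    · rw [← hu, h.lam_eq (im_neg_one_div_pos hzp), lam_S hzp, sub_sub_cancel] at u1
      linarith
    · rw [← hu, h.lam_eq (im_one_sub_inv_pos hzp), lam_one_sub_inv hzp, sub_sub_cancel, norm_div,
        norm_one] at u2
      have hp : 0 < ‖lam z‖ := norm_pos_iff.mpr hl0
      have : 1 ≤ η * (1 / ‖lam z‖) := by
        rw [mul_one_div, one_le_div hp]; exact hl.le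
      nlinarith

lemma hasStrictDerivAt_lam {τ : ℂ} (hτ : 0 < τ.im) : HasStrictDerivAt lam (deriv lam τ) τ := by
  have : AnalyticAt ℂ lam τ := DifferentiableOn.analyticAt (s := {τ : ℂ | 0 < τ.im}) (fun w hw =>
    (differentiableAt_lam hw).differentiableWithinAt) (isOpen_im_pos.mem_nhds hτ)
  exact this.hasStrictDerivAt

lemma exists_nhds_injOn_of_hasStrictDerivAt {f : ℂ → ℂ} {f' x : ℂ} (h : HasStrictDerivAt f f' x)
    (h' : f' ≠ 0) : ∃ s ∈ 𝓝 x, Set.InjOn f s := by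
  let e := (h.hasStrictFDerivAt_equiv h').toOpenPartialHomeomorph f
  exact ⟨e.source, e.open_source.mem_nhds
    (h.hasStrictFDerivAt_equiv h').mem_toOpenPartialHomeomorph_source, e.injOn⟩

lemma nome_eq_iff {z w : ℂ} (h : nome z = nome w) : ∃ k : ℤ, z = w + 2 * k := by
  obtain ⟨k, hk⟩ := exp_eq_exp_iff_exists_int.mp h
  refine ⟨k, ?_⟩
  have hpi : (Real.pi : ℂ) * I ≠ 0 := by simp [Real.pi_ne_zero]
  apply mul_left_cancel₀ hpi
  rw [hk]; ring

lemma continuousAt_mob {M : Matrix (Fin 2) (Fin 2) ℤ} (hM : M ∈ X2 1) {τ : ℂ} (hτ : 0 < τ.im) :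
    ContinuousAt (mob M) τ := by
  have hd := den_ne_zero (M := M) (by rw [hM.1]; norm_num) hτ
  unfold mob
  exact ContinuousAt.div (by fun_prop) (by fun_prop) hd

lemma eventually_not_equiv2 {x₀ y₀ : ℂ} (hx : 0 < x₀.im) (hy : 0 < y₀.im) (h : ¬ Equiv2 x₀ y₀) :
    ∀ᶠ q : ℂ × ℂ in 𝓝 x₀ ×ˢ 𝓝 y₀, ¬ Equiv2 q.1 q.2 := by
  set R := max ‖x₀‖ ‖y₀‖ + 1 with hR
  set δ := min x₀.im y₀.im / 2 with hδd
  have hm : 0 < min x₀.im y₀.im := lt_min hx hy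
  have hδ : 0 < δ := by positivity
  have hfin := finite_gamma2 R δ hδ
  have h1 : ∀ᶠ q : ℂ × ℂ in 𝓝 x₀ ×ˢ 𝓝 y₀, ∀ M ∈ {M ∈ X2 1 | ∃ x : ℂ, ‖x‖ ≤ R ∧ δ ≤ x.im ∧
      ‖mob M x‖ ≤ R ∧ δ ≤ (mob M x).im}, mob M q.1 ≠ q.2 := by
    rw [hfin.eventually_all]
    rintro M ⟨hM, -⟩
    have t1 : Tendsto (fun q : ℂ × ℂ => mob M q.1) (𝓝 x₀ ×ˢ 𝓝 y₀) (𝓝 (mob M x₀)) :=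
      (continuousAt_mob hM hx).tendsto.comp tendsto_fst
    have t2 : Tendsto (fun q : ℂ × ℂ => q.2) (𝓝 x₀ ×ˢ 𝓝 y₀) (𝓝 y₀) := tendsto_snd
    exact (t1.prodMk_nhds t2).eventually ((isOpen_ne_fun continuous_fst continuous_snd).mem_nhds
      (show mob M x₀ ≠ y₀ from fun e => h ⟨M, hM, e⟩))
  have e1 : ∀ᶠ x in 𝓝 x₀, ‖x‖ < R ∧ δ < x.im := by
    refine (continuous_norm.continuousAt.eventually_lt_const ?_).and
      (continuous_im.continuousAt.eventually_const_lt ?_)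
    · have := le_max_left ‖x₀‖ ‖y₀‖; linarith
    · have := min_le_left x₀.im y₀.im; linarith
  have e2 : ∀ᶠ x in 𝓝 y₀, ‖x‖ < R ∧ δ < x.im := by
    refine (continuous_norm.continuousAt.eventually_lt_const ?_).and
      (continuous_im.continuousAt.eventually_const_lt ?_)
    · have := le_max_right ‖x₀‖ ‖y₀‖; linarith
    · have := min_le_right x₀.im y₀.im; linarith
  filter_upwards [h1, tendsto_fst.eventually e1, tendsto_snd.eventually e2] with q hq hq1 hq2
  rintro ⟨M, hM, hMq⟩
  refine hq M ⟨hM, q.1, hq1.1.le, hq1.2.le, ?_, ?_⟩ hMq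
  · rw [hMq]; exact hq2.1.le
  · rw [hMq]; exact hq2.2.le

/-- The values at which the modular lambda function fails to be injective modulo `Equiv2`. -/
def badValues : Set ℂ :=
  {v | ∃ x y : ℂ, 0 < x.im ∧ 0 < y.im ∧ lam x = v ∧ lam y = v ∧ ¬ Equiv2 x y}

lemma isOpen_badValues : IsOpen badValues := by
  rw [isOpen_iff_mem_nhds]
  rintro v ⟨x, y, hx, hy, rfl, hyv, hne⟩
  obtain ⟨pa, ha, pb, hb, hab⟩ := Filter.eventually_prod_iff.mp (eventually_not_equiv2 hx hy hne)
  have mx := (hasStrictDerivAt_lam hx).map_nhds_eq (deriv_lam_ne_zero hx)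
  have my := (hasStrictDerivAt_lam hy).map_nhds_eq (deriv_lam_ne_zero hy)
  have sx := Filter.image_mem_map (m := lam) (ha.and (isOpen_im_pos.mem_nhds hx))
  have sy := Filter.image_mem_map (m := lam) (hb.and (isOpen_im_pos.mem_nhds hy))
  rw [mx] at sx
  rw [my, hyv] at sy
  filter_upwards [sx, sy]
  rintro u ⟨x', hx', rfl⟩ ⟨y', hy', hxy⟩
  exact ⟨x', y', hx'.2, hy'.2, rfl, hxy, hab hx'.1 hy'.1⟩

lemma eventually_notMem_badValues {v : ℂ} (h0 : v ≠ 0) (h1 : v ≠ 1) (hv : v ∉ badValues) :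
    ∀ᶠ u in 𝓝 v, u ∉ badValues := by
  obtain ⟨R, hR⟩ := exists_cuspBox h0 h1
  by_contra hcon
  have hfr : ∃ᶠ u in 𝓝 v, u ∈ badValues := by
    simpa only [not_eventually, not_not] using hcon
  set E : Set (ℂ × ℂ) := {q | q.1 ∈ cuspBox R ∧ q.2 ∈ cuspBox R ∧ lam q.1 = lam q.2 ∧
    ¬ Equiv2 q.1 q.2} with hE
  set F : Filter (ℂ × ℂ) := comap (fun q => lam q.1) (𝓝 v) ⊓ 𝓟 E with hF
  have hFne : F.NeBot := by
    rw [hF, Filter.inf_principal_neBot_iff]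
    intro U hU
    obtain ⟨W, hW, hWU⟩ := Filter.mem_comap.mp hU
    obtain ⟨u, ⟨x, y, hx, hy, hxu, hyu, hne⟩, hu, huW⟩ := (hfr.and_eventually (hR.and hW)).exists
    obtain ⟨x', hx', hxx⟩ := hu x hx hxu
    obtain ⟨y', hy', hyy⟩ := hu y hy hyu
    have ex := hxx.lam_eq (cuspBox_im_pos hx')
    have ey := hyy.lam_eq (cuspBox_im_pos hy')
    refine ⟨(x', y'), hWU ?_, hx', hy', ?_, fun he => hne ?_⟩
    · change lam x' ∈ W
      rwa [← ex, hxu]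
    · change lam x' = lam y'
      rw [← ex, ← ey, hxu, hyu]
    · exact ((hxx.symm (cuspBox_im_pos hx')).trans hx he).trans hx hyy
  have hFK : F ≤ 𝓟 (cuspBox R ×ˢ cuspBox R) := by
    refine inf_le_right.trans (principal_mono.mpr ?_)
    intro q hq
    exact ⟨hq.1, hq.2.1⟩
  obtain ⟨⟨x, y⟩, ⟨hx, hy⟩, hcl⟩ := ((isCompact_cuspBox R).prod (isCompact_cuspBox R)) hFK
  have hx0 : 0 < x.im := cuspBox_im_pos hx
  have hy0 : 0 < y.im := cuspBox_im_pos hy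
  have : (𝓝 (x, y) ⊓ F).NeBot := hcl
  have t1 : Tendsto (fun q : ℂ × ℂ => lam q.1) (𝓝 (x, y)) (𝓝 (lam x)) :=
    ((differentiableAt_lam hx0).continuousAt.tendsto).comp continuousAt_fst
  have t2 : Tendsto (fun q : ℂ × ℂ => lam q.2) (𝓝 (x, y)) (𝓝 (lam y)) :=
    ((differentiableAt_lam hy0).continuousAt.tendsto).comp continuousAt_snd
  have t3 : Tendsto (fun q : ℂ × ℂ => lam q.1) F (𝓝 v) := tendsto_comap.mono_left inf_le_left
  have hmE : ∀ᶠ q in 𝓝 (x, y) ⊓ F, q ∈ E :=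
    (inf_le_right.trans inf_le_right : 𝓝 (x, y) ⊓ F ≤ 𝓟 E) (mem_principal_self E)
  have hxv : lam x = v :=
    tendsto_nhds_unique (t1.mono_left inf_le_left) (t3.mono_left inf_le_right)
  have hyv : lam y = v := by
    refine tendsto_nhds_unique (t2.mono_left inf_le_left) ((t3.mono_left inf_le_right).congr' ?_)
    filter_upwards [hmE] with q hq
    exact hq.2.2.1
  have heq : Equiv2 x y := by
    by_contra hne
    exact hv ⟨x, y, hx0, hy0, hxv, hyv, hne⟩
  obtain ⟨M, hM, hMxy⟩ := heq
  obtain ⟨s, hs, hinj⟩ := exists_nhds_injOn_of_hasStrictDerivAt (hasStrictDerivAt_lam hy0)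
    (deriv_lam_ne_zero hy0)
  have t4 : Tendsto (fun q : ℂ × ℂ => mob M q.1) (𝓝 (x, y)) (𝓝 y) := by
    have := (continuousAt_mob hM hx0).tendsto
    rw [hMxy] at this
    exact this.comp continuousAt_fst
  have t5 : Tendsto (fun q : ℂ × ℂ => q.2) (𝓝 (x, y)) (𝓝 y) := continuousAt_snd
  obtain ⟨q, hq, hq1, hq2⟩ := (hmE.and (((t4.eventually hs).and (t5.eventually hs)).filter_mono
    inf_le_left)).exists
  refine hq.2.2.2 ⟨M, hM, hinj hq1 hq2 ?_⟩
  rw [lam_gamma2 hM (cuspBox_im_pos hq.1)]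
  exact hq.2.2.1

lemma exists_height_injective : ∃ R : ℝ, ∀ z w : ℂ, R < z.im → R < w.im → lam z = lam w →
    Equiv2 z w := by
  obtain ⟨S, hS, hS0, hS1, hSl⟩ := exists_lam_germ
  have hd : HasStrictDerivAt S (deriv S 0) 0 := hS.hasStrictDerivAt
  obtain ⟨s, hs, hinj⟩ := exists_nhds_injOn_of_hasStrictDerivAt hd (by rw [hS1]; norm_num)
  have hn : ∀ᶠ τ in comap im atTop, nome τ ∈ s :=
    (tendsto_nome.mono_right nhdsWithin_le_nhds).eventually hs
  have h := hSl.and hn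
  rw [eventually_comap] at h
  obtain ⟨R, hR⟩ := eventually_atTop.mp h
  refine ⟨R, fun z w hz hw hzw => ?_⟩
  obtain ⟨z1, z2⟩ := hR z.im hz.le z rfl
  obtain ⟨w1, w2⟩ := hR w.im hw.le w rfl
  obtain ⟨k, hk⟩ := nome_eq_iff (hinj w2 z2 (by rw [← z1, ← w1, hzw]))
  refine ⟨!![1, 2 * k; 0, 1], X2_upper k, ?_⟩
  rw [mob_upper, hk]

lemma exists_notMem_badValues : ∃ v : ℂ, v ≠ 0 ∧ v ≠ 1 ∧ v ∉ badValues := by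
  obtain ⟨R1, hR1⟩ := exists_height_injective
  obtain ⟨R2, hR20, hR2⟩ := exists_height (show (0 : ℝ) < 1 / 2 by norm_num)
  set R := max R1 R2 with hR
  obtain ⟨m, hm0, hm⟩ : ∃ m : ℝ, 0 < m ∧ ∀ z ∈ cuspBox R, m ≤ ‖lam z‖ := by
    have hc : ContinuousOn (fun z => ‖lam z‖) (cuspBox R) := fun z hz =>
      (differentiableAt_lam (cuspBox_im_pos hz)).continuousAt.norm.continuousWithinAt
    exact (isCompact_cuspBox R).exists_forall_le' hc (a := 0) fun z hz =>
      norm_pos_iff.mpr (lam_ne_zero (cuspBox_im_pos hz))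
  have hε : 0 < min m (1 / 2) / 2 := by positivity
  set ε := min m (1 / 2) / 2 with hεd
  have hεm : ε < m := by have := min_le_left m (1 / 2); linarith
  have hε2 : ε < 1 / 2 := by have := min_le_right m (1 / 2); linarith
  have key : ∀ x : ℂ, 0 < x.im → lam x = (ε : ℂ) → ∃ z : ℂ, 0 < z.im ∧ R < z.im ∧ Equiv2 z x := by
    intro x hx hxε
    have hn : ‖lam x‖ = ε := by rw [hxε, norm_real, Real.norm_of_nonneg hε.le]
    obtain ⟨z, hz1, hz2, hz⟩ := exists_reduced hx
    have hzp : 0 < z.im := by linarith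
    by_cases hzR : z.im ≤ R
    · exfalso
      have hmem : z ∈ redBox R := ⟨hz1, hz2, hzR⟩
      obtain ⟨w, hw, hwx⟩ : ∃ w ∈ cuspBox R, Equiv2 w x := by
        rcases hz with h | h | h
        · exact ⟨z, Or.inl hmem, h⟩
        · exact ⟨_, Or.inr (Or.inl ⟨z, hmem, rfl⟩), h⟩
        · exact ⟨_, Or.inr (Or.inr ⟨z, hmem, rfl⟩), h⟩
      have := hm w hw
      rw [← hwx.lam_eq (cuspBox_im_pos hw), hn] at this
      linarith
    · rw [not_le] at hzR
      have hl := hR2 z ((le_max_right _ _).trans_lt hzR)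
      rcases hz with h | h | h
      · exact ⟨z, hzp, hzR, h⟩
      · exfalso
        rw [h.lam_eq (im_neg_one_div_pos hzp), lam_S hzp] at hn
        have := norm_sub_norm_le (1 : ℂ) (lam z)
        rw [norm_one] at this
        linarith
      · exfalso
        rw [h.lam_eq (im_one_sub_inv_pos hzp), lam_one_sub_inv hzp, norm_sub_rev] at hn
        have h2 := norm_sub_norm_le (1 / lam z) (1 : ℂ)
        rw [norm_one, norm_div, norm_one] at h2
        have hp : 0 < ‖lam z‖ := norm_pos_iff.mpr (lam_ne_zero hzp)
        have : 2 ≤ 1 / ‖lam z‖ := by rw [le_div_iff₀ hp]; linarith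
        linarith
  refine ⟨ε, by exact_mod_cast hε.ne', by norm_cast; linarith, ?_⟩
  rintro ⟨x, y, hx, hy, hxε, hyε, hne⟩
  obtain ⟨z, hz0, hz, hzx⟩ := key x hx hxε
  obtain ⟨w, hw0, hw, hwy⟩ := key y hy hyε
  have hzw := hR1 z w ((le_max_left _ _).trans_lt hz) ((le_max_left _ _).trans_lt hw) (by
    rw [← hzx.lam_eq hz0, ← hwy.lam_eq hw0, hxε, hyε])
  exact hne (((hzx.symm hz0).trans hx hzw).trans hx hwy)

/-- The modular lambda function separates points modulo the congruence subgroup of level two. -/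
theorem equiv2_of_lam_eq {x y : ℂ} (hx : 0 < x.im) (hy : 0 < y.im) (h : lam x = lam y) :
    Equiv2 x y := by
  have hconn : IsPreconnected (({0, 1} : Set ℂ)ᶜ) := by
    have : 1 < Module.rank ℝ ℂ := by rw [Complex.rank_real_complex]; norm_num
    exact ((Set.toFinite _).countable.isPathConnected_compl_of_one_lt_rank
      this).isConnected.isPreconnected
  set U : Set ℂ := {v | v ≠ 0 ∧ v ≠ 1 ∧ v ∉ badValues} with hU
  have hUo : IsOpen U := by
    rw [isOpen_iff_mem_nhds]
    rintro v ⟨h0, h1, hv⟩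
    filter_upwards [eventually_ne_nhds h0, eventually_ne_nhds h1,
      eventually_notMem_badValues h0 h1 hv] with u a b c
    exact ⟨a, b, c⟩
  obtain ⟨v, hv0, hv1, hv⟩ := exists_notMem_badValues
  have hsub := hconn.subset_left_of_subset_union hUo isOpen_badValues
    (Set.disjoint_left.mpr fun u hu hu' => hu.2.2 hu')
    (fun u hu => by
      simp only [Set.mem_compl_iff, Set.mem_insert_iff, Set.mem_singleton_iff, not_or] at hu
      by_cases hb : u ∈ badValues
      · exact Or.inr hb
      · exact Or.inl ⟨hu.1, hu.2, hb⟩)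
    ⟨v, by simp [hv0, hv1], hv0, hv1, hv⟩
  have hmem : lam x ∈ U := hsub (by simp [lam_ne_zero hx, lam_ne_one hx])
  by_contra hne
  exact hmem.2.2 ⟨x, y, hx, hy, rfl, h.symm, hne⟩

end LambdaInjective

end LegendreSatoTate

namespace LegendreSatoTate

open Complex Filter Topology Asymptotics

section FundamentalDomain

/-- The interior of a fundamental domain for the principal congruence subgroup of level two. -/
def fundDom : Set ℂ := {τ | 0 < τ.im ∧ |τ.re| < 1 ∧ |τ.re| < normSq τ}

lemma one_lt_normSq_of_mem_fundDom {τ : ℂ} (h : τ ∈ fundDom) {c d : ℤ} (hc : Even c) (hc0 : c ≠ 0)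
    (hd : Odd d) : 1 < normSq (c * τ + d) := by
  obtain ⟨h1, h2, h3⟩ := h
  rw [normSq_apply] at h3
  have e : normSq (c * τ + d) =
      (c : ℝ) ^ 2 * (τ.re * τ.re + τ.im * τ.im) + 2 * c * d * τ.re + (d : ℝ) ^ 2 := by
    rw [normSq_apply]; simp; ring
  have hc2 : 0 < (c : ℝ) ^ 2 := by positivity
  have hd1 : (1 : ℝ) ≤ |(d : ℝ)| ^ 2 := by
    have : d ≠ 0 := by rintro rfl; simp at hd
    have h1 : (1 : ℤ) ≤ |d| := Int.one_le_abs this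
    have : (1 : ℝ) ≤ |(d : ℝ)| := by exact_mod_cast h1
    nlinarith
  have hcd : (1 : ℝ) ≤ (|(c : ℝ)| - |(d : ℝ)|) ^ 2 := by
    have hodd : Odd (|c| - |d|) := (even_abs.mpr hc).sub_odd (odd_abs.mpr hd)
    have : |c| - |d| ≠ 0 := by intro h; rw [h] at hodd; simp at hodd
    have h1 : (1 : ℤ) ≤ |(|c| - |d|)| := Int.one_le_abs this
    have h2 : (1 : ℤ) ≤ (|c| - |d|) ^ 2 := by rw [← sq_abs]; nlinarith
    exact_mod_cast h2
  have hb : -(2 * |(c : ℝ)| * |(d : ℝ)| * |τ.re|) ≤ 2 * c * d * τ.re := by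
    have := neg_abs_le (2 * c * d * τ.re)
    rwa [abs_mul, abs_mul, abs_mul, abs_two] at this
  have hx := abs_nonneg τ.re
  rw [e]
  have hlt : (c : ℝ) ^ 2 * |τ.re| < (c : ℝ) ^ 2 * (τ.re * τ.re + τ.im * τ.im) :=
    mul_lt_mul_of_pos_left h3 hc2
  have h4 : (1 - |τ.re|) * 1 + |τ.re| * 1 ≤
      (1 - |τ.re|) * |(d : ℝ)| ^ 2 + |τ.re| * (|(c : ℝ)| - |(d : ℝ)|) ^ 2 :=
    add_le_add (mul_le_mul_of_nonneg_left hd1 (by linarith)) (mul_le_mul_of_nonneg_left hcd hx)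
  have h5 : |(c : ℝ)| ^ 2 = (c : ℝ) ^ 2 := sq_abs _
  have h6 : |(d : ℝ)| ^ 2 = (d : ℝ) ^ 2 := sq_abs _
  nlinarith

lemma eq_one_or_neg_one_of_mob_mem_fundDom {τ : ℂ} (h : τ ∈ fundDom)
    {M : Matrix (Fin 2) (Fin 2) ℤ} (hM : M ∈ X2 1) (h' : mob M τ ∈ fundDom) : M = 1 ∨ M = -1 := by
  obtain ⟨hdet, h00, h01, h10, h11⟩ := hM
  by_cases hc : M 1 0 = 0
  · rw [Matrix.det_fin_two, hc, mul_zero, sub_zero] at hdet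
    obtain ⟨ha, hd⟩ | ⟨ha, hd⟩ := Int.mul_eq_one_iff_eq_one_or_neg_one.mp hdet
    · left
      have e : mob M τ = τ + M 0 1 := by simp [mob, ha, hd, hc]
      have h1 := abs_lt.mp h.2.1
      have h2 := abs_lt.mp h'.2.1
      rw [e, add_re, intCast_re] at h2
      have : |(M 0 1 : ℝ)| < 2 := by rw [abs_lt]; constructor <;> linarith
      have h3 : |M 0 1| < 2 := by exact_mod_cast this
      have h4 : M 0 1 = 0 := by
        obtain ⟨k, hk⟩ := h01
        rw [abs_lt] at h3
        omega
      rw [Matrix.eta_fin_two M, ha, hd, hc, h4, Matrix.one_fin_two]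
    · right
      have e : mob M τ = τ + -M 0 1 := by simp [mob, ha, hd, hc]; ring
      have h1 := abs_lt.mp h.2.1
      have h2 := abs_lt.mp h'.2.1
      rw [e, add_re, neg_re, intCast_re] at h2
      have : |(M 0 1 : ℝ)| < 2 := by rw [abs_lt]; constructor <;> linarith
      have h3 : |M 0 1| < 2 := by exact_mod_cast this
      have h4 : M 0 1 = 0 := by
        obtain ⟨k, hk⟩ := h01
        rw [abs_lt] at h3
        omega
      rw [Matrix.eta_fin_two M, ha, hd, hc, h4, Matrix.one_fin_two]
      simp
  · exfalso
    have lt_im : ∀ {τ : ℂ} {M : Matrix (Fin 2) (Fin 2) ℤ}, τ ∈ fundDom → M ∈ X2 1 → M 1 0 ≠ 0 →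
        (mob M τ).im < τ.im := by
      intro τ M hτ hM hc
      have h1 := one_lt_normSq_of_mem_fundDom hτ hM.2.2.2.1 hc hM.2.2.2.2
      rw [im_mob, hM.1]
      push_cast
      rw [one_mul]
      exact div_lt_self hτ.1 h1
    have hM : M ∈ X2 1 := ⟨hdet, h00, h01, h10, h11⟩
    have h1 := lt_im h hM hc
    have h2 := lt_im h' (X2_adjugate hM) (by rw [Matrix.adjugate_fin_two]; simpa using hc)
    rw [mob_adjugate_mob one_ne_zero hdet h.1] at h2
    linarith

lemma eq_of_lam_eq_of_mem_fundDom {x y : ℂ} (hx : x ∈ fundDom) (hy : y ∈ fundDom)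
    (h : lam x = lam y) : x = y := by
  obtain ⟨M, hM, rfl⟩ := equiv2_of_lam_eq hx.1 hy.1 h
  rcases eq_one_or_neg_one_of_mob_mem_fundDom hx hM hy with rfl | rfl
  · rw [mob_one]
  · rw [mob_neg, mob_one]

end FundamentalDomain

section Cosets

variable (p : ℕ)

/-- Representatives for the left cosets of the level two group in the matrices of determinant `p`. -/
def rep : Option (Fin p) → Matrix (Fin 2) (Fin 2) ℤ
  | none => !![(p : ℤ), 0; 0, 1]
  | some j => !![1, 2 * (j : ℤ); 0, (p : ℤ)]

variable {p} [hp : Fact p.Prime]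

lemma rep_mem (hp2 : p ≠ 2) (i : Option (Fin p)) : rep p i ∈ X2 p := by
  have hodd : Odd (p : ℤ) := by exact_mod_cast hp.out.odd_of_ne_two hp2
  cases i with
  | none => refine ⟨by simp [rep, Matrix.det_fin_two], by simpa [rep] using hodd, by simp [rep],
      by simp [rep], by simp [rep]⟩
  | some j => refine ⟨by simp [rep, Matrix.det_fin_two], by simp [rep], by simp [rep],
      by simp [rep], by simpa [rep] using hodd⟩

lemma exists_rep (hp2 : p ≠ 2) {M : Matrix (Fin 2) (Fin 2) ℤ} (hM : M ∈ X2 p) :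
    ∃ γ ∈ X2 1, ∃ i, M = γ * rep p i := by
  obtain ⟨hdet, h00, h01, h10, h11⟩ := hM
  rw [Matrix.det_fin_two] at hdet
  have hodd : Odd (p : ℤ) := by exact_mod_cast hp.out.odd_of_ne_two hp2
  have hp0 : (p : ℤ) ≠ 0 := by exact_mod_cast hp.out.ne_zero
  have hpp : Prime (p : ℤ) := Nat.prime_iff_prime_int.mp hp.out
  have hM := Matrix.eta_fin_two M
  obtain ⟨a, ha⟩ : ∃ a, a = M 0 0 := ⟨_, rfl⟩
  obtain ⟨b, hb⟩ : ∃ b, b = M 0 1 := ⟨_, rfl⟩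
  obtain ⟨c, hc⟩ : ∃ c, c = M 1 0 := ⟨_, rfl⟩
  obtain ⟨d, hd⟩ : ∃ d, d = M 1 1 := ⟨_, rfl⟩
  rw [← ha, ← hb, ← hc, ← hd] at hdet hM
  rw [← ha] at h00
  rw [← hb] at h01
  rw [← hc] at h10
  rw [← hd] at h11
  clear ha hb hc hd
  by_cases hac : (p : ℤ) ∣ a ∧ (p : ℤ) ∣ c
  · obtain ⟨⟨a', rfl⟩, c', rfl⟩ := hac
    refine ⟨!![a', b; c', d], ⟨?_, ?_, ?_, ?_, ?_⟩, none, ?_⟩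
    · rw [Matrix.det_fin_two]
      apply mul_left_cancel₀ hp0
      simp only [Matrix.of_apply, Matrix.cons_val', Matrix.cons_val_zero, Matrix.cons_val_one,
        Matrix.cons_val_fin_one]
      linear_combination hdet
    · simpa using (Int.odd_mul.mp h00).2
    · simpa using h01
    · rcases Int.even_mul.mp h10 with h | h
      · exact absurd h (Int.not_even_iff_odd.mpr hodd)
      · simpa using h
    · simpa using h11
    · rw [hM]; simp [rep, mul_comm]
  · have hcop : IsCoprime (2 : ℤ) p := by
      have := (Int.isCoprime_iff_gcd_eq_one (m := 2) (n := (p : ℤ))).mpr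
      apply this
      have h2 := (Nat.coprime_primes Nat.prime_two hp.out).mpr (Ne.symm hp2)
      exact_mod_cast h2
    have key : ∃ k : ℤ, (p : ℤ) ∣ b - 2 * k * a ∧ (p : ℤ) ∣ d - 2 * k * c := by
      have inv : ∀ x : ℤ, ¬ (p : ℤ) ∣ x → ∃ y s : ℤ, 2 * y * x + s * p = 1 := by
        intro x hx
        have hx' : IsCoprime x (p : ℤ) := ((hpp.coprime_iff_not_dvd).mpr hx).symm
        obtain ⟨u, v, huv⟩ := IsCoprime.mul_left hcop hx'
        exact ⟨u, v, by linear_combination huv⟩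
      by_cases hpa : (p : ℤ) ∣ a
      · have hpc : ¬ (p : ℤ) ∣ c := fun h => hac ⟨hpa, h⟩
        obtain ⟨y, s, hys⟩ := inv c hpc
        refine ⟨d * y, ?_, ?_⟩
        · refine hpp.dvd_or_dvd (b := c) ?_ |>.resolve_right hpc
          exact ⟨-1 + a * d * s, by linear_combination -hdet - a * d * hys⟩
        · exact ⟨d * s, by linear_combination -d * hys⟩
      · obtain ⟨y, s, hys⟩ := inv a hpa
        refine ⟨b * y, ?_, ?_⟩
        · exact ⟨b * s, by linear_combination -b * hys⟩
        · refine hpp.dvd_or_dvd (b := a) ?_ |>.resolve_right hpa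
          exact ⟨1 + b * c * s, by linear_combination hdet - b * c * hys⟩
    obtain ⟨k, hk1, hk2⟩ := key
    have hj0 : 0 ≤ k % p := Int.emod_nonneg _ hp0
    have hj1 : k % p < p := Int.emod_lt_of_pos _ (by exact_mod_cast hp.out.pos)
    obtain ⟨j, hj⟩ : ∃ j : ℕ, (j : ℤ) = k % p := ⟨(k % p).toNat, Int.toNat_of_nonneg hj0⟩
    have hjp : j < p := by omega
    have hjk : (j : ℤ) = k - p * (k / p) := by rw [hj, Int.emod_def]
    obtain ⟨β, hβ⟩ : (p : ℤ) ∣ b - 2 * j * a := by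
      obtain ⟨w, hw⟩ := hk1
      exact ⟨w + 2 * (k / p) * a, by rw [hjk]; linear_combination hw⟩
    obtain ⟨δ, hδ⟩ : (p : ℤ) ∣ d - 2 * j * c := by
      obtain ⟨w, hw⟩ := hk2
      exact ⟨w + 2 * (k / p) * c, by rw [hjk]; linear_combination hw⟩
    refine ⟨!![a, β; c, δ], ⟨?_, ?_, ?_, ?_, ?_⟩, some ⟨j, hjp⟩, ?_⟩
    · rw [Matrix.det_fin_two]
      apply mul_left_cancel₀ hp0
      simp only [Matrix.of_apply, Matrix.cons_val', Matrix.cons_val_zero, Matrix.cons_val_one,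
        Matrix.cons_val_fin_one]
      linear_combination hdet - a * hδ + c * hβ
    · simpa using h00
    · have : Even ((p : ℤ) * β) := by
        rw [← hβ]; exact h01.sub (mul_assoc 2 (j : ℤ) a ▸ even_two_mul _)
      rcases Int.even_mul.mp this with h | h
      · exact absurd h (Int.not_even_iff_odd.mpr hodd)
      · simpa using h
    · simpa using h10
    · have : Odd ((p : ℤ) * δ) := by
        rw [← hδ]; exact h11.sub_even (mul_assoc 2 (j : ℤ) c ▸ even_two_mul _)
      simpa using (Int.odd_mul.mp this).2
    · rw [hM]
      simp only [rep, Matrix.mul_fin_two]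
      congr 1
      ext x y
      fin_cases x <;> fin_cases y <;> simp <;> linarith

lemma rep_unique {γ : Matrix (Fin 2) (Fin 2) ℤ} (hγ : γ ∈ X2 1) {i j : Option (Fin p)}
    (hp2 : p ≠ 2) (h : rep p i = γ * rep p j) : i = j := by
  have hp1 : (1 : ℤ) < p := by exact_mod_cast hp.out.one_lt
  have hpp : Prime (p : ℤ) := Nat.prime_iff_prime_int.mp hp.out
  have hdet := hγ.1
  rw [Matrix.det_fin_two] at hdet
  have e00 := congrFun (congrFun h 0) 0
  have e01 := congrFun (congrFun h 0) 1
  have e10 := congrFun (congrFun h 1) 0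
  have e11 := congrFun (congrFun h 1) 1
  cases i with
  | none =>
    cases j with
    | none => rfl
    | some j =>
      exfalso
      simp [rep, Matrix.mul_apply] at e00 e01 e10 e11
      rw [← e10, ← e00] at hdet
      have : (p : ℤ) ∣ 1 := ⟨γ 1 1, by linarith⟩
      exact hpp.not_dvd_one this
  | some i =>
    cases j with
    | none =>
      exfalso
      simp [rep, Matrix.mul_apply] at e00 e01 e10 e11
      exact hpp.not_dvd_one ⟨γ 0 0, by linarith⟩
    | some j =>
      simp [rep, Matrix.mul_apply] at e00 e01 e10 e11
      rw [← e00, one_mul] at e01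
      have hd : (p : ℤ) ∣ 2 * ((i : ℤ) - j) := ⟨γ 0 1, by linarith⟩
      have h2 : ¬ (p : ℤ) ∣ 2 := by
        intro h
        have : p ∣ 2 := by exact_mod_cast h
        exact hp2 ((Nat.prime_dvd_prime_iff_eq hp.out Nat.prime_two).mp this)
      have hd' := (hpp.dvd_or_dvd hd).resolve_left h2
      have : ((i : ℤ) - j) = 0 := by
        apply Int.eq_zero_of_abs_lt_dvd hd'
        have := i.2; have := j.2
        rw [abs_lt]; constructor <;> omega
      congr 1
      ext
      omega

lemma prod_rep_perm {α : Type*} [CommMonoid α] (hp2 : p ≠ 2) (φ : Matrix (Fin 2) (Fin 2) ℤ → α)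
    (hφ : ∀ γ ∈ X2 1, ∀ M ∈ X2 p, φ (γ * M) = φ M)
    (ψ : Matrix (Fin 2) (Fin 2) ℤ → Matrix (Fin 2) (Fin 2) ℤ) (hψ : ∀ M ∈ X2 p, ψ M ∈ X2 p)
    (hinj : ∀ M ∈ X2 p, ∀ N ∈ X2 p, ∀ γ ∈ X2 1, ψ M = γ * ψ N → ∃ γ' ∈ X2 1, M = γ' * N) :
    ∏ i, φ (ψ (rep p i)) = ∏ i, φ (rep p i) := by
  have h : ∀ i, ∃ γ ∈ X2 1, ∃ j, ψ (rep p i) = γ * rep p j := fun i =>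
    exists_rep hp2 (hψ _ (rep_mem hp2 i))
  choose γ hγ σ hσ using h
  have hσinj : Function.Injective σ := by
    intro i j hij
    have e : ψ (rep p i) = (γ i * (γ j).adjugate) * ψ (rep p j) := by
      rw [hσ i, hσ j, hij, Matrix.mul_assoc, ← Matrix.mul_assoc (γ j).adjugate, Matrix.adjugate_mul,
        (hγ j).1, one_smul, Matrix.one_mul]
    obtain ⟨γ', hγ', h'⟩ := hinj _ (rep_mem hp2 i) _ (rep_mem hp2 j) _
      (by simpa using X2_mul (hγ i) (X2_adjugate (hγ j))) e
    exact rep_unique hγ' hp2 h'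
  have hbij : Function.Bijective σ := Finite.injective_iff_bijective.mp hσinj
  have : ∀ i, φ (ψ (rep p i)) = φ (rep p (σ i)) := fun i => by
    rw [hσ i, hφ _ (hγ i) _ (rep_mem hp2 _)]
  simp_rw [this]
  exact hbij.prod_comp fun i => φ (rep p i)

lemma prod_rep_mul_right {α : Type*} [CommMonoid α] (hp2 : p ≠ 2)
    (φ : Matrix (Fin 2) (Fin 2) ℤ → α) (hφ : ∀ γ ∈ X2 1, ∀ M ∈ X2 p, φ (γ * M) = φ M)
    {g : Matrix (Fin 2) (Fin 2) ℤ} (hg : g ∈ X2 1) :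
    ∏ i, φ (rep p i * g) = ∏ i, φ (rep p i) := by
  refine prod_rep_perm hp2 φ hφ (fun M => M * g) (fun M hM => by simpa using X2_mul hM hg) ?_
  intro M hM N hN γ hγ h
  refine ⟨γ, hγ, ?_⟩
  have := congrArg (· * g.adjugate) h
  simpa [Matrix.mul_assoc, Matrix.mul_adjugate, hg.1] using this

/-- Matrices normalising the level two structure. -/
lemma conj_mem_X2 {n : ℤ} {M A B : Matrix (Fin 2) (Fin 2) ℤ} (hM : M ∈ X2 n) (hA : B * A = 1) :
    B * M * A ∈ X2 n := by
  obtain ⟨hdet, h00, h01, h10, h11⟩ := hM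
  have hA' : A * B = 1 := mul_eq_one_comm.mp hA
  obtain ⟨a, ha⟩ := h00
  obtain ⟨b, hb⟩ := h01
  obtain ⟨c, hc⟩ := h10
  obtain ⟨d, hd⟩ := h11
  have hM : M = 1 + 2 • !![a, b; c, d] := by
    rw [Matrix.eta_fin_two M, Matrix.one_fin_two, ha, hb, hc, hd]
    ext x y
    fin_cases x <;> fin_cases y <;> simp <;> ring
  have e : B * M * A = 1 + 2 • (B * !![a, b; c, d] * A) := by
    rw [hM, Matrix.mul_add, Matrix.add_mul, Matrix.mul_one, hA, Matrix.mul_smul, Matrix.smul_mul]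
  refine ⟨?_, ?_, ?_, ?_, ?_⟩
  · rw [Matrix.det_mul, Matrix.det_mul, mul_right_comm, ← Matrix.det_mul, hA, Matrix.det_one,
      one_mul, hdet]
  all_goals rw [e]
  · exact ⟨(B * !![a, b; c, d] * A) 0 0, by
      rw [Matrix.add_apply, Matrix.smul_apply, Matrix.one_apply_eq, nsmul_eq_mul]; push_cast; ring⟩
  · exact ⟨(B * !![a, b; c, d] * A) 0 1, by simp [Matrix.add_apply, two_mul]⟩
  · exact ⟨(B * !![a, b; c, d] * A) 1 0, by simp [Matrix.add_apply, two_mul]⟩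
  · exact ⟨(B * !![a, b; c, d] * A) 1 1, by
      rw [Matrix.add_apply, Matrix.smul_apply, Matrix.one_apply_eq, nsmul_eq_mul]; push_cast; ring⟩

lemma prod_rep_conj {α : Type*} [CommMonoid α] (hp2 : p ≠ 2)
    (φ : Matrix (Fin 2) (Fin 2) ℤ → α) (hφ : ∀ γ ∈ X2 1, ∀ M ∈ X2 p, φ (γ * M) = φ M)
    {A B : Matrix (Fin 2) (Fin 2) ℤ} (hA : B * A = 1) :
    ∏ i, φ (B * rep p i * A) = ∏ i, φ (rep p i) := by
  have hA' : A * B = 1 := mul_eq_one_comm.mp hA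
  refine prod_rep_perm hp2 φ hφ (fun M => B * M * A) (fun M hM => conj_mem_X2 hM hA) ?_
  intro M hM N hN γ hγ h
  refine ⟨A * γ * B, conj_mem_X2 hγ hA', ?_⟩
  have := congrArg (fun Z => A * Z * B) h
  simp only [Matrix.mul_assoc, hA', Matrix.mul_one] at this
  simp only [← Matrix.mul_assoc, hA', Matrix.one_mul] at this
  exact this

end Cosets

end LegendreSatoTate

namespace LegendreSatoTate

open Complex Filter Topology Asymptotics

section HeckeFunctions

lemma mob_conj {A B M : Matrix (Fin 2) (Fin 2) ℤ} (hA : B * A = 1) {τ : ℂ} (h1 : den A τ ≠ 0)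
    (h2 : den (B * M * A) τ ≠ 0) : mob M (mob A τ) = mob A (mob (B * M * A) τ) := by
  have hA' : A * B = 1 := mul_eq_one_comm.mp hA
  rw [← mob_mul _ _ h1, ← mob_mul _ _ h2, ← Matrix.mul_assoc, ← Matrix.mul_assoc, hA',
    Matrix.one_mul]

lemma den_conj {A B M : Matrix (Fin 2) (Fin 2) ℤ} (hA : B * A = 1) {τ : ℂ} (h1 : den A τ ≠ 0)
    (h2 : den (B * M * A) τ ≠ 0) :
    den M (mob A τ) * den A τ = den A (mob (B * M * A) τ) * den (B * M * A) τ := by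
  have hA' : A * B = 1 := mul_eq_one_comm.mp hA
  rw [← den_mul _ _ h1, ← den_mul _ _ h2, ← Matrix.mul_assoc, ← Matrix.mul_assoc, hA',
    Matrix.one_mul]

lemma lam_mob_gamma2_mul {n : ℤ} (hn : 0 < n) {γ M : Matrix (Fin 2) (Fin 2) ℤ} (hγ : γ ∈ X2 1)
    (hM : M ∈ X2 n) {τ : ℂ} (hτ : 0 < τ.im) : lam (mob (γ * M) τ) = lam (mob M τ) := by
  rw [mob_mul _ _ (den_ne_zero (by rw [hM.1]; exact hn.ne') hτ),
    lam_gamma2 hγ (im_mob_pos (by rwa [hM.1]) hτ)]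

lemma mob_S (τ : ℂ) : mob !![0, -1; 1, 0] τ = -1 / τ := by simp [mob]

lemma den_S (τ : ℂ) : den !![0, -1; 1, 0] τ = τ := by simp [den]

lemma mob_U {τ : ℂ} (hτ : 0 < τ.im) : mob !![1, -1; 1, 0] τ = 1 - 1 / τ := by
  have := ne_zero_of_im_pos hτ
  simp [mob]; field_simp; ring

lemma den_U (τ : ℂ) : den !![1, -1; 1, 0] τ = τ := by simp [den]

lemma S_inv_mul : !![0, 1; -1, 0] * !![0, -1; 1, 0] = (1 : Matrix (Fin 2) (Fin 2) ℤ) := by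
  decide

lemma U_inv_mul : !![0, 1; -1, 1] * !![1, -1; 1, 0] = (1 : Matrix (Fin 2) (Fin 2) ℤ) := by
  decide

variable (p : ℕ)

/-- The weight one Hecke quotient attached to a matrix of determinant `p`. -/
noncomputable def hk (M : Matrix (Fin 2) (Fin 2) ℤ) (τ : ℂ) : ℂ :=
  chi M * p * (den M τ)⁻¹ * thA (mob M τ) / thA τ

variable {p} [hp : Fact p.Prime]

lemma pos_of_prime : (0 : ℤ) < p := by exact_mod_cast hp.out.pos

lemma den_ne_zero_of_mem {M : Matrix (Fin 2) (Fin 2) ℤ} (hM : M ∈ X2 p) {τ : ℂ} (hτ : 0 < τ.im) :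
    den M τ ≠ 0 := den_ne_zero (by rw [hM.1]; exact (pos_of_prime (p := p)).ne') hτ

lemma im_mob_pos_of_mem {M : Matrix (Fin 2) (Fin 2) ℤ} (hM : M ∈ X2 p) {τ : ℂ} (hτ : 0 < τ.im) :
    0 < (mob M τ).im := im_mob_pos (by rw [hM.1]; exact pos_of_prime (p := p)) hτ

lemma chi_sq_cast {n : ℤ} {M : Matrix (Fin 2) (Fin 2) ℤ} (hM : M ∈ X2 n) : (chi M : ℂ) ^ 2 = 1 := by
  exact_mod_cast chi_sq hM

lemma hk_mul_left {γ M : Matrix (Fin 2) (Fin 2) ℤ} (hγ : γ ∈ X2 1) (hM : M ∈ X2 p) {τ : ℂ}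
    (hτ : 0 < τ.im) : hk p (γ * M) τ = hk p M τ := by
  have h1 := den_ne_zero_of_mem hM hτ
  have h2 := im_mob_pos_of_mem hM hτ
  have h3 := den_ne_zero (M := γ) (by rw [hγ.1]; norm_num) h2
  have h4 := chi_sq_cast hγ
  have h5 := thA_ne_zero hτ
  unfold hk
  rw [mob_mul _ _ h1, den_mul _ _ h1, thA_gamma2 hγ h2, chi_mul hγ hM]
  push_cast
  field_simp
  linear_combination (chi M : ℂ) * p * thA (mob M τ) * h4

lemma hk_mul_right {γ M : Matrix (Fin 2) (Fin 2) ℤ} (hγ : γ ∈ X2 1) (hM : M ∈ X2 p) {τ : ℂ}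
    (hτ : 0 < τ.im) : hk p M (mob γ τ) = hk p (M * γ) τ := by
  have h1 := den_ne_zero (M := γ) (by rw [hγ.1]; norm_num) hτ
  have h2 : 0 < (mob γ τ).im := im_mob_pos (by rw [hγ.1]; norm_num) hτ
  have h3 := den_ne_zero_of_mem hM h2
  have h4 := chi_sq_cast hγ
  have h5 := thA_ne_zero hτ
  have h6 : (chi γ : ℂ) ≠ 0 := by intro h; rw [h] at h4; norm_num at h4
  unfold hk
  rw [mob_mul _ _ h1, den_mul _ _ h1, thA_gamma2 hγ hτ, chi_mul hM hγ]
  push_cast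
  field_simp
  linear_combination -(chi M * p * thA (mob M (mob γ τ)) : ℂ) * h4

lemma hk_S {M : Matrix (Fin 2) (Fin 2) ℤ} (hM : M ∈ X2 p) {τ : ℂ} (hτ : 0 < τ.im) :
    hk p M (-1 / τ) = chi M * chi (!![0, 1; -1, 0] * M * !![0, -1; 1, 0]) *
      hk p (!![0, 1; -1, 0] * M * !![0, -1; 1, 0]) τ := by
  have hM' := conj_mem_X2 hM S_inv_mul
  set M' := !![0, 1; -1, 0] * M * !![0, -1; 1, 0] with hdef
  have h0 := ne_zero_of_im_pos hτ
  have h1 : den !![0, -1; 1, 0] τ ≠ 0 := by rwa [den_S]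
  have h2 := den_ne_zero_of_mem hM' hτ
  have e1 := mob_conj (M := M) S_inv_mul h1 h2
  have e2 := den_conj (M := M) S_inv_mul h1 h2
  rw [← hdef] at e1 e2
  have hw := im_mob_pos_of_mem hM' hτ
  have hw0 := ne_zero_of_im_pos hw
  rw [mob_S] at e1
  rw [mob_S, den_S, den_S] at e2
  have h3 : den M (-1 / τ) ≠ 0 := den_ne_zero_of_mem hM (im_neg_one_div_pos hτ)
  have e3 : den M (-1 / τ) = mob M' τ * den M' τ / τ := by
    rw [eq_div_iff h0]; exact e2
  have h4 := chi_sq_cast hM'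
  have h5 := thA_ne_zero hτ
  unfold hk
  rw [e1, mob_S, thA_S hw, thA_S hτ, e3]
  field_simp
  linear_combination -(chi M : ℂ) * p * thA (mob M' τ) * h4

lemma hk_U_sq {M : Matrix (Fin 2) (Fin 2) ℤ} (hM : M ∈ X2 p) {τ : ℂ} (hτ : 0 < τ.im) :
    lam τ * hk p M (1 - 1 / τ) ^ 2 = lam (mob (!![0, 1; -1, 1] * M * !![1, -1; 1, 0]) τ) *
      hk p (!![0, 1; -1, 1] * M * !![1, -1; 1, 0]) τ ^ 2 := by
  have hM' := conj_mem_X2 hM U_inv_mul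
  set M' := !![0, 1; -1, 1] * M * !![1, -1; 1, 0] with hdef
  have h0 := ne_zero_of_im_pos hτ
  have h1 : den !![1, -1; 1, 0] τ ≠ 0 := by rwa [den_U]
  have h2 := den_ne_zero_of_mem hM' hτ
  have e1 := mob_conj (M := M) U_inv_mul h1 h2
  have e2 := den_conj (M := M) U_inv_mul h1 h2
  rw [← hdef] at e1 e2
  have hw := im_mob_pos_of_mem hM' hτ
  have hw0 := ne_zero_of_im_pos hw
  rw [mob_U hτ, mob_U hw] at e1
  rw [mob_U hτ, den_U, den_U] at e2
  have h3 : den M (1 - 1 / τ) ≠ 0 := den_ne_zero_of_mem hM (im_one_sub_inv_pos hτ)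
  have e3 : den M (1 - 1 / τ) = mob M' τ * den M' τ / τ := by
    rw [eq_div_iff h0]; exact e2
  have h4 := chi_sq_cast hM'
  have h4' := chi_sq_cast hM
  have h5 := thA_ne_zero hτ
  have h6 := thA_ne_zero hw
  have h7 := thC_ne_zero hτ
  unfold hk
  rw [e1, thA_one_sub_inv hw, thA_one_sub_inv hτ, e3, lam_eq hτ, lam_eq hw]
  field_simp
  rw [h4, h4']
  ring

lemma hk_eq_rep (hp2 : p ≠ 2) {M : Matrix (Fin 2) (Fin 2) ℤ} (hM : M ∈ X2 p) : ∃ i, ∀ τ : ℂ,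
    0 < τ.im → hk p M τ = hk p (rep p i) τ ∧ lam (mob M τ) = lam (mob (rep p i) τ) := by
  obtain ⟨γ, hγ, i, rfl⟩ := exists_rep hp2 hM
  exact ⟨i, fun τ hτ => ⟨hk_mul_left hγ (rep_mem hp2 i) hτ,
    lam_mob_gamma2_mul pos_of_prime hγ (rep_mem hp2 i) hτ⟩⟩

omit hp in
lemma mob_rep_none (τ : ℂ) : mob (rep p none) τ = p * τ := by simp [mob, rep]

omit hp in
lemma mob_rep_some (j : Fin p) (τ : ℂ) : mob (rep p (some j)) τ = (τ + 2 * (j : ℕ)) / p := by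
  simp [mob, rep]

lemma tendsto_mob_rep (i : Option (Fin p)) :
    Tendsto (mob (rep p i)) (comap im atTop) (comap im atTop) := by
  cases i with
  | none =>
    simp_rw [funext (mob_rep_none (p := p))]
    exact tendsto_nat_mul_im hp.out.ne_zero
  | some j =>
    simp_rw [funext (mob_rep_some j)]
    rw [tendsto_comap_iff]
    have : (im ∘ fun τ : ℂ => (τ + 2 * (j : ℕ)) / p) = fun τ : ℂ => τ.im / p := by
      ext τ
      simp [div_natCast_im]
    rw [this]
    exact tendsto_comap.atTop_div_const (by exact_mod_cast hp.out.pos)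

lemma tendsto_lam_rep (i : Option (Fin p)) :
    Tendsto (fun τ => lam (mob (rep p i) τ)) (comap im atTop) (𝓝 0) :=
  tendsto_lam_im.comp (tendsto_mob_rep i)

lemma isBigO_hk_rep (i : Option (Fin p)) :
    (fun τ => hk p (rep p i) τ) =O[comap im atTop] (1 : ℂ → ℝ) := by
  have h1 : Tendsto (fun τ => thA (mob (rep p i) τ) / thA τ) (comap im atTop) (𝓝 (1 / 1)) :=
    (tendsto_thA_im.comp (tendsto_mob_rep i)).div tendsto_thA_im one_ne_zero
  obtain ⟨c, hc⟩ : ∃ c : ℂ, ∀ τ, den (rep p i) τ = c := by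
    cases i with
    | none => exact ⟨1, fun τ => by simp [den, rep]⟩
    | some j => exact ⟨p, fun τ => by simp [den, rep]⟩
  have h2 := (h1.const_mul (chi (rep p i) * p * c⁻¹ : ℂ)).isBigO_one ℝ
  refine h2.congr_left fun τ => ?_
  rw [hk, hc]; ring

lemma isBigO_hk (hp2 : p ≠ 2) {M : Matrix (Fin 2) (Fin 2) ℤ} (hM : M ∈ X2 p) :
    (fun τ => hk p M τ) =O[comap im atTop] (1 : ℂ → ℝ) := by
  obtain ⟨i, hi⟩ := hk_eq_rep hp2 hM
  refine (isBigO_hk_rep i).congr' ?_ EventuallyEq.rfl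
  filter_upwards [eventually_im_pos] with τ hτ using (hi τ hτ).1.symm

lemma isBigO_lam_mob (hp2 : p ≠ 2) {M : Matrix (Fin 2) (Fin 2) ℤ} (hM : M ∈ X2 p) :
    (fun τ => lam (mob M τ)) =O[comap im atTop] (1 : ℂ → ℝ) := by
  obtain ⟨i, hi⟩ := hk_eq_rep hp2 hM
  refine ((tendsto_lam_rep i).isBigO_one ℝ).congr' ?_ EventuallyEq.rfl
  filter_upwards [eventually_im_pos] with τ hτ using (hi τ hτ).2.symm

lemma isBigO_lam_one : lam =O[comap im atTop] (1 : ℂ → ℝ) := tendsto_lam_im.isBigO_one ℝ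

lemma IsBigO.finset_prod_one {ι : Type*} (s : Finset ι) {l : Filter ℂ} {f : ι → ℂ → ℂ}
    (h : ∀ i ∈ s, f i =O[l] (1 : ℂ → ℝ)) : (fun τ => ∏ i ∈ s, f i τ) =O[l] (1 : ℂ → ℝ) := by
  refine (IsBigO.finsetProd h).congr (fun τ => by simp) fun τ => ?_
  simp

lemma differentiableAt_mob_of_mem {M : Matrix (Fin 2) (Fin 2) ℤ} (hM : M ∈ X2 p) {τ : ℂ}
    (hτ : 0 < τ.im) : DifferentiableAt ℂ (mob M) τ := by
  have hd := den_ne_zero_of_mem hM hτ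
  unfold mob
  exact DifferentiableAt.div (by fun_prop) (by fun_prop) hd

lemma differentiableAt_lam_mob {M : Matrix (Fin 2) (Fin 2) ℤ} (hM : M ∈ X2 p) {τ : ℂ}
    (hτ : 0 < τ.im) : DifferentiableAt ℂ (fun τ => lam (mob M τ)) τ :=
  (differentiableAt_lam (im_mob_pos_of_mem hM hτ)).comp τ (differentiableAt_mob_of_mem hM hτ)

lemma differentiableAt_hk {M : Matrix (Fin 2) (Fin 2) ℤ} (hM : M ∈ X2 p) {τ : ℂ}
    (hτ : 0 < τ.im) : DifferentiableAt ℂ (hk p M) τ := by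
  have h1 : DifferentiableAt ℂ (fun τ => thA (mob M τ)) τ :=
    (differentiableAt_thA (im_mob_pos_of_mem hM hτ)).comp τ (differentiableAt_mob_of_mem hM hτ)
  have h2 : DifferentiableAt ℂ (den M) τ := by unfold den; fun_prop
  unfold hk
  exact (((h2.inv (den_ne_zero_of_mem hM hτ)).const_mul _).mul h1).div (differentiableAt_thA hτ)
    (thA_ne_zero hτ)

variable (p) in
/-- The product over cosets whose vanishing expresses the modular equation on the diagonal. -/
noncomputable def modF (τ : ℂ) : ℂ := ∏ i, (lam τ - lam (mob (rep p i) τ))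

variable (p) in
/-- The characteristic polynomial of the Hecke quotients at `x`. -/
noncomputable def modG (x τ : ℂ) : ℂ := ∏ i, (x - hk p (rep p i) τ)

lemma gamma2Invariant_modF (hp2 : p ≠ 2) : Gamma2Invariant (modF p) where
  differentiableAt τ hτ := by
    unfold modF
    refine DifferentiableAt.fun_finsetProd fun i _ => ?_
    exact (differentiableAt_lam hτ).sub (differentiableAt_lam_mob (rep_mem hp2 i) hτ)
  invariant M hM τ hτ := by
    have hd : den M τ ≠ 0 := den_ne_zero (by rw [hM.1]; norm_num) hτ
    have := prod_rep_mul_right hp2 (fun N => lam τ - lam (mob N τ)) (fun γ hγ N hN => by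
      rw [lam_mob_gamma2_mul pos_of_prime hγ hN hτ]) hM
    simp only [modF, lam_gamma2 hM hτ, ← mob_mul _ _ hd]
    exact this

lemma gamma2Invariant_modG (hp2 : p ≠ 2) (x : ℂ) : Gamma2Invariant (modG p x) where
  differentiableAt τ hτ := by
    unfold modG
    refine DifferentiableAt.fun_finsetProd fun i _ => ?_
    exact (differentiableAt_const _).sub (differentiableAt_hk (rep_mem hp2 i) hτ)
  invariant M hM τ hτ := by
    have := prod_rep_mul_right hp2 (fun N => x - hk p N τ) (fun γ hγ N hN => by
      rw [hk_mul_left hγ hN hτ]) hM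
    simp only [modG, hk_mul_right hM (rep_mem hp2 _) hτ]
    exact this

lemma modF_S (hp2 : p ≠ 2) {τ : ℂ} (hτ : 0 < τ.im) :
    modF p (-1 / τ) = ∏ i, (lam (mob (rep p i) τ) - lam τ) := by
  have h := prod_rep_conj hp2 (fun N => lam (mob N τ) - lam τ) (fun γ hγ N hN => by
    rw [lam_mob_gamma2_mul pos_of_prime hγ hN hτ]) S_inv_mul
  rw [← h]
  refine Finset.prod_congr rfl fun i _ => ?_
  have hM' := conj_mem_X2 (rep_mem hp2 i) S_inv_mul
  have e := mob_conj (M := rep p i) S_inv_mul (by rw [den_S]; exact ne_zero_of_im_pos hτ)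
    (den_ne_zero_of_mem hM' hτ)
  rw [mob_S, mob_S] at e
  rw [e, lam_S hτ, lam_S (im_mob_pos_of_mem hM' hτ)]
  ring

lemma modF_U (hp2 : p ≠ 2) {τ : ℂ} (hτ : 0 < τ.im) :
    modF p (1 - 1 / τ) = ∏ i, (1 / lam (mob (rep p i) τ) - 1 / lam τ) := by
  have h := prod_rep_conj hp2 (fun N => 1 / lam (mob N τ) - 1 / lam τ) (fun γ hγ N hN => by
    rw [lam_mob_gamma2_mul pos_of_prime hγ hN hτ]) U_inv_mul
  rw [← h]
  refine Finset.prod_congr rfl fun i _ => ?_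
  have hM' := conj_mem_X2 (rep_mem hp2 i) U_inv_mul
  have e := mob_conj (M := rep p i) U_inv_mul (by rw [den_U]; exact ne_zero_of_im_pos hτ)
    (den_ne_zero_of_mem hM' hτ)
  rw [mob_U hτ, mob_U (im_mob_pos_of_mem hM' hτ)] at e
  rw [e, lam_one_sub_inv hτ, lam_one_sub_inv (im_mob_pos_of_mem hM' hτ)]
  ring

lemma isBigO_lam_nome : lam =O[comap im atTop] nome := by
  have h := tendsto_lam_div_nome.isBigO_one ℂ
  have := h.mul (isBigO_refl nome (comap im atTop))
  refine (this.congr_left fun τ => div_mul_cancel₀ _ (nome_ne_zero τ)).congr_right fun τ => ?_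
  simp

lemma isBigO_lam_pow_div : (fun τ => lam τ ^ p / lam (p * τ)) =O[comap im atTop] (1 : ℂ → ℝ) := by
  have h1 : (fun τ => lam τ ^ p) =O[comap im atTop] fun τ => lam (p * τ) := by
    refine (isBigO_lam_nome.pow p).trans ?_
    have := isBigO_nome_lam.comp_tendsto (tendsto_nat_mul_im hp.out.ne_zero)
    refine this.congr_left fun τ => ?_
    exact nome_nat_mul p τ
  have h2 := h1.mul (isBigO_refl (fun τ => (lam (p * τ))⁻¹) (comap im atTop))
  have h3 : (fun τ => lam (p * τ) * (lam (p * τ))⁻¹) =O[comap im atTop] (1 : ℂ → ℝ) := by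
    refine (isBigO_refl (1 : ℂ → ℝ) _).norm_left.congr' ?_ EventuallyEq.rfl |>.of_norm_left
    filter_upwards [(tendsto_nat_mul_im hp.out.ne_zero).eventually eventually_im_pos] with τ hτ
    rw [mul_inv_cancel₀ (lam_ne_zero hτ)]; simp
  simpa only [div_eq_mul_inv] using h2.trans h3

lemma isBigO_lam_div (j : Fin p) :
    (fun τ => lam τ / lam (mob (rep p (some j)) τ)) =O[comap im atTop] (1 : ℂ → ℝ) := by
  have h1 : lam =O[comap im atTop] fun τ => lam (mob (rep p (some j)) τ) := by
    refine isBigO_lam_nome.trans ?_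
    have h2 := isBigO_nome_lam.comp_tendsto (tendsto_mob_rep (some j))
    refine IsBigO.trans ?_ h2
    refine IsBigO.of_bound 1 ?_
    filter_upwards [(tendsto_mob_rep (some j)).eventually eventually_im_pos] with τ hτ
    have hp0 : (p : ℂ) ≠ 0 := by exact_mod_cast hp.out.ne_zero
    have e : nome τ = nome (mob (rep p (some j)) τ) ^ p := by
      rw [← nome_nat_mul, mob_rep_some, mul_div_cancel₀ _ hp0, nome_add, mul_comm (2 : ℂ),
        nome_nat_mul, nome_two, one_pow, mul_one]
    rw [e, norm_pow, one_mul]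
    exact pow_le_of_le_one (norm_nonneg _) (norm_nome_lt_one hτ).le hp.out.ne_zero
  have h2 := h1.mul (isBigO_refl (fun τ => (lam (mob (rep p (some j)) τ))⁻¹) (comap im atTop))
  have h3 : (fun τ => lam (mob (rep p (some j)) τ) * (lam (mob (rep p (some j)) τ))⁻¹)
      =O[comap im atTop] (1 : ℂ → ℝ) := by
    refine (isBigO_refl (1 : ℂ → ℝ) _).norm_left.congr' ?_ EventuallyEq.rfl |>.of_norm_left
    filter_upwards [(tendsto_mob_rep (some j)).eventually eventually_im_pos] with τ hτ
    rw [mul_inv_cancel₀ (lam_ne_zero hτ)]; simp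
  simpa only [div_eq_mul_inv] using h2.trans h3

variable (p) in
/-- `modF` is a polynomial of degree at most `2 * p` in the modular lambda function. -/
theorem exists_polynomial_modF (hp2 : p ≠ 2) : ∃ P : Polynomial ℂ, P.natDegree ≤ 2 * p ∧
    ∀ τ : ℂ, 0 < τ.im → modF p τ = P.eval (lam τ) := by
  refine (gamma2Invariant_modF hp2).exists_polynomial (2 * p) ?_ ?_ ?_
  · exact IsBigO.finset_prod_one _ fun i _ =>
      isBigO_lam_one.sub (isBigO_lam_mob hp2 (rep_mem hp2 i))
  · have : (fun τ => ∏ i, (lam (mob (rep p i) τ) - lam τ)) =O[comap im atTop] (1 : ℂ → ℝ) :=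
      IsBigO.finset_prod_one _ fun i _ => (isBigO_lam_mob hp2 (rep_mem hp2 i)).sub isBigO_lam_one
    refine this.congr' ?_ EventuallyEq.rfl
    filter_upwards [eventually_im_pos] with τ hτ using (modF_S hp2 hτ).symm
  · have h1 : (fun τ => lam τ ^ p / lam (p * τ) - lam τ ^ (p - 1)) =O[comap im atTop]
        (1 : ℂ → ℝ) :=
      isBigO_lam_pow_div.sub ((tendsto_lam_im.pow _).isBigO_one ℝ)
    have h2 : (fun τ => ∏ j : Fin p, (lam τ / lam (mob (rep p (some j)) τ) - 1)) =O[comap im atTop]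
        (1 : ℂ → ℝ) := IsBigO.finset_prod_one _ fun j _ =>
      (isBigO_lam_div j).sub ((tendsto_const_nhds (x := (1 : ℂ))).isBigO_one ℝ)
    have h3 := h1.mul h2
    refine h3.congr' ?_ (Eventually.of_forall fun τ => by simp)
    filter_upwards [eventually_im_pos] with τ hτ
    have hl := lam_ne_zero hτ
    have e : ∏ j : Fin p, (lam τ / lam (mob (rep p (some j)) τ) - 1) =
        lam τ ^ p * ∏ j : Fin p, (1 / lam (mob (rep p (some j)) τ) - 1 / lam τ) := by
      rw [← Fin.prod_const p (lam τ), ← Finset.prod_mul_distrib]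
      refine Finset.prod_congr rfl fun j _ => ?_
      field_simp
    rw [modF_U hp2 hτ, Fintype.prod_option, e, mob_rep_none]
    have e2 : lam τ ^ p = lam τ ^ (p - 1) * lam τ := by
      rw [← pow_succ, Nat.sub_add_cancel hp.out.one_le]
    have e3 : lam τ ^ p / lam (p * τ) - lam τ ^ (p - 1) =
        lam τ ^ p * (1 / lam (p * τ) - 1 / lam τ) := by
      rw [e2]; field_simp
    rw [e3]
    ring

variable (p) in
/-- `modG` is a polynomial in the modular lambda function. -/
theorem exists_polynomial_modG (hp2 : p ≠ 2) (x : ℂ) : ∃ P : Polynomial ℂ,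
    ∀ τ : ℂ, 0 < τ.im → modG p x τ = P.eval (lam τ) := by
  have hx : (fun _ : ℂ => x) =O[comap im atTop] (1 : ℂ → ℝ) :=
    (tendsto_const_nhds (x := x)).isBigO_one ℝ
  suffices h : ∃ P : Polynomial ℂ, P.natDegree ≤ p + 1 ∧ ∀ τ : ℂ, 0 < τ.im → modG p x τ = P.eval (lam τ) from
    h.imp fun P hP => hP.2
  refine (gamma2Invariant_modG hp2 x).exists_polynomial (p + 1) ?_ ?_ ?_
  · exact IsBigO.finset_prod_one _ fun i _ => hx.sub (isBigO_hk hp2 (rep_mem hp2 i))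
  · refine IsBigO.finset_prod_one _ fun i _ => hx.sub ?_
    have h := (isBigO_hk hp2 (conj_mem_X2 (rep_mem hp2 i) S_inv_mul)).const_mul_left
      (chi (rep p i) * chi (!![0, 1; -1, 0] * rep p i * !![0, -1; 1, 0]) : ℂ)
    refine h.congr' ?_ EventuallyEq.rfl
    filter_upwards [eventually_im_pos] with τ hτ using (hk_S (rep_mem hp2 i) hτ).symm
  · have e : ∀ τ : ℂ, lam τ ^ (p + 1) * modG p x (1 - 1 / τ) =
        ∏ i, (lam τ * x - lam τ * hk p (rep p i) (1 - 1 / τ)) := by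
      intro τ
      rw [modG]
      have : lam τ ^ (p + 1) = ∏ _i : Option (Fin p), lam τ := by simp
      rw [this, ← Finset.prod_mul_distrib]
      exact Finset.prod_congr rfl fun i _ => by ring
    simp_rw [e]
    refine IsBigO.finset_prod_one _ fun i _ => IsBigO.sub ?_ ?_
    · exact (isBigO_lam_one.mul hx).congr_right fun τ => by simp
    · have hM' := conj_mem_X2 (rep_mem hp2 i) U_inv_mul
      have h := (isBigO_lam_one.mul (isBigO_lam_mob hp2 hM')).mul ((isBigO_hk hp2 hM').pow 2)
      refine IsBigO.of_pow two_ne_zero ?_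
      refine h.congr' ?_ (Eventually.of_forall fun τ => by simp)
      filter_upwards [eventually_im_pos] with τ hτ
      have := hk_U_sq (rep_mem hp2 i) hτ
      simp only [Pi.pow_apply]
      linear_combination -(lam τ) * this

end HeckeFunctions

end LegendreSatoTate

namespace LegendreSatoTate

section HasseInvariant

open PowerSeries Filter

lemma toC_injective : Function.Injective toC :=
  PowerSeries.map_injective _ Int.cast_injective

lemma psiSer_add : psiSer + rescale (-1) psiSer = 2 * expand 2 two_ne_zero psiSer := by
  apply toC_injective
  have h1 := qExp_thA.add qExp_thB
  have h2 := (QExp.C 2).mul (qExp_thA.dilate two_ne_zero)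
  have h3 := h1.unique (h2.congr (by
    filter_upwards [eventually_im_pos] with τ hτ
    rw [thA_add_thB hτ]; simp))
  rw [map_add, h3, map_mul, map_expand, map_ofNat toC, map_ofNat C]

lemma psiSer_mul : psiSer * rescale (-1) psiSer =
    expand 2 two_ne_zero (rescale (-1) psiSer) ^ 2 := by
  apply toC_injective
  have h1 := qExp_thA.mul qExp_thB
  have h2 := (qExp_thB.dilate two_ne_zero).pow 2
  have h3 := h1.unique (h2.congr (by
    filter_upwards [eventually_im_pos] with τ hτ
    rw [thA_mul_thB hτ]; simp))
  rw [map_mul, h3, map_pow, map_expand]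

/-- The Hasse polynomial `∑ (m choose i) ^ 2 x ^ i` of the Legendre family. -/
def hasse {R : Type*} [CommRing R] (m : ℕ) (x : R) : R :=
  ∑ i ∈ Finset.range (m + 1), (m.choose i : R) ^ 2 * x ^ i

lemma map_hasse {R S F : Type*} [CommRing R] [CommRing S] [FunLike F R S] [RingHomClass F R S]
    (f : F) (m : ℕ) (x : R) : f (hasse m x) = hasse m (f x) := by
  simp [hasse]

lemma choose_central_mod {p m : ℕ} [hp : Fact p.Prime] (hm : p = 2 * m + 1) (R : Type*) [CommRing R]
    [CharP R p] : ∀ n ≤ m, ((-1) ^ n * (Nat.centralBinom n : R)) = 4 ^ n * (m.choose n : R) := by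
  have h2 : (2 * m + 1 : R) = 0 := by
    rw [← CharP.cast_eq_zero R p, hm]; push_cast; ring
  intro n
  induction n with
  | zero => simp
  | succ n ih =>
    intro hn
    have ih := ih (by omega)
    have e1 : ((n + 1 : ℕ) : R) * (Nat.centralBinom (n + 1)) = 2 * (2 * n + 1) * Nat.centralBinom n := by
      exact_mod_cast congrArg (Nat.cast (R := R)) (Nat.succ_mul_centralBinom_succ n)
    have e2 : (m.choose (n + 1) : R) * ((n + 1 : ℕ) : R) = m.choose n * (m - n) := by
      have := congrArg (Nat.cast (R := R)) (Nat.choose_succ_right_eq m n)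
      rw [Nat.cast_mul, Nat.cast_mul, Nat.cast_sub (by omega)] at this
      exact this
    have hu : IsUnit ((n + 1 : ℕ) : R) := by
      rw [CharP.isUnit_natCast_iff hp.out]
      intro h
      have := Nat.le_of_dvd (by omega) h
      omega
    apply hu.mul_left_cancel
    rw [pow_succ, pow_succ]
    linear_combination (-(-1) ^ n) * e1 - 4 ^ n * 4 * e2 - 2 * (2 * n + 1) * ih +
      -4 ^ n * m.choose n * 2 * h2

lemma hasse_quadratic {p m : ℕ} [hp : Fact p.Prime] (hm : p = 2 * m + 1) {R : Type*} [CommRing R]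
    [CharP R p] (x : R) : hasse m (x ^ 2) =
      ∑ n ∈ Finset.range (m + 1), (m.choose n : R) ^ 2 * (4 * x) ^ n * (1 + x) ^ (2 * (m - n)) := by
  have key : ((1 + Polynomial.C x * Polynomial.X) ^ m * (Polynomial.X + Polynomial.C x) ^ m : Polynomial R) =
      (Polynomial.C x * (Polynomial.X - 1) ^ 2 + Polynomial.X * Polynomial.C ((1 + x) ^ 2)) ^ m := by
    rw [← mul_pow]
    congr 1
    simp only [map_pow, map_add, map_one]
    ring
  have h1 : Polynomial.coeff ((1 + Polynomial.C x * Polynomial.X) ^ m * (Polynomial.X + Polynomial.C x) ^ m : Polynomial R) m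
      = hasse m (x ^ 2) := by
    rw [Polynomial.coeff_mul, Finset.Nat.sum_antidiagonal_eq_sum_range_succ_mk, hasse]
    refine Finset.sum_congr rfl fun i hi => ?_
    have hi : i ≤ m := by simpa [Nat.lt_succ_iff] using hi
    have e : (1 + Polynomial.C x * Polynomial.X : Polynomial R) =
        (1 + Polynomial.X : Polynomial R).comp (Polynomial.C x * Polynomial.X) := by simp
    rw [e, ← Polynomial.pow_comp, Polynomial.comp_C_mul_X_coeff, Polynomial.coeff_one_add_X_pow,
      Polynomial.coeff_X_add_C_pow]
    simp only
    rw [Nat.choose_symm hi, Nat.sub_sub_self hi]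
    ring
  have h2 : Polynomial.coeff ((Polynomial.C x * (Polynomial.X - 1) ^ 2 + Polynomial.X * Polynomial.C ((1 + x) ^ 2)) ^ m : Polynomial R) m
      = ∑ n ∈ Finset.range (m + 1), (m.choose n : R) ^ 2 * (4 * x) ^ n * (1 + x) ^ (2 * (m - n)) := by
    rw [add_pow, Polynomial.finsetSum_coeff]
    refine Finset.sum_congr rfl fun n hn => ?_
    have hn : n ≤ m := by simpa [Nat.lt_succ_iff] using hn
    have e : ((Polynomial.C x * (Polynomial.X - 1) ^ 2) ^ n * (Polynomial.X * Polynomial.C ((1 + x) ^ 2)) ^ (m - n) *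
        (m.choose n : Polynomial R)) = Polynomial.C (x ^ n * (1 + x) ^ (2 * (m - n)) * m.choose n) *
          (Polynomial.X - Polynomial.C 1) ^ (2 * n) * Polynomial.X ^ (m - n) := by
      simp only [map_pow, map_add, map_one, map_mul, map_natCast, mul_pow, ← pow_mul]
      ring
    rw [e]
    have e2 : m = n + (m - n) := by omega
    conv_lhs => rw [e2]
    rw [Nat.add_sub_cancel_left, Polynomial.coeff_mul_X_pow, Polynomial.coeff_C_mul,
      sub_eq_add_neg, ← Polynomial.C_neg, Polynomial.coeff_X_add_C_pow]
    have e3 : 2 * n - n = n := by omega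
    rw [e3, ← e2, ← Nat.centralBinom_eq_two_mul_choose, choose_central_mod hm R n hn]
    ring
  rw [← h1, ← h2, key]

lemma eq_C_of_expand_two {R : Type*} [CommRing R] {u : R⟦X⟧} (h : expand 2 two_ne_zero u = u) :
    u = C (constantCoeff u) := by
  have key : ∀ n, n ≠ 0 → coeff n u = 0 := by
    intro n
    induction n using Nat.strong_induction_on with
    | _ n ih =>
      intro hn
      rw [← h, coeff_expand]
      split_ifs with h2
      · exact ih _ (by omega) (by omega)
      · rfl
  ext n
  by_cases hn : n = 0
  · simp [hn]
  · rw [key n hn, coeff_C, if_neg hn]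

/-- In characteristic `p` the Hasse polynomial inverts the `(p - 1)`-st power of theta. -/
theorem hasse_lamSer {p m : ℕ} [hp : Fact p.Prime] (hm : p = 2 * m + 1) (k : Type*) [Field k]
    [CharP k p] : hasse m (PowerSeries.map (Int.castRingHom k) lamSer) *
      PowerSeries.map (Int.castRingHom k) psiSer ^ (p - 1) = 1 := by
  set φ := PowerSeries.map (Int.castRingHom k) with hφ
  set L := φ lamSer with hL
  set a := φ psiSer with ha
  set b := φ (rescale (-1) psiSer) with hb
  set c := expand 2 two_ne_zero a with hc
  set d := expand 2 two_ne_zero b with hd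
  have h2 : (2 : k) ≠ 0 := by
    have : ((2 : ℕ) : k) ≠ 0 := by
      rw [Ne, CharP.cast_eq_zero_iff k p]
      intro h
      have := Nat.le_of_dvd (by omega) h
      have := hp.out.two_le
      omega
    exact_mod_cast this
  have D1 : a + b = 2 * c := by
    have := congrArg φ psiSer_add
    rwa [map_add, map_mul, hφ, map_expand, map_ofNat] at this
  have D2 : a * b = d ^ 2 := by
    have := congrArg φ psiSer_mul
    rwa [map_mul, map_pow, hφ, map_expand] at this
  set a' := φ psiInv with ha'
  have haa : a * a' = 1 := by rw [ha, ha', ← map_mul, psiSer_mul_psiInv, map_one]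
  have hLdef : L = 1 - (b * a') ^ 2 := by simp [hL, lamSer, hb, ha']
  set c' := expand 2 two_ne_zero a' with hc'
  have hcc : c * c' = 1 := by rw [hc, hc', ← map_mul, haa, map_one]
  set L2 := expand 2 two_ne_zero L with hL2
  have hL2def : L2 = 1 - (d * c') ^ 2 := by rw [hL2, hLdef]; simp [hd, hc']
  -- the half-integer uniformizer
  set x := C (2⁻¹ : k) * (a - b) * c' with hx
  have hC : C (2⁻¹ : k) * 2 = 1 := by
    have : (2 : k⟦X⟧) = C 2 := (map_ofNat C 2).symm
    rw [this, ← map_mul, inv_mul_cancel₀ h2, map_one]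
  have x1 : (1 + x) * c = a := by
    rw [hx]; linear_combination C (2⁻¹ : k) * (a - b) * hcc - C (2⁻¹ : k) * D1 + (a - c) * hC
  have x2 : (1 - x) * c = b := by
    rw [hx]; linear_combination -C (2⁻¹ : k) * (a - b) * hcc - C (2⁻¹ : k) * D1 + (b - c) * hC
  have x3 : L2 = x ^ 2 := by
    have : d ^ 2 * c' ^ 2 = (1 + x) * (1 - x) := by
      rw [← D2, ← x1, ← x2]
      linear_combination (1 + x) * (1 - x) * (c * c' + 1) * hcc
    rw [hL2def, mul_pow, this]; ring
  have x4 : L * (1 + x) ^ 2 = 4 * x := by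
    have h3 : (1 + x) * (c * a') = 1 := by linear_combination a' * x1 + haa
    have : b * a' * (1 + x) = 1 - x := by rw [← x2]; linear_combination (1 - x) * h3
    rw [hLdef]
    linear_combination (-(b * a' * (1 + x)) - (1 - x)) * this
  have : CharP k⟦X⟧ p := by
    refine ⟨fun n => ?_⟩
    rw [← CharP.cast_eq_zero_iff k p, ← map_natCast (C (R := k)), map_eq_zero_iff _ C_injective]
  have e1 : hasse m L2 = (1 + x) ^ (2 * m) * hasse m L := by
    rw [x3, hasse_quadratic hm, hasse, Finset.mul_sum]
    refine Finset.sum_congr rfl fun n hn => ?_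
    have hn : n ≤ m := by simpa [Nat.lt_succ_iff] using hn
    rw [← x4, mul_pow, ← pow_mul]
    have : 2 * m = 2 * n + 2 * (m - n) := by omega
    rw [this, pow_add]; ring
  have e2 : p - 1 = 2 * m := by omega
  rw [e2]
  have e3 : expand 2 two_ne_zero (hasse m L * a ^ (2 * m)) = hasse m L * a ^ (2 * m) := by
    have e4 : a ^ (2 * m) = (1 + x) ^ (2 * m) * c ^ (2 * m) := by rw [← mul_pow, x1]
    rw [map_mul, map_pow, map_hasse, ← hL2, ← hc, e1, e4]
    ring
  rw [eq_C_of_expand_two e3]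
  have hL0 : constantCoeff L = 0 := by
    rw [← coeff_zero_eq_constantCoeff_apply, hL, hφ, coeff_map, coeff_zero_lamSer]; simp
  have ha0 : constantCoeff a = 1 := by
    rw [← coeff_zero_eq_constantCoeff_apply, ha, hφ, coeff_map, coeff_zero_eq_constantCoeff_apply,
      constantCoeff_psiSer]; simp
  rw [map_mul, map_pow, ha0, map_hasse, hL0, hasse, Finset.sum_range_succ']
  simp

end HasseInvariant

end LegendreSatoTate

namespace LegendreSatoTate

section Reduction

open PowerSeries Filter Complex

lemma exists_valuationSubring (p : ℕ) [hp : Fact p.Prime] :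
    ∃ O : ValuationSubring ℂ, (p : ℂ) ∈ O.nonunits := by
  let A : Subring ℂ := (Int.castRingHom ℂ).range
  let pA : A := ⟨p, ⟨p, by simp⟩⟩
  have hI : Ideal.span {pA} ≠ ⊤ := by
    rw [Ne, Ideal.span_singleton_eq_top]
    intro h
    obtain ⟨⟨_, n, rfl⟩, hb⟩ := isUnit_iff_exists_inv.mp h
    have h1 : ((p : ℤ) * n : ℂ) = 1 := by simpa [pA] using congrArg Subtype.val hb
    have h2 : (p : ℤ) * n = 1 := by exact_mod_cast h1
    have h3 := Int.isUnit_iff.mp (IsUnit.of_mul_eq_one _ h2)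
    have := hp.out.two_le
    omega
  obtain ⟨B, -, hB⟩ := Ideal.image_subset_nonunits_valuationSubring _ hI
  exact ⟨B, hB ⟨pA, Ideal.subset_span rfl, rfl⟩⟩

lemma aeval_series_injective {R : Type*} [CommRing R] [IsDomain R] {L : R⟦X⟧} (h0 : constantCoeff L = 0)
    (h1 : L ≠ 0) {P : Polynomial R} (hP : Polynomial.aeval L P = 0) : P = 0 := by
  by_contra hne
  obtain ⟨Q, hQ, hd⟩ := Polynomial.exists_eq_pow_rootMultiplicity_mul_and_not_dvd P hne 0
  rw [map_zero, sub_zero] at hQ hd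
  rw [hQ, map_mul, map_pow, Polynomial.aeval_X, mul_eq_zero] at hP
  rcases hP with h | h
  · exact pow_ne_zero _ h1 h
  · apply hd
    rw [Polynomial.X_dvd_iff]
    have := congrArg constantCoeff h
    rw [map_zero, Polynomial.aeval_def, Polynomial.hom_eval₂, h0, Polynomial.eval₂_at_zero] at this
    simpa using! this

/-- Evaluating a polynomial commutes with a change of coefficients of power series. -/
lemma map_aeval_series {R S : Type*} [CommRing R] [CommRing S] (f : R →+* S) (L : R⟦X⟧)
    (P : Polynomial R) : PowerSeries.map f (Polynomial.aeval L P) =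
      Polynomial.aeval (PowerSeries.map f L) (P.map f) := by
  rw [Polynomial.aeval_def, Polynomial.hom_eval₂, Polynomial.aeval_def, Polynomial.eval₂_map]
  congr 1
  ext r : 1
  simp

lemma map_map_int {R S : Type*} [CommRing R] [CommRing S] (f : R →+* S) (u : ℤ⟦X⟧) :
    PowerSeries.map f (PowerSeries.map (Int.castRingHom R) u) = PowerSeries.map (Int.castRingHom S) u := by
  ext n; simp

lemma expand_map_int {p : ℕ} [hp : Fact p.Prime] (k : Type*) [Field k] [CharP k p] (u : ℤ⟦X⟧) :
    expand p hp.out.ne_zero (PowerSeries.map (Int.castRingHom k) u) =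
      PowerSeries.map (Int.castRingHom k) u ^ p := by
  have : ExpChar k p := ExpChar.prime hp.out
  have := MvPowerSeries.map_frobenius_expand (σ := Unit) (R := k) p hp.out.ne_zero
    (f := PowerSeries.map (Int.castRingHom k) u)
  rw [← this]
  change _ = PowerSeries.map (frobenius k p) (expand p hp.out.ne_zero _)
  rw [map_expand, map_map_int]

lemma rep_chi_some {p : ℕ} (j : Fin p) : chi (rep p (some j)) = 1 := by
  simp [chi, rep]

section Place

variable {p m : ℕ} [hp : Fact p.Prime] (hm : p = 2 * m + 1) {O k : Type*} [CommRing O] [Field k]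
  [CharP k p] {ι : O →+* ℂ} (hι : Function.Injective ι) (π : O →+* k) (h16 : IsUnit (16 : O))
  (hζ : ∀ z : ℂ, z ^ p = 1 → ∃ y, ι y = z)

include hι h16 in
omit hp in
lemma exists_polynomial_lift (P : Polynomial ℂ) : ∀ w : O⟦X⟧,
    PowerSeries.map ι w = Polynomial.aeval (toC lamSer) P → ∃ Q : Polynomial O, Q.map ι = P := by
  have hL0 : constantCoeff (toC lamSer) = 0 := by
    rw [← coeff_zero_eq_constantCoeff_apply, coeff_map, coeff_zero_lamSer]; simp
  have hev : ∀ P : Polynomial ℂ, constantCoeff (Polynomial.aeval (toC lamSer) P) = P.coeff 0 := by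
    intro P
    rw [Polynomial.aeval_def, Polynomial.hom_eval₂, hL0, Polynomial.eval₂_at_zero]
    simp
  obtain ⟨V, hV⟩ : (X : ℤ⟦X⟧) ∣ lamSer := by
    rw [X_dvd_iff, ← coeff_zero_eq_constantCoeff_apply, coeff_zero_lamSer]
  have hV0 : constantCoeff V = 16 := by
    have := coeff_one_lamSer
    rwa [hV, show (1 : ℕ) = 0 + 1 from rfl, coeff_succ_X_mul, coeff_zero_eq_constantCoeff_apply]
      at this
  have hVu : IsUnit (PowerSeries.map (Int.castRingHom O) V) := by
    rw [isUnit_iff_constantCoeff, ← coeff_zero_eq_constantCoeff_apply, coeff_map,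
      coeff_zero_eq_constantCoeff_apply, hV0]
    simpa using h16
  obtain ⟨W, hW⟩ := isUnit_iff_exists_inv.mp hVu
  have hW' : toC V * PowerSeries.map ι W = 1 := by
    rw [← map_map_int ι, ← map_mul, hW, map_one]
  refine Polynomial.recOnHorner P ?_ ?_ ?_
  · exact fun w _ => ⟨0, by simp⟩
  · intro P a hP0 _ ih w hw
    have ha : ι (constantCoeff w) = a := by
      have := congrArg constantCoeff hw
      rw [hev, Polynomial.coeff_add, hP0, zero_add, Polynomial.coeff_C_zero] at this
      rw [← this, ← coeff_zero_eq_constantCoeff_apply, ← coeff_zero_eq_constantCoeff_apply, coeff_map]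
    obtain ⟨Q, hQ⟩ := ih (w - C (constantCoeff w)) (by
      rw [map_sub, hw, map_C, ha, map_add, Polynomial.aeval_C, PowerSeries.algebraMap_apply]
      simp)
    exact ⟨Q + Polynomial.C (constantCoeff w), by simp [hQ, ha]⟩
  · intro P _ ih w hw
    rw [map_mul, Polynomial.aeval_X] at hw
    obtain ⟨w', rfl⟩ : X ∣ w := by
      rw [X_dvd_iff]
      apply hι
      have := congrArg constantCoeff hw
      rw [map_mul, hL0, mul_zero] at this
      rw [map_zero, ← this, ← coeff_zero_eq_constantCoeff_apply, ← coeff_zero_eq_constantCoeff_apply,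
        coeff_map]
    obtain ⟨Q, hQ⟩ := ih (w' * W) (by
      have e : X * PowerSeries.map ι w' = X * (Polynomial.aeval (toC lamSer) P * toC V) := by
        rw [map_mul, map_X, hV, map_mul, map_X] at hw
        rw [hw, hV, map_mul, map_X]; ring
      have e' := mul_left_cancel₀ X_ne_zero e
      rw [map_mul, e', mul_assoc, hW', mul_one])
    exact ⟨Q * Polynomial.X, by simp [hQ]⟩

include hι h16 in
/-- A polynomial in the modular lambda function with integral `q`-expansion at `p w` is integral, and
its reduction is the reduction of the `q`-expansion. -/
lemma exists_polynomial_lift_of_expand {P : Polynomial ℂ} {w : O⟦X⟧}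
    (h : PowerSeries.map ι w = expand p hp.out.ne_zero (Polynomial.aeval (toC lamSer) P)) :
    ∃ Q : Polynomial O, Q.map ι = P ∧
      Polynomial.aeval (PowerSeries.map (Int.castRingHom k) lamSer ^ p) (Q.map π) =
        PowerSeries.map π w := by
  obtain ⟨Q, hQ⟩ := exists_polynomial_lift hι h16 P (PowerSeries.mk fun n => coeff (p * n) w) (by
    ext n
    rw [coeff_map, coeff_mk, ← coeff_map, h, coeff_expand_mul])
  refine ⟨Q, hQ, ?_⟩
  have e1 : w = expand p hp.out.ne_zero (Polynomial.aeval (PowerSeries.map (Int.castRingHom O) lamSer) Q) := by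
    apply PowerSeries.map_injective ι hι
    rw [h, map_expand, map_aeval_series, map_map_int, hQ]
  rw [e1, map_expand, map_aeval_series, map_map_int, ← Polynomial.aeval_algHom_apply, expand_map_int]

lemma lamSer_pow_reduction (hm : p = 2 * m + 1) :
    constantCoeff (PowerSeries.map (Int.castRingHom k) lamSer ^ p) = 0 ∧
      PowerSeries.map (Int.castRingHom k) lamSer ^ p ≠ 0 := by
  constructor
  · rw [map_pow, ← coeff_zero_eq_constantCoeff_apply, coeff_map, coeff_zero_lamSer]
    simp [hp.out.ne_zero]
  · refine pow_ne_zero _ fun h => ?_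
    have := congrArg (coeff 1) h
    rw [coeff_map, coeff_one_lamSer, map_zero] at this
    have h2 : ((16 : ℕ) : k) = 0 := by simpa using this
    rw [CharP.cast_eq_zero_iff k p, show 16 = 2 ^ 4 by norm_num] at h2
    have := Nat.le_of_dvd (by omega) (hp.out.dvd_of_dvd_pow h2)
    have := hp.out.two_le
    omega

/-- The roots of unity entering the shifts `τ ↦ τ + 2 j / p`. -/
lemma nome_two_mul_div_pow (j : ℕ) : nome (2 * j / p) ^ p = 1 := by
  rw [← nome_nat_mul]
  have : (p : ℂ) * (2 * j / p) = j * 2 := by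
    have : (p : ℂ) ≠ 0 := by exact_mod_cast hp.out.ne_zero
    field_simp
  rw [this, nome_nat_mul, nome_two, one_pow]

omit hp in
lemma qExp_shift_nome {u : ℂ⟦X⟧} {g : ℂ → ℂ} (hu : QExp u g) (hp0 : p ≠ 0) (j : Fin p) :
    QExp (rescale (nome (2 * (j : ℕ) / p)) u) (fun w => g (mob (rep p (some j)) (p * w))) := by
  refine (hu.shift (2 * (j : ℕ) / p)).congr (Eventually.of_forall fun w => ?_)
  have : (p : ℂ) ≠ 0 := by exact_mod_cast hp0
  rw [mob_rep_some]
  congr 1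
  field_simp

omit hp in
lemma qExp_dilate_none {u : ℂ⟦X⟧} {g : ℂ → ℂ} (hu : QExp u g) (hp0 : p ≠ 0) :
    QExp (expand p hp0 (expand p hp0 u)) (fun w => g (mob (rep p none) (p * w))) := by
  refine ((hu.dilate hp0).dilate hp0).congr (Eventually.of_forall fun w => ?_)
  rw [mob_rep_none]

omit hp in
lemma rescale_one_apply {R : Type*} [CommRing R] (u : R⟦X⟧) : rescale 1 u = u := by
  rw [rescale_one]; rfl

include hζ in
lemma exists_zeta : ∃ ζ : Fin p → O, ∀ j, ι (ζ j) = nome (2 * (j : ℕ) / p) := by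
  choose ζ h using fun j : Fin p => hζ _ (nome_two_mul_div_pow (p := p) j)
  exact ⟨ζ, h⟩

include hι in
lemma zeta_reduction {y : O} (h : ι y ^ p = 1) : π y = 1 := by
  have h1 : y ^ p = 1 := hι (by simpa using h)
  have h2 : (π y) ^ p = 1 := by rw [← map_pow, h1, map_one]
  have h3 : (π y - 1) ^ p = 0 := by rw [sub_pow_char, h2, one_pow, sub_self]
  exact sub_eq_zero.mp (pow_eq_zero_iff hp.out.ne_zero |>.mp h3)

include hm hι h16 hζ in
/-- The modular equation on the diagonal is integral and reduces to `-(X ^ p - X) ^ 2`. -/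
theorem modF_reduction : ∃ Q : Polynomial O, Q.natDegree ≤ 2 * p ∧
    (∀ τ : ℂ, 0 < τ.im → modF p τ = (Q.map ι).eval (lam τ)) ∧
    Q.map π = -(Polynomial.X ^ p - Polynomial.X) ^ 2 := by
  have hp2 : p ≠ 2 := by omega
  have hp0 := hp.out.ne_zero
  obtain ⟨P, hdeg, hP⟩ := exists_polynomial_modF p hp2
  obtain ⟨ζ, hζ'⟩ := exists_zeta (p := p) hζ
  set LO := PowerSeries.map (Int.castRingHom O) lamSer with hLO
  set Y := PowerSeries.map (Int.castRingHom k) lamSer with hY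
  have hιL : PowerSeries.map ι LO = toC lamSer := map_map_int _ _
  have hπL : PowerSeries.map π LO = Y := map_map_int _ _
  let w : O⟦X⟧ := (expand p hp0 LO - expand p hp0 (expand p hp0 LO)) *
    ∏ j : Fin p, (expand p hp0 LO - rescale (ζ j) LO)
  have hw : PowerSeries.map ι w = expand p hp0 (Polynomial.aeval (toC lamSer) P) := by
    have h1 := ((qExp_lam.aeval P).dilate hp0)
    have hd := qExp_lam.dilate hp0
    have h2 := (hd.sub (qExp_dilate_none qExp_lam hp0)).mul (QExp.prod Finset.univ fun j _ =>
      hd.sub (qExp_shift_nome qExp_lam hp0 j))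
    refine QExp.unique (g := fun τ => modF p (p * τ)) ?_ (h1.congr ?_)
    · have e : PowerSeries.map ι w = (expand p hp0 (toC lamSer) - expand p hp0 (expand p hp0 (toC lamSer))) *
          ∏ j : Fin p, (expand p hp0 (toC lamSer) - rescale (nome (2 * (j : ℕ) / p)) (toC lamSer)) := by
        simp only [w, map_mul, map_sub, map_prod, map_expand, hιL, ← rescale_map, hζ']
      rw [e]
      refine h2.congr (Eventually.of_forall fun τ => ?_)
      rw [modF, Fintype.prod_option]
    · filter_upwards [eventually_im_pos] with τ hτ
      exact (hP _ (by simpa using mul_pos (Nat.cast_pos.mpr hp.out.pos) hτ)).symm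
  obtain ⟨Q, hQ, hQ'⟩ := exists_polynomial_lift_of_expand (p := p) hι π h16 hw
  have hinj : Function.Injective (Polynomial.map ι) := Polynomial.map_injective ι hι
  refine ⟨Q, ?_, ?_, ?_⟩
  · rw [← Polynomial.natDegree_map_eq_of_injective hι, hQ]; exact hdeg
  · rw [hQ]; exact hP
  · obtain ⟨hc, hne⟩ := lamSer_pow_reduction (p := p) (k := k) hm
    rw [← hY] at hc hne hQ'
    rw [← sub_eq_zero]
    refine aeval_series_injective hc hne ?_
    rw [map_sub, hQ']
    have hz : ∀ j, π (ζ j) = 1 := fun j => zeta_reduction (p := p) hι π (by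
      rw [hζ', nome_two_mul_div_pow])
    have e1 : expand p hp0 Y = Y ^ p := expand_map_int k lamSer
    have e : PowerSeries.map π w = (Y ^ p - (Y ^ p) ^ p) * (Y ^ p - Y) ^ p := by
      simp only [w, map_mul, map_sub, map_prod, map_expand, hπL, ← rescale_map, hz, e1, map_pow,
        rescale_one_apply, Finset.prod_const, Finset.card_univ, Fintype.card_fin]
    have : CharP k⟦X⟧ p := by
      refine ⟨fun n => ?_⟩
      rw [← CharP.cast_eq_zero_iff k p, ← map_natCast (C (R := k)), map_eq_zero_iff _ C_injective]
    rw [e, sub_pow_char]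
    simp only [map_neg, map_pow, map_sub, Polynomial.aeval_X]
    ring

include hm hι h16 hζ in
/-- The characteristic polynomial of the Hecke quotients is integral, and reduces to the
Hasse polynomial relation. -/
theorem modG_reduction (x r : O) {τ : ℂ} (hτ : 0 < τ.im) (hr : ι r = lam τ)
    (h0 : modG p (ι x) τ = 0) : π x = 0 ∨ π x ^ p = hasse m (π r) := by
  have hp2 : p ≠ 2 := by omega
  have hp0 := hp.out.ne_zero
  have hpC : (p : ℂ) ≠ 0 := by exact_mod_cast hp0
  obtain ⟨P, hP⟩ := exists_polynomial_modG p hp2 (ι x)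
  obtain ⟨ζ, hζ'⟩ := exists_zeta (p := p) hζ
  set TO := PowerSeries.map (Int.castRingHom O) psiSer with hTO
  set TI := PowerSeries.map (Int.castRingHom O) psiInv with hTI
  set T := PowerSeries.map (Int.castRingHom k) psiSer with hT
  set S := PowerSeries.map (Int.castRingHom k) psiInv with hS
  set Y := PowerSeries.map (Int.castRingHom k) lamSer with hY
  let w : O⟦X⟧ := (C x - C (chi (rep p none) * p : O) * (expand p hp0 (expand p hp0 TO) * expand p hp0 TI)) *
    ∏ j : Fin p, (C x - rescale (ζ j) TO * expand p hp0 TI)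
  have hw : PowerSeries.map ι w = expand p hp0 (Polynomial.aeval (toC lamSer) P) := by
    have h1 := ((qExp_lam.aeval P).dilate hp0)
    have hd := qExp_thA_inv.dilate hp0
    have h2 := ((QExp.C (ι x)).sub ((QExp.C (chi (rep p none) * p : ℂ)).mul
      ((qExp_dilate_none qExp_thA hp0).mul hd))).mul (QExp.prod Finset.univ fun j _ =>
      (QExp.C (ι x)).sub ((qExp_shift_nome qExp_thA hp0 j).mul hd))
    refine QExp.unique (g := fun τ => modG p (ι x) (p * τ)) ?_ (h1.congr ?_)
    · have e : PowerSeries.map ι w = (C (ι x) - C (chi (rep p none) * p : ℂ) *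
            (expand p hp0 (expand p hp0 (toC psiSer)) * expand p hp0 (toC psiInv))) *
          ∏ j : Fin p, (C (ι x) - rescale (nome (2 * (j : ℕ) / p)) (toC psiSer) *
            expand p hp0 (toC psiInv)) := by
        simp only [w, map_mul, map_sub, map_prod, map_expand, map_C, hTO, hTI, map_map_int,
          ← rescale_map, hζ', map_intCast, map_natCast]
      rw [e]
      refine h2.congr (Eventually.of_forall fun τ => ?_)
      rw [modG, Fintype.prod_option]
      congr 1
      · simp only [hk, den, rep]; simp; ring
      · refine Finset.prod_congr rfl fun j _ => ?_
        simp only [hk, rep_chi_some]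
        have : den (rep p (some j)) (p * τ) = p := by simp [den, rep]
        rw [this]
        field_simp
        simp
    · filter_upwards [eventually_im_pos] with τ hτ
      exact (hP _ (by simpa using mul_pos (Nat.cast_pos.mpr hp.out.pos) hτ)).symm
  obtain ⟨Q, hQ, hQ'⟩ := exists_polynomial_lift_of_expand (p := p) hι π h16 hw
  have key : Q.map π = Polynomial.C (π x) * (Polynomial.C (π x) ^ p - hasse m Polynomial.X) := by
    obtain ⟨hc, hne⟩ := lamSer_pow_reduction (p := p) (k := k) hm
    rw [← hY] at hc hne hQ'
    rw [← sub_eq_zero]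
    refine aeval_series_injective hc hne ?_
    rw [map_sub, hQ']
    have hz : ∀ j, π (ζ j) = 1 := fun j => zeta_reduction (p := p) hι π (by
      rw [hζ', nome_two_mul_div_pow])
    have e1 : expand p hp0 S = S ^ p := expand_map_int k psiInv
    have hTS : T * S = 1 := by rw [hT, hS, ← map_mul, psiSer_mul_psiInv, map_one]
    have hH : T * S ^ p = hasse m Y := by
      have := hasse_lamSer hm k
      have hpp : p = (p - 1) + 1 := by omega
      calc T * S ^ p = (hasse m Y * T ^ (p - 1)) * (T * S ^ p) := by rw [this, one_mul]
        _ = hasse m Y * (T ^ p * S ^ p) := by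
          conv_rhs => rw [hpp, pow_succ T]
          rw [← hpp]; ring
        _ = _ := by rw [← mul_pow, hTS, one_pow, mul_one]
    have : CharP k⟦X⟧ p := by
      refine ⟨fun n => ?_⟩
      rw [← CharP.cast_eq_zero_iff k p, ← map_natCast (C (R := k)), map_eq_zero_iff _ C_injective]
    have e : PowerSeries.map π w = C (π x) * (C (π x) - hasse m Y) ^ p := by
      simp only [w, map_mul, map_sub, map_prod, map_expand, hTO, hTI, map_map_int, ← rescale_map, hz,
        rescale_one_apply, Finset.prod_const, Finset.card_univ, Fintype.card_fin, map_C, map_natCast]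
      rw [← hT, ← hS, e1, hH, CharP.cast_eq_zero k⟦X⟧ p, mul_zero, zero_mul, sub_zero]
    have : ExpChar k⟦X⟧ p := ExpChar.prime hp.out
    have e2 : hasse m Y ^ p = hasse m (Y ^ p) := map_hasse (frobenius k⟦X⟧ p) m Y
    rw [e, sub_pow_char, e2]
    simp only [map_mul, map_pow, map_sub, Polynomial.aeval_C, map_hasse, Polynomial.aeval_X,
      PowerSeries.algebraMap_apply]
    simp
  have h1 : (Q.map ι).eval (ι r) = 0 := by rw [hQ, hr, ← hP τ hτ, h0]
  rw [Polynomial.eval_map, Polynomial.eval₂_hom] at h1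
  have h2 : Q.eval r = 0 := hι (by rw [h1, map_zero])
  have h3 : (Q.map π).eval (π r) = 0 := by
    rw [Polynomial.eval_map, Polynomial.eval₂_hom, h2, map_zero]
  rw [key, Polynomial.eval_mul, Polynomial.eval_sub, mul_eq_zero, Polynomial.eval_C,
    Polynomial.eval_pow, Polynomial.eval_C] at h3
  have h4 : Polynomial.eval (π r) (hasse m (Polynomial.X : Polynomial k)) = hasse m (π r) := by
    have := map_hasse (Polynomial.evalRingHom (π r)) m Polynomial.X
    simpa using! this
  rw [h4] at h3
  exact h3.imp id sub_eq_zero.mp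

end Place

end Reduction

end LegendreSatoTate

namespace LegendreSatoTate

section Multiplicity

open Filter Topology Complex

/-- If `P ∘ g` is a product of functions, `n` of which vanish at a point where `g` is a local
coordinate, then `P` vanishes to order at least `n` at the value of `g`. -/
lemma card_le_rootMultiplicity {ι : Type*} [Fintype ι] {P : Polynomial ℂ} (hP : P ≠ 0) {g : ℂ → ℂ}
    {f : ι → ℂ → ℂ} {z : ℂ} (hg : DifferentiableAt ℂ g z) (hg' : deriv g z ≠ 0)
    (hf : ∀ i, DifferentiableAt ℂ (f i) z) (h : ∀ᶠ τ in 𝓝 z, P.eval (g τ) = ∏ i, f i τ)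
    (s : Finset ι) (hs : ∀ i ∈ s, f i z = 0) : s.card ≤ P.rootMultiplicity (g z) := by
  classical
  by_contra! hlt
  set k := P.rootMultiplicity (g z) with hk
  obtain ⟨R, hR, hd⟩ := Polynomial.exists_eq_pow_rootMultiplicity_mul_and_not_dvd P hP (g z)
  rw [← hk] at hR
  rw [Polynomial.dvd_iff_isRoot, Polynomial.IsRoot.def] at hd
  have h1 : Tendsto (fun τ => (slope g z τ) ^ k * R.eval (g τ)) (𝓝[≠] z)
      (𝓝 (deriv g z ^ k * R.eval (g z))) := by
    refine (hg.hasDerivAt.tendsto_slope.pow k).mul ?_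
    exact (R.continuous.continuousAt.comp hg.continuousAt).tendsto.mono_left nhdsWithin_le_nhds
  have h2 : Tendsto (fun τ => (∏ i ∈ s, slope (f i) z τ) * (∏ i ∈ sᶜ, f i τ) * (τ - z) ^ (s.card - k))
      (𝓝[≠] z) (𝓝 ((∏ i ∈ s, deriv (f i) z) * (∏ i ∈ sᶜ, f i z) * 0)) := by
    refine Tendsto.mul (Tendsto.mul ?_ ?_) ?_
    · exact tendsto_finsetProd _ fun i _ => (hf i).hasDerivAt.tendsto_slope
    · exact tendsto_finsetProd _ fun i _ =>
        (hf i).continuousAt.tendsto.mono_left nhdsWithin_le_nhds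
    · have : Tendsto (fun τ : ℂ => (τ - z) ^ (s.card - k)) (𝓝 z) (𝓝 ((z - z) ^ (s.card - k))) :=
        ((continuous_id.sub continuous_const).pow _).tendsto z
      rw [sub_self, zero_pow (by omega)] at this
      exact this.mono_left nhdsWithin_le_nhds
  rw [mul_zero] at h2
  have h3 : (fun τ => (slope g z τ) ^ k * R.eval (g τ)) =ᶠ[𝓝[≠] z]
      fun τ => (∏ i ∈ s, slope (f i) z τ) * (∏ i ∈ sᶜ, f i τ) * (τ - z) ^ (s.card - k) := by
    filter_upwards [self_mem_nhdsWithin, nhdsWithin_le_nhds h] with τ hτ hP'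
    have hτ0 : τ - z ≠ 0 := sub_ne_zero.mpr hτ
    have e1 : ∏ i ∈ s, slope (f i) z τ = (∏ i ∈ s, f i τ) / (τ - z) ^ s.card := by
      rw [← Finset.prod_const, ← Finset.prod_div_distrib]
      refine Finset.prod_congr rfl fun i hi => ?_
      rw [slope_def_field, hs i hi, sub_zero]
    have e2 : (τ - z) ^ s.card = (τ - z) ^ k * (τ - z) ^ (s.card - k) := by
      rw [← pow_add]; congr 1; omega
    have e3 : (∏ i ∈ s, f i τ) * ∏ i ∈ sᶜ, f i τ = (g τ - g z) ^ k * R.eval (g τ) := by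
      rw [Finset.prod_mul_prod_compl, ← hP', hR]
      simp
    rw [e1, slope_def_field, e2, div_pow]
    field_simp
    rw [e3]
  have := tendsto_nhds_unique (h1.congr' h3) h2
  exact mul_ne_zero (pow_ne_zero _ hg') hd this

end Multiplicity

section Places

open Polynomial

variable {p : ℕ} [hp : Fact p.Prime]

open Classical in
/-- If `Q` reduces to `-(X ^ p - X) ^ 2` then any family of roots respecting multiplicities reduces
to a family in which each residue class occurs at most twice. -/
lemma card_filter_roots_le (O : ValuationSubring ℂ) [CharP (IsLocalRing.ResidueField O) p]
    {Q : Polynomial O} (hdeg : Q.natDegree ≤ 2 * p)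
    (hQ : Q.map (IsLocalRing.residue O) = -(X ^ p - X) ^ 2) :
    (∀ r : ℂ, (Q.map O.subtype).IsRoot r → r ∈ O) ∧
    (∀ {α : Type} (S : Finset α) (f : α → O)
      (_ : ∀ r : O, (S.filter fun x => f x = r).card ≤ (Q.map O.subtype).rootMultiplicity (r : ℂ)),
      ∀ Λ : Finset (IsLocalRing.ResidueField O),
      (S.filter fun x => IsLocalRing.residue O (f x) ∈ Λ).card ≤ 2 * Λ.card) := by
  set k := IsLocalRing.ResidueField O
  set π := IsLocalRing.residue O
  have hmon : (X ^ p - X : k[X]).Monic := by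
    apply monic_X_pow_sub
    rw [degree_X]
    exact_mod_cast hp.out.one_lt
  have hnd : (X ^ p - X : k[X]).natDegree = p :=
    FiniteField.X_pow_card_sub_X_natDegree_eq k hp.out.one_lt
  have hdeg2 : (-(X ^ p - X : k[X]) ^ 2).natDegree = 2 * p := by
    rw [natDegree_neg, natDegree_pow, hnd]
  have hndQ : Q.natDegree = 2 * p := le_antisymm hdeg (by
    rw [← hdeg2, ← hQ]; exact natDegree_map_le)
  have hlead : π Q.leadingCoeff = -1 := by
    rw [leadingCoeff, hndQ, ← coeff_map, hQ, ← hdeg2, coeff_natDegree, leadingCoeff_neg,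
      (hmon.pow 2).leadingCoeff]
  have hunit : IsUnit Q.leadingCoeff := by
    rw [← isUnit_map_iff π, hlead]; exact isUnit_one.neg
  have hint : ∀ r : ℂ, (Q.map O.subtype).IsRoot r → r ∈ O := by
    intro r hr
    obtain ⟨v, hv⟩ := isUnit_iff_exists_inv'.mp hunit
    have hI : IsIntegral O r := by
      refine ⟨C v * Q, ?_, ?_⟩
      · rw [Monic, leadingCoeff_C_mul_of_isUnit (IsUnit.of_mul_eq_one _ hv), hv]
      · rw [eval₂_mul]
        have : eval₂ (algebraMap O ℂ) r Q = 0 := by rwa [IsRoot.def, eval_map] at hr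
        rw [this, mul_zero]
    obtain ⟨y, hy⟩ := IsIntegrallyClosed.isIntegral_iff.mp hI
    rw [← hy]; exact y.2
  refine ⟨hint, fun S f hf Λ => ?_⟩
  have hinj : Function.Injective O.subtype := Subtype.val_injective
  have hQ0 : Q.map O.subtype ≠ 0 := by
    rw [Ne, Polynomial.map_eq_zero_iff hinj]
    rintro rfl
    simp at hndQ
    exact hp.out.ne_zero (by omega)
  let g : ℂ → O := fun r => if h : r ∈ O then ⟨r, h⟩ else 0
  have hg : ∀ r ∈ (Q.map O.subtype).roots, ((g r : O) : ℂ) = r := by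
    intro r hr
    have := hint r (isRoot_of_mem_roots hr)
    simp [g, this]
  obtain ⟨Rt, hRt'⟩ : ∃ Rt : Multiset O,
      Rt.map (fun y : O => (y : ℂ)) = (Q.map O.subtype).roots := by
    refine ⟨(Q.map O.subtype).roots.map g, ?_⟩
    rw [Multiset.map_map]
    conv_rhs => rw [← Multiset.map_id (Q.map O.subtype).roots]
    exact Multiset.map_congr rfl fun r hr => hg r hr
  have hfac : Q = C Q.leadingCoeff * (Rt.map fun y => X - C y).prod := by
    apply Polynomial.map_injective O.subtype hinj
    have h1 := (IsAlgClosed.splits (Q.map O.subtype)).eq_prod_roots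
    have h2 : (Rt.map fun y => X - C y).map (Polynomial.map O.subtype) =
        (Q.map O.subtype).roots.map fun y => X - C y := by
      rw [← hRt', Multiset.map_map, Multiset.map_map]
      refine Multiset.map_congr rfl fun y _ => ?_
      simp
    rw [Polynomial.map_mul, map_C, Polynomial.map_multiset_prod, h2,
      ← leadingCoeff_map_of_injective hinj]
    exact h1
  have hroots : (Q.map π).roots = Rt.map π := by
    have h1 : Q.map π = C (-1) * ((Rt.map π).map fun y => X - C y).prod := by
      conv_lhs => rw [hfac]
      have h2 : (Rt.map fun y => X - C y).map (Polynomial.map π) =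
          (Rt.map π).map fun y => X - C y := by
        rw [Multiset.map_map, Multiset.map_map]
        refine Multiset.map_congr rfl fun y _ => ?_
        simp
      rw [Polynomial.map_mul, map_C, hlead, Polynomial.map_multiset_prod, h2]
    rw [h1, roots_C_mul _ (by simp), roots_multiset_prod_X_sub_C]
  have hle : S.val.map f ≤ Rt := by
    rw [Multiset.le_iff_count]
    intro r
    have h1 : Multiset.count r (S.val.map f) = (S.filter fun x => f x = r).card := by
      rw [Multiset.count_map, Finset.card_def, Finset.filter_val]
      congr 1
      exact Multiset.filter_congr fun x _ => eq_comm
    rw [h1]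
    refine (hf r).trans (le_of_eq ?_)
    rw [← count_roots, ← hRt', Multiset.count_map_eq_count' _ _ Subtype.val_injective]
  have hle2 : (S.val.map f).map π ≤ (Q.map π).roots := by
    rw [hroots]; exact Multiset.map_le_map hle
  have h2 : (S.filter fun x => π (f x) ∈ Λ).card =
      Multiset.countP (· ∈ Λ) ((S.val.map f).map π) := by
    rw [Multiset.map_map, Multiset.countP_map, Finset.card_def, Finset.filter_val]
    rfl
  rw [h2]
  refine (Multiset.countP_le_of_le _ hle2).trans ?_
  rw [hQ, roots_neg, roots_pow]
  have hcount : ∀ x, Multiset.count x (X ^ p - X : k[X]).roots ≤ 1 := fun x =>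
    count_roots_le_one (galois_poly_separable p p dvd_rfl) x
  have hnodup : (X ^ p - X : k[X]).roots.Nodup := Multiset.nodup_iff_count_le_one.mpr hcount
  rw [Multiset.countP_nsmul]
  refine Nat.mul_le_mul_left 2 ?_
  rw [Multiset.countP_eq_card_filter]
  have : (⟨_, hnodup.filter (· ∈ Λ)⟩ : Finset k) ⊆ Λ := fun x hx => by
    have : x ∈ Multiset.filter (· ∈ Λ) (X ^ p - X : k[X]).roots := hx
    exact (Multiset.mem_filter.mp this).2
  exact Finset.card_le_card this

end Places

end LegendreSatoTate

namespace LegendreSatoTate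

section LegendreTrace

open Finset

variable {p : ℕ} [hp : Fact p.Prime]

/-- The trace of Frobenius of the Legendre curve `y² = x (x - 1) (x - l)`. -/
def frobTrace (l : ZMod p) : ℤ :=
  -∑ x : ZMod p, quadraticChar (ZMod p) (x * (x - 1) * (x - l))

lemma sum_pow_eq {i : ℕ} (h0 : 0 < i) (hi : i < 2 * (p - 1)) :
    ∑ x : ZMod p, x ^ i = if i = p - 1 then -1 else 0 := by
  have h1 : ∑ x : ZMod p, x ^ i = ∑ x : (ZMod p)ˣ, ((x : ZMod p) ^ i) := by
    classical
    have h2 : ∑ x : (ZMod p)ˣ, ((x : ZMod p) ^ i) = ∑ x ∈ univ.filter (fun x : ZMod p => x ≠ 0), x ^ i := by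
      refine Finset.sum_bij (fun x _ => (x : ZMod p)) ?_ ?_ ?_ ?_
      · intro x _; simp
      · intro x _ y _ h; exact Units.ext h
      · intro x hx; exact ⟨Units.mk0 x (by simpa using hx), mem_univ _, rfl⟩
      · intro x _; rfl
    rw [h2, Finset.sum_filter_of_ne]
    intro x _ hx h
    rw [h, zero_pow h0.ne'] at hx
    exact hx rfl
  rw [h1]
  have := FiniteField.sum_pow_units (ZMod p) i
  rw [ZMod.card] at this
  rw [this]
  congr 1
  have : p - 1 ∣ i ↔ i = p - 1 := by
    constructor
    · rintro ⟨c, rfl⟩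
      have hc0 : c ≠ 0 := by rintro rfl; simp at h0
      have hc2 : c < 2 := by
        by_contra! h
        have := Nat.mul_le_mul_left (p - 1) h
        omega
      have : c = 1 := by omega
      rw [this, mul_one]
    · rintro rfl; exact dvd_rfl
  simp [this]

lemma frobTrace_cast {m : ℕ} (hm : p = 2 * m + 1) (l : ZMod p) :
    (frobTrace l : ZMod p) = (-1) ^ m * hasse m l := by
  have hp1 := hp.out.one_lt
  have hm0 : 0 < m := by omega
  have hchar : ringChar (ZMod p) ≠ 2 := by
    rw [ZMod.ringChar_zmod_n]; omega
  have h1 : ∀ x : ZMod p, ((quadraticChar (ZMod p) (x * (x - 1) * (x - l)) : ℤ) : ZMod p) =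
      ∑ i ∈ range (m + 1), ∑ j ∈ range (m + 1),
        (m.choose i : ZMod p) * (-1) ^ (m - i) * ((m.choose j : ZMod p) * (-l) ^ (m - j)) *
          x ^ (m + i + j) := by
    intro x
    have h2 := quadraticChar_eq_pow_of_char_ne_two' hchar (x * (x - 1) * (x - l))
    rw [h2, ZMod.card, show p / 2 = m by omega, mul_pow, mul_pow, sub_eq_add_neg, sub_eq_add_neg,
      add_pow, add_pow, mul_assoc, sum_mul_sum, mul_sum]
    refine sum_congr rfl fun i _ => ?_
    rw [mul_sum]
    refine sum_congr rfl fun j _ => ?_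
    ring
  unfold frobTrace
  push_cast
  simp_rw [h1]
  rw [sum_comm]
  have h3 : ∀ i ∈ range (m + 1), ∑ x : ZMod p, ∑ j ∈ range (m + 1),
        (m.choose i : ZMod p) * (-1) ^ (m - i) * ((m.choose j : ZMod p) * (-l) ^ (m - j)) *
          x ^ (m + i + j) = -((-1) ^ m * ((m.choose i : ZMod p) ^ 2 * l ^ i)) := by
    intro i hi
    rw [mem_range] at hi
    rw [sum_comm, sum_eq_single (m - i)]
    · rw [← mul_sum, sum_pow_eq (by omega) (by omega), if_pos (by omega),
        Nat.choose_symm (by omega), show m - (m - i) = i by omega]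
      have : (-1 : ZMod p) ^ m = (-1) ^ (m - i) * (-1) ^ i := by
        rw [← pow_add]; congr 1; omega
      rw [this, neg_pow l]
      ring
    · intro j hj hji
      rw [mem_range] at hj
      rw [← mul_sum, sum_pow_eq (by omega) (by omega), if_neg (by omega), mul_zero]
    · intro h
      exact absurd (mem_range.mpr (by omega)) h
  rw [sum_congr rfl h3, sum_neg_distrib, neg_neg, hasse, mul_sum]

lemma frobTrace_even_and_abs_le (hp2 : p ≠ 2) {l : ZMod p} (h0 : l ≠ 0) (h1 : l ≠ 1) :
    Even (frobTrace l) ∧ |frobTrace l| ≤ p - 3 := by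
  have hodd := hp.out.odd_of_ne_two hp2
  set f : ZMod p → ℤ := fun x => quadraticChar (ZMod p) (x * (x - 1) * (x - l)) with hf
  set S : Finset (ZMod p) := univ \ {0, 1, l} with hS
  have hsum : ∑ x, f x = ∑ x ∈ S, f x := by
    symm
    refine sum_subset (subset_univ _) fun x _ hx => ?_
    have : x = 0 ∨ x = 1 ∨ x = l := by
      by_contra! h
      exact hx (by simp [hS, h])
    rcases this with rfl | rfl | rfl <;> simp [hf]
  have hcard : (S.card : ℤ) = p - 3 := by
    have h3 : ({0, 1, l} : Finset (ZMod p)).card = 3 :=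
      card_eq_three.mpr ⟨0, 1, l, zero_ne_one, h0.symm, h1.symm, rfl⟩
    have h4 := card_sdiff_add_card_eq_card (subset_univ ({0, 1, l} : Finset (ZMod p)))
    rw [h3, card_univ, ZMod.card] at h4
    have : S.card + 3 = p := h4
    omega
  have hpm : ∀ x ∈ S, f x = 1 ∨ f x = -1 := by
    intro x hx
    have : x ≠ 0 ∧ x ≠ 1 ∧ x ≠ l := by simpa [hS, not_or] using hx
    exact quadraticChar_dichotomy (mul_ne_zero (mul_ne_zero this.1 (sub_ne_zero.mpr this.2.1))
      (sub_ne_zero.mpr this.2.2))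
  have hfr : frobTrace l = -∑ x ∈ S, f x := by rw [← hsum]; rfl
  constructor
  · rw [hfr, even_neg]
    have h5 : Even (∑ x ∈ S, (f x - 1)) :=
      even_sum _ fun x hx => by rcases hpm x hx with h | h <;> rw [h] <;> decide
    rw [sum_sub_distrib, sum_const, nsmul_eq_mul, mul_one, hcard] at h5
    obtain ⟨a, ha⟩ := h5
    obtain ⟨b, hb⟩ := hodd
    exact ⟨a + b - 1, by omega⟩
  · rw [hfr, abs_neg, ← hcard]
    refine (abs_sum_le_sum_abs _ _).trans ?_
    have : ∑ x ∈ S, |f x| = ∑ x ∈ S, 1 :=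
      sum_congr rfl fun x hx => by rcases hpm x hx with h | h <;> rw [h] <;> rfl
    rw [this]; simp

lemma frobTrace_one_sub (l : ZMod p) :
    frobTrace (1 - l) = quadraticChar (ZMod p) (-1) * frobTrace l := by
  unfold frobTrace
  rw [mul_neg, mul_sum, ← Equiv.sum_comp (Equiv.subLeft (1 : ZMod p))]
  congr 1
  refine sum_congr rfl fun x _ => ?_
  rw [← map_mul]
  congr 1
  simp only [Equiv.subLeft_apply]
  ring

end LegendreTrace

end LegendreSatoTate

namespace LegendreSatoTate

section LowerBound

open Finset IsLocalRing

/-- Matrices of determinant `p` in the level two order with an elliptic fixed point in the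
fundamental domain, normalised by the character and with nonzero trace. -/
structure IsGood (p : ℕ) (M : Matrix (Fin 2) (Fin 2) ℤ) : Prop where
  mem : M ∈ X2 p
  chi_eq : chi M = 1
  trace_ne : M.trace ≠ 0
  trace_sq_lt : M.trace ^ 2 < 4 * p
  fixed : ∃ τ ∈ fundDom, mob M τ = τ

variable {p m : ℕ} [hp : Fact p.Prime]

omit hp in
lemma mul_sub_den_of_mob_eq {M : Matrix (Fin 2) (Fin 2) ℤ} {n : ℤ} (hM : M.det = n) {τ : ℂ}
    (hd : den M τ ≠ 0) (h : mob M τ = τ) : den M τ * (M.trace - den M τ) = n := by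
  have h1 : (M 0 0 * τ + M 0 1 : ℂ) = τ * den M τ := (div_eq_iff hd).mp h
  have h2 : (n : ℂ) = M 0 0 * M 1 1 - M 0 1 * M 1 0 := by
    rw [← hM, Matrix.det_fin_two]; push_cast; ring
  rw [h2, Matrix.trace_fin_two]
  simp only [den] at *
  push_cast
  linear_combination (M 1 0 : ℂ) * h1

lemma hk_of_mob_eq {M : Matrix (Fin 2) (Fin 2) ℤ} (hM : M ∈ X2 p) {τ : ℂ} (hτ : 0 < τ.im)
    (h : mob M τ = τ) : hk p M τ = chi M * (M.trace - den M τ) := by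
  have hd := den_ne_zero_of_mem hM hτ
  have h1 := mul_sub_den_of_mob_eq hM.1 hd h
  have hA := thA_ne_zero hτ
  rw [hk, h]
  push_cast at h1
  field_simp
  linear_combination (-(chi M) : ℂ) * h1

lemma modG_eq_zero (hp2 : p ≠ 2) {M : Matrix (Fin 2) (Fin 2) ℤ} (hM : M ∈ X2 p) {τ : ℂ}
    (hτ : 0 < τ.im) : modG p (hk p M τ) τ = 0 := by
  obtain ⟨i, hi⟩ := hk_eq_rep hp2 hM
  rw [modG, prod_eq_zero_iff]
  exact ⟨i, mem_univ _, by rw [(hi τ hτ).1, sub_self]⟩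

lemma modF_eq_zero (hp2 : p ≠ 2) {M : Matrix (Fin 2) (Fin 2) ℤ} (hM : M ∈ X2 p) {τ : ℂ}
    (hτ : 0 < τ.im) (h : mob M τ = τ) : modF p τ = 0 := by
  obtain ⟨i, hi⟩ := hk_eq_rep hp2 hM
  rw [modF, prod_eq_zero_iff]
  exact ⟨i, mem_univ _, by rw [← (hi τ hτ).2, h, sub_self]⟩

/-- Good matrices with a common fixed point embed in the coset representatives. -/
lemma eq_of_eq_gamma2_mul {M M' : Matrix (Fin 2) (Fin 2) ℤ} (hM : M ∈ X2 p)
    {γ γ' R : Matrix (Fin 2) (Fin 2) ℤ} (hγ : γ ∈ X2 1) (hγ' : γ' ∈ X2 1) (hc : chi M = 1)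
    (hc' : chi M' = 1) (e : M = γ * R) (e' : M' = γ' * R) {τ : ℂ} (hτ : τ ∈ fundDom)
    (h : mob M τ = τ) (h' : mob M' τ = τ) : M = M' := by
  have h1 : γ' * γ.adjugate * M = M' := by
    rw [e, e', Matrix.mul_assoc, ← Matrix.mul_assoc γ.adjugate, Matrix.adjugate_mul, hγ.1, one_smul,
      Matrix.one_mul]
  have h2 : γ' * γ.adjugate ∈ X2 1 := by
    have := X2_mul hγ' (X2_adjugate hγ)
    rwa [mul_one] at this
  have h3 : mob (γ' * γ.adjugate) τ = τ := by
    have := mob_mul (γ' * γ.adjugate) M (den_ne_zero_of_mem hM hτ.1)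
    rw [h1, h, h'] at this
    exact this.symm
  rcases eq_one_or_neg_one_of_mob_mem_fundDom hτ h2 (by rwa [h3]) with h4 | h4
  · rw [← h1, h4, Matrix.one_mul]
  · rw [h4, Matrix.neg_mul, Matrix.one_mul] at h1
    rw [← h1, chi_neg, hc] at hc'
    norm_num at hc'

omit hp in
lemma chi_adjugate (hm : p = 2 * m + 1) {M : Matrix (Fin 2) (Fin 2) ℤ} (hM : M ∈ X2 p)
    (hc : chi M = 1) : chi M.adjugate = (-1) ^ m := by
  have h1 := chi_mul hM (X2_adjugate hM)
  rw [Matrix.mul_adjugate, hM.1, hc, one_mul] at h1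
  rw [← h1]
  have h2 : chi ((p : ℤ) • (1 : Matrix (Fin 2) (Fin 2) ℤ)) = ZMod.χ₄ (p : ZMod 4) := by
    simp [chi]
  rw [h2, ZMod.χ₄_eq_neg_one_pow (by omega)]
  congr 1; omega

lemma eq_of_cast_eq (hp2 : p ≠ 2) {x t : ℤ} (hx : Even x) (hx' : |x| ≤ p - 3) (ht : Even t)
    (ht' : t ^ 2 < 4 * p) (h : (x : ZMod p) = t) : x = t := by
  have h1 : (p : ℤ) ∣ x - t := by
    rw [← ZMod.intCast_zmod_eq_zero_iff_dvd]; push_cast; rw [h, sub_self]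
  obtain ⟨c, hc⟩ := h1
  have hodd : Odd (p : ℤ) := by exact_mod_cast hp.out.odd_of_ne_two hp2
  have h2 : Even c := by
    have : Even ((p : ℤ) * c) := hc ▸ hx.sub ht
    rcases Int.even_mul.mp this with h | h
    · exact absurd hodd (Int.not_odd_iff_even.mpr h)
    · exact h
  obtain ⟨e, rfl⟩ := h2
  have h3 : |t| < p + 3 := by
    apply abs_lt_of_sq_lt_sq _ (by positivity)
    nlinarith [sq_nonneg ((p : ℤ) - 1)]
  have hp0 : (0 : ℤ) < p := pos_of_prime
  rw [abs_le] at hx'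
  rw [abs_lt] at h3
  have he : e = 0 := by
    by_contra hne
    rcases lt_or_gt_of_ne hne with h | h
    · have : e ≤ -1 := by omega
      nlinarith
    · have : 1 ≤ e := h
      nlinarith
  rw [he] at hc
  linarith

lemma card_good_le (hm : p = 2 * m + 1) (T : Set ℤ) (hT : ∀ t ∈ T, (-1) ^ m * t ∈ T)
    (S : Finset (Matrix (Fin 2) (Fin 2) ℤ)) (hS : ∀ M ∈ S, IsGood p M ∧ M.trace ∈ T) :
    S.card ≤ 2 * ({l : ZMod p | l ≠ 0 ∧ l ≠ 1 ∧ frobTrace l ∈ T}.ncard + 2) := by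
  classical
  have hp2 : p ≠ 2 := by omega
  obtain ⟨O, hO⟩ := exists_valuationSubring p
  have hO' : (p : ℂ) ∈ O := O.nonunits_le hO
  set k := ResidueField O
  set π := residue O with hπ
  have hpπ : (p : k) = 0 := by
    have h1 : (⟨p, hO'⟩ : O) ∈ maximalIdeal O :=
      (ValuationSubring.mem_nonunits_iff_exists_mem_maximalIdeal.mp hO).2
    have h2 := (residue_eq_zero_iff _).mpr h1
    rw [← h2, ← map_natCast (residue O)]
    rfl
  have : CharP k p := (CharP.charP_iff_prime_eq_zero hp.out).mpr hpπ
  have hinj : Function.Injective O.subtype := Subtype.val_injective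
  have h2k : (2 : k) ≠ 0 := by
    intro h
    have := (CharP.cast_eq_zero_iff k p 2).mp (by exact_mod_cast h)
    exact hp2 ((Nat.prime_dvd_prime_iff_eq hp.out Nat.prime_two).mp this)
  have h16 : IsUnit (16 : O) := by
    rw [← isUnit_map_iff π, isUnit_iff_ne_zero]
    have : π 16 = 2 ^ 4 := by rw [map_ofNat]; norm_num
    rw [this]; exact pow_ne_zero _ h2k
  have hint : ∀ z : ℂ, IsIntegral ℤ z → z ∈ O := fun z hz => by
    have h1 : IsIntegral O z := hz.tower_top
    obtain ⟨y, hy⟩ := IsIntegrallyClosed.isIntegral_iff.mp h1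
    rw [← hy]; exact y.2
  have hζ : ∀ z : ℂ, z ^ p = 1 → ∃ y, O.subtype y = z := fun z hz =>
    ⟨⟨z, hint z ⟨Polynomial.X ^ p - 1, Polynomial.monic_X_pow_sub_C 1 hp.out.ne_zero, by
      simp [hz]⟩⟩, rfl⟩
  obtain ⟨Q, hdeg, hQ, hQπ⟩ := modF_reduction hm hinj π h16 hζ
  obtain ⟨hroot, hcard⟩ := card_filter_roots_le O hdeg hQπ
  have hQ0 : Q.map O.subtype ≠ 0 := by
    rw [Ne, Polynomial.map_eq_zero_iff hinj]
    rintro rfl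
    rw [Polynomial.map_zero, eq_comm, neg_eq_zero, sq_eq_zero_iff] at hQπ
    exact FiniteField.X_pow_card_sub_X_ne_zero k hp.out.one_lt hQπ
  have hτ : ∀ M, ∃ τ : ℂ, M ∈ S → τ ∈ fundDom ∧ mob M τ = τ := fun M => by
    by_cases h : M ∈ S
    · obtain ⟨τ, h1, h2⟩ := (hS M h).1.fixed
      exact ⟨τ, fun _ => ⟨h1, h2⟩⟩
    · exact ⟨0, fun h' => absurd h' h⟩
  choose τ hτ using hτ
  have hQroot : ∀ M ∈ S, (Q.map O.subtype).IsRoot (lam (τ M)) := fun M hM => by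
    rw [Polynomial.IsRoot.def, ← hQ _ (hτ M hM).1.1]
    exact modF_eq_zero hp2 (hS M hM).1.mem (hτ M hM).1.1 (hτ M hM).2
  have hf : ∀ M, ∃ r : O, M ∈ S → (r : ℂ) = lam (τ M) := fun M => by
    by_cases h : M ∈ S
    · exact ⟨⟨_, hroot _ (hQroot M h)⟩, fun _ => rfl⟩
    · exact ⟨0, fun h' => absurd h' h⟩
  choose f hf using hf
  set L : Set (ZMod p) := {l : ZMod p | l ≠ 0 ∧ l ≠ 1 ∧ frobTrace l ∈ T} with hL
  let F : ZMod p →+* k := ZMod.castHom dvd_rfl k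
  let Λ : Finset k := (L.toFinset ∪ {0, 1}).image F
  have hfib : ∀ r : O, (S.filter fun M => f M = r).card ≤
      (Q.map O.subtype).rootMultiplicity (r : ℂ) := by
    intro r
    rcases (S.filter fun M => f M = r).eq_empty_or_nonempty with h | ⟨M0, hM0⟩
    · rw [h, card_empty]; exact Nat.zero_le _
    rw [mem_filter] at hM0
    obtain ⟨hM0, rfl⟩ := hM0
    rw [hf M0 hM0]
    have hτ0 : ∀ M ∈ S.filter fun M => f M = f M0, M ∈ S ∧ τ M = τ M0 := fun M hM => by
      rw [mem_filter] at hM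
      refine ⟨hM.1, eq_of_lam_eq_of_mem_fundDom (hτ M hM.1).1 (hτ M0 hM0).1 ?_⟩
      rw [← hf M hM.1, ← hf M0 hM0, hM.2]
    have hrep : ∀ M, ∃ i, M ∈ S → ∃ γ ∈ X2 1, M = γ * rep p i := fun M => by
      by_cases h : M ∈ S
      · obtain ⟨γ, h1, i, h2⟩ := exists_rep hp2 (hS M h).1.mem
        exact ⟨i, fun _ => ⟨γ, h1, h2⟩⟩
      · exact ⟨none, fun h' => absurd h' h⟩
    choose i hi using hrep
    have hicard : ((S.filter fun M => f M = f M0).image i).card =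
        (S.filter fun M => f M = f M0).card := by
      refine card_image_of_injOn fun M hM M' hM' h => ?_
      obtain ⟨h1, h2⟩ := hτ0 M hM
      obtain ⟨h1', h2'⟩ := hτ0 M' hM'
      obtain ⟨γ, hγ, e⟩ := hi M h1
      obtain ⟨γ', hγ', e'⟩ := hi M' h1'
      rw [← h] at e'
      refine eq_of_eq_gamma2_mul (hS M h1).1.mem hγ hγ' (hS M h1).1.chi_eq
        (hS M' h1').1.chi_eq e e' (hτ M0 hM0).1 ?_ ?_
      · rw [← h2]; exact (hτ M h1).2
      · rw [← h2']; exact (hτ M' h1').2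
    rw [← hicard]
    have him := (hτ M0 hM0).1.1
    refine card_le_rootMultiplicity (f := fun i τ => lam τ - lam (mob (rep p i) τ)) hQ0
      (differentiableAt_lam him) (deriv_lam_ne_zero him)
      (fun i => (differentiableAt_lam him).sub (differentiableAt_lam_mob (rep_mem hp2 i) him))
      ?_ _ ?_
    · filter_upwards [isOpen_im_pos.mem_nhds him] with z hz
      rw [← hQ z hz]; rfl
    · intro j hj
      rw [mem_image] at hj
      obtain ⟨M, hM, rfl⟩ := hj
      obtain ⟨h1, h2⟩ := hτ0 M hM
      obtain ⟨γ, hγ, e⟩ := hi M h1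
      have := lam_mob_gamma2_mul pos_of_prime hγ (rep_mem hp2 (i M)) him
      rw [← this, ← e, ← h2, (hτ M h1).2, sub_self]
  have hmemΛ : ∀ M ∈ S, π (f M) ∈ Λ := by
    intro M hM
    obtain ⟨hgood, htT⟩ := hS M hM
    obtain ⟨hfd, hfix⟩ := hτ M hM
    have hfM := hf M hM
    have hr1 : (π (f M)) ^ p = π (f M) := by
      have h1 : (Q.map π).eval (π (f M)) = 0 := by
        have h2 := hQroot M hM
        rw [← hfM, Polynomial.IsRoot.def] at h2
        have h3 : O.subtype (Q.eval (f M)) = 0 := by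
          rw [← Polynomial.eval_map_apply]; exact h2
        rw [Polynomial.eval_map_apply, (map_eq_zero_iff _ hinj).mp h3, map_zero]
      rw [hQπ] at h1
      simpa [sub_eq_zero] using h1
    obtain ⟨n, hn⟩ := (mem_bot_iff_intCast p k).mp
      ((Subfield.mem_bot_iff_pow_eq_self k p).mpr hr1)
    set l : ZMod p := (n : ZMod p) with hl
    have hFl : F l = π (f M) := by rw [← hn, hl, map_intCast]
    refine mem_image.mpr ⟨l, ?_, hFl⟩
    by_cases h0 : l = 0
    · simp [h0]
    by_cases h1 : l = 1
    · simp [h1]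
    refine mem_union_left _ (Set.mem_toFinset.mpr ⟨h0, h1, ?_⟩)
    obtain ⟨hev, hle⟩ := frobTrace_even_and_abs_le hp2 h0 h1
    have htev : Even M.trace := by
      rw [Matrix.trace_fin_two]
      exact hgood.mem.2.1.add_odd hgood.mem.2.2.2.2
    set ν := den M (τ M) with hν
    have hνt : ν * (M.trace - ν) = p := by
      have := mul_sub_den_of_mob_eq hgood.mem.1 (den_ne_zero_of_mem hgood.mem hfd.1) hfix
      exact_mod_cast this
    have hνint : IsIntegral ℤ ν := by
      refine ⟨Polynomial.X ^ 2 - Polynomial.C M.trace * Polynomial.X + Polynomial.C (p : ℤ), ?_, ?_⟩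
      · monicity!
      · rw [Polynomial.eval₂_add, Polynomial.eval₂_sub, Polynomial.eval₂_mul, Polynomial.eval₂_X_pow,
          Polynomial.eval₂_C, Polynomial.eval₂_C, Polynomial.eval₂_X]
        simp
        linear_combination -hνt
    let nu : O := ⟨ν, hint ν hνint⟩
    let t : O := (M.trace : O)
    have hxν : nu * (t - nu) = (p : O) := by
      apply hinj
      rw [map_mul, map_sub, map_natCast]
      have : O.subtype t = (M.trace : ℂ) := by simp [t]
      rw [this]; exact hνt
    have hxν' : π nu * (π t - π nu) = 0 := by
      rw [← map_sub, ← map_mul, hxν, map_natCast, hpπ]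
    have hπt : π t = F (M.trace : ZMod p) := by simp [t]
    have htne : π t ≠ 0 := by
      rw [hπt, Ne, map_eq_zero, ZMod.intCast_zmod_eq_zero_iff_dvd]
      intro hd
      apply hgood.trace_ne
      symm
      refine eq_of_cast_eq hp2 (Even.zero) ?_ htev hgood.trace_sq_lt ?_
      · rw [abs_zero]
        have : (3 : ℤ) ≤ p := by have := hp.out.two_le; omega
        omega
      · rw [Int.cast_zero, eq_comm, ZMod.intCast_zmod_eq_zero_iff_dvd]; exact hd
    have hhasse : hasse m (π (f M)) = (-1) ^ m * F (frobTrace l : ZMod p) := by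
      rw [frobTrace_cast hm, ← hFl, map_mul, map_pow, map_neg, map_one, map_hasse, ← mul_assoc,
        ← mul_pow]
      norm_num
    have hFpow : ∀ y : ZMod p, (F y) ^ p = F y := fun y => by rw [← map_pow, ZMod.pow_card]
    have hkey : (frobTrace l : ZMod p) = M.trace ∨ (frobTrace l : ZMod p) = (-1) ^ m * M.trace := by
      have hm1 : ((-1 : k) ^ m) * (-1) ^ m = 1 := by rw [← mul_pow]; norm_num
      rcases mul_eq_zero.mp hxν' with h | h
      · right
        rw [h, sub_zero] at hxν'
        have h1 : O.subtype (t - nu) = hk p M (τ M) := by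
          rw [hk_of_mob_eq hgood.mem hfd.1 hfix, hgood.chi_eq, map_sub]
          simp [t, nu, hν]
        have h2 := modG_reduction hm hinj π h16 hζ (t - nu) (f M) hfd.1 hfM
          (by rw [h1]; exact modG_eq_zero hp2 hgood.mem hfd.1)
        rw [map_sub, h, sub_zero] at h2
        have h3 := h2.resolve_left htne
        rw [hπt, hFpow, hhasse] at h3
        apply F.injective
        rw [map_mul, map_pow, map_neg, map_one, h3, ← mul_assoc, hm1, one_mul]
      · left
        have hν2 : π nu = π t := (sub_eq_zero.mp h).symm
        have hadj := X2_adjugate hgood.mem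
        have hfix' : mob M.adjugate (τ M) = τ M := by
          conv_lhs => rw [← hfix]
          exact mob_adjugate_mob (pos_of_prime (p := p)).ne' hgood.mem.1 hfd.1
        have h1 : O.subtype ((-1) ^ m * nu) = hk p M.adjugate (τ M) := by
          rw [hk_of_mob_eq hadj hfd.1 hfix', chi_adjugate hm hgood.mem hgood.chi_eq, map_mul,
            map_pow, map_neg, map_one]
          have : (M.adjugate.trace : ℂ) - den M.adjugate (τ M) = ν := by
            rw [hν, Matrix.adjugate_fin_two, Matrix.trace_fin_two]
            simp [den, add_comm]
          rw [this]
          push_cast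
          rfl
        have h2 := modG_reduction hm hinj π h16 hζ ((-1) ^ m * nu) (f M) hfd.1 hfM
          (by rw [h1]; exact modG_eq_zero hp2 hadj hfd.1)
        rw [map_mul, hν2, hπt, map_pow, map_neg, map_one] at h2
        rw [hπt] at htne
        have h3 := h2.resolve_left
          (mul_ne_zero (pow_ne_zero _ (neg_ne_zero.mpr one_ne_zero)) htne)
        have h4 : ((-1 : k) ^ m) = F ((-1) ^ m) := by simp
        rw [h4, ← map_mul, hFpow, hhasse, map_mul, ← h4] at h3
        exact F.injective (mul_left_cancel₀ (pow_ne_zero _ (neg_ne_zero.mpr one_ne_zero)) h3).symm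
    rcases hkey with h | h
    · rw [eq_of_cast_eq hp2 hev hle htev hgood.trace_sq_lt h]; exact htT
    · have h5 : frobTrace l = (-1) ^ m * M.trace := by
        refine eq_of_cast_eq hp2 hev hle (htev.mul_left _) ?_ (by push_cast; exact h)
        have : ((-1 : ℤ) ^ m * M.trace) ^ 2 = M.trace ^ 2 := by
          rw [mul_pow, ← pow_mul, mul_comm m, pow_mul]; norm_num
        rw [this]; exact hgood.trace_sq_lt
      rw [h5]; exact hT _ htT
  have h1 := hcard S f hfib Λ
  rw [filter_true_of_mem (fun M hM => by convert hmemΛ M hM)] at h1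
  refine h1.trans (Nat.mul_le_mul_left 2 ?_)
  refine card_image_le.trans ((card_union_le _ _).trans ?_)
  rw [Set.ncard_eq_toFinset_card' L]
  exact Nat.add_le_add_left card_le_two _

end LowerBound

end LegendreSatoTate

namespace LegendreSatoTate

section Kloosterman

open Finset

variable {n : ℕ} [NeZero n]

/-- The incomplete Kloosterman sum over a set of units. -/
noncomputable def kloosterman (W : Finset (ZMod n)ˣ) (s t : ZMod n) : ℂ :=
  ∑ r ∈ W, ZMod.stdAddChar (s * (r : ZMod n) + t * ((r⁻¹ : (ZMod n)ˣ) : ZMod n))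

lemma norm_kloosterman_le (W : Finset (ZMod n)ˣ) (s t : ZMod n) : ‖kloosterman W s t‖ ≤ n := by
  refine (norm_sum_le _ _).trans ?_
  have : ∀ r ∈ W, ‖ZMod.stdAddChar (s * (r : ZMod n) + t * ((r⁻¹ : (ZMod n)ˣ) : ZMod n))‖ = 1 := fun r _ =>
    AddChar.norm_apply _ _
  rw [sum_congr rfl this, sum_const, nsmul_eq_mul, mul_one]
  have h1 : W.card ≤ n := by
    refine (card_le_univ W).trans ?_
    rw [ZMod.card_units_eq_totient]
    exact Nat.totient_le n
  exact_mod_cast h1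

/-- The quadruples counted by the fourth moment of Kloosterman sums. -/
def kloostermanQuads (W : Finset (ZMod n)ˣ) :
    Finset (((ZMod n)ˣ × (ZMod n)ˣ) × ((ZMod n)ˣ × (ZMod n)ˣ)) :=
  ((W ×ˢ W) ×ˢ (W ×ˢ W)).filter fun q =>
    (q.1.1 + q.1.2 : ZMod n) = q.2.1 + q.2.2 ∧
    ((q.1.1⁻¹ : (ZMod n)ˣ) + (q.1.2⁻¹ : (ZMod n)ˣ) : ZMod n) =
      (q.2.1⁻¹ : (ZMod n)ˣ) + (q.2.2⁻¹ : (ZMod n)ˣ)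

lemma norm_kloosterman_pow_four (W : Finset (ZMod n)ˣ) (s t : ZMod n) :
    ((‖kloosterman W s t‖ ^ 4 : ℝ) : ℂ) = ∑ q ∈ (W ×ˢ W) ×ˢ (W ×ˢ W),
      ZMod.stdAddChar (s * (q.1.1 + q.1.2 - (q.2.1 + q.2.2) : ZMod n)) *
      ZMod.stdAddChar (t * ((q.1.1⁻¹ : (ZMod n)ˣ) + (q.1.2⁻¹ : (ZMod n)ˣ) -
        ((q.2.1⁻¹ : (ZMod n)ˣ) + (q.2.2⁻¹ : (ZMod n)ˣ)) : ZMod n)) := by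
  have h1 : ((‖kloosterman W s t‖ ^ 4 : ℝ) : ℂ) =
      (kloosterman W s t * kloosterman W s t) *
      (starRingEnd ℂ (kloosterman W s t) * starRingEnd ℂ (kloosterman W s t)) := by
    have := Complex.mul_conj' (kloosterman W s t)
    push_cast
    linear_combination (-(‖kloosterman W s t‖ : ℂ) ^ 2 -
      kloosterman W s t * starRingEnd ℂ (kloosterman W s t)) * this
  have h2 : starRingEnd ℂ (kloosterman W s t) =
      ∑ r ∈ W, ZMod.stdAddChar (-(s * (r : ZMod n) + t * ((r⁻¹ : (ZMod n)ˣ) : ZMod n))) := by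
    rw [kloosterman, map_sum]
    exact sum_congr rfl fun r _ => (AddChar.map_neg_eq_conj _ _).symm
  rw [h1, h2, kloosterman]
  simp_rw [sum_product, sum_mul_sum]
  refine sum_congr rfl fun a _ => ?_
  rw [sum_comm]
  refine sum_congr rfl fun b _ => sum_congr rfl fun c _ => sum_congr rfl fun d _ => ?_
  simp only [← AddChar.map_add_eq_mul]
  congr 1
  ring

lemma sum_norm_kloosterman_pow_four (W : Finset (ZMod n)ˣ) :
    ∑ s : ZMod n, ∑ t : ZMod n, ‖kloosterman W s t‖ ^ 4 =
      (n : ℝ) ^ 2 * (kloostermanQuads W).card := by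
  have h0 : ∀ b : ZMod n, ∑ x : ZMod n, (ZMod.stdAddChar (x * b) : ℂ) =
      if b = 0 then (n : ℂ) else 0 := fun b => by
    rw [AddChar.sum_mulShift b (ZMod.isPrimitive_stdAddChar n), ZMod.card]
    push_cast; rfl
  apply Complex.ofReal_injective
  push_cast
  have h1 := fun s t => norm_kloosterman_pow_four W s t
  push_cast at h1
  simp_rw [h1]
  rw [sum_congr rfl fun s _ => sum_comm, sum_comm, kloostermanQuads, card_filter]
  push_cast
  rw [mul_sum]
  refine sum_congr rfl fun q _ => ?_
  simp_rw [← mul_sum, ← sum_mul, h0, sub_eq_zero]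
  split_ifs <;> simp_all [pow_two]

/-- The pairs parametrising the fourth moment after scaling. -/
def cubicPairs (n : ℕ) [NeZero n] : Finset (ZMod n × ZMod n) :=
  univ.filter fun v => (v.1 + v.2) * (v.1 - 1) * (v.2 - 1) = 0

lemma card_kloostermanQuads_le (W : Finset (ZMod n)ˣ) :
    (kloostermanQuads W).card ≤ W.card * (cubicPairs n).card := by
  rw [← card_product]
  refine card_le_card_of_injOn
    (fun q => (q.2.2, (((q.1.1 * q.2.2⁻¹ : (ZMod n)ˣ) : ZMod n), ((q.1.2 * q.2.2⁻¹ : (ZMod n)ˣ) : ZMod n))))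
    ?_ ?_
  · rintro ⟨⟨a, b⟩, c, d⟩ hq
    simp only [kloostermanQuads, mem_coe, mem_filter, mem_product] at hq
    obtain ⟨⟨⟨ha, hb⟩, hc, hd⟩, h1, h2⟩ := hq
    refine mem_coe.mpr (mem_product.mpr ⟨hd, mem_filter.mpr ⟨mem_univ _, ?_⟩⟩)
    simp only [Units.val_mul]
    have ea := a.mul_inv; have eb := b.mul_inv; have ec := c.mul_inv; have ed := d.mul_inv
    generalize (a : ZMod n) = A at *
    generalize (b : ZMod n) = B at *
    generalize (c : ZMod n) = C at *
    generalize (d : ZMod n) = D at *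
    generalize ((a⁻¹ : (ZMod n)ˣ) : ZMod n) = A' at *
    generalize ((b⁻¹ : (ZMod n)ˣ) : ZMod n) = B' at *
    generalize ((c⁻¹ : (ZMod n)ˣ) : ZMod n) = C' at *
    generalize ((d⁻¹ : (ZMod n)ˣ) : ZMod n) = D' at *
    have h3 : (A + B) * (C * D) = (C + D) * (A * B) := by
      linear_combination (A * B * C * D) * h2 - (B * C * D) * ea - (A * C * D) * eb +
        (A * B * D) * ec + (A * B * C) * ed
    have h4 : (A + B) * (A - D) * (B - D) = 0 := by
      have : C = A + B - D := by linear_combination -h1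
      rw [this] at h3
      linear_combination -h3
    have h5 : A * D' - 1 = (A - D) * D' := by linear_combination ed
    have h6 : B * D' - 1 = (B - D) * D' := by linear_combination ed
    rw [h5, h6]
    linear_combination D' ^ 3 * h4
  · rintro ⟨⟨a, b⟩, c, d⟩ hq ⟨⟨a', b'⟩, c', d'⟩ hq' h
    simp only [kloostermanQuads, mem_coe, mem_filter, mem_product] at hq hq'
    simp only [Prod.mk.injEq] at h
    obtain ⟨rfl, h1, h2⟩ := h
    have h1 := mul_right_cancel (Units.ext h1)
    have h2 := mul_right_cancel (Units.ext h2)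
    subst h1 h2
    have : c = c' := Units.ext (by linear_combination hq'.2.1 - hq.2.1)
    rw [this]

end Kloosterman

end LegendreSatoTate

namespace LegendreSatoTate

section KloostermanBound

open Finset

variable {n : ℕ} [NeZero n]

lemma kloosterman_mul_unit {W : Finset (ZMod n)ˣ} {u : (ZMod n)ˣ} (hu : ∀ r, u * r ∈ W ↔ r ∈ W)
    (s t : ZMod n) :
    kloosterman W (s * (u : ZMod n)) (t * ((u⁻¹ : (ZMod n)ˣ) : ZMod n)) = kloosterman W s t := by
  unfold kloosterman
  refine sum_bij' (fun r _ => u * r) (fun r _ => u⁻¹ * r) (fun r hr => (hu r).mpr hr)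
    (fun r hr => (hu _).mp (by simpa using hr)) (by simp) (by simp) fun r _ => ?_
  congr 1
  rw [mul_inv]
  push_cast
  ring

lemma card_filter_mul_eq_le {s : ZMod n} {N : ℕ}
    (hN : (univ.filter fun x : ZMod n => s * x = 0).card ≤ N) (y : ZMod n)
    (H : Finset (ZMod n)ˣ) : (H.filter fun u : (ZMod n)ˣ => s * (u : ZMod n) = y).card ≤ N := by
  rcases (H.filter fun u : (ZMod n)ˣ => s * (u : ZMod n) = y).eq_empty_or_nonempty with h | ⟨u0, h0⟩
  · rw [h, card_empty]; exact Nat.zero_le _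
  refine le_trans (card_le_card_of_injOn (fun u : (ZMod n)ˣ => (u : ZMod n) - u0) ?_ ?_) hN
  · intro u hu
    rw [mem_filter] at h0
    have hu := (mem_filter.mp (mem_coe.mp hu)).2
    refine mem_coe.mpr (mem_filter.mpr ⟨mem_univ _, ?_⟩)
    rw [mul_sub, hu, h0.2, sub_self]
  · intro u _ v _ h
    exact Units.ext (sub_left_inj.mp h)

lemma card_mul_norm_kloosterman_pow_four_le {W H : Finset (ZMod n)ˣ}
    (hH : ∀ u ∈ H, ∀ r, u * r ∈ W ↔ r ∈ W) {s : ZMod n} (t : ZMod n) {N : ℕ}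
    (hN : (univ.filter fun x : ZMod n => s * x = 0).card ≤ N) :
    H.card * ‖kloosterman W s t‖ ^ 4 ≤ N * (n : ℝ) ^ 2 * W.card * (cubicPairs n).card := by
  set φ : (ZMod n)ˣ → ZMod n × ZMod n :=
    fun u => (s * (u : ZMod n), t * ((u⁻¹ : (ZMod n)ˣ) : ZMod n)) with hφ
  set g : ZMod n × ZMod n → ℝ := fun v => ‖kloosterman W v.1 v.2‖ ^ 4 with hg
  have hg0 : ∀ v, 0 ≤ g v := fun v => by positivity
  have h1 : (H.card : ℝ) * ‖kloosterman W s t‖ ^ 4 = ∑ u ∈ H, g (φ u) := by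
    rw [← nsmul_eq_mul, ← sum_const]
    refine sum_congr rfl fun u hu => ?_
    simp only [hg, hφ]
    rw [kloosterman_mul_unit (hH u hu)]
  have h2 : ∑ u ∈ H, g (φ u) ≤ N * ∑ v, g v := by
    rw [sum_comp g φ, mul_sum]
    refine (sum_le_sum_of_subset_of_nonneg (subset_univ _) fun v _ _ => ?_).trans
      (sum_le_sum fun v _ => ?_)
    · exact nsmul_nonneg (hg0 v) _
    · rw [nsmul_eq_mul]
      refine mul_le_mul_of_nonneg_right ?_ (hg0 v)
      have : (H.filter fun u => φ u = v).card ≤ N := by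
        refine (card_le_card ?_).trans (card_filter_mul_eq_le hN v.1 H)
        intro u hu
        rw [mem_filter] at hu ⊢
        exact ⟨hu.1, by rw [← hu.2]⟩
      exact_mod_cast this
  have h3 : ∑ v, g v = (n : ℝ) ^ 2 * (kloostermanQuads W).card := by
    rw [← sum_norm_kloosterman_pow_four, ← univ_product_univ, sum_product]
  have h4 : ((kloostermanQuads W).card : ℝ) ≤ W.card * (cubicPairs n).card := by
    exact_mod_cast card_kloostermanQuads_le W
  rw [h1]
  refine h2.trans ?_
  rw [h3, mul_assoc, mul_assoc]
  gcongr

lemma card_filter_dvd_val_le {d : ℕ} (hd : d ∣ n) :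
    ((univ.filter fun x : ZMod n => d ∣ x.val).card : ℝ) ≤ n / d := by
  have hn := NeZero.pos n
  have hd0 : 0 < d := Nat.pos_of_dvd_of_pos hd hn
  have h1 : (univ.filter fun x : ZMod n => d ∣ x.val).card ≤ (range (n / d)).card := by
    refine card_le_card_of_injOn (fun x => x.val / d) ?_ ?_
    · intro x _
      refine mem_coe.mpr (mem_range.mpr ?_)
      exact Nat.div_lt_div_of_lt_of_dvd hd (ZMod.val_lt x)
    · intro x hx y hy h
      have hx := (mem_filter.mp (mem_coe.mp hx)).2
      have hy := (mem_filter.mp (mem_coe.mp hy)).2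
      apply ZMod.val_injective
      rw [← Nat.div_mul_cancel hx, ← Nat.div_mul_cancel hy]
      simp only at h
      rw [h]
  rw [card_range] at h1
  rw [← Nat.cast_div hd (by positivity)]
  exact_mod_cast h1

/-- The sum of `1 / d` over the divisors `d ≥ y` of `n`. -/
noncomputable def largeDivisorSum (n y : ℕ) : ℝ := ∑ d ∈ n.divisors with y ≤ d, (d : ℝ)⁻¹

lemma card_filter_le_gcd_le (y : ℕ) :
    ((univ.filter fun x : ZMod n => y ≤ n.gcd x.val).card : ℝ) ≤ n * largeDivisorSum n y := by
  have h1 : (univ.filter fun x : ZMod n => y ≤ n.gcd x.val) ⊆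
      (n.divisors.filter (y ≤ ·)).biUnion fun d => univ.filter fun x : ZMod n => d ∣ x.val := by
    intro x hx
    rw [mem_filter] at hx
    rw [mem_biUnion]
    exact ⟨n.gcd x.val, mem_filter.mpr ⟨Nat.mem_divisors.mpr ⟨Nat.gcd_dvd_left _ _, NeZero.ne n⟩,
      hx.2⟩, mem_filter.mpr ⟨mem_univ _, Nat.gcd_dvd_right _ _⟩⟩
  have h2 := (card_le_card h1).trans card_biUnion_le
  calc ((univ.filter fun x : ZMod n => y ≤ n.gcd x.val).card : ℝ)
      ≤ ∑ d ∈ n.divisors with y ≤ d, ((univ.filter fun x : ZMod n => d ∣ x.val).card : ℝ) := by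
        exact_mod_cast h2
    _ ≤ ∑ d ∈ n.divisors with y ≤ d, (n / d : ℝ) := sum_le_sum fun d hd =>
        card_filter_dvd_val_le (Nat.dvd_of_mem_divisors (mem_filter.mp hd).1)
    _ = n * largeDivisorSum n y := by
        rw [largeDivisorSum, mul_sum]; rfl

lemma card_cubicPairs_le {y : ℕ} (hy : y ^ 3 ≤ n) :
    ((cubicPairs n).card : ℝ) ≤ 3 * n ^ 2 * largeDivisorSum n y := by
  set A : Finset (ZMod n) := univ.filter fun x : ZMod n => y ≤ n.gcd x.val with hA
  have h0 : ∀ f : ZMod n × ZMod n ≃ ZMod n × ZMod n,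
      (univ.filter fun v => (f v).1 ∈ A).card = n * A.card := by
    intro f
    have : (univ.filter fun v => (f v).1 ∈ A).map f.toEmbedding = A ×ˢ univ := by
      ext v
      simp only [mem_map_equiv, mem_filter, mem_univ, true_and, Equiv.apply_symm_apply,
        mem_product, and_true]
    rw [← card_map f.toEmbedding, this, card_product, card_univ, ZMod.card, mul_comm]
  let f1 : ZMod n × ZMod n ≃ ZMod n × ZMod n :=
    ⟨fun v => (v.1 + v.2, v.2), fun v => (v.1 - v.2, v.2), fun v => by simp, fun v => by simp⟩
  let f2 : ZMod n × ZMod n ≃ ZMod n × ZMod n :=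
    ⟨fun v => (v.1 - 1, v.2), fun v => (v.1 + 1, v.2), fun v => by simp, fun v => by simp⟩
  let f3 : ZMod n × ZMod n ≃ ZMod n × ZMod n :=
    ⟨fun v => (v.2 - 1, v.1), fun v => (v.2, v.1 + 1), fun v => by simp, fun v => by simp⟩
  have h1 : cubicPairs n ⊆ ((univ.filter fun v => (f1 v).1 ∈ A) ∪
      (univ.filter fun v => (f2 v).1 ∈ A)) ∪ (univ.filter fun v => (f3 v).1 ∈ A) := by
    intro v hv
    have hv : (v.1 + v.2) * (v.1 - 1) * (v.2 - 1) = 0 := (mem_filter.mp hv).2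
    by_contra hcon
    simp only [mem_union, mem_filter, mem_univ, true_and, not_or, hA, f1, f2, f3, Equiv.coe_fn_mk,
      not_le] at hcon
    obtain ⟨⟨k1, k2⟩, k3⟩ := hcon
    have hdvd : n ∣ (v.1 + v.2).val * (v.1 - 1).val * (v.2 - 1).val := by
      rw [← ZMod.natCast_eq_zero_iff]
      push_cast
      simpa using hv
    have h3 : n ≤ n.gcd (v.1 + v.2).val * n.gcd (v.1 - 1).val * n.gcd (v.2 - 1).val := by
      have e1 : n.gcd ((v.1 + v.2).val * (v.1 - 1).val * (v.2 - 1).val) = n :=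
        Nat.gcd_eq_left hdvd
      have e2 := (Nat.gcd_mul_right_dvd_mul_gcd n ((v.1 + v.2).val * (v.1 - 1).val) (v.2 - 1).val)
      have e3 := (Nat.gcd_mul_right_dvd_mul_gcd n (v.1 + v.2).val (v.1 - 1).val)
      rw [e1] at e2
      refine (Nat.le_of_dvd ?_ (e2.trans (Nat.mul_dvd_mul_right e3 _)))
      have := NeZero.pos n
      have hg : ∀ a, 0 < n.gcd a := fun a => Nat.gcd_pos_of_pos_left _ this
      exact Nat.mul_pos (Nat.mul_pos (hg _) (hg _)) (hg _)
    have h4 : n.gcd (v.1 + v.2).val * n.gcd (v.1 - 1).val * n.gcd (v.2 - 1).val < y * y * y :=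
      Nat.mul_lt_mul'' (Nat.mul_lt_mul'' k1 k2) k3
    have : y ^ 3 = y * y * y := by ring
    omega
  have h2 : (cubicPairs n).card ≤ 3 * (n * A.card) := by
    refine (card_le_card h1).trans ((card_union_le _ _).trans ?_)
    have := card_union_le (univ.filter fun v => (f1 v).1 ∈ A) (univ.filter fun v => (f2 v).1 ∈ A)
    have e1 := h0 f1
    have e2 := h0 f2
    have e3 := h0 f3
    omega
  have h3 := card_filter_le_gcd_le (n := n) y
  calc ((cubicPairs n).card : ℝ) ≤ 3 * (n * A.card) := by exact_mod_cast h2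
    _ ≤ 3 * (n * (n * largeDivisorSum n y)) := by gcongr
    _ = _ := by ring

/-- Weil-type saving for incomplete Kloosterman sums over cosets. -/
lemma norm_kloosterman_pow_four_le {W H : Finset (ZMod n)ˣ} (hWH : W.card ≤ H.card)
    (hH : ∀ u ∈ H, ∀ r, u * r ∈ W ↔ r ∈ W) {s : ZMod n} (t : ZMod n) {N y : ℕ} (hy : y ^ 3 ≤ n)
    (hN : (univ.filter fun x : ZMod n => s * x = 0).card ≤ N) :
    ‖kloosterman W s t‖ ^ 4 ≤ 3 * N * n ^ 4 * largeDivisorSum n y := by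
  have hD : 0 ≤ largeDivisorSum n y := sum_nonneg fun d _ => by positivity
  rcases W.eq_empty_or_nonempty with rfl | hW
  · simp [kloosterman]; positivity
  have hH0 : (0 : ℝ) < H.card := by exact_mod_cast hW.card_pos.trans_le hWH
  have h1 := card_mul_norm_kloosterman_pow_four_le hH t hN
  have h2 := card_cubicPairs_le hy
  have h3 : (W.card : ℝ) ≤ H.card := by exact_mod_cast hWH
  refine le_of_mul_le_mul_left (h1.trans ?_) hH0
  calc N * (n : ℝ) ^ 2 * W.card * (cubicPairs n).card
      ≤ N * (n : ℝ) ^ 2 * H.card * (3 * n ^ 2 * largeDivisorSum n y) := by gcongr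
    _ = _ := by ring

end KloostermanBound

end LegendreSatoTate

namespace LegendreSatoTate

section Averaging

open Finset

lemma sum_largeDivisorSum_le (X : ℕ) {y : ℕ} (hy : 0 < y) :
    ∑ n ∈ Icc 1 X, largeDivisorSum n y ≤ 2 * X / y := by
  have h1 : ∀ n ∈ Icc 1 X, largeDivisorSum n y =
      ∑ d ∈ Ioo (y - 1) (X + 1), if d ∣ n then (d : ℝ)⁻¹ else 0 := by
    intro n hn
    rw [mem_Icc] at hn
    rw [largeDivisorSum, ← sum_filter]
    refine sum_congr ?_ fun _ _ => rfl
    ext d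
    simp only [mem_filter, Nat.mem_divisors, mem_Ioo]
    constructor
    · rintro ⟨⟨h, -⟩, h'⟩
      exact ⟨⟨by omega, by have := Nat.le_of_dvd (by omega) h; omega⟩, h⟩
    · rintro ⟨⟨h, -⟩, h'⟩
      exact ⟨⟨h', by omega⟩, by omega⟩
  rw [sum_congr rfl h1, sum_comm]
  have h2 : ∀ d ∈ Ioo (y - 1) (X + 1), (∑ n ∈ Icc 1 X, if d ∣ n then (d : ℝ)⁻¹ else 0) ≤
      X * ((d : ℝ) ^ 2)⁻¹ := by
    intro d hd
    rw [mem_Ioo] at hd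
    have hd0 : 0 < d := by omega
    rw [← sum_filter, sum_const, nsmul_eq_mul]
    have : ((Icc 1 X).filter fun n => d ∣ n).card = X / d := by
      have := Nat.Ioc_filter_dvd_card_eq_div X d
      rwa [show Ioc 0 X = Icc 1 X from rfl] at this
    rw [this]
    have h3 : ((X / d : ℕ) : ℝ) ≤ X / d := Nat.cast_div_le
    have h4 : (0 : ℝ) < d := by exact_mod_cast hd0
    calc ((X / d : ℕ) : ℝ) * (d : ℝ)⁻¹ ≤ X / d * (d : ℝ)⁻¹ := by gcongr
      _ = _ := by field_simp
  refine (sum_le_sum h2).trans ?_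
  rw [← mul_sum]
  have h5 := sum_Ioo_inv_sq_le (α := ℝ) (y - 1) (X + 1)
  have h6 : ((y - 1 : ℕ) : ℝ) + 1 = y := by
    have : y - 1 + 1 = y := by omega
    exact_mod_cast this
  rw [h6] at h5
  calc (X : ℝ) * _ ≤ X * (2 / y) := by gcongr
    _ = _ := by ring

lemma sum_largeDivisorSum_four_mul_le (G : ℕ) {y : ℕ} (hy : 0 < y) :
    ∑ g ∈ range G, largeDivisorSum (4 * (g + 1)) y ≤ 8 * G / y := by
  have h := sum_largeDivisorSum_le (4 * G) hy
  have h1 : ∑ g ∈ range G, largeDivisorSum (4 * (g + 1)) y ≤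
      ∑ n ∈ Icc 1 (4 * G), largeDivisorSum n y := by
    rw [← sum_image (f := fun n => largeDivisorSum n y) (g := fun g => 4 * (g + 1))
      (fun a _ b _ h => by simpa using h)]
    refine sum_le_sum_of_subset_of_nonneg ?_ fun n _ _ => sum_nonneg fun d _ => by positivity
    intro n hn
    simp only [mem_image, mem_range] at hn
    obtain ⟨g, hg, rfl⟩ := hn
    rw [mem_Icc]; omega
  refine h1.trans (h.trans_eq ?_)
  push_cast; ring

/-- Kloosterman sums with nearly full invariance are `o(G ^ 2)` on average over the modulus. -/
lemma exists_sum_norm_kloosterman_le (N : ℕ) {ε : ℝ} (hε : 0 < ε) :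
    ∃ C : ℝ, ∀ G : ℕ, ∀ (W H : ∀ g : ℕ, Finset (ZMod (4 * (g + 1)))ˣ)
      (s t : ∀ g : ℕ, ZMod (4 * (g + 1))), (∀ g < G, (W g).card ≤ (H g).card ∧
        (∀ u ∈ H g, ∀ r, u * r ∈ W g ↔ r ∈ W g) ∧
        (univ.filter fun x : ZMod (4 * (g + 1)) => s g * x = 0).card ≤ N) →
      ∑ g ∈ range G, ‖kloosterman (W g) (s g) (t g)‖ ≤ ε * G ^ 2 + C := by
  set δ : ℝ := ε / 8 with hδ
  have hδ0 : 0 < δ := by positivity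
  obtain ⟨y, hy⟩ := exists_nat_gt (192 * N / (δ ^ 3 * ε))
  have hy0' : (0 : ℝ) < y := lt_of_le_of_lt (by positivity) hy
  have hy0 : 0 < y := by exact_mod_cast hy0'
  have hy' : 96 * N / (y * δ ^ 3) ≤ ε / 2 := by
    rw [div_lt_iff₀ (by positivity)] at hy
    rw [div_le_iff₀ (by positivity)]
    nlinarith
  refine ⟨(y : ℝ) ^ 3 * y ^ 3, fun G W H s t h => ?_⟩
  have key : ∀ g ∈ range G, ‖kloosterman (W g) (s g) (t g)‖ ≤
      4 * G * (δ + 3 * N / δ ^ 3 * largeDivisorSum (4 * (g + 1)) y) +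
        (if g < y ^ 3 then (y : ℝ) ^ 3 else 0) := by
    intro g hg
    rw [mem_range] at hg
    obtain ⟨h1, h2, h3⟩ := h g hg
    have hL : 0 ≤ largeDivisorSum (4 * (g + 1)) y := sum_nonneg fun d _ => by positivity
    have hle := norm_kloosterman_le (W g) (s g) (t g)
    by_cases hn : y ^ 3 ≤ 4 * (g + 1)
    · have h4 := norm_kloosterman_pow_four_le h1 h2 (t g) hn h3
      set n : ℝ := ((4 * (g + 1) : ℕ) : ℝ) with hn'
      have hn0 : 0 < n := by rw [hn']; positivity
      have hnG : n ≤ 4 * G := by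
        rw [hn']; exact_mod_cast (by omega : 4 * (g + 1) ≤ 4 * G)
      set K := ‖kloosterman (W g) (s g) (t g)‖
      set L := largeDivisorSum (4 * (g + 1)) y
      have hK0 : 0 ≤ K := norm_nonneg _
      have h5 : K ≤ n * (δ + 3 * N / δ ^ 3 * L) := by
        have hz : K / n ≤ δ + (K / n) ^ 4 / δ ^ 3 := by
          set z := K / n
          have hz0 : 0 ≤ z := by positivity
          rcases le_or_gt z δ with hzd | hzd
          · have : 0 ≤ z ^ 4 / δ ^ 3 := by positivity
            linarith
          · have : z ≤ z ^ 4 / δ ^ 3 := by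
              rw [le_div_iff₀ (by positivity)]
              calc z * δ ^ 3 ≤ z * z ^ 3 := by gcongr
                _ = z ^ 4 := by ring
            linarith
        have h6 : (K / n) ^ 4 ≤ 3 * N * L := by
          rw [div_pow, div_le_iff₀ (by positivity)]
          linarith
        have h7 : K / n ≤ δ + 3 * N / δ ^ 3 * L := by
          refine hz.trans ?_
          have : (K / n) ^ 4 / δ ^ 3 ≤ 3 * N * L / δ ^ 3 := by gcongr
          have e : 3 * N * L / δ ^ 3 = 3 * N / δ ^ 3 * L := by ring
          linarith
        rw [div_le_iff₀ hn0] at h7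
        linarith
      have h8 : n * (δ + 3 * N / δ ^ 3 * L) ≤ 4 * G * (δ + 3 * N / δ ^ 3 * L) := by gcongr
      have h9 : (0 : ℝ) ≤ if g < y ^ 3 then (y : ℝ) ^ 3 else 0 := by split_ifs <;> positivity
      linarith
    · rw [if_pos (by omega)]
      have h5 : ((4 * (g + 1) : ℕ) : ℝ) ≤ (y : ℝ) ^ 3 := by
        exact_mod_cast (by omega : 4 * (g + 1) ≤ y ^ 3)
      have : 0 ≤ 4 * G * (δ + 3 * N / δ ^ 3 * largeDivisorSum (4 * (g + 1)) y) := by positivity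
      linarith
  refine (sum_le_sum key).trans ?_
  rw [sum_add_distrib, ← mul_sum, sum_add_distrib, ← mul_sum, sum_const, card_range, nsmul_eq_mul]
  have h1 : ∑ g ∈ range G, (if g < y ^ 3 then (y : ℝ) ^ 3 else 0) ≤ (y : ℝ) ^ 3 * y ^ 3 := by
    rw [← sum_filter, sum_const, nsmul_eq_mul]
    gcongr
    have : ((range G).filter fun g => g < y ^ 3) ⊆ range (y ^ 3) := fun g hg => by
      simp only [mem_filter, mem_range] at hg ⊢; exact hg.2
    have := card_le_card this
    rw [card_range] at this
    exact_mod_cast this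
  have h2 := sum_largeDivisorSum_four_mul_le G hy0
  have h3 : 4 * (G : ℝ) * (G * δ + 3 * N / δ ^ 3 *
      ∑ g ∈ range G, largeDivisorSum (4 * (g + 1)) y) ≤ ε * G ^ 2 := by
    calc 4 * (G : ℝ) * (G * δ + 3 * N / δ ^ 3 * ∑ g ∈ range G, largeDivisorSum (4 * (g + 1)) y)
        ≤ 4 * (G : ℝ) * (G * δ + 3 * N / δ ^ 3 * (8 * G / y)) := by gcongr
      _ = G ^ 2 * (4 * δ + 96 * N / (y * δ ^ 3)) := by field_simp; ring
      _ ≤ G ^ 2 * (4 * δ + ε / 2) := by gcongr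
      _ = ε * G ^ 2 := by rw [hδ]; ring
  linarith

end Averaging

end LegendreSatoTate

namespace LegendreSatoTate

section UnitsModFour

open Finset

/-- The units modulo `4 * (g + 1)` reducing to `e` modulo `4`. -/
def unitsMod4 (g : ℕ) (e : ZMod 4) : Finset (ZMod (4 * (g + 1)))ˣ :=
  univ.filter fun r => ZMod.castHom (dvd_mul_right 4 (g + 1)) (ZMod 4) (r : ZMod (4 * (g + 1))) = e

variable {g : ℕ} {e : ZMod 4}

lemma mem_unitsMod4 {r : (ZMod (4 * (g + 1)))ˣ} : r ∈ unitsMod4 g e ↔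
    ZMod.castHom (dvd_mul_right 4 (g + 1)) (ZMod 4) (r : ZMod (4 * (g + 1))) = e := by
  rw [unitsMod4, mem_filter, and_iff_right (mem_univ _)]

lemma mul_mem_unitsMod4 {u : (ZMod (4 * (g + 1)))ˣ} (hu : u ∈ unitsMod4 g 1)
    (r : (ZMod (4 * (g + 1)))ˣ) : u * r ∈ unitsMod4 g e ↔ r ∈ unitsMod4 g e := by
  rw [mem_unitsMod4] at hu
  rw [mem_unitsMod4, mem_unitsMod4, Units.val_mul, map_mul, hu, one_mul]

lemma neg_mem_unitsMod4 (r : (ZMod (4 * (g + 1)))ˣ) :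
    -r ∈ unitsMod4 g e ↔ r ∈ unitsMod4 g (-e) := by
  rw [mem_unitsMod4, mem_unitsMod4, Units.val_neg, map_neg, neg_eq_iff_eq_neg]

lemma inv_mem_unitsMod4 (he : e ^ 2 = 1) (r : (ZMod (4 * (g + 1)))ˣ) :
    r⁻¹ ∈ unitsMod4 g e ↔ r ∈ unitsMod4 g e := by
  rw [mem_unitsMod4, mem_unitsMod4]
  have h : ZMod.castHom (dvd_mul_right 4 (g + 1)) (ZMod 4) (r : ZMod (4 * (g + 1))) *
      ZMod.castHom (dvd_mul_right 4 (g + 1)) (ZMod 4)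
        ((r⁻¹ : (ZMod (4 * (g + 1)))ˣ) : ZMod (4 * (g + 1))) = 1 := by
    rw [← map_mul, ← Units.val_mul, mul_inv_cancel, Units.val_one, map_one]
  generalize ZMod.castHom (dvd_mul_right 4 (g + 1)) (ZMod 4) (r : ZMod (4 * (g + 1))) = a at h ⊢
  generalize ZMod.castHom (dvd_mul_right 4 (g + 1)) (ZMod 4)
    ((r⁻¹ : (ZMod (4 * (g + 1)))ˣ) : ZMod (4 * (g + 1))) = b at h ⊢
  revert he h
  revert a b e
  decide

lemma card_unitsMod4_neg (e : ZMod 4) : (unitsMod4 g (-e)).card = (unitsMod4 g e).card :=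
  card_bij (fun r _ => -r) (fun r hr => (neg_mem_unitsMod4 r).2 hr) (fun _ _ _ _ h => neg_inj.1 h)
    fun r hr => ⟨-r, (neg_mem_unitsMod4 r).2 (by rwa [neg_neg]), neg_neg r⟩

lemma two_mul_card_unitsMod4_one (g : ℕ) :
    2 * (unitsMod4 g 1).card = (4 * (g + 1)).totient := by
  rw [two_mul]
  nth_rw 2 [← card_unitsMod4_neg]
  rw [← card_union_of_disjoint, ← ZMod.card_units_eq_totient, ← card_univ]
  · congr 1
    refine eq_univ_of_forall fun r => ?_
    rw [mem_union, mem_unitsMod4, mem_unitsMod4]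
    have h := (r.isUnit.map (ZMod.castHom (dvd_mul_right 4 (g + 1)) (ZMod 4)))
    generalize ZMod.castHom (dvd_mul_right 4 (g + 1)) (ZMod 4) (r : ZMod (4 * (g + 1))) = a at h ⊢
    rw [isUnit_iff_exists_inv] at h
    revert h
    revert a
    decide
  · rw [disjoint_left]
    intro r h1 h2
    rw [mem_unitsMod4] at h1 h2
    rw [h1] at h2
    exact absurd h2 (by decide)

lemma two_mul_card_unitsMod4 (g : ℕ) (he : e ^ 2 = 1) :
    2 * (unitsMod4 g e).card = (4 * (g + 1)).totient := by
  have : e = 1 ∨ e = -1 := by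
    revert he; revert e; decide
  rcases this with rfl | rfl
  · exact two_mul_card_unitsMod4_one g
  · rw [card_unitsMod4_neg]; exact two_mul_card_unitsMod4_one g

lemma kloosterman_unitsMod4_swap (he : e ^ 2 = 1) (s t : ZMod (4 * (g + 1))) :
    kloosterman (unitsMod4 g e) s t = kloosterman (unitsMod4 g e) t s := by
  rw [kloosterman, kloosterman]
  refine sum_bij (fun r _ => r⁻¹) (fun r hr => (inv_mem_unitsMod4 he r).2 hr)
    (fun _ _ _ _ h => inv_inj.1 h)
    (fun r hr => ⟨r⁻¹, (inv_mem_unitsMod4 he r).2 hr, inv_inv r⟩) fun r _ => ?_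
  rw [inv_inv, add_comm (s * _)]

lemma card_intCast_mul_eq_zero_le {n : ℕ} [NeZero n] {h : ℤ} (hh : h ≠ 0) :
    (univ.filter fun x : ZMod n => (h : ZMod n) * x = 0).card ≤ h.natAbs := by
  have key : ∀ x : ZMod n, (h : ZMod n) * x = 0 → n * (x.val * h.natAbs / n) = x.val * h.natAbs := by
    intro x hx
    apply Nat.mul_div_cancel'
    have : ((h * x.val : ℤ) : ZMod n) = 0 := by
      push_cast; rw [ZMod.natCast_zmod_val]; exact hx
    rw [ZMod.intCast_zmod_eq_zero_iff_dvd] at this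
    have := Int.natAbs_dvd_natAbs.2 this
    rw [Int.natAbs_mul] at this
    rwa [Int.natAbs_natCast, Int.natAbs_natCast, mul_comm] at this
  have hn : 0 < n := NeZero.pos n
  rw [← card_range h.natAbs]
  refine card_le_card_of_injOn (fun x => x.val * h.natAbs / n) ?_ ?_
  · intro x _
    simp only [coe_range, Set.mem_Iio]
    rw [Nat.div_lt_iff_lt_mul hn, mul_comm]
    exact Nat.mul_lt_mul_of_pos_left (ZMod.val_lt x) (Int.natAbs_pos.2 hh)
  · intro x hx y hy hxy
    simp only [coe_filter, mem_univ, true_and, Set.mem_ofPred_eq] at hx hy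
    simp only at hxy
    have := key x hx
    rw [hxy, key y hy] at this
    exact ZMod.val_injective n (Nat.eq_of_mul_eq_mul_right (Int.natAbs_pos.2 hh) this).symm

lemma card_unit_mul_eq_zero {n : ℕ} [NeZero n] {u s : ZMod n} (hu : IsUnit u) :
    (univ.filter fun x : ZMod n => s * u * x = 0) = univ.filter fun x : ZMod n => s * x = 0 := by
  refine filter_congr fun x _ => ?_
  rw [show s * u * x = u * (s * x) by ring, hu.mul_right_eq_zero]

/-- On average over the modulus there is cancellation in Kloosterman sums with fixed frequencies
`h, k`, not both zero. -/
lemma exists_sum_norm_kloosterman_unitsMod4_le (he : e ^ 2 = 1) {h k : ℤ} (hk : h ≠ 0 ∨ k ≠ 0)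
    {ε : ℝ} (hε : 0 < ε) :
    ∃ C : ℝ, ∀ G p : ℕ, (∀ g < G, p.Coprime (4 * (g + 1))) →
      ∑ g ∈ range G, ‖kloosterman (unitsMod4 g e) h (k * p)‖ ≤ ε * G ^ 2 + C := by
  have hcard : ∀ g, (unitsMod4 g e).card ≤ (unitsMod4 g 1).card := fun g => by
    have := two_mul_card_unitsMod4 g he
    have := two_mul_card_unitsMod4_one g
    omega
  by_cases hh : h = 0
  · have hk : k ≠ 0 := by tauto
    obtain ⟨C, hC⟩ := exists_sum_norm_kloosterman_le k.natAbs hε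
    refine ⟨C, fun G p hp => ?_⟩
    have := hC G (fun g => unitsMod4 g e) (fun g => unitsMod4 g 1) (fun g => k * p) (fun g => h)
      fun g hg => ⟨hcard g, fun u hu r => mul_mem_unitsMod4 hu r, ?_⟩
    · refine (sum_congr rfl fun g _ => ?_).trans_le this
      rw [kloosterman_unitsMod4_swap he]
    · rw [card_unit_mul_eq_zero ((ZMod.isUnit_iff_coprime p _).2 (hp g hg))]
      exact card_intCast_mul_eq_zero_le hk
  · obtain ⟨C, hC⟩ := exists_sum_norm_kloosterman_le h.natAbs hε
    exact ⟨C, fun G p hp => hC G (fun g => unitsMod4 g e) (fun g => unitsMod4 g 1) (fun g => h)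
      (fun g => k * p) fun g hg => ⟨hcard g, fun u hu r => mul_mem_unitsMod4 hu r,
        card_intCast_mul_eq_zero_le hh⟩⟩

end UnitsModFour

end LegendreSatoTate

namespace LegendreSatoTate

section Totient

open Finset Filter Topology ArithmeticFunction

/-- The Möbius function restricted to odd integers. -/
def oddMoebius (d : ℕ) : ℤ := if Odd d then moebius d else 0

lemma moebius_two_mul (d : ℕ) : moebius (2 * d) = -oddMoebius d := by
  rw [oddMoebius]
  split_ifs with h
  · rw [isMultiplicative_moebius.map_mul_of_coprime (Nat.coprime_two_left.2 h),
      moebius_apply_prime Nat.prime_two, neg_one_mul]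
  · rw [Nat.not_odd_iff_even] at h
    obtain ⟨k, rfl⟩ := h
    rw [neg_zero]
    apply moebius_eq_zero_of_not_squarefree
    intro hs
    have := hs 2 ⟨k, by ring⟩
    exact absurd this (by decide)

lemma abs_oddMoebius_le (d : ℕ) : |oddMoebius d| ≤ 1 := by
  rw [oddMoebius]
  split_ifs
  · exact abs_moebius_le_one
  · simp

lemma totient_eq_sum_moebius {n : ℕ} (hn : 0 < n) :
    (n.totient : ℝ) = ∑ d ∈ n.divisors, (moebius d : ℝ) * (n / d) := by
  have h := (sum_eq_iff_sum_mul_moebius_eq (R := ℝ) (f := fun n => (n.totient : ℝ))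
    (g := fun n => (n : ℝ))).1 (fun n _ => by exact_mod_cast Nat.sum_totient n) n hn
  rw [← h, Nat.sum_divisorsAntidiagonal (fun d e => (moebius d : ℝ) * (e : ℝ))]
  refine sum_congr rfl fun d hd => ?_
  rw [Nat.cast_div (Nat.dvd_of_mem_divisors hd)
    (by exact_mod_cast (Nat.pos_of_mem_divisors hd).ne')]

lemma totient_two_mul_eq_sum {m : ℕ} (hm : 0 < m) :
    ((2 * m).totient : ℝ) = ∑ d ∈ m.divisors, (oddMoebius d : ℝ) * (m / d) := by
  rw [totient_eq_sum_moebius (by omega), ← sum_filter_add_sum_filter_not _ (fun d => Odd d)]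
  have h1 : ∑ d ∈ (2 * m).divisors with Odd d, (moebius d : ℝ) * ((2 * m : ℕ) / d) =
      ∑ d ∈ m.divisors, 2 * ((oddMoebius d : ℝ) * (m / d)) := by
    rw [← sum_filter_add_sum_filter_not m.divisors (fun d => Odd d),
      sum_eq_zero (s := m.divisors.filter fun d => ¬ Odd d), add_zero]
    · refine sum_congr ?_ fun d hd => ?_
      · ext d
        simp only [mem_filter, Nat.mem_divisors]
        constructor
        · rintro ⟨⟨h, -⟩, ho⟩
          exact ⟨⟨(Nat.coprime_two_right.2 ho).dvd_of_dvd_mul_left h, by omega⟩, ho⟩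
        · rintro ⟨⟨h, -⟩, ho⟩
          exact ⟨⟨h.mul_left 2, by omega⟩, ho⟩
      · rw [oddMoebius, if_pos (mem_filter.1 hd).2]
        push_cast; ring
    · intro d hd
      rw [oddMoebius, if_neg (mem_filter.1 hd).2]; simp
  have h2 : ∑ d ∈ (2 * m).divisors with ¬ Odd d, (moebius d : ℝ) * ((2 * m : ℕ) / d) =
      ∑ d ∈ m.divisors, -((oddMoebius d : ℝ) * (m / d)) := by
    symm
    refine sum_bij (fun d _ => 2 * d) (fun d hd => ?_) (fun a _ b _ h => by omega)
      (fun d hd => ?_) fun d hd => ?_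
    · rw [mem_filter, Nat.mem_divisors]
      exact ⟨⟨Nat.mul_dvd_mul_left 2 (Nat.dvd_of_mem_divisors hd), by omega⟩, by simp⟩
    · rw [mem_filter, Nat.mem_divisors, Nat.not_odd_iff_even] at hd
      obtain ⟨⟨h, -⟩, he⟩ := hd
      obtain ⟨k, rfl⟩ := even_iff_two_dvd.1 he
      exact ⟨k, Nat.mem_divisors.2 ⟨(Nat.mul_dvd_mul_iff_left two_pos).1 h, by omega⟩, rfl⟩
    · rw [moebius_two_mul]
      have : (d : ℝ) ≠ 0 := by exact_mod_cast (Nat.pos_of_mem_divisors hd).ne'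
      push_cast; field_simp
  rw [h1, h2, ← sum_add_distrib]
  exact sum_congr rfl fun d _ => by ring

lemma totient_four_mul_eq_sum {m : ℕ} (hm : 0 < m) :
    ((4 * m).totient : ℝ) = 2 * ∑ d ∈ m.divisors, (oddMoebius d : ℝ) * (m / d) := by
  rw [← totient_two_mul_eq_sum hm, show 4 * m = 2 * (2 * m) by ring,
    Nat.totient_mul_of_prime_of_dvd Nat.prime_two (dvd_mul_right 2 m)]
  push_cast; ring

lemma sum_totient_four_mul (G : ℕ) : ∑ g ∈ range G, ((4 * (g + 1)).totient : ℝ) =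
    ∑ d ∈ Icc 1 G, (oddMoebius d : ℝ) * ((G / d : ℕ) * ((G / d : ℕ) + 1)) := by
  have h0 : ∑ g ∈ range G, ((4 * (g + 1)).totient : ℝ) =
      ∑ m ∈ Icc 1 G, ((4 * m).totient : ℝ) := by
    rw [range_eq_Ico, sum_Ico_add' (fun m => ((4 * m).totient : ℝ)) 0 G 1]
    rfl
  have h1 : ∀ m ∈ Icc 1 G, ((4 * m).totient : ℝ) =
      ∑ d ∈ Icc 1 G, if d ∣ m then 2 * ((oddMoebius d : ℝ) * (m / d)) else 0 := by
    intro m hm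
    rw [mem_Icc] at hm
    rw [totient_four_mul_eq_sum (by omega), ← sum_filter, mul_sum]
    refine sum_congr ?_ fun _ _ => rfl
    ext d
    rw [mem_filter, Nat.mem_divisors, mem_Icc]
    constructor
    · rintro ⟨h, -⟩
      have := Nat.le_of_dvd (by omega) h
      have := Nat.pos_of_dvd_of_pos h (by omega)
      exact ⟨by omega, h⟩
    · rintro ⟨-, h⟩; exact ⟨h, by omega⟩
  rw [h0, sum_congr rfl h1, sum_comm]
  refine sum_congr rfl fun d hd => ?_
  rw [mem_Icc] at hd
  have hd0 : (d : ℝ) ≠ 0 := by exact_mod_cast (by omega : d ≠ 0)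
  have h2 : ∑ m ∈ Icc 1 G, (if d ∣ m then 2 * ((oddMoebius d : ℝ) * (m / d)) else 0) =
      ∑ k ∈ Icc 1 (G / d), 2 * (oddMoebius d : ℝ) * k := by
    rw [← sum_filter]
    symm
    refine sum_bij (fun k _ => d * k) (fun k hk => ?_)
      (fun a _ b _ h => Nat.eq_of_mul_eq_mul_left (by omega) h) (fun m hm => ?_) fun k hk => ?_
    · rw [mem_Icc] at hk
      rw [mem_filter, mem_Icc]
      refine ⟨⟨Nat.mul_pos (by omega) (by omega), ?_⟩, dvd_mul_right d k⟩
      rw [mul_comm]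
      exact (Nat.le_div_iff_mul_le (by omega)).1 hk.2
    · rw [mem_filter, mem_Icc] at hm
      obtain ⟨⟨h1, h2⟩, k, rfl⟩ := hm
      refine ⟨k, mem_Icc.2 ⟨Nat.pos_of_mul_pos_left h1, ?_⟩, rfl⟩
      rw [Nat.le_div_iff_mul_le (by omega), mul_comm]; exact h2
    · push_cast; field_simp
  have h3 : ∀ K : ℕ, ∑ k ∈ Icc 1 K, (k : ℝ) = K * (K + 1) / 2 := by
    intro K
    induction K with
    | zero => simp
    | succ K ih => rw [sum_Icc_succ_top (by omega), ih]; push_cast; ring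
  rw [h2, ← mul_sum, h3]
  ring

lemma tsum_moebius_div_sq : Summable (fun d : ℕ => (moebius d : ℝ) / d ^ 2) ∧
    ∑' d : ℕ, (moebius d : ℝ) / d ^ 2 = 6 / Real.pi ^ 2 := by
  have hs : Summable (fun d : ℕ => (moebius d : ℝ) / d ^ 2) := by
    refine Summable.of_norm_bounded (g := fun d : ℕ => 1 / (d : ℝ) ^ 2)
      (Real.summable_one_div_nat_pow.2 one_lt_two) fun d => ?_
    rw [norm_div, Real.norm_eq_abs, norm_pow, Real.norm_natCast]
    have : |(moebius d : ℝ)| ≤ 1 := by exact_mod_cast abs_moebius_le_one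
    gcongr
  refine ⟨hs, ?_⟩
  have h := LSeries_one_mul_Lseries_moebius (s := 2) (by norm_num)
  rw [LSeries_one_eq_riemannZeta (by norm_num), riemannZeta_two] at h
  have h2 : LSeries (fun n => (moebius n : ℂ)) 2 =
      ((∑' d : ℕ, (moebius d : ℝ) / d ^ 2 : ℝ) : ℂ) := by
    rw [LSeries, Complex.ofReal_tsum]
    refine tsum_congr fun d => ?_
    rcases eq_or_ne d 0 with rfl | hd
    · simp
    · rw [LSeries.term_of_ne_zero hd]
      push_cast
      norm_cast
  rw [h2] at h
  have h3 : Real.pi ^ 2 / 6 * (∑' d : ℕ, (moebius d : ℝ) / d ^ 2) = 1 := by exact_mod_cast h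
  have := Real.pi_pos
  field_simp at h3 ⊢
  linarith

lemma summable_oddMoebius_div_sq : Summable (fun d : ℕ => (oddMoebius d : ℝ) / d ^ 2) := by
  refine Summable.of_norm_bounded (g := fun d : ℕ => 1 / (d : ℝ) ^ 2)
    (Real.summable_one_div_nat_pow.2 one_lt_two) fun d => ?_
  rw [norm_div, Real.norm_eq_abs, norm_pow, Real.norm_natCast]
  have : |(oddMoebius d : ℝ)| ≤ 1 := by exact_mod_cast abs_oddMoebius_le d
  gcongr

lemma tsum_oddMoebius_div_sq :
    ∑' d : ℕ, (oddMoebius d : ℝ) / d ^ 2 = 8 / Real.pi ^ 2 := by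
  obtain ⟨hs, h⟩ := tsum_moebius_div_sq
  have split : ∀ f : ℕ → ℝ, Summable f → ∑' k, f (2 * k) + ∑' k, f (2 * k + 1) = ∑' k, f k :=
    fun f hf => tsum_even_add_odd
      (hf.comp_injective (i := fun k : ℕ => 2 * k) fun a b h => by simpa using h)
      (hf.comp_injective (i := fun k : ℕ => 2 * k + 1) fun a b h => by simpa using h)
  have e1 := split _ hs
  have e2 := split _ summable_oddMoebius_div_sq
  have h1 : ∀ k : ℕ, (moebius (2 * k) : ℝ) / ((2 * k : ℕ) : ℝ) ^ 2 =
      -(1 / 4) * ((oddMoebius k : ℝ) / k ^ 2) := fun k => by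
    rw [moebius_two_mul]
    push_cast
    rw [mul_pow, div_mul_eq_div_div_swap]
    ring
  have h2 : ∀ k : ℕ, (oddMoebius (2 * k) : ℝ) / ((2 * k : ℕ) : ℝ) ^ 2 = 0 := fun k => by
    rw [oddMoebius, if_neg (by simp)]; simp
  have h3 : ∀ k : ℕ, (oddMoebius (2 * k + 1) : ℝ) / ((2 * k + 1 : ℕ) : ℝ) ^ 2 =
      (moebius (2 * k + 1) : ℝ) / ((2 * k + 1 : ℕ) : ℝ) ^ 2 := fun k => by
    rw [oddMoebius, if_pos (by simp)]
  simp only [h1, tsum_mul_left] at e1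
  simp only [h2, h3, tsum_zero, zero_add] at e2
  rw [e2, h] at e1
  linear_combination (4 / 3 : ℝ) * e1

lemma tendsto_sum_totient_four_mul :
    Tendsto (fun G : ℕ => (∑ g ∈ range G, ((4 * (g + 1)).totient : ℝ)) / G ^ 2) atTop
      (𝓝 (8 / Real.pi ^ 2)) := by
  have key : Tendsto (fun G : ℕ => ∑' d : ℕ,
      (oddMoebius d : ℝ) * ((G / d : ℕ) * ((G / d : ℕ) + 1)) / G ^ 2) atTop
      (𝓝 (∑' d : ℕ, (oddMoebius d : ℝ) / d ^ 2)) := by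
    refine tendsto_tsum_of_dominated_convergence (bound := fun d : ℕ => 2 * (1 / (d : ℝ) ^ 2))
      ((Real.summable_one_div_nat_pow.2 one_lt_two).mul_left 2) (fun d => ?_)
      (Eventually.of_forall fun G d => ?_)
    · have h1 : Tendsto (fun G : ℕ => ((G / d : ℕ) : ℝ) / G) atTop (𝓝 (1 / d)) := by
        have := (tendsto_nat_floor_mul_div_atTop (R := ℝ) (a := 1 / d) (by positivity)).comp
          tendsto_natCast_atTop_atTop
        refine this.congr fun G => ?_
        simp only [Function.comp_apply]
        rw [one_div, inv_mul_eq_div, Nat.floor_div_natCast, Nat.floor_natCast]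
      have h2 : Tendsto (fun G : ℕ => 1 / (G : ℝ)) atTop (𝓝 0) :=
        tendsto_one_div_atTop_nhds_zero_nat
      have h3 := (h1.mul (h1.add h2)).const_mul (oddMoebius d : ℝ)
      convert! h3 using 2 with G
      · ring
      · ring
    · rcases Nat.eq_zero_or_pos (G / d) with h0 | h0
      · rw [h0]; simp
      · have hd : 0 < d := by
          rcases Nat.eq_zero_or_pos d with rfl | h
          · simp at h0
          · exact h
        have hG : 0 < G := by
          rcases Nat.eq_zero_or_pos G with rfl | h
          · simp at h0
          · exact h
        have h1 : |(oddMoebius d : ℝ)| ≤ 1 := by exact_mod_cast abs_oddMoebius_le d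
        have h2 : ((G / d : ℕ) : ℝ) ≤ G / d := Nat.cast_div_le
        have h3 : (1 : ℝ) ≤ ((G / d : ℕ) : ℝ) := by exact_mod_cast h0
        have hd' : (0 : ℝ) < d := by exact_mod_cast hd
        have hG' : (0 : ℝ) < G := by exact_mod_cast hG
        generalize ((G / d : ℕ) : ℝ) = x at h2 h3 ⊢
        rw [Real.norm_eq_abs, abs_div, abs_mul, abs_of_nonneg (by positivity : 0 ≤ x * (x + 1)),
          abs_of_nonneg (by positivity : (0 : ℝ) ≤ (G : ℝ) ^ 2)]
        calc |(oddMoebius d : ℝ)| * (x * (x + 1)) / (G : ℝ) ^ 2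
            ≤ 1 * ((G / d) * (G / d + G / d)) / (G : ℝ) ^ 2 := by
              gcongr
              exact h3.trans h2
          _ = 2 * (1 / (d : ℝ) ^ 2) := by field_simp; ring
  rw [tsum_oddMoebius_div_sq] at key
  refine key.congr fun G => ?_
  rw [sum_totient_four_mul, sum_div]
  refine tsum_eq_sum fun d hd => ?_
  have : G / d = 0 := by
    rw [mem_Icc] at hd
    rcases Nat.eq_zero_or_pos d with rfl | h
    · simp
    · exact Nat.div_eq_of_lt (by omega)
  rw [this]; simp

lemma tendsto_sum_card_unitsMod4 {e : ZMod 4} (he : e ^ 2 = 1) :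
    Tendsto (fun G : ℕ => (∑ g ∈ range G, ((unitsMod4 g e).card : ℝ)) / G ^ 2) atTop
      (𝓝 (4 / Real.pi ^ 2)) := by
  have h := tendsto_sum_totient_four_mul.div_const 2
  rw [show 8 / Real.pi ^ 2 / 2 = 4 / Real.pi ^ 2 by ring] at h
  refine h.congr fun G => ?_
  rw [div_right_comm, sum_div]
  congr 1
  refine sum_congr rfl fun g _ => ?_
  rw [← two_mul_card_unitsMod4 g he]
  push_cast; ring

end Totient

end LegendreSatoTate

namespace LegendreSatoTate

section Weyl

open Finset Filter Topology MeasureTheory AddCircle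

lemma integral_fourier (n : ℤ) :
    ∫ x, fourier n x ∂(haarAddCircle : Measure UnitAddCircle) = if n = 0 then 1 else 0 := by
  split_ifs with h
  · simp [h]
  · exact integral_eq_zero_of_add_right_eq_neg (μ := haarAddCircle)
      (fourier_add_half_inv_index h one_pos)

lemma norm_integral_continuousMap_le (f : C(UnitAddCircle, ℂ)) :
    ‖∫ x, f x ∂(haarAddCircle : Measure UnitAddCircle)‖ ≤ ‖f‖ := by
  have := norm_integral_le_of_norm_le_const (μ := (haarAddCircle : Measure UnitAddCircle))
    (f := f) (C := ‖f‖) (ae_of_all _ fun x => f.norm_coe_le_norm x)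
  simpa using this

lemma integrable_continuousMap (f : C(UnitAddCircle, ℂ)) :
    Integrable f (haarAddCircle : Measure UnitAddCircle) :=
  f.continuous.integrable_of_hasCompactSupport (HasCompactSupport.of_compactSpace f)

/-- Weyl's criterion for uniformly bounded linear functionals. -/
lemma tendsto_of_tendsto_fourier {ι : Type*} {l : Filter ι} (L : ι → C(UnitAddCircle, ℂ) →ₗ[ℂ] ℂ)
    {B : ℝ} (hB : ∀ᶠ p in l, ∀ f, ‖L p f‖ ≤ B * ‖f‖) (c : ℂ)
    (h : ∀ n : ℤ, Tendsto (fun p => L p (fourier n)) l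
      (𝓝 (c * ∫ x, fourier n x ∂(haarAddCircle : Measure UnitAddCircle))))
    (f : C(UnitAddCircle, ℂ)) :
    Tendsto (fun p => L p f) l
      (𝓝 (c * ∫ x, f x ∂(haarAddCircle : Measure UnitAddCircle))) := by
  have hspan : ∀ f ∈ Submodule.span ℂ (Set.range (fourier (T := 1))),
      Tendsto (fun p => L p f) l
        (𝓝 (c * ∫ x, f x ∂(haarAddCircle : Measure UnitAddCircle))) := by
    intro f hf
    induction hf using Submodule.span_induction with
    | mem f hf => obtain ⟨n, rfl⟩ := hf; exact h n
    | zero => simpa using tendsto_const_nhds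
    | add f g _ _ hf hg =>
      simp only [map_add, ContinuousMap.add_apply]
      rw [integral_add (integrable_continuousMap f) (integrable_continuousMap g), mul_add]
      exact hf.add hg
    | smul a f _ hf =>
      simp only [map_smul, ContinuousMap.smul_apply, smul_eq_mul]
      rw [integral_const_mul, mul_left_comm]
      exact hf.const_mul a
  have hf : f ∈ (Submodule.span ℂ (Set.range (fourier (T := 1)))).topologicalClosure := by
    rw [span_fourier_closure_eq_top]; trivial
  rw [Metric.tendsto_nhds]
  intro ε hε
  set D : ℝ := |B| + ‖c‖ + 1 with hD
  have hD0 : 0 < D := by positivity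
  obtain ⟨g, hg, hfg⟩ := Metric.mem_closure_iff.1 hf (ε / (2 * D)) (by positivity)
  have h1 := Metric.tendsto_nhds.1 (hspan g hg) (ε / 2) (by positivity)
  filter_upwards [hB, h1] with p hp1 hp2
  rw [dist_eq_norm] at hp2 hfg ⊢
  have e1 : L p f - c * ∫ x, f x ∂(haarAddCircle : Measure UnitAddCircle) =
      L p (f - g) - c * (∫ x, (f - g) x ∂(haarAddCircle : Measure UnitAddCircle)) +
      (L p g - c * ∫ x, g x ∂(haarAddCircle : Measure UnitAddCircle)) := by
    simp only [map_sub, ContinuousMap.sub_apply]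
    rw [integral_sub (integrable_continuousMap f) (integrable_continuousMap g)]
    ring
  have e2 : ‖L p (f - g)‖ ≤ |B| * ‖f - g‖ := (hp1 _).trans (by gcongr; exact le_abs_self B)
  have e3 : ‖c * (∫ x, (f - g) x ∂(haarAddCircle : Measure UnitAddCircle))‖ ≤ ‖c‖ * ‖f - g‖ := by
    rw [norm_mul]; gcongr; exact norm_integral_continuousMap_le _
  have e4 : (|B| + ‖c‖) * ‖f - g‖ ≤ ε / 2 := by
    calc (|B| + ‖c‖) * ‖f - g‖ ≤ D * (ε / (2 * D)) := by
          gcongr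
          linarith
      _ = ε / 2 := by field_simp
  rw [e1]
  calc _ ≤ ‖L p (f - g)‖ + ‖c * (∫ x, (f - g) x ∂(haarAddCircle : Measure UnitAddCircle))‖ +
        ‖L p g - c * ∫ x, g x ∂(haarAddCircle : Measure UnitAddCircle)‖ :=
        (norm_add_le _ _).trans (by gcongr; exact norm_sub_le _ _)
    _ < ε := by linarith

/-- The number of `g : ℕ` with `2 * (g + 1) < u * √p`. -/
noncomputable def cutoff (u : ℝ) (p : ℕ) : ℕ := ⌈u * √p / 2⌉₊ - 1

lemma lt_cutoff {u : ℝ} {p g : ℕ} : g < cutoff u p ↔ 2 * ((g : ℝ) + 1) < u * √p := by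
  rw [cutoff, Nat.lt_sub_iff_add_lt, Nat.lt_ceil]
  push_cast
  rw [lt_div_iff₀ two_pos, mul_comm]

lemma tendsto_cutoff_sq {u : ℝ} (hu : 0 ≤ u) :
    Tendsto (fun p : ℕ => ((cutoff u p : ℕ) : ℝ) ^ 2 / p) atTop (𝓝 (u ^ 2 / 4)) := by
  have hs : Tendsto (fun p : ℕ => √(p : ℝ)) atTop atTop :=
    Real.tendsto_sqrt_atTop.comp tendsto_natCast_atTop_atTop
  have h1 : Tendsto (fun p : ℕ => (⌈u / 2 * √(p : ℝ)⌉₊ : ℝ) / √p) atTop (𝓝 (u / 2)) :=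
    (tendsto_nat_ceil_mul_div_atTop (by positivity)).comp hs
  have h2 : Tendsto (fun p : ℕ => 1 / √(p : ℝ)) atTop (𝓝 0) :=
    tendsto_const_nhds.div_atTop hs
  have h3 : Tendsto (fun p : ℕ => ((cutoff u p : ℕ) : ℝ) / √p) atTop (𝓝 (u / 2)) := by
    refine tendsto_of_tendsto_of_tendsto_of_le_of_le (by simpa using h1.sub h2) h1 (fun p => ?_)
      fun p => ?_
    · simp only
      rw [← one_div, ← sub_div]
      gcongr
      rw [cutoff, div_mul_eq_mul_div, sub_le_iff_le_add]
      exact_mod_cast (by omega)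
    · simp only
      gcongr
      rw [cutoff, div_mul_eq_mul_div]
      omega
  have h4 := h3.pow 2
  rw [show (u / 2) ^ 2 = u ^ 2 / 4 by ring] at h4
  refine h4.congr fun p => ?_
  rw [div_pow, Real.sq_sqrt (by positivity)]

lemma tendsto_cutoff {u : ℝ} (hu : 0 < u) : Tendsto (cutoff u) atTop atTop := by
  have hs : Tendsto (fun p : ℕ => u * √(p : ℝ) / 2) atTop atTop :=
    (((Real.tendsto_sqrt_atTop.comp tendsto_natCast_atTop_atTop).const_mul_atTop hu)).atTop_div_const
      two_pos
  exact (tendsto_sub_atTop_nat 1).comp (tendsto_nat_ceil_atTop.comp hs)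

lemma tendsto_sum_card_cutoff {e : ZMod 4} (he : e ^ 2 = 1) {u : ℝ} (hu : 0 ≤ u) :
    Tendsto (fun p : ℕ => (∑ g ∈ range (cutoff u p), ((unitsMod4 g e).card : ℝ)) / p) atTop
      (𝓝 (u ^ 2 / Real.pi ^ 2)) := by
  rcases hu.eq_or_lt with rfl | hu'
  · have : ∀ p : ℕ, cutoff 0 p = 0 := fun p => by simp [cutoff]
    simp [this]
  have h1 := ((tendsto_sum_card_unitsMod4 he).comp (tendsto_cutoff hu')).mul (tendsto_cutoff_sq hu)
  rw [show 4 / Real.pi ^ 2 * (u ^ 2 / 4) = u ^ 2 / Real.pi ^ 2 by ring] at h1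
  refine h1.congr' ?_
  filter_upwards [(tendsto_cutoff hu').eventually_gt_atTop 0] with p hp
  have : ((cutoff u p : ℕ) : ℝ) ≠ 0 := by exact_mod_cast hp.ne'
  simp only [Function.comp_apply]
  field_simp

lemma cutoff_mono {u v : ℝ} (h : u ≤ v) (p : ℕ) : cutoff u p ≤ cutoff v p := by
  unfold cutoff
  gcongr

/-- The correlation sum over the points `(r / 4(g+1), p r⁻¹ / 4(g+1))` with `2(g+1) / √p` in
`[u₀, u₁)` and `r ≡ e mod 4`. -/
noncomputable def weylSum (e : ZMod 4) (u₀ u₁ : ℝ) (p : ℕ) :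
    C(UnitAddCircle, ℂ) →ₗ[ℂ] C(UnitAddCircle, ℂ) →ₗ[ℂ] ℂ :=
  LinearMap.mk₂ ℂ (fun f₁ f₂ => (∑ g ∈ Ico (cutoff u₀ p) (cutoff u₁ p), ∑ r ∈ unitsMod4 g e,
      f₁ (ZMod.toAddCircle (r : ZMod (4 * (g + 1)))) *
      f₂ (ZMod.toAddCircle ((p : ZMod (4 * (g + 1))) *
        ((r⁻¹ : (ZMod (4 * (g + 1)))ˣ) : ZMod (4 * (g + 1)))))) / p)
    (fun _ _ _ => by simp only [ContinuousMap.add_apply, add_mul, sum_add_distrib, add_div])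
    (fun _ _ _ => by
      simp only [ContinuousMap.smul_apply, smul_eq_mul, mul_assoc, ← mul_sum, mul_div_assoc])
    (fun _ _ _ => by simp only [ContinuousMap.add_apply, mul_add, sum_add_distrib, add_div])
    (fun _ _ _ => by
      simp only [ContinuousMap.smul_apply, smul_eq_mul, mul_left_comm, ← mul_sum, mul_div_assoc])

lemma weylSum_apply (e : ZMod 4) (u₀ u₁ : ℝ) (p : ℕ) (f₁ f₂ : C(UnitAddCircle, ℂ)) :
    weylSum e u₀ u₁ p f₁ f₂ = (∑ g ∈ Ico (cutoff u₀ p) (cutoff u₁ p), ∑ r ∈ unitsMod4 g e,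
      f₁ (ZMod.toAddCircle (r : ZMod (4 * (g + 1)))) *
      f₂ (ZMod.toAddCircle ((p : ZMod (4 * (g + 1))) *
        ((r⁻¹ : (ZMod (4 * (g + 1)))ˣ) : ZMod (4 * (g + 1)))))) / p := rfl

lemma fourier_toAddCircle {n : ℕ} [NeZero n] (h : ℤ) (x : ZMod n) :
    fourier h (ZMod.toAddCircle x) = ZMod.stdAddChar ((h : ZMod n) * x) := by
  rw [fourier_apply, ← map_zsmul, zsmul_eq_mul]
  rfl

lemma weylSum_fourier (e : ZMod 4) (u₀ u₁ : ℝ) (p : ℕ) (h k : ℤ) :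
    weylSum e u₀ u₁ p (fourier h) (fourier k) = (∑ g ∈ Ico (cutoff u₀ p) (cutoff u₁ p),
      kloosterman (unitsMod4 g e) h (k * p)) / p := by
  rw [weylSum_apply]
  congr 1
  refine sum_congr rfl fun g _ => sum_congr rfl fun r _ => ?_
  rw [fourier_toAddCircle, fourier_toAddCircle, ← AddChar.map_add_eq_mul, ← mul_assoc]

lemma norm_weylSum_le (e : ZMod 4) (u₀ u₁ : ℝ) (p : ℕ) (f₁ f₂ : C(UnitAddCircle, ℂ)) :
    ‖weylSum e u₀ u₁ p f₁ f₂‖ ≤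
      (∑ g ∈ range (cutoff u₁ p), ((unitsMod4 g e).card : ℝ)) / p * (‖f₁‖ * ‖f₂‖) := by
  rw [weylSum_apply, norm_div, Complex.norm_natCast, div_mul_eq_mul_div]
  gcongr
  refine (norm_sum_le _ _).trans ?_
  rw [sum_mul]
  refine (sum_le_sum_of_subset_of_nonneg (t := range (cutoff u₁ p)) ?_
    fun _ _ _ => norm_nonneg _).trans (sum_le_sum fun g _ => ?_)
  · intro g hg
    rw [mem_Ico] at hg
    exact mem_range.2 hg.2
  · rw [← nsmul_eq_mul, ← sum_const]
    refine norm_sum_le_of_le _ fun r _ => ?_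
    rw [norm_mul]
    gcongr <;> exact ContinuousMap.norm_coe_le_norm _ _

lemma eventually_coprime_of_lt_cutoff (u : ℝ) :
    ∀ᶠ p : ℕ in atTop ⊓ 𝓟 {p | p.Prime}, ∀ g < cutoff u p, p.Coprime (4 * (g + 1)) := by
  rw [eventually_inf_principal]
  have hs : Tendsto (fun p : ℕ => √(p : ℝ)) atTop atTop :=
    Real.tendsto_sqrt_atTop.comp tendsto_natCast_atTop_atTop
  filter_upwards [hs.eventually_gt_atTop u, eventually_gt_atTop 2] with p hp hp2 hpp g hg
  rw [lt_cutoff] at hg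
  have h1 : u * √(p : ℝ) ≤ p := by
    calc u * √(p : ℝ) ≤ √p * √p := by gcongr
      _ = p := Real.mul_self_sqrt (by positivity)
  have h2 : 2 * (g + 1) < p := by
    have : 2 * ((g : ℝ) + 1) < p := hg.trans_le h1
    exact_mod_cast this
  rw [Nat.Prime.coprime_iff_not_dvd hpp, show 4 * (g + 1) = 2 * (2 * (g + 1)) by ring]
  intro h
  rcases hpp.dvd_mul.1 h with h | h
  · exact absurd (Nat.le_of_dvd two_pos h) (by omega)
  · exact absurd (Nat.le_of_dvd (by omega) h) (by omega)

lemma tendsto_weylSum_fourier {e : ZMod 4} (he : e ^ 2 = 1) {u₀ u₁ : ℝ} (h0 : 0 ≤ u₀)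
    (h1 : u₀ < u₁) (h k : ℤ) :
    Tendsto (fun p => weylSum e u₀ u₁ p (fourier h) (fourier k)) (atTop ⊓ 𝓟 {p | p.Prime})
      (𝓝 (((u₁ ^ 2 - u₀ ^ 2) / Real.pi ^ 2 : ℝ) *
        (∫ x, fourier h x ∂(haarAddCircle : Measure UnitAddCircle)) *
        ∫ x, fourier k x ∂(haarAddCircle : Measure UnitAddCircle))) := by
  by_cases hk : h = 0 ∧ k = 0
  · obtain ⟨rfl, rfl⟩ := hk
    simp only [weylSum_fourier, integral_fourier, if_true, mul_one]
    have h2 := ((tendsto_sum_card_cutoff he (h0.trans h1.le)).sub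
      (tendsto_sum_card_cutoff he h0)).ofReal
    rw [← sub_div] at h2
    refine (h2.congr fun p => ?_).mono_left inf_le_left
    rw [← sub_div, ← sum_Ico_eq_sub _ (cutoff_mono h1.le p)]
    push_cast
    congr 1
    refine sum_congr rfl fun g _ => ?_
    simp [kloosterman]
  · have hz : ((u₁ ^ 2 - u₀ ^ 2) / Real.pi ^ 2 : ℝ) *
        (∫ x, fourier h x ∂(haarAddCircle : Measure UnitAddCircle)) *
        ∫ x, fourier k x ∂(haarAddCircle : Measure UnitAddCircle) = 0 := by
      rw [integral_fourier, integral_fourier]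
      split_ifs <;> simp_all
    rw [hz]
    have hk' : h ≠ 0 ∨ k ≠ 0 := by tauto
    rw [Metric.tendsto_nhds]
    intro ε hε
    obtain ⟨C, hC⟩ := exists_sum_norm_kloosterman_unitsMod4_le he hk'
      (ε := ε / (u₁ ^ 2 + 1)) (by positivity)
    have h2 : Tendsto (fun p : ℕ => ε / (u₁ ^ 2 + 1) * (((cutoff u₁ p : ℕ) : ℝ) ^ 2 / p) + C / p)
        atTop (𝓝 (ε / (u₁ ^ 2 + 1) * (u₁ ^ 2 / 4) + 0)) :=
      ((tendsto_cutoff_sq (h0.trans h1.le)).const_mul _).add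
        (tendsto_const_nhds.div_atTop tendsto_natCast_atTop_atTop)
    have h3 : ε / (u₁ ^ 2 + 1) * (u₁ ^ 2 / 4) + 0 < ε := by
      rw [add_zero, div_mul_eq_mul_div, div_lt_iff₀ (by positivity)]
      nlinarith [sq_nonneg u₁]
    filter_upwards [(h2.eventually_lt_const h3).filter_mono inf_le_left,
      eventually_coprime_of_lt_cutoff u₁] with p hp1 hp2
    rw [dist_zero_right, weylSum_fourier, norm_div, Complex.norm_natCast]
    refine lt_of_le_of_lt ?_ hp1
    rw [← mul_div_assoc, ← add_div]
    gcongr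
    refine (norm_sum_le _ _).trans ((sum_le_sum_of_subset_of_nonneg (t := range (cutoff u₁ p)) ?_
      fun _ _ _ => norm_nonneg _).trans (hC _ p hp2))
    intro g hg
    rw [mem_Ico] at hg
    exact mem_range.2 hg.2

lemma tendsto_weylSum {e : ZMod 4} (he : e ^ 2 = 1) {u₀ u₁ : ℝ} (h0 : 0 ≤ u₀)
    (h1 : u₀ < u₁) (f₁ f₂ : C(UnitAddCircle, ℂ)) :
    Tendsto (fun p => weylSum e u₀ u₁ p f₁ f₂) (atTop ⊓ 𝓟 {p | p.Prime})
      (𝓝 (((u₁ ^ 2 - u₀ ^ 2) / Real.pi ^ 2 : ℝ) *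
        (∫ x, f₁ x ∂(haarAddCircle : Measure UnitAddCircle)) *
        ∫ x, f₂ x ∂(haarAddCircle : Measure UnitAddCircle))) := by
  set B : ℝ := u₁ ^ 2 / Real.pi ^ 2 + 1
  have hB : ∀ᶠ p : ℕ in atTop ⊓ 𝓟 {p | p.Prime}, ∀ f₁ f₂ : C(UnitAddCircle, ℂ),
      ‖weylSum e u₀ u₁ p f₁ f₂‖ ≤ B * (‖f₁‖ * ‖f₂‖) := by
    filter_upwards [((tendsto_sum_card_cutoff he (h0.trans h1.le)).eventually_lt_const
      (lt_add_one _)).filter_mono inf_le_left] with p hp f₁ f₂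
    refine (norm_weylSum_le e u₀ u₁ p f₁ f₂).trans ?_
    gcongr
  set κ : ℂ := (((u₁ ^ 2 - u₀ ^ 2) / Real.pi ^ 2 : ℝ) : ℂ) with hκ
  have step : ∀ h : ℤ, ∀ f₂ : C(UnitAddCircle, ℂ),
      Tendsto (fun p => weylSum e u₀ u₁ p (fourier h) f₂) (atTop ⊓ 𝓟 {p | p.Prime})
      (𝓝 (κ * (∫ x, fourier h x ∂(haarAddCircle : Measure UnitAddCircle)) *
        ∫ x, f₂ x ∂(haarAddCircle : Measure UnitAddCircle))) := by
    intro h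
    have hb : ∀ᶠ p : ℕ in atTop ⊓ 𝓟 {p | p.Prime}, ∀ f : C(UnitAddCircle, ℂ),
        ‖weylSum e u₀ u₁ p (fourier h) f‖ ≤ B * ‖fourier (T := 1) h‖ * ‖f‖ := by
      filter_upwards [hB] with p hp f
      rw [mul_assoc]; exact hp _ _
    exact tendsto_of_tendsto_fourier (fun p => weylSum e u₀ u₁ p (fourier h)) hb
      (κ * ∫ x, fourier h x ∂(haarAddCircle : Measure UnitAddCircle))
      fun k => tendsto_weylSum_fourier he h0 h1 h k
  have hb : ∀ᶠ p : ℕ in atTop ⊓ 𝓟 {p | p.Prime}, ∀ f : C(UnitAddCircle, ℂ),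
      ‖(weylSum e u₀ u₁ p).flip f₂ f‖ ≤ B * ‖f₂‖ * ‖f‖ := by
    filter_upwards [hB] with p hp f
    rw [LinearMap.flip_apply, mul_assoc, mul_comm ‖f₂‖]
    exact hp f f₂
  have hflip : ∀ h : ℤ, Tendsto (fun p => (weylSum e u₀ u₁ p).flip f₂ (fourier h))
      (atTop ⊓ 𝓟 {p | p.Prime})
      (𝓝 (κ * (∫ x, f₂ x ∂(haarAddCircle : Measure UnitAddCircle)) *
        ∫ x, fourier h x ∂(haarAddCircle : Measure UnitAddCircle))) := by
    intro h
    have := step h f₂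
    rw [mul_right_comm] at this
    simpa only [LinearMap.flip_apply] using this
  have := tendsto_of_tendsto_fourier (fun p => (weylSum e u₀ u₁ p).flip f₂) hb
    (κ * ∫ x, f₂ x ∂(haarAddCircle : Measure UnitAddCircle)) hflip f₁
  rw [mul_right_comm] at this
  simpa only [LinearMap.flip_apply] using this

end Weyl

end LegendreSatoTate

namespace LegendreSatoTate

section Boxes

open Finset Filter Topology MeasureTheory AddCircle

lemma exists_tent {A₀ A₁ η : ℝ} (h : A₁ ≤ A₀ + 1) (hη : 0 < η) (hη' : η < A₁ - A₀) :
    ∃ f : C(UnitAddCircle, ℝ), (∀ θ, 0 ≤ f θ) ∧ (∀ θ, f θ ≤ 1) ∧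
      (∀ x : ℝ, f x ≠ 0 → ∃ n : ℤ, x + n ∈ Set.Ico A₀ A₁) ∧
      A₁ - A₀ - η ≤ ∫ θ, f θ ∂(haarAddCircle : Measure UnitAddCircle) := by
  set c : ℝ := (A₀ + A₁) / 2 with hc
  set r : ℝ := (A₁ - A₀) / 2 with hr
  set f : C(UnitAddCircle, ℝ) :=
    ⟨fun θ => min 1 (max 0 ((r - ‖θ - (c : UnitAddCircle)‖) / (η / 2))), by fun_prop⟩ with hf
  have hfa : ∀ θ, f θ = min 1 (max 0 ((r - ‖θ - (c : UnitAddCircle)‖) / (η / 2))) := fun _ => rfl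
  refine ⟨f, fun θ => ?_, fun θ => ?_, fun x hx => ?_, ?_⟩
  · rw [hfa]; exact le_min zero_le_one (le_max_left _ _)
  · rw [hfa]; exact min_le_left _ _
  · have h1 : ‖((x - c : ℝ) : UnitAddCircle)‖ < r := by
      by_contra! hle
      apply hx
      rw [hfa, max_eq_left, min_eq_right zero_le_one]
      apply div_nonpos_of_nonpos_of_nonneg _ (by positivity)
      rw [← AddCircle.coe_sub]
      linarith
    rw [UnitAddCircle.norm_eq, abs_lt] at h1
    refine ⟨-round (x - c), ?_, ?_⟩
    · push_cast; linarith
    · push_cast; linarith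
  · have hv : (haarAddCircle : Measure UnitAddCircle) = volume := by
      rw [volume_eq_smul_haarAddCircle, ENNReal.ofReal_one, one_smul]
    have hint : Integrable f (haarAddCircle : Measure UnitAddCircle) :=
      f.continuous.integrable_of_hasCompactSupport (HasCompactSupport.of_compactSpace f)
    set s := Metric.closedBall (c : UnitAddCircle) (r - η / 2)
    have hs : MeasurableSet s := Metric.isClosed_closedBall.measurableSet
    have h1 : ∫ θ, s.indicator (fun _ => (1 : ℝ)) θ ∂(haarAddCircle : Measure UnitAddCircle) ≤
        ∫ θ, f θ ∂(haarAddCircle : Measure UnitAddCircle) := by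
      refine integral_mono ((integrable_const 1).indicator hs) hint fun θ => ?_
      by_cases hθ : θ ∈ s
      · rw [Set.indicator_of_mem hθ, hfa]
        refine le_min le_rfl (le_max_of_le_right ?_)
        rw [le_div_iff₀ (by positivity), one_mul]
        have := mem_closedBall_iff_norm.1 hθ
        linarith
      · rw [Set.indicator_of_notMem hθ, hfa]
        exact le_min zero_le_one (le_max_left _ _)
    refine le_trans ?_ h1
    rw [integral_indicator_const _ hs, measureReal_def, hv, volume_closedBall, min_eq_right
      (by linarith), ENNReal.toReal_ofReal (by linarith), smul_eq_mul]
    linarith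

/-- The integer points `(g, a, d)` with `a ≡ e mod 4` and `4(g+1) ∣ ad - p` whose normalisation
`(2(g+1)/√p, a/4(g+1), d/4(g+1))` lies in `Ω`. -/
def latticeTriples (e : ZMod 4) (p : ℕ) (Ω : Set (ℝ × ℝ × ℝ)) : Set (ℕ × ℤ × ℤ) :=
  {v | (v.2.1 : ZMod 4) = e ∧ ((4 * (v.1 + 1) : ℕ) : ℤ) ∣ v.2.1 * v.2.2 - p ∧
    (2 * ((v.1 : ℝ) + 1) / √p, v.2.1 / ((4 * (v.1 + 1) : ℕ) : ℝ),
      v.2.2 / ((4 * (v.1 + 1) : ℕ) : ℝ)) ∈ Ω}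

/-- The lower density of `latticeTriples e p Ω`, normalised by `p`, is at least `v`. -/
def DensityAtLeast (e : ZMod 4) (Ω : Set (ℝ × ℝ × ℝ)) (v : ℝ) : Prop :=
  ∀ m < v, ∀ᶠ p : ℕ in atTop ⊓ 𝓟 {p | p.Prime}, ∃ S : Finset (ℕ × ℤ × ℤ),
    ↑S ⊆ latticeTriples e p Ω ∧ m * p ≤ S.card

lemma DensityAtLeast.mono {e : ZMod 4} {Ω Ω' : Set (ℝ × ℝ × ℝ)} {v : ℝ}
    (h : DensityAtLeast e Ω v) (hΩ : Ω ⊆ Ω') : DensityAtLeast e Ω' v := fun m hm => by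
  filter_upwards [h m hm] with p ⟨S, hS, hc⟩
  exact ⟨S, fun x hx => ⟨(hS hx).1, (hS hx).2.1, hΩ (hS hx).2.2⟩, hc⟩

lemma DensityAtLeast.union {e : ZMod 4} {Ω Ω' : Set (ℝ × ℝ × ℝ)} {v v' : ℝ}
    (h : DensityAtLeast e Ω v) (h' : DensityAtLeast e Ω' v') (hd : Disjoint Ω Ω') :
    DensityAtLeast e (Ω ∪ Ω') (v + v') := fun m hm => by
  filter_upwards [h (v - (v + v' - m) / 2) (by linarith),
    h' (v' - (v + v' - m) / 2) (by linarith)] with p ⟨S, hS, hc⟩ ⟨S', hS', hc'⟩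
  refine ⟨S ∪ S', fun x hx => ?_, ?_⟩
  · rw [Finset.mem_coe, mem_union] at hx
    rcases hx with hx | hx
    · exact ⟨(hS hx).1, (hS hx).2.1, Or.inl (hS hx).2.2⟩
    · exact ⟨(hS' hx).1, (hS' hx).2.1, Or.inr (hS' hx).2.2⟩
  · rw [card_union_of_disjoint]
    · push_cast
      linarith
    · rw [Finset.disjoint_left]
      intro x hx hx'
      exact Set.disjoint_left.1 hd (hS hx).2.2 (hS' hx').2.2

lemma densityAtLeast_empty (e : ZMod 4) : DensityAtLeast e ∅ 0 := fun m hm => by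
  refine Eventually.of_forall fun p => ⟨∅, by simp, ?_⟩
  have : (0 : ℝ) ≤ p := by positivity
  simp only [card_empty, Nat.cast_zero]
  nlinarith

lemma DensityAtLeast.biUnion {ι : Type*} {e : ZMod 4} (s : Finset ι) {Ω : ι → Set (ℝ × ℝ × ℝ)}
    {v : ι → ℝ} (h : ∀ i ∈ s, DensityAtLeast e (Ω i) (v i))
    (hd : ∀ i ∈ s, ∀ j ∈ s, i ≠ j → Disjoint (Ω i) (Ω j)) :
    DensityAtLeast e (⋃ i ∈ s, Ω i) (∑ i ∈ s, v i) := by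
  classical
  induction s using Finset.induction_on with
  | empty => simpa using densityAtLeast_empty e
  | insert a s ha ih =>
    rw [sum_insert ha, set_biUnion_insert]
    refine (h a (mem_insert_self a s)).union (ih (fun i hi => h i (mem_insert_of_mem hi))
      fun i hi j hj => hd i (mem_insert_of_mem hi) j (mem_insert_of_mem hj)) ?_
    rw [Set.disjoint_iUnion₂_right]
    exact fun i hi => hd a (mem_insert_self a s) i (mem_insert_of_mem hi)
      (by rintro rfl; exact ha hi)

lemma exists_int_lift {n : ℕ} [NeZero n] {f : C(UnitAddCircle, ℝ)} {A₀ A₁ : ℝ}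
    (hf : ∀ x : ℝ, f x ≠ 0 → ∃ n : ℤ, x + n ∈ Set.Ico A₀ A₁) {z : ZMod n}
    (hz : f (ZMod.toAddCircle z) ≠ 0) :
    ∃ a : ℤ, (a : ZMod n) = z ∧ (a : ℝ) / n ∈ Set.Ico A₀ A₁ := by
  rw [ZMod.toAddCircle_apply] at hz
  obtain ⟨k, hk⟩ := hf _ hz
  have hn : (n : ℝ) ≠ 0 := by exact_mod_cast NeZero.ne n
  refine ⟨z.val + k * n, by simp, ?_⟩
  convert! hk using 1
  push_cast
  field_simp

lemma densityAtLeast_box {e : ZMod 4} (he : e ^ 2 = 1) {u₀ u₁ A₀ A₁ D₀ D₁ : ℝ} (h0 : 0 ≤ u₀)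
    (h1 : u₀ < u₁) (hA : A₀ < A₁) (hA' : A₁ ≤ A₀ + 1) (hD : D₀ < D₁) (hD' : D₁ ≤ D₀ + 1) :
    DensityAtLeast e (Set.Ico u₀ u₁ ×ˢ Set.Ico A₀ A₁ ×ˢ Set.Ico D₀ D₁)
      ((u₁ ^ 2 - u₀ ^ 2) / Real.pi ^ 2 * ((A₁ - A₀) * (D₁ - D₀))) := by
  intro m hm
  set κ : ℝ := (u₁ ^ 2 - u₀ ^ 2) / Real.pi ^ 2 with hκ
  have hκ0 : 0 ≤ κ := by
    have : u₀ ^ 2 ≤ u₁ ^ 2 := by gcongr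
    exact div_nonneg (by linarith) (by positivity)
  obtain ⟨η, hη0, hηA, hηD, hηm⟩ : ∃ η : ℝ, 0 < η ∧ η < A₁ - A₀ ∧ η < D₁ - D₀ ∧
      m < κ * ((A₁ - A₀ - η) * (D₁ - D₀ - η)) := by
    have hc : Tendsto (fun η : ℝ => κ * ((A₁ - A₀ - η) * (D₁ - D₀ - η))) (𝓝[>] 0)
        (𝓝 (κ * ((A₁ - A₀ - 0) * (D₁ - D₀ - 0)))) :=
      (Continuous.tendsto (by fun_prop) 0).mono_left nhdsWithin_le_nhds
    have := ((hc.eventually_const_lt (by simpa using hm)).and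
      ((eventually_nhdsWithin_of_eventually_nhds (eventually_lt_nhds (sub_pos.2 hA))).and
      ((eventually_nhdsWithin_of_eventually_nhds (eventually_lt_nhds (sub_pos.2 hD))).and
      self_mem_nhdsWithin))).exists
    obtain ⟨η, a, b, c, d⟩ := this
    exact ⟨η, d, b, c, a⟩
  obtain ⟨f₁, f₁0, f₁1, f₁s, f₁i⟩ := exists_tent hA' hη0 hηA
  obtain ⟨f₂, f₂0, f₂1, f₂s, f₂i⟩ := exists_tent hD' hη0 hηD
  set F₁ : C(UnitAddCircle, ℂ) := ⟨fun θ => (f₁ θ : ℂ), by fun_prop⟩ with hF₁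
  set F₂ : C(UnitAddCircle, ℂ) := ⟨fun θ => (f₂ θ : ℂ), by fun_prop⟩ with hF₂
  have hF₁a : ∀ θ, F₁ θ = (f₁ θ : ℂ) := fun _ => rfl
  have hF₂a : ∀ θ, F₂ θ = (f₂ θ : ℂ) := fun _ => rfl
  set R : ℕ → ℝ := fun p => (∑ g ∈ Ico (cutoff u₀ p) (cutoff u₁ p), ∑ r ∈ unitsMod4 g e,
      f₁ (ZMod.toAddCircle (r : ZMod (4 * (g + 1)))) *
      f₂ (ZMod.toAddCircle ((p : ZMod (4 * (g + 1))) *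
        ((r⁻¹ : (ZMod (4 * (g + 1)))ˣ) : ZMod (4 * (g + 1)))))) with hR
  have hlim : Tendsto (fun p => R p / p) (atTop ⊓ 𝓟 {p | p.Prime})
      (𝓝 (κ * (∫ x, f₁ x ∂(haarAddCircle : Measure UnitAddCircle)) *
        ∫ x, f₂ x ∂(haarAddCircle : Measure UnitAddCircle))) := by
    have := tendsto_weylSum he h0 h1 F₁ F₂
    simp only [weylSum_apply, hF₁a, hF₂a] at this
    rw [integral_complex_ofReal, integral_complex_ofReal] at this
    have := (Complex.continuous_re.tendsto _).comp this
    rw [← Complex.ofReal_mul, ← Complex.ofReal_mul, Complex.ofReal_re] at this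
    refine this.congr fun p => ?_
    simp only [Function.comp_apply]
    rw [← Complex.ofReal_re (R p / p), hR]
    push_cast
    rfl
  have hlt : m < κ * (∫ x, f₁ x ∂(haarAddCircle : Measure UnitAddCircle)) *
        ∫ x, f₂ x ∂(haarAddCircle : Measure UnitAddCircle) := by
    refine hηm.trans_le ?_
    rw [mul_assoc]
    gcongr
    linarith
  have hpos : ∀ᶠ p : ℕ in atTop ⊓ 𝓟 {p | p.Prime}, 0 < p :=
    (eventually_gt_atTop 0).filter_mono inf_le_left
  filter_upwards [hlim.eventually_const_lt hlt, hpos] with p hp hp0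
  have hp0' : (0 : ℝ) < p := by exact_mod_cast hp0
  rw [lt_div_iff₀ hp0'] at hp
  classical
  set P : (g : ℕ) → (ZMod (4 * (g + 1)))ˣ → Prop := fun g r =>
    f₁ (ZMod.toAddCircle (r : ZMod (4 * (g + 1)))) ≠ 0 ∧
      f₂ (ZMod.toAddCircle ((p : ZMod (4 * (g + 1))) *
        ((r⁻¹ : (ZMod (4 * (g + 1)))ˣ) : ZMod (4 * (g + 1))))) ≠ 0 with hP
  set S' : Finset (Σ g : ℕ, (ZMod (4 * (g + 1)))ˣ) :=
    (Ico (cutoff u₀ p) (cutoff u₁ p)).sigma fun g => (unitsMod4 g e).filter (P g) with hS'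
  have hcard : R p ≤ S'.card := by
    rw [hS', card_sigma, Nat.cast_sum]
    refine sum_le_sum fun g _ => ?_
    rw [card_filter, Nat.cast_sum]
    refine sum_le_sum fun r _ => ?_
    split_ifs with h
    · rw [Nat.cast_one]
      exact mul_le_one₀ (f₁1 _) (f₂0 _) (f₂1 _)
    · simp only [not_and_or, not_not] at h
      rcases h with h | h <;> simp [h]
  have hex : ∀ x : Σ g : ℕ, (ZMod (4 * (g + 1)))ˣ, ∃ ad : ℤ × ℤ, x ∈ S' →
      (ad.1 : ZMod (4 * (x.1 + 1))) = x.2 ∧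
      (ad.1 : ℝ) / ((4 * (x.1 + 1) : ℕ) : ℝ) ∈ Set.Ico A₀ A₁ ∧
      (ad.2 : ZMod (4 * (x.1 + 1))) = p *
        ((x.2⁻¹ : (ZMod (4 * (x.1 + 1)))ˣ) : ZMod (4 * (x.1 + 1))) ∧
      (ad.2 : ℝ) / ((4 * (x.1 + 1) : ℕ) : ℝ) ∈ Set.Ico D₀ D₁ := by
    intro x
    by_cases hx : x ∈ S'
    · rw [hS', mem_sigma, mem_filter] at hx
      obtain ⟨a, ha, ha'⟩ := exists_int_lift f₁s hx.2.2.1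
      obtain ⟨d, hd, hd'⟩ := exists_int_lift f₂s hx.2.2.2
      exact ⟨(a, d), fun _ => ⟨ha, ha', hd, hd'⟩⟩
    · exact ⟨0, fun h => absurd h hx⟩
  choose ad had using hex
  refine ⟨S'.image fun x => (x.1, (ad x).1, (ad x).2), ?_, ?_⟩
  · intro v hv
    rw [Finset.mem_coe, mem_image] at hv
    obtain ⟨⟨g, r⟩, hx, rfl⟩ := hv
    obtain ⟨e1, e2, e3, e4⟩ := had _ hx
    rw [hS', mem_sigma, mem_filter, mem_Ico] at hx
    obtain ⟨⟨hg0, hg1⟩, hr, -⟩ := hx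
    simp only at e1 e2 e3 e4 hg0 hg1 hr
    refine ⟨?_, ?_, ?_, e2, e4⟩
    · rw [mem_unitsMod4, ← e1, map_intCast] at hr
      exact hr
    · rw [← ZMod.intCast_zmod_eq_zero_iff_dvd]
      push_cast
      rw [e1, e3, mul_left_comm, ← Units.val_mul, mul_inv_cancel]
      simp
    · have hsq : 0 < √(p : ℝ) := Real.sqrt_pos.2 hp0'
      constructor
      · rw [le_div_iff₀ hsq]
        by_contra! hlt
        exact absurd (lt_cutoff.2 hlt) (not_lt.2 hg0)
      · rw [div_lt_iff₀ hsq]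
        exact lt_cutoff.1 hg1
  · rw [card_image_of_injOn]
    · exact hp.le.trans hcard
    · rintro ⟨g, r⟩ hx ⟨g', r'⟩ hx' h
      simp only [Prod.mk.injEq] at h
      obtain ⟨rfl, h1, -⟩ := h
      have e1 := (had _ hx).1
      have e2 := (had _ hx').1
      rw [h1, e2] at e1
      obtain rfl : r' = r := Units.ext e1
      rfl

end Boxes

end LegendreSatoTate

namespace LegendreSatoTate

section OpenSets

open Finset Filter Topology MeasureTheory

/-- The measure `2u/π² du` on the line. -/
noncomputable def scaleMeasure : Measure ℝ :=
  volume.withDensity fun u => ENNReal.ofReal (2 * u / Real.pi ^ 2)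

instance : IsLocallyFiniteMeasure scaleMeasure :=
  IsLocallyFiniteMeasure.withDensity_ofReal (by fun_prop)

lemma scaleMeasure_Ico {u₀ u₁ : ℝ} (h0 : 0 ≤ u₀) (h1 : u₀ ≤ u₁) :
    scaleMeasure (Set.Ico u₀ u₁) = ENNReal.ofReal ((u₁ ^ 2 - u₀ ^ 2) / Real.pi ^ 2) := by
  rw [scaleMeasure, withDensity_apply _ measurableSet_Ico,
    ← ofReal_integral_eq_lintegral_ofReal]
  · congr 1
    rw [integral_Ico_eq_integral_Ioc, ← intervalIntegral.integral_of_le h1]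
    rw [intervalIntegral.integral_div, intervalIntegral.integral_const_mul, integral_id]
    ring
  · exact ((by fun_prop : Continuous fun u : ℝ => 2 * u / Real.pi ^ 2).integrableOn_Icc).mono_set
      Set.Ico_subset_Icc_self
  · refine (ae_restrict_mem measurableSet_Ico).mono fun u hu => ?_
    have : 0 ≤ u := h0.trans hu.1
    show 0 ≤ 2 * u / Real.pi ^ 2
    positivity

/-- The measure for which `latticeTriples e p` equidistributes. -/
noncomputable def boxMeasure : Measure (ℝ × ℝ × ℝ) :=
  scaleMeasure.prod (volume.prod volume)

instance : IsLocallyFiniteMeasure boxMeasure := by unfold boxMeasure; infer_instance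

lemma abs_sub_lt_of_floor_eq {h x y : ℝ} (hh : 0 < h) (e : ⌊x / h⌋ = ⌊y / h⌋) : |x - y| < h := by
  have := Int.abs_sub_lt_one_of_floor_eq_floor e
  rwa [← sub_div, abs_div, abs_of_pos hh, div_lt_one hh] at this

lemma mem_Ico_iff_floor {h x : ℝ} (hh : 0 < h) (n : ℤ) :
    x ∈ Set.Ico (h * n) (h * (n + 1)) ↔ ⌊x / h⌋ = n := by
  rw [Int.floor_eq_iff, le_div_iff₀ hh, div_lt_iff₀ hh, Set.mem_Ico, mul_comm h, mul_comm h]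

lemma densityAtLeast_of_isOpen {e : ZMod 4} (he : e ^ 2 = 1) {Ω : Set (ℝ × ℝ × ℝ)}
    (hΩ : IsOpen Ω) (hpos : ∀ x ∈ Ω, 0 < x.1) {v : ℝ} (hv : ENNReal.ofReal v ≤ boxMeasure Ω) :
    DensityAtLeast e Ω v := by
  intro m hm
  rcases le_or_gt m 0 with hm0 | hm0
  · refine Eventually.of_forall fun p => ⟨∅, by simp, ?_⟩
    rw [card_empty, Nat.cast_zero]
    exact mul_nonpos_of_nonpos_of_nonneg hm0 (by positivity)
  obtain ⟨K, hKΩ, hK, hmK⟩ := hΩ.exists_lt_isCompact (μ := boxMeasure)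
    (((ENNReal.ofReal_lt_ofReal_iff (hm0.trans hm)).2 hm).trans_le hv)
  obtain ⟨δ, hδ, hδΩ⟩ := hK.exists_thickening_subset_open hΩ hKΩ
  set h : ℝ := min δ 1 with hh
  have h0 : 0 < h := lt_min hδ one_pos
  set idx : ℝ × ℝ × ℝ → ℤ × ℤ × ℤ := fun x => (⌊x.1 / h⌋, ⌊x.2.1 / h⌋, ⌊x.2.2 / h⌋) with hidx
  set cube : ℤ × ℤ × ℤ → Set (ℝ × ℝ × ℝ) := fun i => Set.Ico (h * i.1) (h * (i.1 + 1)) ×ˢ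
    Set.Ico (h * i.2.1) (h * (i.2.1 + 1)) ×ˢ Set.Ico (h * i.2.2) (h * (i.2.2 + 1)) with hcube
  have hmem : ∀ x i, x ∈ cube i ↔ idx x = i := by
    rintro ⟨x, y, z⟩ ⟨i, j, k⟩
    simp only [hcube, hidx, Set.mem_prod, mem_Ico_iff_floor h0, Prod.mk.injEq]
  have hfin : (idx '' K).Finite := by
    obtain ⟨R, hR⟩ := hK.isBounded.subset_closedBall 0
    have key : ∀ t : ℝ, |t| ≤ R → ⌊t / h⌋ ∈ Set.Icc ⌊-R / h⌋ ⌊R / h⌋ := fun t ht => by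
      rw [abs_le] at ht
      exact ⟨Int.floor_mono (by gcongr; exact ht.1), Int.floor_mono (by gcongr; exact ht.2)⟩
    refine ((Set.finite_Icc ⌊-R / h⌋ ⌊R / h⌋).prod ((Set.finite_Icc ⌊-R / h⌋ ⌊R / h⌋).prod
      (Set.finite_Icc ⌊-R / h⌋ ⌊R / h⌋))).subset ?_
    rintro _ ⟨x, hx, rfl⟩
    have hx' := hR hx
    rw [mem_closedBall_zero_iff, norm_prod_le_iff, norm_prod_le_iff] at hx'
    exact ⟨key _ hx'.1, key _ hx'.2.1, key _ hx'.2.2⟩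
  set T := hfin.toFinset with hT
  have hTmem : ∀ i ∈ T, ∃ x ∈ K, idx x = i := fun i hi => by
    rwa [hT, Set.Finite.mem_toFinset] at hi
  have hTnn : ∀ i ∈ T, (0 : ℝ) ≤ i.1 := fun i hi => by
    obtain ⟨x, hx, rfl⟩ := hTmem i hi
    have : 0 < x.1 := hpos x (hKΩ hx)
    exact_mod_cast Int.floor_nonneg.2 (by positivity : 0 ≤ x.1 / h)
  set w : ℤ × ℤ × ℤ → ℝ := fun i => ((h * (i.1 + 1)) ^ 2 - (h * i.1) ^ 2) / Real.pi ^ 2 *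
    ((h * (i.2.1 + 1) - h * i.2.1) * (h * (i.2.2 + 1) - h * i.2.2)) with hw
  have hw0 : ∀ i ∈ T, 0 ≤ ((h * (i.1 + 1)) ^ 2 - (h * i.1) ^ 2) / Real.pi ^ 2 := fun i hi => by
    have := hTnn i hi
    refine div_nonneg ?_ (by positivity)
    nlinarith [sq_nonneg h, mul_nonneg (sq_nonneg h) this]
  have hcubeΩ : ⋃ i ∈ T, cube i ⊆ Ω := by
    refine Set.iUnion₂_subset fun i hi y hy => hδΩ ?_
    obtain ⟨x, hx, rfl⟩ := hTmem i hi
    rw [hmem] at hy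
    refine Metric.mem_thickening_iff.2 ⟨x, hx, lt_of_lt_of_le ?_ (min_le_left δ 1)⟩
    simp only [hidx, Prod.mk.injEq] at hy
    rw [Prod.dist_eq, Prod.dist_eq, max_lt_iff, max_lt_iff]
    exact ⟨abs_sub_lt_of_floor_eq h0 hy.1, abs_sub_lt_of_floor_eq h0 hy.2.1,
      abs_sub_lt_of_floor_eq h0 hy.2.2⟩
  have hbox : ∀ i ∈ T, DensityAtLeast e (cube i) (w i) := fun i hi => by
    have h1 : h ≤ 1 := min_le_right _ _
    have := hTnn i hi
    exact densityAtLeast_box he (by positivity) (by nlinarith) (by nlinarith) (by nlinarith)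
      (by nlinarith) (by nlinarith)
  have hdis : ∀ i ∈ T, ∀ j ∈ T, i ≠ j → Disjoint (cube i) (cube j) := fun i _ j _ hij => by
    rw [Set.disjoint_left]
    intro x hx hx'
    rw [hmem] at hx hx'
    exact hij (hx.symm.trans hx')
  refine ((DensityAtLeast.biUnion T hbox hdis).mono hcubeΩ) m ?_
  have hcover : K ⊆ ⋃ i ∈ T, cube i := fun x hx => by
    refine Set.mem_iUnion₂.2 ⟨idx x, ?_, (hmem _ _).2 rfl⟩
    rw [hT, Set.Finite.mem_toFinset]
    exact ⟨x, hx, rfl⟩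
  have hmeas : ∀ i ∈ T, boxMeasure (cube i) = ENNReal.ofReal (w i) := fun i hi => by
    have := hTnn i hi
    rw [hcube, boxMeasure, Measure.prod_prod, Measure.prod_prod, Real.volume_Ico, Real.volume_Ico,
      scaleMeasure_Ico (by positivity) (by nlinarith), ← ENNReal.ofReal_mul (by nlinarith),
      ← ENNReal.ofReal_mul (hw0 i hi)]
  have := hmK.trans_le ((measure_mono hcover).trans (measure_biUnion_finset_le T cube))
  rw [sum_congr rfl hmeas, ← ENNReal.ofReal_sum_of_nonneg] at this
  · exact (ENNReal.ofReal_lt_ofReal_iff_of_nonneg hm0.le).1 this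
  · intro i hi
    exact mul_nonneg (hw0 i hi) (mul_nonneg (by nlinarith) (by nlinarith))

end OpenSets

end LegendreSatoTate

namespace LegendreSatoTate

section Volume

open Set MeasureTheory

lemma lintegral_inv_sqrt_mul (c : ℝ) :
    ∫⁻ x in Ioo (-c) (1 - c), ENNReal.ofReal (√((x + c) * (1 - c - x)))⁻¹ =
      ENNReal.ofReal Real.pi := by
  have hc : ContinuousOn (fun x : ℝ => Real.arcsin (2 * (x + c) - 1)) (Icc (-c) (1 - c)) :=
    (Real.continuous_arcsin.comp (by fun_prop)).continuousOn
  have hd : ∀ x ∈ Ioo (-c) (1 - c), HasDerivAt (fun x : ℝ => Real.arcsin (2 * (x + c) - 1))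
      (√((x + c) * (1 - c - x)))⁻¹ x := fun x hx => by
    have h1 : 0 < x + c := by linarith [hx.1]
    have h2 : 0 < 1 - c - x := by linarith [hx.2]
    have h := (Real.hasDerivAt_arcsin (x := 2 * (x + c) - 1) (by linarith) (by linarith)).comp x
      ((((hasDerivAt_id x).add_const c).const_mul 2).sub_const 1)
    refine h.congr_deriv ?_
    have : 1 - (2 * (x + c) - 1) ^ 2 = 2 ^ 2 * ((x + c) * (1 - c - x)) := by ring
    rw [this, Real.sqrt_mul (by positivity), Real.sqrt_sq (by norm_num)]
    field_simp
  have hle : -c ≤ 1 - c := by linarith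
  have hi := intervalIntegral.integrableOn_deriv_of_nonneg hc hd
    fun x _ => inv_nonneg.2 (Real.sqrt_nonneg _)
  have := intervalIntegral.integral_eq_sub_of_hasDerivAt_of_le hle hc hd
    ((intervalIntegrable_iff_integrableOn_Ioc_of_le hle).2 hi)
  rw [← ofReal_integral_eq_lintegral_ofReal (hi.mono_set Ioo_subset_Ioc_self)
    (ae_of_all _ fun x => inv_nonneg.2 (Real.sqrt_nonneg _)), ← integral_Ioc_eq_integral_Ioo,
    ← intervalIntegral.integral_of_le hle, this]
  congr 1
  have e1 : 2 * (1 - c + c) - 1 = (1 : ℝ) := by ring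
  have e2 : 2 * (-c + c) - 1 = (-1 : ℝ) := by ring
  rw [e1, e2, Real.arcsin_one, Real.arcsin_neg_one]
  ring

lemma le_lintegral_inv_sqrt_abs :
    ENNReal.ofReal (2 * Real.pi) ≤
      ∫⁻ x, (Ioo (-1 : ℝ) 1).indicator (fun x => ENNReal.ofReal (√(|x| * (1 - |x|)))⁻¹) x := by
  rw [lintegral_indicator measurableSet_Ioo]
  have hsub : Ioo (-1 : ℝ) 0 ∪ Ioo 0 1 ⊆ Ioo (-1) 1 := by
    rintro x (hx | hx)
    · exact ⟨hx.1, hx.2.trans one_pos⟩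
    · exact ⟨by linarith [hx.1], hx.2⟩
  refine le_trans (le_of_eq ?_) (lintegral_mono_set hsub)
  rw [lintegral_union measurableSet_Ioo, two_mul, ENNReal.ofReal_add Real.pi_pos.le Real.pi_pos.le]
  · congr 1
    · rw [← lintegral_inv_sqrt_mul 1, sub_self]
      refine setLIntegral_congr_fun measurableSet_Ioo fun x hx => ?_
      simp only [abs_of_neg hx.2]
      ring_nf
    · rw [← lintegral_inv_sqrt_mul 0, sub_zero, neg_zero]
      refine setLIntegral_congr_fun measurableSet_Ioo fun x hx => ?_
      simp only [abs_of_pos hx.1]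
      ring_nf
  · rw [Set.disjoint_left]
    intro x hx hx'
    exact absurd hx.2 (not_lt.2 hx'.1.le)

/-- The normalised coordinates of the matrices whose fixed point is in the fundamental domain and
whose normalised trace is in `J`. -/
def region (J : Set ℝ) : Set (ℝ × ℝ × ℝ) :=
  {w | 0 < w.1 ∧ |w.2.1 - w.2.2| < 1 ∧ 2 * w.1 * (w.2.1 + w.2.2) ∈ J ∧
    4 * w.1 ^ 2 * (|w.2.1 - w.2.2| * (1 - |w.2.1 - w.2.2|)) <
      4 - (2 * w.1 * (w.2.1 + w.2.2)) ^ 2}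

lemma isOpen_region {J : Set ℝ} (hJ : IsOpen J) : IsOpen (region J) :=
  by
  refine (isOpen_lt ?_ ?_).and <| (isOpen_lt ?_ ?_).and <|
    (hJ.preimage (f := fun w : ℝ × ℝ × ℝ => 2 * w.1 * (w.2.1 + w.2.2)) ?_).and (isOpen_lt ?_ ?_) <;> fun_prop

/-- `region J` in the coordinates given by the scale, the real part of the fixed point and the
normalised trace. -/
def shearedRegion (J : Set ℝ) : Set (ℝ × ℝ × ℝ) :=
  {w | 0 < w.1 ∧ |w.2.1| < 1 ∧ w.2.2 ∈ J ∧
    4 * w.1 ^ 2 * (|w.2.1| * (1 - |w.2.1|)) < 4 - w.2.2 ^ 2}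

lemma isOpen_shearedRegion {J : Set ℝ} (hJ : IsOpen J) : IsOpen (shearedRegion J) :=
  by
  refine (isOpen_lt ?_ ?_).and <| (isOpen_lt ?_ ?_).and <|
    (hJ.preimage (f := fun w : ℝ × ℝ × ℝ => w.2.2) ?_).and (isOpen_lt ?_ ?_) <;> fun_prop

lemma volume_region_section (J : Set ℝ) {u : ℝ} (hu : 0 < u) :
    volume (Prod.mk u ⁻¹' region J) =
      ENNReal.ofReal (4 * u)⁻¹ * volume (Prod.mk u ⁻¹' shearedRegion J) := by
  set f : ℝ × ℝ →ₗ[ℝ] ℝ × ℝ := Matrix.toLin (Module.Basis.finTwoProd ℝ)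
    (Module.Basis.finTwoProd ℝ) !![1, -1; 2 * u, 2 * u] with hf
  have hdet : LinearMap.det f = 4 * u := by
    rw [hf, LinearMap.det_toLin, Matrix.det_fin_two_of]
    ring
  have hpre : Prod.mk u ⁻¹' region J = f ⁻¹' (Prod.mk u ⁻¹' shearedRegion J) := by
    ext ⟨x, y⟩
    have hfx : f (x, y) = (x - y, 2 * u * (x + y)) := by
      rw [hf, Matrix.toLin_finTwoProd_apply]
      ext <;> ring
    simp only [mem_preimage, hfx, region, shearedRegion, mem_ofPred_eq]
  rw [hpre, Measure.addHaar_preimage_linearMap _ (by rw [hdet]; positivity), hdet,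
    abs_of_pos (by positivity)]

lemma boxMeasure_region {J : Set ℝ} (hJ : IsOpen J) :
    boxMeasure (region J) = ENNReal.ofReal (1 / (2 * Real.pi ^ 2)) *
      (volume : Measure (ℝ × ℝ × ℝ)) (shearedRegion J) := by
  have hmeas := measurable_measure_prodMk_left (ν := (volume : Measure (ℝ × ℝ)))
    (isOpen_region hJ).measurableSet
  have hmeas' := measurable_measure_prodMk_left (ν := (volume : Measure (ℝ × ℝ)))
    (isOpen_shearedRegion hJ).measurableSet
  change scaleMeasure.prod (volume : Measure (ℝ × ℝ)) (region J) =
    _ * (volume : Measure ℝ).prod (volume : Measure (ℝ × ℝ)) (shearedRegion J)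
  rw [Measure.prod_apply (isOpen_region hJ).measurableSet,
    scaleMeasure, lintegral_withDensity_eq_lintegral_mul _ (by fun_prop) hmeas,
    Measure.prod_apply (isOpen_shearedRegion hJ).measurableSet,
    ← lintegral_const_mul _ hmeas']
  refine lintegral_congr fun u => ?_
  rw [Pi.mul_apply]
  rcases le_or_gt u 0 with hu | hu
  · have e1 : Prod.mk u ⁻¹' region J = ∅ := by
      ext w
      simp [region, hu.not_gt]
    have e2 : Prod.mk u ⁻¹' shearedRegion J = ∅ := by
      ext w
      simp [shearedRegion, hu.not_gt]
    rw [e1, e2, measure_empty, mul_zero, mul_zero]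
  · rw [volume_region_section J hu, ← mul_assoc, ← ENNReal.ofReal_mul (by positivity)]
    congr 2
    field_simp
    norm_num

lemma le_boxMeasure_region {J : Set ℝ} (hJ : IsOpen J) (hJ2 : J ⊆ Ioo (-2) 2) :
    ENNReal.ofReal (1 / (2 * Real.pi) * ∫ s in J, √(4 - s ^ 2)) ≤ boxMeasure (region J) := by
  have hint : IntegrableOn (fun s : ℝ => √(4 - s ^ 2) / 2) J :=
    ((by fun_prop : Continuous fun s : ℝ => √(4 - s ^ 2) / 2).integrableOn_Icc
      (a := -2) (b := 2)).mono_set (hJ2.trans Ioo_subset_Icc_self)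
  have hI0 : 0 ≤ ∫ s in J, √(4 - s ^ 2) / 2 := by positivity
  have key : ∀ x s : ℝ, (Ioo (-1 : ℝ) 1).indicator
      (fun x => ENNReal.ofReal (√(|x| * (1 - |x|)))⁻¹) x *
        J.indicator (fun s => ENNReal.ofReal (√(4 - s ^ 2) / 2)) s ≤
      volume ((fun u => (u, x, s)) ⁻¹' shearedRegion J) := by
    intro x s
    by_cases hx : x ∈ Ioo (-1 : ℝ) 1
    swap
    · rw [indicator_of_notMem hx, zero_mul]
      exact zero_le
    by_cases hs : s ∈ J
    swap
    · rw [indicator_of_notMem hs, mul_zero]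
      exact zero_le
    rw [indicator_of_mem hx, indicator_of_mem hs]
    rcases eq_or_ne x 0 with rfl | hx0
    · simp
    have hx1 : |x| < 1 := abs_lt.2 hx
    have hq : 0 < |x| * (1 - |x|) := mul_pos (abs_pos.2 hx0) (by linarith)
    set q := |x| * (1 - |x|)
    have hs2 : 0 < 4 - s ^ 2 := by nlinarith [(hJ2 hs).1, (hJ2 hs).2]
    rw [← ENNReal.ofReal_mul (by positivity), ← sub_zero ((√q)⁻¹ * (√(4 - s ^ 2) / 2)),
      ← Real.volume_Ioo]
    refine measure_mono fun u hu => ⟨hu.1, hx1, hs, ?_⟩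
    have h1 : u * (2 * √q) < √(4 - s ^ 2) := by
      have := hu.2
      rwa [← div_eq_inv_mul, div_div, lt_div_iff₀ (by positivity)] at this
    have h2 := pow_lt_pow_left₀ h1 (by have := hu.1; positivity) two_ne_zero
    rw [Real.sq_sqrt hs2.le, mul_pow, mul_pow, Real.sq_sqrt hq.le] at h2
    show 4 * u ^ 2 * q < 4 - s ^ 2
    linarith
  have hvol : ENNReal.ofReal (2 * Real.pi) * ENNReal.ofReal (∫ s in J, √(4 - s ^ 2) / 2) ≤
      (volume : Measure (ℝ × ℝ × ℝ)) (shearedRegion J) := by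
    rw [Measure.volume_eq_prod, Measure.prod_apply_symm (isOpen_shearedRegion hJ).measurableSet]
    refine le_trans ?_ (lintegral_mono fun w : ℝ × ℝ => key w.1 w.2)
    rw [Measure.volume_eq_prod, lintegral_prod_mul (by
      exact (Measurable.indicator (by fun_prop) measurableSet_Ioo).aemeasurable) (by
      exact (Measurable.indicator (by fun_prop) hJ.measurableSet).aemeasurable)]
    gcongr
    · exact le_lintegral_inv_sqrt_abs
    · rw [lintegral_indicator hJ.measurableSet, ofReal_integral_eq_lintegral_ofReal hint
        (ae_of_all _ fun s => by positivity)]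
  rw [boxMeasure_region hJ]
  refine le_trans (le_of_eq ?_) (mul_le_mul_right hvol _)
  rw [← ENNReal.ofReal_mul (by positivity), ← ENNReal.ofReal_mul (by positivity), integral_div]
  congr 1
  field_simp

end Volume

end LegendreSatoTate

namespace LegendreSatoTate

section GoodMatrices

open Finset Filter Complex

/-- The matrix of determinant `p` attached to a lattice triple `(g, a, d)`. -/
def tripleMatrix (p : ℕ) (v : ℕ × ℤ × ℤ) : Matrix (Fin 2) (Fin 2) ℤ :=
  !![v.2.1, (v.2.1 * v.2.2 - p) / (2 * (v.1 + 1)); 2 * (v.1 + 1), v.2.2]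

lemma tripleMatrix_injective (p : ℕ) : Function.Injective (tripleMatrix p) := by
  rintro ⟨g, a, d⟩ ⟨g', a', d'⟩ h
  have h1 := congrFun (congrFun h 0) 0
  have h2 := congrFun (congrFun h 1) 0
  have h3 := congrFun (congrFun h 1) 1
  simp only [tripleMatrix, Matrix.of_apply, Matrix.cons_val', Matrix.cons_val_zero,
    Matrix.cons_val_one, Matrix.cons_val_fin_one] at h1 h2 h3
  rw [h1, h3, show g = g' by omega]

lemma odd_of_intCast_eq {a : ℤ} {e : ℤ} (he : Odd e) (h : (a : ZMod 4) = e) : Odd a := by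
  have := (ZMod.intCast_eq_intCast_iff_dvd_sub a e 4).1 h
  rcases he with ⟨k, hk⟩
  rw [Int.odd_iff]
  omega

lemma tripleMatrix_mem {p : ℕ} (hp : Odd p) {e : ℤ} (he : Odd e) {v : ℕ × ℤ × ℤ}
    {Ω : Set (ℝ × ℝ × ℝ)} (hv : v ∈ latticeTriples e p Ω) : tripleMatrix p v ∈ X2 p := by
  obtain ⟨g, a, d⟩ := v
  obtain ⟨ha, ⟨k, hk⟩, -⟩ := hv
  simp only at ha hk
  have hodd := odd_of_intCast_eq he ha
  have hb : (a * d - p) / (2 * ((g : ℤ) + 1)) = 2 * k := by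
    rw [hk]
    push_cast
    exact Int.ediv_eq_of_eq_mul_right (by omega) (by ring)
  have had : Odd (a * d) := by
    have h1 : a * d = 2 * (2 * ((g : ℤ) + 1) * k) + p := by
      push_cast at hk
      linear_combination hk
    rw [h1]
    exact (even_two_mul _).add_odd (by exact_mod_cast hp)
  simp only [tripleMatrix, hb]
  refine ⟨?_, hodd, even_two_mul k, (even_two_mul ((g : ℤ) + 1) :), (Int.odd_mul.1 had).2⟩
  rw [Matrix.det_fin_two_of]
  push_cast at hk
  linear_combination hk

lemma trace_tripleMatrix (p : ℕ) (v : ℕ × ℤ × ℤ) : (tripleMatrix p v).trace = v.2.1 + v.2.2 := by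
  rw [Matrix.trace_fin_two]
  rfl

lemma exists_fixed_of_trace_sq_lt {n a b c d : ℤ} (hdet : a * d - b * c = n) (hc : 0 < c)
    (h1 : |((a : ℝ) - d) / (2 * c)| < 1)
    (h2 : 4 * (c : ℝ) ^ 2 * (|((a : ℝ) - d) / (2 * c)| * (1 - |((a : ℝ) - d) / (2 * c)|)) <
      4 * n - (a + d) ^ 2) : ∃ τ ∈ fundDom, mob !![a, b; c, d] τ = τ := by
  have hc' : (0 : ℝ) < c := by exact_mod_cast hc
  set x : ℝ := ((a : ℝ) - d) / (2 * c) with hx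
  have hx2 : 2 * c * x = a - d := by rw [hx]; field_simp
  have hpos : (0 : ℝ) < 4 * n - (a + d) ^ 2 := by
    refine lt_of_le_of_lt ?_ h2
    have : 0 ≤ 1 - |x| := by linarith
    positivity
  set y : ℝ := √(4 * n - (a + d) ^ 2) / (2 * c) with hy
  have hy0 : 0 < y := div_pos (Real.sqrt_pos.2 hpos) (by positivity)
  have hy2 : 4 * c ^ 2 * y ^ 2 = 4 * n - (a + d) ^ 2 := by
    rw [hy, div_pow, Real.sq_sqrt hpos.le]
    field_simp
    ring
  have hdet' : (a : ℝ) * d - b * c = n := by exact_mod_cast hdet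
  have hnorm : c * (x ^ 2 + y ^ 2) = -b := by
    have : 4 * (c : ℝ) * (c * (x ^ 2 + y ^ 2)) = 4 * c * (-b) := by
      linear_combination hy2 + (2 * c * x + (a - d)) * hx2 - 4 * hdet'
    exact mul_left_cancel₀ (by positivity) this
  refine ⟨⟨x, y⟩, ⟨hy0, h1, ?_⟩, ?_⟩
  · rw [normSq_mk]
    show |x| < x * x + y * y
    rw [← hy2] at h2
    have hxx : |x| * |x| = x * x := abs_mul_abs_self x
    have : 4 * (c : ℝ) ^ 2 * (|x| * (1 - |x|)) < 4 * (c : ℝ) ^ 2 * y ^ 2 := h2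
    have := lt_of_mul_lt_mul_left this (by positivity)
    nlinarith
  · have hden : (c * (⟨x, y⟩ : ℂ) + d : ℂ) ≠ 0 := fun h => by
      have := congrArg Complex.im h
      simp [hc'.ne', hy0.ne'] at this
    show ((a : ℂ) * ⟨x, y⟩ + b) / (c * ⟨x, y⟩ + d) = ⟨x, y⟩
    rw [div_eq_iff hden]
    apply Complex.ext
    · simp
      linear_combination hnorm - x * hx2
    · simp
      linear_combination -y * hx2

lemma tripleMatrix_of_mem_region {p : ℕ} (hp : 0 < p) {e : ZMod 4} {J : Set ℝ} {v : ℕ × ℤ × ℤ}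
    (hv : v ∈ latticeTriples e p (region J)) (hdet : (tripleMatrix p v).det = p) :
    (((tripleMatrix p v).trace : ℤ) : ℝ) / √p ∈ J ∧ (tripleMatrix p v).trace ^ 2 < 4 * p ∧
      ∃ τ ∈ fundDom, mob (tripleMatrix p v) τ = τ := by
  rw [trace_tripleMatrix]
  obtain ⟨g, a, d⟩ := v
  obtain ⟨-, -, -, h1, h2, h3⟩ := hv
  have hp' : (0 : ℝ) < p := by exact_mod_cast hp
  set c : ℤ := 2 * (g + 1) with hc
  have hc' : (0 : ℝ) < c := by rw [hc]; push_cast; positivity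
  have hsq : 0 < √(p : ℝ) := Real.sqrt_pos.2 hp'
  have hsq2 : √(p : ℝ) ^ 2 = p := Real.sq_sqrt hp'.le
  have e1 : 2 * ((g : ℝ) + 1) = c := by rw [hc]; push_cast; ring
  have e2 : ((4 * (g + 1) : ℕ) : ℝ) = 2 * c := by rw [hc]; push_cast; ring
  simp only [e1, e2, ← sub_div, ← add_div] at h1 h2 h3
  have e3 : 2 * (c / √p) * (((a : ℝ) + d) / (2 * c)) = (a + d) / √p := by field_simp
  rw [e3] at h2 h3
  have h4 : 4 * (c : ℝ) ^ 2 * (|((a : ℝ) - d) / (2 * c)| * (1 - |((a : ℝ) - d) / (2 * c)|)) <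
      4 * p - (a + d) ^ 2 := by
    rw [div_pow, div_pow, hsq2] at h3
    have := mul_lt_mul_of_pos_left h3 hp'
    field_simp at this ⊢
    linarith
  have h5 : ((a : ℝ) + d) ^ 2 < 4 * p := by
    have : 0 ≤ 1 - |((a : ℝ) - d) / (2 * c)| := by linarith
    have : 0 ≤ 4 * (c : ℝ) ^ 2 *
      (|((a : ℝ) - d) / (2 * c)| * (1 - |((a : ℝ) - d) / (2 * c)|)) := by positivity
    linarith
  refine ⟨by push_cast; exact h2, by exact_mod_cast h5, ?_⟩
  have hdet' : a * d - (a * d - p) / c * c = p := by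
    rw [tripleMatrix, Matrix.det_fin_two_of] at hdet
    exact hdet
  refine exists_fixed_of_trace_sq_lt hdet' (by omega) h1 ?_
  exact_mod_cast h4

lemma isGood_tripleMatrix {p : ℕ} (hp : Odd p) {J : Set ℝ} (hJ : (0 : ℝ) ∉ J) {v : ℕ × ℤ × ℤ}
    (hv : v ∈ latticeTriples 1 p (region J)) :
    IsGood p (tripleMatrix p v) ∧ (((tripleMatrix p v).trace : ℤ) : ℝ) / √p ∈ J := by
  have hmem := tripleMatrix_mem hp odd_one (by simpa using hv)
  obtain ⟨h1, h2, h3⟩ := tripleMatrix_of_mem_region hp.pos hv hmem.1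
  refine ⟨⟨hmem, ?_, fun h => hJ ?_, h2, h3⟩, h1⟩
  · have : ((tripleMatrix p v 0 0 : ℤ) : ZMod 4) = 1 := hv.1
    rw [chi, this, map_one]
  · simpa [h] using h1

lemma isGood_neg_tripleMatrix {p : ℕ} (hp : Odd p) {J : Set ℝ} (hJ : (0 : ℝ) ∉ J)
    {v : ℕ × ℤ × ℤ} (hv : v ∈ latticeTriples (-1) p (region (-J))) :
    IsGood p (-tripleMatrix p v) ∧ (((-tripleMatrix p v).trace : ℤ) : ℝ) / √p ∈ J := by
  have hmem := tripleMatrix_mem hp (e := -1) (by decide) (by simpa using hv)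
  obtain ⟨h1, h2, τ, hτ, h3⟩ := tripleMatrix_of_mem_region hp.pos hv hmem.1
  rw [Set.mem_neg, ← neg_div, ← Int.cast_neg, ← Matrix.trace_neg] at h1
  refine ⟨⟨X2_neg hmem, ?_, fun h => hJ ?_, ?_, τ, hτ, by rwa [mob_neg]⟩, h1⟩
  · have : ((tripleMatrix p v 0 0 : ℤ) : ZMod 4) = -1 := hv.1
    rw [chi_neg, chi, this]
    decide
  · simpa [h] using h1
  · rwa [Matrix.trace_neg, neg_sq]

/-- The number of good matrices with normalised trace in `J` is asymptotically at least `p` times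
twice the semicircle measure of `J`. -/
lemma exists_good_matrices {J : Set ℝ} (hJ : IsOpen J) (hJ2 : J ⊆ Set.Ioo (-2) 2)
    (hJ0 : (0 : ℝ) ∉ J) {m : ℝ} (hm : m < 1 / Real.pi * ∫ s in J, √(4 - s ^ 2)) :
    ∀ᶠ p : ℕ in atTop ⊓ 𝓟 {p | p.Prime}, ∃ S : Finset (Matrix (Fin 2) (Fin 2) ℤ),
      (∀ M ∈ S, IsGood p M ∧ ((M.trace : ℤ) : ℝ) / √p ∈ J) ∧ m * p ≤ S.card := by
  have hneg : ∫ s in -J, √(4 - s ^ 2) = ∫ s in J, √(4 - s ^ 2) := by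
    have := MeasureTheory.integral_neg_eq_self
      ((-J).indicator fun s : ℝ => √(4 - s ^ 2)) MeasureTheory.volume
    rw [← MeasureTheory.integral_indicator hJ.neg.measurableSet, ← this,
      ← MeasureTheory.integral_indicator hJ.measurableSet]
    congr 1 with s
    by_cases hs : s ∈ J
    · rw [Set.indicator_of_mem hs, Set.indicator_of_mem (by simpa using hs), neg_sq]
    · rw [Set.indicator_of_notMem hs, Set.indicator_of_notMem (by simpa using hs)]
  have hJ2' : -J ⊆ Set.Ioo (-2) 2 := fun s hs => by
    have := hJ2 (Set.mem_neg.1 hs)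
    exact ⟨by linarith [this.2], by linarith [this.1]⟩
  have hpos : ∀ (J : Set ℝ), ∀ x ∈ region J, 0 < x.1 := fun _ x hx => hx.1
  have d1 := densityAtLeast_of_isOpen (e := 1) (by decide) (isOpen_region hJ) (hpos _)
    (le_boxMeasure_region hJ hJ2)
  have d2 := densityAtLeast_of_isOpen (e := -1) (by decide) (isOpen_region hJ.neg) (hpos _)
    (le_boxMeasure_region hJ.neg hJ2')
  rw [hneg] at d2
  have hm2 : m / 2 < 1 / (2 * Real.pi) * ∫ s in J, √(4 - s ^ 2) := by
    have : 1 / (2 * Real.pi) * ∫ s in J, √(4 - s ^ 2) =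
      (1 / Real.pi * ∫ s in J, √(4 - s ^ 2)) / 2 := by field_simp
    linarith
  have hodd : ∀ᶠ p : ℕ in atTop ⊓ 𝓟 {p | p.Prime}, Odd p := by
    rw [eventually_inf_principal]
    filter_upwards [eventually_gt_atTop 2] with p hp hpp
    exact hpp.odd_of_ne_two hp.ne'
  classical
  filter_upwards [d1 _ hm2, d2 _ hm2, hodd] with p ⟨S₁, hS₁, hc₁⟩ ⟨S₂, hS₂, hc₂⟩ hp
  refine ⟨S₁.image (tripleMatrix p) ∪ S₂.image (fun v => -tripleMatrix p v), ?_, ?_⟩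
  · intro M hM
    rw [mem_union, mem_image, mem_image] at hM
    rcases hM with ⟨v, hv, rfl⟩ | ⟨v, hv, rfl⟩
    · exact isGood_tripleMatrix hp hJ0 (hS₁ hv)
    · exact isGood_neg_tripleMatrix hp hJ0 (hS₂ hv)
  · rw [card_union_of_disjoint, card_image_of_injective _ (tripleMatrix_injective p),
      card_image_of_injective (f := fun v => -tripleMatrix p v) _
        (neg_injective.comp (tripleMatrix_injective p))]
    · push_cast
      linarith
    · rw [Finset.disjoint_left]
      intro M hM hM'
      rw [mem_image] at hM hM'
      obtain ⟨v, -, rfl⟩ := hM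
      obtain ⟨w, -, h⟩ := hM'
      have := congrFun (congrFun h 1) 0
      simp only [tripleMatrix, Matrix.neg_apply, Matrix.of_apply, Matrix.cons_val',
        Matrix.cons_val_zero, Matrix.cons_val_one, Matrix.cons_val_fin_one] at this
      omega

end GoodMatrices

end LegendreSatoTate

namespace LegendreSatoTate

section TraceDistribution

open Finset Filter Topology MeasureTheory

/-- The number of Legendre curves over `ZMod p` whose normalised Frobenius trace lies in `J`. -/
noncomputable def traceCount (p : ℕ) [Fact p.Prime] (J : Set ℝ) : ℕ :=
  {l : ZMod p | l ≠ 0 ∧ l ≠ 1 ∧ ((frobTrace l : ℤ) : ℝ) / √p ∈ J}.ncard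

variable {p : ℕ} [hp : Fact p.Prime]

lemma traceCount_mono {J J' : Set ℝ} (h : J ⊆ J') : traceCount p J ≤ traceCount p J' :=
  Set.ncard_le_ncard (fun _ hl => ⟨hl.1, hl.2.1, h hl.2.2⟩) (Set.toFinite _)

lemma traceCount_union_le (J J' : Set ℝ) :
    traceCount p (J ∪ J') ≤ traceCount p J + traceCount p J' := by
  refine le_trans (Set.ncard_le_ncard ?_ (Set.toFinite _)) (Set.ncard_union_le _ _)
  rintro l ⟨h0, h1, h | h⟩
  · exact Or.inl ⟨h0, h1, h⟩
  · exact Or.inr ⟨h0, h1, h⟩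

lemma traceCount_union {J J' : Set ℝ} (h : Disjoint J J') :
    traceCount p (J ∪ J') = traceCount p J + traceCount p J' := by
  unfold traceCount
  rw [← Set.ncard_union_eq _ (Set.toFinite _) (Set.toFinite _)]
  · congr 1
    ext l
    simp only [Set.mem_union, Set.mem_ofPred_eq]
    tauto
  · rw [Set.disjoint_left]
    exact fun l hl hl' => Set.disjoint_left.1 h hl.2.2 hl'.2.2

lemma traceCount_le (J : Set ℝ) : traceCount p J ≤ p := by
  refine (Set.ncard_le_card _).trans ?_
  rw [Nat.card_eq_fintype_card, ZMod.card]

lemma traceCount_neg_of_mod_four (h3 : p % 4 = 3) (J : Set ℝ) : traceCount p (-J) = traceCount p J := by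
  have hq : quadraticChar (ZMod p) (-1) = -1 := by
    rw [quadraticChar_neg_one (by rw [ZMod.ringChar_zmod_n]; omega), ZMod.card,
      ZMod.χ₄_nat_three_mod_four h3]
  refine Set.ncard_congr (fun l _ => 1 - l) ?_ (fun a b _ _ h => sub_right_injective h) ?_
  · rintro l ⟨h0, h1, h⟩
    refine ⟨sub_ne_zero.2 h1.symm, by simpa using h0, ?_⟩
    rw [frobTrace_one_sub, hq]
    simpa [neg_div] using h
  · rintro l ⟨h0, h1, h⟩
    refine ⟨1 - l, ⟨sub_ne_zero.2 h1.symm, by simpa using h0, ?_⟩, by simp⟩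
    rw [frobTrace_one_sub, hq]
    simpa [neg_div] using h

lemma card_le_traceCount {n : ℕ} (hn : p = 2 * n + 1) {J : Set ℝ}
    (hJ : Even n ∨ -J = J) {S : Finset (Matrix (Fin 2) (Fin 2) ℤ)}
    (hS : ∀ M ∈ S, IsGood p M ∧ ((M.trace : ℤ) : ℝ) / √p ∈ J) :
    S.card ≤ 2 * (traceCount p J + 2) := by
  refine card_good_le hn {t : ℤ | (t : ℝ) / √p ∈ J} (fun t ht => ?_) S hS
  rcases n.even_or_odd with h | h
  · rwa [h.neg_one_pow, one_mul]
  · rcases hJ with hJ | hJ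
    · exact absurd hJ (Nat.not_even_iff_odd.2 h)
    · rw [h.neg_one_pow]
      show ((-1 * t : ℤ) : ℝ) / √p ∈ J
      rw [← hJ, Set.mem_neg]
      simpa [neg_div] using ht

omit hp in
lemma setIntegral_union_neg {J : Set ℝ} (hJ : MeasurableSet J) (hd : Disjoint J (-J)) {f : ℝ → ℝ}
    (hf : IntegrableOn f J) (hf' : ∀ x, f (-x) = f x) :
    ∫ s in J ∪ -J, f s = 2 * ∫ s in J, f s := by
  have hpre : -J = Neg.neg ⁻¹' J := rfl
  have hmp : MeasurePreserving (Neg.neg : ℝ → ℝ) := Measure.measurePreserving_neg _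
  have hemb : MeasurableEmbedding (Neg.neg : ℝ → ℝ) := (MeasurableEquiv.neg ℝ).measurableEmbedding
  have hfe : f ∘ Neg.neg = f := funext hf'
  have hi : IntegrableOn f (-J) := by
    rw [hpre, ← hfe, hmp.integrableOn_comp_preimage hemb]
    exact hf
  rw [setIntegral_union hd hJ.neg hf hi, two_mul, ← hmp.setIntegral_preimage_emb hemb f J]
  simp only [hf']
  rfl

omit hp in
lemma eventually_le_traceCount_of_isOpen {J : Set ℝ} (hJ : IsOpen J) (hJ2 : J ⊆ Set.Ioo (-2) 2)
    (hJ0 : (0 : ℝ) ∉ J) (hd : Disjoint J (-J)) {m : ℝ}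
    (hm : m < 1 / (2 * Real.pi) * ∫ s in J, √(4 - s ^ 2)) :
    ∀ᶠ p : ℕ in atTop ⊓ 𝓟 {p | p.Prime}, ∀ _ : Fact p.Prime, m * p ≤ traceCount p J := by
  obtain ⟨m', hm', hm'2⟩ := exists_between hm
  have hint : IntegrableOn (fun s : ℝ => √(4 - s ^ 2)) J :=
    ((by fun_prop : Continuous fun s : ℝ => √(4 - s ^ 2)).integrableOn_Icc
      (a := -2) (b := 2)).mono_set (hJ2.trans Set.Ioo_subset_Icc_self)
  have e1 : 1 / Real.pi * ∫ s in J, √(4 - s ^ 2) =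
      2 * (1 / (2 * Real.pi) * ∫ s in J, √(4 - s ^ 2)) := by field_simp
  have e2 : 1 / Real.pi * ∫ s in J ∪ -J, √(4 - s ^ 2) =
      4 * (1 / (2 * Real.pi) * ∫ s in J, √(4 - s ^ 2)) := by
    rw [setIntegral_union_neg hJ.measurableSet hd hint fun x => by rw [neg_sq]]
    field_simp
    ring
  have hJ2' : J ∪ -J ⊆ Set.Ioo (-2) 2 := by
    rintro s (hs | hs)
    · exact hJ2 hs
    · have := hJ2 (Set.mem_neg.1 hs)
      exact ⟨by linarith [this.2], by linarith [this.1]⟩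
  have h1 := exists_good_matrices hJ hJ2 hJ0 (m := 2 * m') (by linarith)
  have h2 := exists_good_matrices (hJ.union hJ.neg) hJ2' (by simpa using hJ0)
    (m := 4 * m') (by linarith)
  have hlarge : ∀ᶠ p : ℕ in atTop ⊓ 𝓟 {p | p.Prime}, 2 ≤ (m' - m) * p ∧ 2 < p :=
    (((tendsto_natCast_atTop_atTop.const_mul_atTop (sub_pos.2 hm')).eventually_ge_atTop 2).and
      (eventually_gt_atTop 2)).filter_mono inf_le_left
  filter_upwards [h1, h2, hlarge] with p ⟨S₁, hS₁, hc₁⟩ ⟨S₂, hS₂, hc₂⟩ ⟨hlarge, hp2⟩ hp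
  have hodd : Odd p := hp.out.odd_of_ne_two hp2.ne'
  obtain ⟨n, hn⟩ := hodd
  rcases n.even_or_odd with he | ho
  · have h := card_le_traceCount hn (Or.inl he) hS₁
    have : (S₁.card : ℝ) ≤ 2 * (traceCount p J + 2) := by exact_mod_cast h
    linarith
  · have h := card_le_traceCount hn (Or.inr (by rw [Set.union_neg, neg_neg, Set.union_comm]))
      hS₂
    have h3 : p % 4 = 3 := by
      obtain ⟨k, hk⟩ := ho
      omega
    have h' := traceCount_union_le (p := p) J (-J)
    rw [traceCount_neg_of_mod_four h3] at h'
    have : S₂.card ≤ 2 * (2 * traceCount p J + 2) := by omega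
    have : (S₂.card : ℝ) ≤ 2 * (2 * traceCount p J + 2) := by exact_mod_cast this
    linarith

/-- The semicircle measure of the interval from `α` to `β`. -/
noncomputable def semicircle (α β : ℝ) : ℝ := 1 / (2 * Real.pi) * ∫ t in α..β, √(4 - t ^ 2)

omit hp in
lemma semicircle_add (α β γ : ℝ) : semicircle α β + semicircle β γ = semicircle α γ := by
  have hc : Continuous fun s : ℝ => √(4 - s ^ 2) := by fun_prop
  rw [semicircle, semicircle, semicircle, ← mul_add,
    intervalIntegral.integral_add_adjacent_intervals (hc.intervalIntegrable _ _)
      (hc.intervalIntegrable _ _)]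

omit hp in
lemma semicircle_neg (α β : ℝ) : semicircle (-β) (-α) = semicircle α β := by
  rw [semicircle, semicircle, ← intervalIntegral.integral_comp_neg]
  simp only [neg_sq]

omit hp in
lemma semicircle_total : semicircle (-2) 2 = 1 := by
  have h := intervalIntegral.integral_comp_mul_right (fun t : ℝ => √(4 - t ^ 2))
    (a := -1) (b := 1) (two_ne_zero (α := ℝ))
  have e : ∀ x : ℝ, √(4 - (x * 2) ^ 2) = 2 * √(1 - x ^ 2) := fun x => by
    rw [show 4 - (x * 2) ^ 2 = 2 ^ 2 * (1 - x ^ 2) by ring, Real.sqrt_mul (by norm_num),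
      Real.sqrt_sq (by norm_num)]
  simp only [e] at h
  rw [intervalIntegral.integral_const_mul, integral_sqrt_one_sub_sq, smul_eq_mul] at h
  have h' : ∫ t in (-2 : ℝ)..2, √(4 - t ^ 2) = 2 * Real.pi := by
    norm_num at h
    linarith
  rw [semicircle, h']
  field_simp

omit hp in
lemma eventually_le_traceCount_Ioo_of_sign {α β : ℝ} (hα : -2 ≤ α) (hβ : β ≤ 2) (hαβ : α ≤ β)
    (h : 0 ≤ α ∨ β ≤ 0) {m : ℝ} (hm : m < semicircle α β) :
    ∀ᶠ p : ℕ in atTop ⊓ 𝓟 {p | p.Prime}, ∀ _ : Fact p.Prime,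
      m * p ≤ traceCount p (Set.Ioo α β) := by
  rw [semicircle, intervalIntegral.integral_of_le hαβ, integral_Ioc_eq_integral_Ioo] at hm
  refine eventually_le_traceCount_of_isOpen isOpen_Ioo (Set.Ioo_subset_Ioo hα hβ) ?_ ?_ hm
  · rintro ⟨h1, h2⟩
    rcases h with h | h <;> linarith
  · rw [Set.disjoint_left]
    rintro x ⟨h1, h2⟩ ⟨h3, h4⟩
    rcases h with h | h <;> linarith

omit hp in
lemma eventually_le_traceCount_Ioo {α β : ℝ} (hα : -2 ≤ α) (hβ : β ≤ 2) (hαβ : α ≤ β) {m : ℝ}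
    (hm : m < semicircle α β) :
    ∀ᶠ p : ℕ in atTop ⊓ 𝓟 {p | p.Prime}, ∀ _ : Fact p.Prime,
      m * p ≤ traceCount p (Set.Ioo α β) := by
  by_cases h : 0 ≤ α ∨ β ≤ 0
  · exact eventually_le_traceCount_Ioo_of_sign hα hβ hαβ h hm
  rw [not_or, not_le, not_le] at h
  rw [← semicircle_add α 0 β] at hm
  filter_upwards [eventually_le_traceCount_Ioo_of_sign hα (by norm_num) h.1.le (Or.inr le_rfl)
      (m := semicircle α 0 - (semicircle α 0 + semicircle 0 β - m) / 2) (by linarith),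
    eventually_le_traceCount_Ioo_of_sign (by norm_num) hβ h.2.le (Or.inl le_rfl)
      (m := semicircle 0 β - (semicircle α 0 + semicircle 0 β - m) / 2) (by linarith)]
    with p h1 h2 hp
  have hd : Disjoint (Set.Ioo α 0) (Set.Ioo 0 β) := by
    rw [Set.disjoint_left]
    exact fun x hx hx' => lt_asymm hx.2 hx'.1
  have := traceCount_mono (p := p)
    (Set.union_subset (Set.Ioo_subset_Ioo_right h.2.le) (Set.Ioo_subset_Ioo_left h.1.le) :
      Set.Ioo α 0 ∪ Set.Ioo 0 β ⊆ Set.Ioo α β)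
  rw [traceCount_union hd] at this
  have : (traceCount p (Set.Ioo α 0) : ℝ) + traceCount p (Set.Ioo 0 β) ≤
    traceCount p (Set.Ioo α β) := by exact_mod_cast this
  linarith [h1 hp, h2 hp]

omit hp in
lemma eventually_abs_traceCount_Icc {α β : ℝ} (hα : -2 ≤ α) (hβ : β ≤ 2) (hαβ : α ≤ β) {ε : ℝ}
    (hε : 0 < ε) :
    ∀ᶠ p : ℕ in atTop ⊓ 𝓟 {p | p.Prime}, ∀ _ : Fact p.Prime,
      |(traceCount p (Set.Icc α β) : ℝ) / p - semicircle α β| ≤ ε := by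
  filter_upwards [
    eventually_le_traceCount_Ioo le_rfl (hαβ.trans hβ) hα (m := semicircle (-2) α - ε / 2)
      (by linarith),
    eventually_le_traceCount_Ioo hα hβ hαβ (m := semicircle α β - ε / 2) (by linarith),
    eventually_le_traceCount_Ioo (hα.trans hαβ) le_rfl hβ (m := semicircle β 2 - ε / 2)
      (by linarith)] with p h1 h2 h3 hp
  have hp0 : (0 : ℝ) < p := by exact_mod_cast hp.out.pos
  have hIcc : (traceCount p (Set.Ioo α β) : ℝ) ≤ traceCount p (Set.Icc α β) := by
    exact_mod_cast traceCount_mono Set.Ioo_subset_Icc_self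
  have hd1 : Disjoint (Set.Ioo (-2) α) (Set.Icc α β) := by
    rw [Set.disjoint_left]
    exact fun x hx hx' => hx.2.not_ge hx'.1
  have hd2 : Disjoint (Set.Ioo (-2) α ∪ Set.Icc α β) (Set.Ioo β 2) := by
    rw [Set.disjoint_left]
    rintro x (hx | hx) hx'
    · exact lt_irrefl x (hx.2.trans (hαβ.trans_lt hx'.1))
    · exact hx'.1.not_ge hx.2
  have htot := traceCount_le (p := p) (Set.Ioo (-2) α ∪ Set.Icc α β ∪ Set.Ioo β 2)
  rw [traceCount_union hd2, traceCount_union hd1] at htot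
  have htot' : (traceCount p (Set.Ioo (-2) α) : ℝ) + traceCount p (Set.Icc α β) +
    traceCount p (Set.Ioo β 2) ≤ p := by exact_mod_cast htot
  have hsum : semicircle (-2) α + semicircle α β + semicircle β 2 = 1 := by
    rw [semicircle_add, semicircle_add, semicircle_total]
  have h1 := h1 hp
  have h2 := h2 hp
  have h3 := h3 hp
  have hlow : semicircle α β - ε / 2 ≤ traceCount p (Set.Icc α β) / p :=
    (le_div_iff₀ hp0).2 (h2.trans hIcc)
  have hup : traceCount p (Set.Icc α β) / p ≤ semicircle α β + ε := by
    rw [div_le_iff₀ hp0]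
    rw [show semicircle (-2) α = 1 - semicircle α β - semicircle β 2 by linarith] at h1
    linarith
  rw [abs_le]
  constructor <;> linarith

end TraceDistribution

end LegendreSatoTate

open Finset Filter

/-- **Semicircular distribution for the `₂G₂` family.**
Let `-2 ≤ a < b ≤ 2`. For primes `p ≡ 1 (mod 3)`, let
`a_p(λ) = -∑_{x ∈ F_p} φ(x(x-1)(x-λ))` where `φ` is the quadratic character of `F_p`.
Then, as `p → ∞` through primes `p ≡ 1 (mod 3)`, the proportion of `λ ∈ F_p`,
`λ ≠ 0, 1`, with `φ(-2)·a_p(λ)/√p ∈ [a, b]` converges to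
`(1/(2π)) ∫_a^b √(4 - t²) dt`. -/
theorem sato_tate_2G2 (a b : ℝ) (ha : -2 ≤ a) (hab : a < b) (hb : b ≤ 2) :
    Tendsto
      (fun p : Nat.Primes =>
        haveI : Fact (p : ℕ).Prime := ⟨p.property⟩
        (({l : ZMod p | l ≠ 0 ∧ l ≠ 1 ∧
            a ≤ ((quadraticChar (ZMod p) (-2) *
              (-∑ x : ZMod p, quadraticChar (ZMod p) (x * (x - 1) * (x - l))) : ℤ) : ℝ) /
                Real.sqrt (p : ℕ) ∧
            ((quadraticChar (ZMod p) (-2) *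
              (-∑ x : ZMod p, quadraticChar (ZMod p) (x * (x - 1) * (x - l))) : ℤ) : ℝ) /
                Real.sqrt (p : ℕ) ≤ b}.ncard : ℝ) / (p : ℕ)))
      (Filter.comap ((↑) : Nat.Primes → ℕ) atTop ⊓
        Filter.principal {p : Nat.Primes | (p : ℕ) % 3 = 1})
      (nhds ((1 / (2 * Real.pi)) * ∫ t in a..b, Real.sqrt (4 - t ^ 2))) := by
  have hcoe : Tendsto ((↑) : Nat.Primes → ℕ)
      (Filter.comap ((↑) : Nat.Primes → ℕ) atTop ⊓
        Filter.principal {p : Nat.Primes | (p : ℕ) % 3 = 1}) (atTop ⊓ 𝓟 {p | p.Prime}) :=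
    tendsto_inf.2 ⟨tendsto_comap.mono_left inf_le_left,
      tendsto_principal.2 (Eventually.of_forall fun p => p.property)⟩
  have hsymm : LegendreSatoTate.semicircle (-b) (-a) = LegendreSatoTate.semicircle a b :=
    LegendreSatoTate.semicircle_neg a b
  rw [Metric.tendsto_nhds]
  intro ε hε
  have h1 := LegendreSatoTate.eventually_abs_traceCount_Icc ha hb hab.le (half_pos hε)
  have h2 := LegendreSatoTate.eventually_abs_traceCount_Icc (neg_le_neg hb)
    (by linarith : -a ≤ 2) (neg_le_neg hab.le) (half_pos hε)
  have h3 : ∀ᶠ p : ℕ in atTop ⊓ 𝓟 {p | p.Prime}, 2 < p :=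
    (eventually_gt_atTop 2).filter_mono inf_le_left
  filter_upwards [hcoe.eventually h1, hcoe.eventually h2, hcoe.eventually h3] with p h1 h2 h3
  have : Fact (p : ℕ).Prime := ⟨p.property⟩
  have h1 := h1 this
  have h2 := h2 this
  rw [hsymm, LegendreSatoTate.semicircle, LegendreSatoTate.traceCount] at h2
  rw [LegendreSatoTate.semicircle, LegendreSatoTate.traceCount] at h1
  have hne : (-2 : ZMod p) ≠ 0 := by
    rw [neg_ne_zero]
    exact_mod_cast fun h => (Nat.le_of_dvd two_pos
      ((ZMod.natCast_eq_zero_iff 2 p).1 (by exact_mod_cast h))).not_gt h3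
  rw [Real.dist_eq]
  refine lt_of_le_of_lt ?_ (half_lt_self hε)
  rcases quadraticChar_dichotomy hne with hq | hq
  · convert! h1 using 6
    ext l
    simp only [hq, one_mul, Set.mem_Icc, Set.mem_ofPred_eq, LegendreSatoTate.frobTrace]
  · convert! h2 using 6
    ext l
    simp only [hq, Set.mem_Icc, Set.mem_ofPred_eq, LegendreSatoTate.frobTrace, neg_one_mul,
      neg_neg, Int.cast_neg, neg_div, neg_le_neg_iff, and_comm]
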